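/- Weak Gibbsianity of the renormalized measure (main theorem). Let U be a translationally invariant finite-range lattice gas potential on {0,1}^{ℤ^d} satisfying SM(ℓ0,b,B). Then for any sufficiently large ℓ multiple of ℓ0 there exists a family of functions {ψ_I^{(ℓ)}, φ_I^{(ℓ)} : ℳ^{(ℓ)} → ℝ}, indexed by finite I ⊆ (ℓℤ)^d, such that: (1) ψ_I^{(ℓ)}, φ_I^{(ℓ)} are ℬ_I^{(ℓ)}-measurable; (2) ψ_I^{(ℓ)} = φ_I^{(ℓ)} ≡ 0 whenever I is not ℓ-connected; (3) the family is translationally invariant: ψ_I^{(ℓ)}(m) = ψ_{I−i}^{(ℓ)}(Θ_i m) and φ_I^{(ℓ)}(m) = φ_{I−i}^{(ℓ)}(Θ_i m) for all i ∈ (ℓℤ)^d; (4) there exist a measurable set M̄^{(ℓ)} ⊆ ℳ^{(ℓ)} with ν^{(ℓ)}(M̄^{(ℓ)}) = 1 and functions r_i^{(ℓ)} : M̄^{(ℓ)} → ℕ∖{0} such that for each m ∈ M̄^{(ℓ)}, if I ∋ i and diam_ℓ(I) > r_i^{(ℓ)}(m) then ψ_I^{(ℓ)}(m) = 0; in particular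 for each i and m ∈ M̄^{(ℓ)} there is c_i^{(ℓ)}(m) ∈ [0,∞) with Σ_{I∋i}|ψ_I^{(ℓ)}(m)| ≤ c_i^{(ℓ)}(m); (5) for every q ∈ [1,∞), sup_i ν^{(ℓ)}(|Σ_{I∋i} ψ_I^{(ℓ)}|^q) < ∞; (6) there exists α' > 0 with sup_m sup_i Σ_{I∋i} e^{α' diam_ℓ(I)} |φ_I^{(ℓ)}(m)| < ∞; (7) the DLR equations hold: for every finite J ⊆ (ℓℤ)^d and every bounded ℬ_J^{(ℓ)}-measurable f, ν^{(ℓ)}(f) = ∫ ν^{(ℓ)}(dm') Z_J(m')^{-1} Σ_{m∈ℳ_J^{(ℓ)}} f(m) exp{Σ_{I∩J≠∅}[ψ_I^{(ℓ)}(m m'_{Jᶜ}) + φ_I^{(ℓ)}(m m'_{Jᶜ})]}, where Z_J(m') = Σ_{m∈ℳ_J^{(ℓ)}} exp{Σ_{I∩J≠∅}[ψ_I^{(ℓ)}(m m'_{Jᶜ}) + φ_I^{(ℓ)}(m m'_{Jᶜ})]}. -/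

import Mathlib

namespace Paper

open MeasureTheory
open scoped Classical

noncomputable section

/-- The lattice `ℤ^d`. -/
abbrev ZLat (d : ℕ) := Fin d → ℤ

/-- A lattice gas configuration `η ∈ {0,1}^{ℤ^d}` (`true` = occupied). -/
abbrev GConf (d : ℕ) := ZLat d → Bool

/-- The sup distance on `ℤ^d`. -/
def supD {d : ℕ} (x y : ZLat d) : ℕ := Finset.univ.sup fun i => (x i - y i).natAbs

/-- The sup distance between two finite subsets of the lattice. -/
def fDist {d : ℕ} (A B : Finset (ZLat d)) : ℝ :=
  sInf ((fun p : ZLat d × ZLat d => (supD p.1 p.2 : ℝ)) '' {p | p.1 ∈ A ∧ p.2 ∈ B})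

/-- `f` is a local function with support contained in the finite set `S`. -/
def LocalOn {d : ℕ} (f : GConf d → ℝ) (S : Finset (ZLat d)) : Prop :=
  ∀ σ τ : GConf d, (∀ x ∈ S, σ x = τ x) → f σ = f τ

/-- Sup norm of a real valued function. -/
def supNorm {α : Type*} (f : α → ℝ) : ℝ := ⨆ a, |f a|

/-- The cube `Q_ℓ(i) ⊆ ℤ^d` of side `ℓ` whose lowest corner is the site `ℓ·i`. -/
def cube {d : ℕ} (ℓ : ℕ) (i : ZLat d) : Finset (ZLat d) :=
  Fintype.piFinset fun k => Finset.Ico ((ℓ : ℤ) * i k) ((ℓ : ℤ) * i k + ℓ)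

/-- The Hamiltonian `H_Λ(σ) = ∑_{X ∩ Λ ≠ ∅} Φ_X(σ)` of a potential `Φ`. -/
def hamil {d : ℕ} (Φ : Finset (ZLat d) → GConf d → ℝ) (Λ : Finset (ZLat d))
    (σ : GConf d) : ℝ :=
  ∑' X : Finset (ZLat d), if (X ∩ Λ).Nonempty then Φ X σ else 0

/-- The configuration equal to `σ` inside `Λ` and to the boundary condition `τ`
outside `Λ`. -/
def override {d : ℕ} (Λ : Finset (ZLat d)) (σ : ↥Λ → Bool) (τ : GConf d) : GConf d :=
  fun x => if h : x ∈ Λ then σ ⟨x, h⟩ else τ x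

/-- The finite volume partition function `Z_Λ(τ)`. -/
def partFun {d : ℕ} (Φ : Finset (ZLat d) → GConf d → ℝ) (Λ : Finset (ZLat d))
    (τ : GConf d) : ℝ :=
  ∑ σ : ↥Λ → Bool, Real.exp (hamil Φ Λ (override Λ σ τ))

/-- The expectation of `f` under the finite volume Gibbs measure `μ_Λ^τ`. -/
def gibbsExp {d : ℕ} (Φ : Finset (ZLat d) → GConf d → ℝ) (Λ : Finset (ZLat d))
    (τ : GConf d) (f : GConf d → ℝ) : ℝ :=
  (∑ σ : ↥Λ → Bool, Real.exp (hamil Φ Λ (override Λ σ τ)) * f (override Λ σ τ)) /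
    partFun Φ Λ τ

/-- The finite region `⋃_{i ∈ I} Q_{ℓ0}(i)`: a finite union of cubes of side `ℓ0`
from the partition of `ℤ^d` into such cubes. -/
def cubesRegion {d : ℕ} (ℓ0 : ℕ) (I : Finset (ZLat d)) : Finset (ZLat d) :=
  I.biUnion (cube ℓ0)

/-- Condition SM(ℓ0, b, B) (strong mixing) for the potential `Φ`. -/
def SM {d : ℕ} (Φ : Finset (ZLat d) → GConf d → ℝ) (ℓ0 : ℕ) (b B : ℝ) : Prop :=
  ∀ (I : Finset (ZLat d)) (f g : GConf d → ℝ) (Sf Sg : Finset (ZLat d)),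
    LocalOn f Sf → LocalOn g Sg →
    Sf ⊆ cubesRegion ℓ0 I → Sg ⊆ cubesRegion ℓ0 I →
    (min Sf.card Sg.card : ℝ) * Real.exp (-b * fDist Sf Sg) ≤ 1 →
    ∀ τ : GConf d,
      |gibbsExp Φ (cubesRegion ℓ0 I) τ (fun σ => f σ * g σ) -
          gibbsExp Φ (cubesRegion ℓ0 I) τ f * gibbsExp Φ (cubesRegion ℓ0 I) τ g| ≤
        B * supNorm f * supNorm g * (min Sf.card Sg.card : ℝ) *
          Real.exp (-b * fDist Sf Sg)

/-- A translationally invariant finite-range lattice gas interaction, together with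
an activity `z > 0`; `U_X` vanishes unless `|X| > 1`, is a local function of the
coordinates in `X`, has range `r` and is translationally invariant. -/
structure LatticeGas (d : ℕ) where
  z : ℝ
  zpos : 0 < z
  U : Finset (ZLat d) → GConf d → ℝ
  r : ℕ
  Ulocal : ∀ X, LocalOn (U X) X
  Upair : ∀ X : Finset (ZLat d), X.card ≤ 1 → U X = 0
  Urange : ∀ X : Finset (ZLat d), ∀ x ∈ X, ∀ y ∈ X, r < supD x y → U X = 0
  UtransInv : ∀ (X : Finset (ZLat d)) (i : ZLat d) (σ : GConf d),
    U (X.image (· + i)) σ = U X fun x => σ (x + i)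

/-- The full lattice gas potential determined by the interaction `G.U` and a
(possibly inhomogeneous) family of activities `zf`: single-site terms
`η_x ↦ η_x log (zf x)` and interaction `U_X` for `|X| > 1`. -/
def gasPot {d : ℕ} (G : LatticeGas d) (zf : ZLat d → ℝ) :
    Finset (ZLat d) → GConf d → ℝ :=
  fun X σ =>
    if X.card = 1 then ∑ x ∈ X, (if σ x then Real.log (zf x) else 0) else G.U X σ

/-- The homogeneous lattice gas potential with activity `G.z`. -/
def gasPotH {d : ℕ} (G : LatticeGas d) : Finset (ZLat d) → GConf d → ℝ :=
  gasPot G fun _ => G.z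

/-- `μ` is an infinite volume Gibbs measure for the potential `Φ` (DLR equations). -/
def IsGibbs {d : ℕ} (Φ : Finset (ZLat d) → GConf d → ℝ)
    (μ : Measure (GConf d)) : Prop :=
  ∀ (Λ : Finset (ZLat d)) (f : GConf d → ℝ) (S : Finset (ZLat d)), LocalOn f S →
    (∫ τ, gibbsExp Φ Λ τ f ∂μ) = ∫ σ, f σ ∂μ

/-- The occupation number `η_x ∈ {0,1}` as a real number. -/
def occ {d : ℕ} (x : ZLat d) (η : GConf d) : ℝ := if η x then 1 else 0

/-- The equilibrium density `ρ = μ(η_0)`. -/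
def rho {d : ℕ} (μ : Measure (GConf d)) : ℝ := ∫ η, occ 0 η ∂μ

/-- The compressibility `χ = ∑_x [μ(η_0 η_x) − μ(η_0) μ(η_x)]`. -/
def chi {d : ℕ} (μ : Measure (GConf d)) : ℝ :=
  ∑' x : ZLat d, ((∫ η, occ 0 η * occ x η ∂μ) - rho μ * ∫ η, occ x η ∂μ)

/-- The centered and normalized block variable
`M_i^{(ℓ)}(η) = (∑_{x ∈ Q_ℓ(i)} η_x − ρℓ^d) / √(ℓ^d χ)`. -/
def Mblk {d : ℕ} (μ : Measure (GConf d)) (ℓ : ℕ) (i : ZLat d) (η : GConf d) : ℝ :=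
  ((∑ x ∈ cube ℓ i, occ x η) - rho μ * (ℓ : ℝ) ^ d) / Real.sqrt ((ℓ : ℝ) ^ d * chi μ)

/-- The renormalized measure `ν^{(ℓ)}`: the image of `μ` under the block averaging
map `η ↦ (M_i^{(ℓ)}(η))_i`. -/
def nu {d : ℕ} (μ : Measure (GConf d)) (ℓ : ℕ) : Measure (ZLat d → ℝ) :=
  μ.map fun η => fun i => Mblk μ ℓ i η

/-- The (finite) single-site renormalized configuration space `ℳ_i^{(ℓ)}`. -/
def Mset (d : ℕ) (μ : Measure (GConf d)) (ℓ : ℕ) : Finset ℝ :=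
  (Finset.range (ℓ ^ d + 1)).image fun k =>
    ((k : ℝ) - rho μ * (ℓ : ℝ) ^ d) / Real.sqrt ((ℓ : ℝ) ^ d * chi μ)


/-- A function of the renormalized configuration is `ℬ_I`-measurable, i.e. it depends
only on the block variables `m_i` with `i ∈ I`. -/
def LocalOnR {d : ℕ} (f : (ZLat d → ℝ) → ℝ) (I : Finset (ZLat d)) : Prop :=
  ∀ m m' : ZLat d → ℝ, (∀ i ∈ I, m i = m' i) → f m = f m'

/-- The (sup-)diameter of a finite subset of the renormalized lattice, in units of
the renormalization scale. -/
def diamIdx {d : ℕ} (I : Finset (ZLat d)) : ℕ := (I ×ˢ I).sup fun p => supD p.1 p.2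

/-- `I` is `ℓ`-connected: any two of its points are joined within `I` by steps of
sup-distance (at most) `1` in units of the renormalization scale. -/
def IdxConnected {d : ℕ} (I : Finset (ZLat d)) : Prop :=
  ∀ x ∈ I, ∀ y ∈ I, ∃ (n : ℕ) (p : ℕ → ZLat d), p 0 = x ∧ p n = y ∧
    (∀ k ≤ n, p k ∈ I) ∧ ∀ k < n, supD (p k) (p (k + 1)) ≤ 1

/-- The renormalized configuration `m m'_{Jᶜ}` equal to `mJ` on `J` and to `m'`
off `J`. -/
def glue {d : ℕ} (J : Finset (ZLat d)) (mJ : ↥J → ℝ) (m' : ZLat d → ℝ) :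
    ZLat d → ℝ :=
  fun i => if h : i ∈ J then mJ ⟨i, h⟩ else m' i

/-- `∑_{I ∩ J ≠ ∅} [ψ_I(m) + φ_I(m)]`. -/
def Wsum {d : ℕ} (ψ φ : Finset (ZLat d) → (ZLat d → ℝ) → ℝ) (J : Finset (ZLat d))
    (m : ZLat d → ℝ) : ℝ :=
  ∑' I : Finset (ZLat d), if (I ∩ J).Nonempty then ψ I m + φ I m else 0

/-- The DLR equations for the renormalized measure `ν` with respect to the potential
`{ψ_I + φ_I}`, with single-site renormalized configuration space `Ms`. -/
def RenDLR {d : ℕ} (ν : Measure (ZLat d → ℝ)) (Ms : Finset ℝ)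
    (ψ φ : Finset (ZLat d) → (ZLat d → ℝ) → ℝ) : Prop :=
  ∀ (J : Finset (ZLat d)) (f : (ZLat d → ℝ) → ℝ),
    LocalOnR f J → (∃ C : ℝ, ∀ m, |f m| ≤ C) →
    (∫ m, f m ∂ν) =
      ∫ m', (∑ mJ ∈ Fintype.piFinset fun _ : ↥J => Ms,
          f (glue J mJ m') * Real.exp (Wsum ψ φ J (glue J mJ m'))) /
        (∑ mJ ∈ Fintype.piFinset fun _ : ↥J => Ms,
          Real.exp (Wsum ψ φ J (glue J mJ m'))) ∂ν

/-- The conclusion of the weak Gibbsianity theorem for the renormalized measure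
`ν^{(ℓ)}` with renormalized potential `{ψ_I, φ_I}` (items (1)–(7)). -/
def WeakGibbs {d : ℕ} (μ : Measure (GConf d)) (ℓ : ℕ)
    (ψ φ : Finset (ZLat d) → (ZLat d → ℝ) → ℝ) : Prop :=
  -- (1) ℬ_I-measurability
  (∀ I : Finset (ZLat d), LocalOnR (ψ I) I ∧ LocalOnR (φ I) I) ∧
  -- (2) vanishing on non-ℓ-connected sets
  (∀ I : Finset (ZLat d), ¬ IdxConnected I → ψ I = 0 ∧ φ I = 0) ∧
  -- (3) translation invariance
  (∀ (I : Finset (ZLat d)) (i : ZLat d) (m : ZLat d → ℝ),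
    ψ (I.image (· - i)) (fun j => m (j + i)) = ψ I m ∧
    φ (I.image (· - i)) (fun j => m (j + i)) = φ I m) ∧
  -- (4) a.s. finite range of ψ and pointwise summability
  (∃ Mbar : Set (ZLat d → ℝ), MeasurableSet Mbar ∧ nu μ ℓ Mbar = 1 ∧
    ∃ rr : (ZLat d → ℝ) → ZLat d → ℕ,
      (∀ m ∈ Mbar, ∀ i : ZLat d, 1 ≤ rr m i) ∧
      (∀ m ∈ Mbar, ∀ (i : ZLat d) (I : Finset (ZLat d)),
        i ∈ I → rr m i < diamIdx I → ψ I m = 0) ∧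
      (∀ m ∈ Mbar, ∀ i : ZLat d, ∃ c : ℝ, 0 ≤ c ∧
        ∀ F : Finset (Finset (ZLat d)), (∀ I ∈ F, i ∈ I) →
          (∑ I ∈ F, |ψ I m|) ≤ c)) ∧
  -- (5) finiteness of the q-th moments of ∑_{I∋i} ψ_I
  (∀ q : ℝ, 1 ≤ q → ∃ Cq : ℝ, ∀ i : ZLat d,
    (∫ m, |∑' I : {I : Finset (ZLat d) // i ∈ I}, ψ I.1 m| ^ q ∂nu μ ℓ) ≤ Cq) ∧
  -- (6) uniform exponential summability of φ
  (∃ α' : ℝ, 0 < α' ∧ ∃ C : ℝ,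
    ∀ (m : ZLat d → ℝ) (i : ZLat d) (F : Finset (Finset (ZLat d))),
      (∀ I ∈ F, i ∈ I) →
      (∑ I ∈ F, Real.exp (α' * diamIdx I) * |φ I m|) ≤ C) ∧
  -- (7) DLR equations
  RenDLR (nu μ ℓ) (Mset d μ ℓ) ψ φ

set_option linter.unusedSectionVars false

section

/-- Finite volume expectations of a lattice gas. -/
local notation:max "𝔼[" G "]" => gibbsExp (gasPotH G)

/-- Finite sets of sites. -/
local notation "ℱ[" d "]" => Finset (ZLat d)

/-- The indicator of a level set. -/
local notation:max "𝟙[" N "," n "]" => fun η => ite (N η = n) 1 0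

/-- Block count configurations. -/
local notation "𝒩[" d "]" => ZLat d → ℕ

open Finset (Icc Ico abs_sum_le_sum_abs card_le_card card_range disjoint_left
  disjoint_of_subset_left disjoint_of_subset_right image_id induction_on insert_subset le_inf'
  le_sup mem_Icc mem_Ico mem_biUnion mem_coe mem_filter mem_image mem_image_of_mem mem_insert
  mem_insert_of_mem mem_insert_self mem_inter mem_powerset mem_product mem_range mem_sdiff
  mem_singleton mem_singleton_self mem_union mem_union_left mem_union_right mem_univ mul_sum
  notMem_empty prod_congr prod_const prod_const_one prod_mul_distrib prod_ne_zero_iff prod_nonneg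
  prod_pow prod_sdiff range sdiff_subset single_le_sum subset_insert subset_union_left
  sum_add_distrib sum_comm sum_congr sum_const sum_div sum_eq_single sum_eq_zero sum_filter
  sum_image sum_insert sum_ite_eq sum_le_sum sum_mul sum_mul_sum sum_nonneg sum_pos sum_product'
  sum_range_succ sum_singleton sum_sub_distrib union_insert union_sdiff_of_subset univ
  univ_nonempty)
open Real (exp exp_add exp_le_exp exp_nat_mul exp_pos exp_zero log log_mul mul_self_sqrt
  one_le_exp rpow_nonneg sq_sqrt sqrt)
open Function (Injective comp update update_eq_self update_of_ne)
open Set (piecewise_eq_of_mem piecewise_eq_of_notMem)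

/-- Weight of the edges of a walk `x, l` ending at `i`. -/
def edgeWeight {V : Type*} (D : V → V → ℕ) (i : V) : V → List V → ℝ
  | x, [] => if x = i then 1 else 0
  | x, y :: l => exp (-(D x y : ℝ)) * edgeWeight D i y l

lemma edgeWeight_nonneg {V : Type*} (D : V → V → ℕ) (i : V) (x : V) (l : List V) :
    0 ≤ edgeWeight D i x l := by
  induction l generalizing x with
  | nil => unfold edgeWeight; split_ifs <;> norm_num
  | cons y l ih => unfold edgeWeight; exact mul_nonneg (exp_pos _).le (ih y)

lemma sum_edgeWeight_le {V : Type*} [Fintype V] (D : V → V → ℕ)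
    (htri : ∀ x y z, D x z ≤ D x y + D y z) (hself : ∀ x, D x x = 0) (Cs : ℝ)
    (hCs : ∀ x, ∑ y, exp (-(D x y : ℝ) / 2) ≤ Cs) (i : V) (r : ℕ) (x : V) :
    ∑ f : Fin r → V, edgeWeight D i x (List.ofFn f) ≤ Cs ^ r * exp (-(D x i : ℝ) / 2) := by
  induction r generalizing x with
  | zero =>
    simp only [Fintype.sum_unique, List.ofFn_zero, edgeWeight, pow_zero, one_mul]
    split_ifs with h
    · subst h; simp [hself]
    · exact (exp_pos _).le
  | succ r ih =>
    rw [← (Fin.consEquiv fun _ => V).sum_comp, Fintype.sum_prod_type]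
    simp only [Fin.consEquiv_apply, List.ofFn_succ, Fin.cons_zero, Fin.cons_succ, edgeWeight,
      ← mul_sum]
    have hC : 0 ≤ Cs := le_trans (sum_nonneg fun y _ => (exp_pos _).le) (hCs x)
    calc ∑ y, exp (-(D x y : ℝ)) * ∑ f : Fin r → V, edgeWeight D i y (List.ofFn f)
        ≤ ∑ y, exp (-(D x y : ℝ) / 2) * (Cs ^ r * exp (-(D x i : ℝ) / 2)) := by
          refine sum_le_sum fun y _ => ?_
          refine (mul_le_mul_of_nonneg_left (ih y) (exp_pos _).le).trans ?_
          have : exp (-(D x y : ℝ)) * exp (-(D y i : ℝ) / 2) ≤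
              exp (-(D x y : ℝ) / 2) * exp (-(D x i : ℝ) / 2) := by
            rw [← exp_add, ← exp_add, exp_le_exp]
            have : (D x i : ℝ) ≤ D x y + D y i := by exact_mod_cast htri x y i
            linarith
          calc _ = Cs ^ r * (exp (-(D x y : ℝ)) * exp (-(D y i : ℝ) / 2)) := by ring
            _ ≤ Cs ^ r * (exp (-(D x y : ℝ) / 2) * exp (-(D x i : ℝ) / 2)) :=
              mul_le_mul_of_nonneg_left this (pow_nonneg hC r)
            _ = _ := by ring
      _ = (∑ y, exp (-(D x y : ℝ) / 2)) * (Cs ^ r * exp (-(D x i : ℝ) / 2)) := by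
          rw [sum_mul]
      _ ≤ Cs * (Cs ^ r * exp (-(D x i : ℝ) / 2)) :=
          mul_le_mul_of_nonneg_right (hCs x) (by positivity)
      _ = _ := by ring

lemma one_le_edgeWeight_mul {V : Type*} (D : V → V → ℕ) (L : V → ℝ) (hL : ∀ x, 0 ≤ L x) (i : V)
    (x : V) (l : List V)
    (hc : List.IsChain (fun x y => (D x y : ℝ) ≤ L x + L y) (x :: l))
    (hlast : (x :: l).getLast (by simp) = i) :
    exp (L x) ≤ edgeWeight D i x l * ((x :: l).map fun y => exp (2 * L y)).prod := by
  induction l generalizing x with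
  | nil =>
    simp only [List.getLast_singleton] at hlast
    subst hlast
    simp only [edgeWeight, if_true, List.map_cons, List.map_nil, List.prod_cons, List.prod_nil]
    rw [mul_one, one_mul, exp_le_exp]; linarith [hL x]
  | cons y l ih =>
    rw [List.isChain_cons_cons] at hc
    have h2 := ih y hc.2 (by simpa using hlast)
    rw [List.map_cons, List.prod_cons, edgeWeight]
    have h1 : exp (L x) ≤
        exp (-(D x y : ℝ)) * exp (2 * L x) * exp (L y) := by
      rw [← exp_add, ← exp_add, exp_le_exp]; linarith [hc.1]
    calc exp (L x) ≤ exp (-(D x y : ℝ)) * exp (2 * L x) * exp (L y) := h1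
      _ ≤ exp (-(D x y : ℝ)) * exp (2 * L x) * _ :=
        mul_le_mul_of_nonneg_left h2 (by positivity)
      _ = _ := by ring

lemma sum_pi_prod_mul_prod {V Ω : Type*} [Fintype V] [Fintype Ω] (ρ : V → Ω → ℝ)
    (hsum : ∀ v, ∑ ω, ρ v ω = 1) (S : Finset V) (h : V → Ω → ℝ) :
    ∑ u : V → Ω, (∏ v, ρ v (u v)) * ∏ v ∈ S, h v (u v) = ∏ v ∈ S, ∑ ω, ρ v ω * h v ω := by
  have : ∀ u : V → Ω, (∏ v, ρ v (u v)) * ∏ v ∈ S, h v (u v) =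
      ∏ v, (ρ v (u v) * if v ∈ S then h v (u v) else 1) := by
    intro u
    rw [prod_mul_distrib, Finset.prod_ite_mem, Finset.univ_inter]
  simp_rw [this]
  rw [← Fintype.prod_sum fun v ω => ρ v ω * if v ∈ S then h v ω else 1]
  rw [← Finset.prod_subset (Finset.subset_univ S)]
  · exact prod_congr rfl fun v hv => by simp [hv]
  · intro v _ hv; simp [hv, hsum]

lemma coupled_prod_le {V Ω : Type*} [Fintype V] [Fintype Ω] (ρ : V → Ω → ℝ)
    (hρ : ∀ v ω, 0 ≤ ρ v ω) (hsum : ∀ v, ∑ ω, ρ v ω = 1)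
    (Q : (V → Ω) → (V → Ω) → ℝ) (hQ : ∀ u u', 0 ≤ Q u u')
    (hQ1 : ∀ u, ∑ u', Q u u' ≤ ∏ v, ρ v (u v)) (hQ2 : ∀ u', ∑ u, Q u u' ≤ ∏ v, ρ v (u' v))
    (γ : V → Ω → ℝ) (S : Finset V) :
    ∑ u, ∑ u', Q u u' * ∏ v ∈ S, (γ v (u v) + γ v (u' v)) ≤
      ∏ v ∈ S, (2 * sqrt (∑ ω, ρ v ω * γ v ω ^ 2)) := by
  have key : ∀ T ⊆ S, ∑ u, ∑ u', Q u u' * ((∏ v ∈ T, γ v (u v)) * ∏ v ∈ S \ T, γ v (u' v)) ≤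
      ∏ v ∈ S, sqrt (∑ ω, ρ v ω * γ v ω ^ 2) := by
    intro T hT
    have cs := Finset.sum_mul_sq_le_sq_mul_sq (univ : Finset ((V → Ω) × (V → Ω)))
      (fun p => sqrt (Q p.1 p.2) * ∏ v ∈ T, γ v (p.1 v))
      (fun p => sqrt (Q p.1 p.2) * ∏ v ∈ S \ T, γ v (p.2 v))
    have e0 : ∑ p : (V → Ω) × (V → Ω), (sqrt (Q p.1 p.2) * ∏ v ∈ T, γ v (p.1 v)) *
        (sqrt (Q p.1 p.2) * ∏ v ∈ S \ T, γ v (p.2 v)) =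
        ∑ u, ∑ u', Q u u' * ((∏ v ∈ T, γ v (u v)) * ∏ v ∈ S \ T, γ v (u' v)) := by
      rw [Fintype.sum_prod_type]
      refine sum_congr rfl fun u _ => sum_congr rfl fun u' _ => ?_
      have := mul_self_sqrt (hQ u u')
      linear_combination ((∏ v ∈ T, γ v (u v)) * ∏ v ∈ S \ T, γ v (u' v)) * this
    have e1 : ∑ p : (V → Ω) × (V → Ω), (sqrt (Q p.1 p.2) * ∏ v ∈ T, γ v (p.1 v)) ^ 2 ≤
        ∏ v ∈ T, ∑ ω, ρ v ω * γ v ω ^ 2 := by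
      rw [Fintype.sum_prod_type, ← sum_pi_prod_mul_prod ρ hsum T fun v ω => γ v ω ^ 2]
      refine sum_le_sum fun u _ => ?_
      simp only [mul_pow, sq_sqrt (hQ _ _), prod_pow]
      rw [← sum_mul]
      exact mul_le_mul_of_nonneg_right (hQ1 u) (sq_nonneg _)
    have e2 : ∑ p : (V → Ω) × (V → Ω), (sqrt (Q p.1 p.2) * ∏ v ∈ S \ T, γ v (p.2 v)) ^ 2 ≤
        ∏ v ∈ S \ T, ∑ ω, ρ v ω * γ v ω ^ 2 := by
      rw [Fintype.sum_prod_type_right, ← sum_pi_prod_mul_prod ρ hsum (S \ T) fun v ω => γ v ω ^ 2]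
      refine sum_le_sum fun u _ => ?_
      simp only [mul_pow, sq_sqrt (hQ _ _), prod_pow]
      rw [← sum_mul]
      exact mul_le_mul_of_nonneg_right (hQ2 u) (sq_nonneg _)
    have hn : ∀ v, 0 ≤ ∑ ω, ρ v ω * γ v ω ^ 2 := fun v =>
      sum_nonneg fun ω _ => mul_nonneg (hρ v ω) (sq_nonneg _)
    rw [e0] at cs
    refine abs_le_of_sq_le_sq' ?_ (prod_nonneg fun v _ => Real.sqrt_nonneg _) |>.2
    refine cs.trans ((mul_le_mul e1 e2 (sum_nonneg fun _ _ => sq_nonneg _)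
      (prod_nonneg fun v _ => hn v)).trans ?_)
    rw [← prod_pow, mul_comm, prod_sdiff hT]
    exact le_of_eq (prod_congr rfl fun v _ => (sq_sqrt (hn v)).symm)
  calc ∑ u, ∑ u', Q u u' * ∏ v ∈ S, (γ v (u v) + γ v (u' v))
      = ∑ T ∈ S.powerset,
        ∑ u, ∑ u', Q u u' * ((∏ v ∈ T, γ v (u v)) * ∏ v ∈ S \ T, γ v (u' v)) := by
        rw [Finset.sum_comm' (t' := univ) (s' := fun _ => S.powerset) (by simp)]
        refine sum_congr rfl fun u _ => ?_
        rw [sum_comm]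
        refine sum_congr rfl fun u' _ => ?_
        rw [Finset.prod_add, mul_sum]
    _ ≤ ∑ T ∈ S.powerset, ∏ v ∈ S, sqrt (∑ ω, ρ v ω * γ v ω ^ 2) :=
        sum_le_sum fun T hT => key T (mem_powerset.1 hT)
    _ = _ := by
        rw [sum_const, Finset.card_powerset, prod_mul_distrib, prod_const]
        simp

/-- The larger of the two levels at a vertex for a pair of inputs. -/
def pairLev {V Ω : Type*} (lev : Ω → ℕ) (u u' : V → Ω) (x : V) : ℕ :=
  max (lev (u x)) (lev (u' x))

/-- The graph on vertices of positive level (and the endpoints `i, j`), adjacent when the balls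
of radius `D' + level` meet. -/
def levelGraph {V Ω : Type*} (D : V → V → ℕ) (lev : Ω → ℕ) (D' : ℕ) (i j : V) (u u' : V → Ω)
    (hD : ∀ x y, D x y = D y x) : SimpleGraph V where
  Adj x y := x ≠ y ∧ (1 ≤ pairLev lev u u' x ∨ x = i ∨ x = j) ∧
    (1 ≤ pairLev lev u u' y ∨ y = i ∨ y = j) ∧
    D x y ≤ (D' + pairLev lev u u' x) + (D' + pairLev lev u u' y)
  symm := ⟨fun x y h => ⟨h.1.symm, h.2.2.1, h.2.1, by rw [hD]; omega⟩⟩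
  loopless := ⟨fun _ h => h.1 rfl⟩

/-- The single-vertex factor in the path expansion. -/
def levFactor {V Ω : Type*} (lev : Ω → ℕ) (D' : ℕ) (i j : V) (x : V) (ω : Ω) : ℝ :=
  if 1 ≤ lev ω ∨ x = i ∨ x = j then exp (2 * ((D' : ℝ) + lev ω)) else 0

lemma levFactor_nonneg {V Ω : Type*} (lev : Ω → ℕ) (D' : ℕ) (i j : V) (x : V) (ω : Ω) :
    0 ≤ levFactor lev D' i j x ω := by
  unfold levFactor; split_ifs <;> positivity

lemma exp_pairLev_le {V Ω : Type*} (lev : Ω → ℕ) (D' : ℕ) (i j : V) (u u' : V → Ω) (x : V)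
    (hx : 1 ≤ pairLev lev u u' x ∨ x = i ∨ x = j) :
    exp (2 * ((D' + pairLev lev u u' x : ℕ) : ℝ)) ≤
      levFactor lev D' i j x (u x) + levFactor lev D' i j x (u' x) := by
  have h0 := levFactor_nonneg lev D' i j x (u x)
  have h1 := levFactor_nonneg lev D' i j x (u' x)
  rcases le_total (lev (u x)) (lev (u' x)) with h | h
  · have e : pairLev lev u u' x = lev (u' x) := max_eq_right h
    rw [e] at hx ⊢
    have : levFactor lev D' i j x (u' x) = exp (2 * ((D' : ℝ) + lev (u' x))) := if_pos hx
    rw [this] at *; push_cast; linarith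
  · have e : pairLev lev u u' x = lev (u x) := max_eq_left h
    rw [e] at hx ⊢
    have : levFactor lev D' i j x (u x) = exp (2 * ((D' : ℝ) + lev (u x))) := if_pos hx
    rw [this] at *; push_cast; linarith

lemma indicator_reachable_le {V Ω : Type*} [Fintype V] (D : V → V → ℕ)
    (lev : Ω → ℕ) (D' : ℕ) (i j : V) (u u' : V → Ω) (hD : ∀ x y, D x y = D y x) :
    (if (levelGraph D lev D' i j u u' hD).Reachable j i then (1 : ℝ) else 0) ≤
      ∑ r ∈ range (Fintype.card V), ∑ f : Fin r → V,
        if (j :: List.ofFn f).Nodup ∧ i ∈ j :: List.ofFn f then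
          edgeWeight D i j (List.ofFn f) * ∏ v ∈ (j :: List.ofFn f).toFinset,
            (levFactor lev D' i j v (u v) + levFactor lev D' i j v (u' v)) else 0 := by
  have hnn : ∀ r, ∀ f : Fin r → V, 0 ≤
      if (j :: List.ofFn f).Nodup ∧ i ∈ j :: List.ofFn f then
          edgeWeight D i j (List.ofFn f) * ∏ v ∈ (j :: List.ofFn f).toFinset,
            (levFactor lev D' i j v (u v) + levFactor lev D' i j v (u' v)) else 0 := by
    intro r f
    split_ifs
    · exact mul_nonneg (edgeWeight_nonneg _ _ _ _) (prod_nonneg fun v _ =>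
        add_nonneg (levFactor_nonneg _ _ _ _ _ _) (levFactor_nonneg _ _ _ _ _ _))
    · exact le_rfl
  split_ifs with hr
  swap
  · exact sum_nonneg fun r _ => sum_nonneg fun f _ => hnn r f
  obtain ⟨p, hp⟩ := hr.exists_isPath
  obtain ⟨l, hl⟩ : ∃ l, p.support = j :: l := ⟨p.support.tail, (p.cons_tail_support).symm⟩
  have hnd : (j :: l).Nodup := by rw [← hl]; exact hp.support_nodup
  have hmem : i ∈ j :: l := by rw [← hl]; exact p.end_mem_support
  have hlast : (j :: l).getLast (by simp) = i := by
    have := p.getLast_support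
    simpa only [hl] using this
  have hchain : List.IsChain (levelGraph D lev D' i j u u' hD).Adj (j :: l) := by
    rw [← hl]; exact p.isChain_adj_support
  have hcard : l.length < Fintype.card V := by
    have := hnd.length_le_card
    simpa using this
  have hmk : ∀ x ∈ j :: l, 1 ≤ pairLev lev u u' x ∨ x = i ∨ x = j := by
    intro x hx
    rw [← hl] at hx
    by_cases hxj : x = j
    · exact Or.inr (Or.inr hxj)
    · have h1 := p.takeUntil x hx
      cases hh : h1.reverse with
      | nil => exact absurd rfl hxj
      | cons h q => exact h.2.1
  have h1 := one_le_edgeWeight_mul D (fun x => ((D' + pairLev lev u u' x : ℕ) : ℝ))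
    (fun x => Nat.cast_nonneg _) i j l (hchain.imp fun x y h => by exact_mod_cast h.2.2.2) hlast
  refine le_trans ?_ (single_le_sum (fun r _ => sum_nonneg fun f _ => hnn r f)
    (mem_range.2 hcard))
  refine le_trans ?_ (single_le_sum (fun f _ => hnn l.length f)
    (mem_univ l.get))
  have hof : List.ofFn l.get = l := List.ofFn_get l
  rw [hof, if_pos ⟨hnd, hmem⟩]
  refine le_trans ?_ (le_trans h1 ?_)
  · rw [← exp_zero]; exact exp_le_exp.2 (Nat.cast_nonneg _)
  · refine mul_le_mul_of_nonneg_left ?_ (edgeWeight_nonneg _ _ _ _)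
    rw [← List.prod_toFinset _ hnd]
    refine Finset.prod_le_prod (fun v _ => (exp_pos _).le) fun v hv => ?_
    exact exp_pairLev_le lev D' i j u u' v (hmk v (List.mem_toFinset.1 hv))

lemma sum_reachable_le {V Ω : Type*} [Fintype V] [Fintype Ω] (D : V → V → ℕ)
    (hD : ∀ x y, D x y = D y x)
    (htri : ∀ x y z, D x z ≤ D x y + D y z) (hself : ∀ x, D x x = 0) (Cs : ℝ)
    (hCs : ∀ x, ∑ y, exp (-(D x y : ℝ) / 2) ≤ Cs)
    (ρ : V → Ω → ℝ) (hρ : ∀ v ω, 0 ≤ ρ v ω) (hsum : ∀ v, ∑ ω, ρ v ω = 1)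
    (Q : (V → Ω) → (V → Ω) → ℝ) (hQ : ∀ u u', 0 ≤ Q u u')
    (hQ1 : ∀ u, ∑ u', Q u u' ≤ ∏ v, ρ v (u v)) (hQ2 : ∀ u', ∑ u, Q u u' ≤ ∏ v, ρ v (u' v))
    (lev : Ω → ℕ) (D' : ℕ) (i j : V) (hij : i ≠ j) (g E : ℝ)
    (hg : ∀ v, 2 * sqrt (∑ ω, ρ v ω *
      (if 1 ≤ lev ω then exp (2 * ((D' : ℝ) + lev ω)) else 0) ^ 2) ≤ g)
    (hE : ∀ v, 2 * sqrt (∑ ω, ρ v ω * exp (2 * ((D' : ℝ) + lev ω)) ^ 2) ≤ E)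
    (hgC : g * Cs ≤ 1 / 2) :
    ∑ u, ∑ u', Q u u' * (if (levelGraph D lev D' i j u u' hD).Reachable j i then (1 : ℝ) else 0) ≤
      2 * E ^ 2 * Cs * exp (-(D j i : ℝ) / 2) := by
  have hg0 : 0 ≤ g := le_trans (by positivity) (hg i)
  have hE0 : 0 ≤ E := le_trans (by positivity) (hE i)
  have hC0 : 0 ≤ Cs := le_trans (sum_nonneg fun y _ => (exp_pos _).le) (hCs i)
  have hfac : ∀ v, 2 * sqrt (∑ ω, ρ v ω * levFactor lev D' i j v ω ^ 2) ≤
      if v = i ∨ v = j then E else g := by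
    intro v
    split_ifs with hv
    · refine le_trans (le_of_eq ?_) (hE v)
      congr 2
      refine sum_congr rfl fun ω _ => ?_
      rw [levFactor, if_pos (Or.inr hv)]
    · refine le_trans (le_of_eq ?_) (hg v)
      congr 2
      refine sum_congr rfl fun ω _ => ?_
      simp only [levFactor, hv, or_false]
  have hterm : ∀ (r : ℕ) (f : Fin r → V),
      ∑ u, ∑ u', Q u u' * (if (j :: List.ofFn f).Nodup ∧ i ∈ j :: List.ofFn f then
          edgeWeight D i j (List.ofFn f) * ∏ v ∈ (j :: List.ofFn f).toFinset,
            (levFactor lev D' i j v (u v) + levFactor lev D' i j v (u' v)) else 0) ≤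
      if r = 0 then 0 else E ^ 2 * g ^ (r - 1) * edgeWeight D i j (List.ofFn f) := by
    intro r f
    have hew := edgeWeight_nonneg D i j (List.ofFn f)
    by_cases hc : (j :: List.ofFn f).Nodup ∧ i ∈ j :: List.ofFn f
    swap
    · simp only [hc, if_false, mul_zero, Finset.sum_const_zero]
      split_ifs
      · exact le_rfl
      · positivity
    have hr : r ≠ 0 := by
      rintro rfl
      simp at hc
      exact hij hc
    simp only [hc, and_self, if_true, hr, if_false]
    set S := (j :: List.ofFn f).toFinset with hS
    have hiS : i ∈ S := List.mem_toFinset.2 hc.2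
    have hjS : j ∈ S := List.mem_toFinset.2 (by simp)
    have hcard : S.card = r + 1 := by
      rw [hS, List.toFinset_card_of_nodup hc.1]; simp
    have hprod : ∏ v ∈ S, (2 * sqrt (∑ ω, ρ v ω * levFactor lev D' i j v ω ^ 2)) ≤
        E ^ 2 * g ^ (r - 1) := by
      refine (Finset.prod_le_prod (fun v _ => by positivity) fun v _ => hfac v).trans ?_
      have hsub : ({i, j} : Finset V) ⊆ S := by
        intro x hx; simp at hx; rcases hx with rfl | rfl <;> assumption
      rw [← prod_sdiff hsub, Finset.prod_pair hij]
      have : ∏ x ∈ S \ {i, j}, (if x = i ∨ x = j then E else g) = g ^ (r - 1) := by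
        rw [prod_congr rfl (g := fun _ => g)]
        · rw [prod_const, Finset.card_sdiff_of_subset hsub, hcard,
            Finset.card_pair hij]
          congr 1
        · intro x hx
          simp at hx
          simp [hx.2]
      rw [this]
      simp
      nlinarith
    calc _ = edgeWeight D i j (List.ofFn f) * ∑ u, ∑ u', Q u u' * ∏ v ∈ S,
            (levFactor lev D' i j v (u v) + levFactor lev D' i j v (u' v)) := by
          rw [mul_sum]
          refine sum_congr rfl fun u _ => ?_
          rw [mul_sum]
          exact sum_congr rfl fun u' _ => by ring
      _ ≤ edgeWeight D i j (List.ofFn f) * (E ^ 2 * g ^ (r - 1)) :=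
          mul_le_mul_of_nonneg_left ((coupled_prod_le ρ hρ hsum Q hQ hQ1 hQ2 _ S).trans hprod) hew
      _ = _ := by ring
  calc _ ≤ ∑ u, ∑ u', Q u u' * ∑ r ∈ range (Fintype.card V), ∑ f : Fin r → V,
        (if (j :: List.ofFn f).Nodup ∧ i ∈ j :: List.ofFn f then
          edgeWeight D i j (List.ofFn f) * ∏ v ∈ (j :: List.ofFn f).toFinset,
            (levFactor lev D' i j v (u v) + levFactor lev D' i j v (u' v)) else 0) :=
        sum_le_sum fun u _ => sum_le_sum fun u' _ =>
          mul_le_mul_of_nonneg_left (indicator_reachable_le D lev D' i j u u' hD) (hQ u u')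
    _ = ∑ r ∈ range (Fintype.card V), ∑ f : Fin r → V, ∑ u, ∑ u', Q u u' *
        (if (j :: List.ofFn f).Nodup ∧ i ∈ j :: List.ofFn f then
          edgeWeight D i j (List.ofFn f) * ∏ v ∈ (j :: List.ofFn f).toFinset,
            (levFactor lev D' i j v (u v) + levFactor lev D' i j v (u' v)) else 0) := by
        simp_rw [mul_sum]
        simp_rw [sum_comm (s := (univ : Finset (V → Ω)))
          (t := range (Fintype.card V))]
        refine sum_congr rfl fun r _ => ?_
        simp_rw [sum_comm (s := (univ : Finset (V → Ω)))
          (t := (univ : Finset (Fin r → V)))]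
    _ ≤ ∑ r ∈ range (Fintype.card V),
        (if r = 0 then 0 else E ^ 2 * g ^ (r - 1) * (Cs ^ r * exp (-(D j i : ℝ) / 2))) := by
        refine sum_le_sum fun r _ => ?_
        refine (sum_le_sum fun f _ => hterm r f).trans ?_
        split_ifs
        · simp
        · rw [← mul_sum]
          exact mul_le_mul_of_nonneg_left (sum_edgeWeight_le D htri hself Cs hCs i r j)
            (by positivity)
    _ ≤ ∑ r ∈ range (Fintype.card V + 1),
        (if r = 0 then 0 else E ^ 2 * g ^ (r - 1) * (Cs ^ r * exp (-(D j i : ℝ) / 2))) :=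
        Finset.sum_le_sum_of_subset_of_nonneg (by simp) fun r _ _ => by
          split_ifs <;> positivity
    _ = E ^ 2 * Cs * exp (-(D j i : ℝ) / 2) * ∑ r ∈ range (Fintype.card V),
          (g * Cs) ^ r := by
        rw [Finset.sum_range_succ', mul_sum]
        simp only [if_true, add_zero]
        refine sum_congr rfl fun r _ => ?_
        simp [mul_pow, pow_succ]; ring
    _ ≤ E ^ 2 * Cs * exp (-(D j i : ℝ) / 2) * 2 := by
        refine mul_le_mul_of_nonneg_left ?_ (by positivity)
        refine (sum_le_sum fun r _ => pow_le_pow_left₀ (by positivity) hgC r).trans ?_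
        have := sum_geometric_two_le (Fintype.card V)
        simpa using this
    _ = _ := by ring

/-- A finite set with a metric, a colouring whose colour classes are `3`-separated and an
exploration order compatible with the colouring. -/
structure Geom (V : Type*) where
  D : V → V → ℕ
  D_symm : ∀ x y, D x y = D y x
  D_tri : ∀ x y z, D x z ≤ D x y + D y z
  D_self : ∀ x, D x x = 0
  K : ℕ
  col : V → ℕ
  rk : V → ℕ
  col_lt : ∀ x, col x < K
  col_mono : ∀ x y, rk x < rk y → col x ≤ col y
  col_sep : ∀ x y, col x = col y → x ≠ y → 3 ≤ D x y

/-- A representation of a random field on a finite set `V` as a function of independent inputs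
`u : V → Ω`.  Vertices are explored in the order of `rk`; the hidden variable `code u v` is a
response to the input `u v` and to the earlier hidden variables within distance
`2 + lev (u v)`; the observation `obs v` depends on the input and the hidden variable at `v`. -/
structure Coding (V Ω α : Type*) extends Geom V where
  lev : Ω → ℕ
  resp : V → Ω → (V → α) → α
  resp_local : ∀ v ω p p', (∀ x, rk x < rk v → D v x ≤ 2 + lev ω → p x = p' x) →
    resp v ω p = resp v ω p'
  code : (V → Ω) → V → α
  code_eq : ∀ u v, code u v = resp v (u v) (code u)
  obs : V → Ω → α → ℕ
  obs0 : V → Ω → ℕ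

namespace Coding

variable {V Ω α : Type*} (c : Coding V Ω α)

/-- The observed field. -/
def out (u : V → Ω) (v : V) : ℕ := c.obs v (u v) (c.code u v)

/-- The radius added to the level of a vertex. -/
def rad : ℕ := 2 * c.K + 2

lemma code_congr (u w : V → Ω) (m : V → Prop) (L : V → ℕ) (hL : ∀ x, c.lev (u x) ≤ L x)
    (hm : ∀ x, 1 ≤ L x → m x) (Z : Set V) (huw : ∀ x ∈ Z, u x = w x)
    (hZ : ∀ x ∈ Z, m x → ∀ y, c.D x y ≤ c.rad + L x → y ∈ Z) (v : V)
    (hv : ∀ y, c.D v y ≤ 2 * c.col v → y ∈ Z) : c.code u v = c.code w v := by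
  induction hn : c.rk v using Nat.strong_induction_on generalizing v with
  | _ n ih =>
  subst hn
  have hvZ : v ∈ Z := hv v (by rw [c.D_self]; exact Nat.zero_le _)
  rw [c.code_eq, c.code_eq w, ← huw v hvZ]
  refine c.resp_local v _ _ _ fun x hx hxd => ?_
  refine ih _ hx x (fun y hy => ?_) rfl
  have hne : v ≠ x := by rintro rfl; exact lt_irrefl _ hx
  have hcle := c.col_mono x v hx
  have ht := c.D_tri v x y
  by_cases hlev : 1 ≤ L v
  · refine hZ v hvZ (hm v hlev) y ?_
    have := c.col_lt x
    have := hL v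
    unfold rad
    omega
  · have h0 : c.lev (u v) = 0 := by have := hL v; omega
    rw [h0] at hxd
    have hcne : c.col v ≠ c.col x := fun h => by have := c.col_sep v x h hne; omega
    exact hv y (by omega)

/-- The level graph of a pair of inputs. -/
def graph (i j : V) (u u' : V → Ω) : SimpleGraph V :=
  levelGraph c.D c.lev c.rad i j u u' c.D_symm

/-- The union of the balls centred at the component of `j` in the level graph. -/
def cluster (i j : V) (u u' : V → Ω) : Set V :=
  {y | ∃ x, (c.graph i j u u').Reachable j x ∧ c.D x y ≤ c.rad + pairLev c.lev u u' x}

lemma graph_congr (i j : V) (u u' w w' : V → Ω)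
    (h : pairLev c.lev w w' = pairLev c.lev u u') : c.graph i j w w' = c.graph i j u u' := by
  ext x y
  simp only [graph, levelGraph, h]

lemma cluster_congr (i j : V) (u u' w w' : V → Ω)
    (h : pairLev c.lev w w' = pairLev c.lev u u') : c.cluster i j w w' = c.cluster i j u u' := by
  unfold cluster
  rw [c.graph_congr i j u u' w w' h, h]

lemma marked_of_reachable (i j : V) (u u' : V → Ω) (x : V)
    (h : (c.graph i j u u').Reachable j x) : 1 ≤ pairLev c.lev u u' x ∨ x = i ∨ x = j := by
  by_cases hx : x = j
  · exact Or.inr (Or.inr hx)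
  · obtain ⟨p⟩ := h.symm
    cases p with
    | nil => exact absurd rfl hx
    | cons h q => exact h.2.1

lemma reachable_of_near (i j : V) (u u' : V → Ω) (x w : V)
    (hx : (c.graph i j u u').Reachable j x)
    (hw : 1 ≤ pairLev c.lev u u' w ∨ w = i ∨ w = j)
    (hd : c.D x w ≤ (c.rad + pairLev c.lev u u' x) + (c.rad + pairLev c.lev u u' w)) :
    (c.graph i j u u').Reachable j w := by
  by_cases h : x = w
  · exact h ▸ hx
  · exact hx.trans (SimpleGraph.Adj.reachable
      ⟨h, c.marked_of_reachable i j u u' x hx, hw, hd⟩)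

lemma cluster_closed (i j : V) (u u' : V → Ω) (w : V) (hw : w ∈ c.cluster i j u u')
    (hm : 1 ≤ pairLev c.lev u u' w ∨ w = i ∨ w = j) (y : V)
    (hy : c.D w y ≤ c.rad + pairLev c.lev u u' w) : y ∈ c.cluster i j u u' := by
  obtain ⟨x, hx, hxw⟩ := hw
  exact ⟨w, c.reachable_of_near i j u u' x w hx hm (by omega), hy⟩

lemma ball_disjoint_cluster (i j : V) (u u' : V → Ω) (w : V)
    (hw : ¬ (c.graph i j u u').Reachable j w)
    (hm : 1 ≤ pairLev c.lev u u' w ∨ w = i ∨ w = j) (y : V)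
    (hy : c.D w y ≤ c.rad + pairLev c.lev u u' w) : y ∉ c.cluster i j u u' := by
  rintro ⟨x, hx, hxy⟩
  refine hw (c.reachable_of_near i j u u' x w hx hm ?_)
  have := c.D_tri x y w
  rw [c.D_symm y w] at this
  omega

lemma cluster_compl_closed (i j : V) (u u' : V → Ω) (w : V) (hw : w ∉ c.cluster i j u u')
    (hm : 1 ≤ pairLev c.lev u u' w ∨ w = i ∨ w = j) (y : V)
    (hy : c.D w y ≤ c.rad + pairLev c.lev u u' w) : y ∉ c.cluster i j u u' := by
  refine c.ball_disjoint_cluster i j u u' w (fun h => hw ⟨w, h, ?_⟩) hm y hy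
  rw [c.D_self]; exact Nat.zero_le _

lemma lev_le_pairLev (C : Set V) (u u' : V → Ω) (x : V) :
    c.lev (C.piecewise u' u x) ≤ pairLev c.lev u u' x := by
  by_cases h : x ∈ C
  · rw [piecewise_eq_of_mem _ _ _ h]; exact le_max_right _ _
  · rw [piecewise_eq_of_notMem _ _ _ h]; exact le_max_left _ _

lemma pairLev_piecewise (C : Set V) (u u' : V → Ω) :
    pairLev c.lev (C.piecewise u' u) (C.piecewise u u') = pairLev c.lev u u' := by
  funext x
  unfold pairLev
  by_cases h : x ∈ C
  · rw [piecewise_eq_of_mem _ _ _ h, piecewise_eq_of_mem _ _ _ h]; exact max_comm _ _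
  · rw [piecewise_eq_of_notMem _ _ _ h, piecewise_eq_of_notMem _ _ _ h]

lemma pairLev_comm (u u' : V → Ω) : pairLev c.lev u' u = pairLev c.lev u u' := by
  funext x; exact max_comm _ _

/-- Inputs for which low levels around a vertex force the observation to be `obs0`. -/
def Regular (u : V → Ω) : Prop :=
  ∀ v, (∀ t, c.D v t ≤ 1 → c.lev (u t) = 0) → c.out u v = c.obs0 v (u v)

lemma out_piecewise (i j : V) (u u' : V → Ω) (hu : c.Regular u) (hu' : c.Regular u')
    (hw : c.Regular ((c.cluster i j u u').piecewise u' u)) (v : V) :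
    c.out ((c.cluster i j u u').piecewise u' u) v =
      (c.cluster i j u u').piecewise (c.out u') (c.out u) v := by
  set C := c.cluster i j u u' with hC
  set w := C.piecewise u' u with hwdef
  by_cases ht : ∃ t, c.D v t ≤ 1 ∧ (1 ≤ pairLev c.lev u u' t ∨ t = i ∨ t = j)
  · obtain ⟨t, htd, htm⟩ := ht
    have hball : ∀ y, c.D v y ≤ 2 * c.col v → c.D t y ≤ c.rad + pairLev c.lev u u' t := by
      intro y hy
      have h1 := c.D_tri t v y
      rw [c.D_symm t v] at h1
      have h2 := c.col_lt v
      unfold rad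
      omega
    by_cases hr : (c.graph i j u u').Reachable j t
    · have hin : ∀ y, c.D v y ≤ 2 * c.col v → y ∈ C := fun y hy => ⟨t, hr, hball y hy⟩
      have hvC : v ∈ C := hin v (by rw [c.D_self]; exact Nat.zero_le _)
      have hcode := c.code_congr w u' _ (pairLev c.lev u u') (c.lev_le_pairLev C u u')
        (fun x hx => Or.inl hx) C (fun x hx => piecewise_eq_of_mem _ _ _ hx)
        (fun x hx hm y hy => c.cluster_closed i j u u' x hx hm y hy) v hin
      rw [piecewise_eq_of_mem _ _ _ hvC, out, out, hcode, hwdef,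
        piecewise_eq_of_mem _ _ _ hvC]
    · have hin : ∀ y, c.D v y ≤ 2 * c.col v → y ∈ Cᶜ := fun y hy =>
        c.ball_disjoint_cluster i j u u' t hr htm y (hball y hy)
      have hvC : v ∉ C := hin v (by rw [c.D_self]; exact Nat.zero_le _)
      have hcode := c.code_congr w u _ (pairLev c.lev u u') (c.lev_le_pairLev C u u')
        (fun x hx => Or.inl hx) Cᶜ (fun x hx => piecewise_eq_of_notMem _ _ _ hx)
        (fun x hx hm y hy => c.cluster_compl_closed i j u u' x hx hm y hy) v hin
      rw [piecewise_eq_of_notMem _ _ _ hvC, out, out, hcode, hwdef,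
        piecewise_eq_of_notMem _ _ _ hvC]
  · push Not at ht
    have h0 : ∀ t, c.D v t ≤ 1 → pairLev c.lev u u' t = 0 := fun t h => by
      have := (ht t h).1; omega
    have hul : ∀ t, c.D v t ≤ 1 → c.lev (u t) = 0 := fun t h => by
      have := h0 t h; have h2 : c.lev (u t) ≤ pairLev c.lev u u' t := le_max_left _ _; omega
    have hul' : ∀ t, c.D v t ≤ 1 → c.lev (u' t) = 0 := fun t h => by
      have := h0 t h; have h2 : c.lev (u' t) ≤ pairLev c.lev u u' t := le_max_right _ _; omega
    have hwl : ∀ t, c.D v t ≤ 1 → c.lev (w t) = 0 := fun t h => by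
      have := h0 t h; have h2 := c.lev_le_pairLev C u u' t; rw [← hwdef] at h2; omega
    rw [hw v hwl]
    by_cases hvC : v ∈ C
    · rw [piecewise_eq_of_mem _ _ _ hvC, hu' v hul', hwdef, piecewise_eq_of_mem _ _ _ hvC]
    · rw [piecewise_eq_of_notMem _ _ _ hvC, hu v hul, hwdef,
        piecewise_eq_of_notMem _ _ _ hvC]

lemma mem_cluster_self (i j : V) (u u' : V → Ω) : j ∈ c.cluster i j u u' :=
  ⟨j, SimpleGraph.Reachable.refl j, by rw [c.D_self]; exact Nat.zero_le _⟩

lemma notMem_cluster (i j : V) (u u' : V → Ω) (h : ¬ (c.graph i j u u').Reachable j i) :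
    i ∉ c.cluster i j u u' :=
  c.ball_disjoint_cluster i j u u' i h (Or.inr (Or.inl rfl)) i
    (by rw [c.D_self]; exact Nat.zero_le _)

/-- Swap the two inputs on the cluster of `j` unless it is connected to `i`. -/
def swap (i j : V) (p : (V → Ω) × (V → Ω)) : (V → Ω) × (V → Ω) :=
  if (c.graph i j p.1 p.2).Reachable j i then p
  else ((c.cluster i j p.1 p.2).piecewise p.2 p.1, (c.cluster i j p.1 p.2).piecewise p.1 p.2)

lemma graph_swap (i j : V) (p : (V → Ω) × (V → Ω)) :
    c.graph i j (c.swap i j p).1 (c.swap i j p).2 = c.graph i j p.1 p.2 := by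
  unfold swap
  split_ifs
  · rfl
  · exact c.graph_congr i j _ _ _ _ (c.pairLev_piecewise _ _ _)

lemma swap_swap (i j : V) (p : (V → Ω) × (V → Ω)) : c.swap i j (c.swap i j p) = p := by
  by_cases h : (c.graph i j p.1 p.2).Reachable j i
  · have : c.swap i j p = p := if_pos h
    rw [this, this]
  · have h1 : c.swap i j p = ((c.cluster i j p.1 p.2).piecewise p.2 p.1,
      (c.cluster i j p.1 p.2).piecewise p.1 p.2) := if_neg h
    have h2 := c.graph_swap i j p
    have h3 : c.cluster i j (c.swap i j p).1 (c.swap i j p).2 = c.cluster i j p.1 p.2 := by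
      rw [h1]; exact c.cluster_congr i j _ _ _ _ (c.pairLev_piecewise _ _ _)
    rw [swap, if_neg (by rwa [h2]), h3, h1]
    refine Prod.ext ?_ ?_ <;> funext x <;> by_cases hx : x ∈ c.cluster i j p.1 p.2 <;>
      simp [Set.piecewise, hx]

lemma prod_swap [Fintype V] (ρ : V → Ω → ℝ) (i j : V) (p : (V → Ω) × (V → Ω)) :
    (∏ v, ρ v ((c.swap i j p).1 v)) * ∏ v, ρ v ((c.swap i j p).2 v) =
      (∏ v, ρ v (p.1 v)) * ∏ v, ρ v (p.2 v) := by
  rw [← prod_mul_distrib, ← prod_mul_distrib]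
  refine prod_congr rfl fun v _ => ?_
  unfold swap
  split_ifs
  · rfl
  · by_cases hx : v ∈ c.cluster i j p.1 p.2 <;> simp [Set.piecewise, hx, mul_comm]

end Coding

lemma ite_mul_ite_zero (P Q : Prop) [Decidable P] [Decidable Q] [Decidable (P ∧ Q)] (x y : ℝ) :
    (if P then x else 0) * (if Q then y else 0) = if P ∧ Q then x * y else 0 := by
  by_cases h1 : P <;> by_cases h2 : Q <;> simp [h1, h2]

namespace Coding

variable {V Ω α : Type*} [Fintype V] [Fintype Ω] (c : Coding V Ω α)

/-- The probability that the observed field agrees with `m` off `S`. -/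
def prAgree (ρ : V → Ω → ℝ) (S : Finset V) (m : V → ℕ) : ℝ :=
  ∑ u : V → Ω, if ∀ v, v ∉ S → c.out u v = m v then ∏ v, ρ v (u v) else 0

lemma prAgree_nonneg (ρ : V → Ω → ℝ) (hρ : ∀ v ω, 0 ≤ ρ v ω) (S : Finset V) (m : V → ℕ) :
    0 ≤ c.prAgree ρ S m := by
  refine sum_nonneg fun u _ => ?_
  split_ifs
  · exact prod_nonneg fun v _ => hρ v _
  · exact le_rfl

lemma prAgree_congr (ρ : V → Ω → ℝ) (S : Finset V) (m m' : V → ℕ) (h : ∀ v, v ∉ S → m v = m' v) :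
    c.prAgree ρ S m = c.prAgree ρ S m' := by
  refine sum_congr rfl fun u _ => ?_
  have : (∀ v, v ∉ S → c.out u v = m v) ↔ (∀ v, v ∉ S → c.out u v = m' v) :=
    ⟨fun H v hv => (H v hv).trans (h v hv), fun H v hv => (H v hv).trans (h v hv).symm⟩
  simp only [this]

/-- Two independent copies conditioned to have the same observation off `S`. -/
def pairLaw (ρ : V → Ω → ℝ) (S : Finset V) (u u' : V → Ω) : ℝ :=
  if ∀ v, v ∉ S → c.out u' v = c.out u v then
    (∏ v, ρ v (u v)) * (∏ v, ρ v (u' v)) / c.prAgree ρ S (c.out u) else 0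

lemma pairLaw_nonneg (ρ : V → Ω → ℝ) (hρ : ∀ v ω, 0 ≤ ρ v ω) (S : Finset V) (u u' : V → Ω) :
    0 ≤ c.pairLaw ρ S u u' := by
  unfold pairLaw
  split_ifs
  · exact div_nonneg (mul_nonneg (prod_nonneg fun v _ => hρ v _)
      (prod_nonneg fun v _ => hρ v _)) (c.prAgree_nonneg ρ hρ S _)
  · exact le_rfl

lemma pairLaw_symm (ρ : V → Ω → ℝ) (S : Finset V) (u u' : V → Ω) :
    c.pairLaw ρ S u u' = c.pairLaw ρ S u' u := by
  unfold pairLaw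
  by_cases h : ∀ v, v ∉ S → c.out u' v = c.out u v
  · have h' : ∀ v, v ∉ S → c.out u v = c.out u' v := fun v hv => (h v hv).symm
    rw [if_pos h, if_pos h', c.prAgree_congr ρ S _ _ h', mul_comm]
  · have h' : ¬ ∀ v, v ∉ S → c.out u v = c.out u' v := fun H => h fun v hv => (H v hv).symm
    rw [if_neg h, if_neg h']

lemma sum_pairLaw_le (ρ : V → Ω → ℝ) (hρ : ∀ v ω, 0 ≤ ρ v ω) (S : Finset V) (u : V → Ω) :
    ∑ u', c.pairLaw ρ S u u' ≤ ∏ v, ρ v (u v) := by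
  have : ∑ u', c.pairLaw ρ S u u' =
      (∏ v, ρ v (u v)) * (c.prAgree ρ S (c.out u) / c.prAgree ρ S (c.out u)) := by
    conv_rhs => rw [div_eq_mul_inv]; enter [2, 1]; rw [prAgree]
    rw [sum_mul, mul_sum]
    refine sum_congr rfl fun u' _ => ?_
    unfold pairLaw
    split_ifs <;> ring
  rw [this]
  exact mul_le_of_le_one_right (prod_nonneg fun v _ => hρ v _) (div_self_le_one _)

/-- Exponential decay of conditional correlations of the observed field. -/
theorem conditional_decay (ρ : V → Ω → ℝ) (hρ : ∀ v ω, 0 ≤ ρ v ω) (hsum : ∀ v, ∑ ω, ρ v ω = 1)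
    (hreg : ∀ u, (∀ v, ρ v (u v) ≠ 0) → c.Regular u) (Cs : ℝ)
    (hCs : ∀ x, ∑ y, exp (-(c.D x y : ℝ) / 2) ≤ Cs) (i j : V) (hij : i ≠ j) (g E : ℝ)
    (hg : ∀ v, 2 * sqrt (∑ ω, ρ v ω *
      (if 1 ≤ c.lev ω then exp (2 * ((c.rad : ℝ) + c.lev ω)) else 0) ^ 2) ≤ g)
    (hE : ∀ v, 2 * sqrt (∑ ω, ρ v ω * exp (2 * ((c.rad : ℝ) + c.lev ω)) ^ 2) ≤ E)
    (hgC : g * Cs ≤ 1 / 2) (A : Finset (V → ℕ)) :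
    ∑ m ∈ A, |c.prAgree ρ ∅ m * c.prAgree ρ {i, j} m - c.prAgree ρ {i} m * c.prAgree ρ {j} m| /
        c.prAgree ρ {i, j} m ≤ 4 * E ^ 2 * Cs * exp (-(c.D j i : ℝ) / 2) := by
  set W2 : (V → Ω) × (V → Ω) → ℝ := fun p => (∏ v, ρ v (p.1 v)) * ∏ v, ρ v (p.2 v) with hW2
  have hW0 : ∀ p, 0 ≤ W2 p := fun p => mul_nonneg (prod_nonneg fun v _ => hρ v _)
    (prod_nonneg fun v _ => hρ v _)
  set R : (V → Ω) × (V → Ω) → Prop := fun p => (c.graph i j p.1 p.2).Reachable j i with hR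
  set EA : (V → ℕ) → (V → Ω) × (V → Ω) → Prop := fun m p =>
    (∀ v, c.out p.1 v = m v) ∧ (∀ v, v ∉ ({i, j} : Finset V) → c.out p.2 v = m v) with hEA
  set EB : (V → ℕ) → (V → Ω) × (V → Ω) → Prop := fun m p =>
    (∀ v, v ≠ j → c.out p.1 v = m v) ∧ (∀ v, v ≠ i → c.out p.2 v = m v) with hEB
  have hA : ∀ m, c.prAgree ρ ∅ m * c.prAgree ρ {i, j} m = ∑ p, if EA m p then W2 p else 0 := by
    intro m
    rw [prAgree, prAgree, sum_mul_sum, ← sum_product', Finset.univ_product_univ]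
    refine sum_congr rfl fun p _ => ?_
    simp only [hEA, hW2, notMem_empty, not_false_eq_true, true_imp_iff]
    exact ite_mul_ite_zero _ _ _ _
  have hB : ∀ m, c.prAgree ρ {i} m * c.prAgree ρ {j} m = ∑ p, if EB m p then W2 p else 0 := by
    intro m
    rw [mul_comm, prAgree, prAgree, sum_mul_sum, ← sum_product',
      Finset.univ_product_univ]
    refine sum_congr rfl fun p _ => ?_
    simp only [hEB, hW2, mem_singleton]
    exact ite_mul_ite_zero _ _ _ _
  -- on pairs that are not connected, the swap exchanges the two events
  have hswapE : ∀ m p, W2 p ≠ 0 → ¬ R p → (EA m (c.swap i j p) ↔ EB m p) := by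
    intro m p hp hr
    have hp1 : ∀ v, ρ v (p.1 v) ≠ 0 := fun v => by
      have := left_ne_zero_of_mul hp
      exact prod_ne_zero_iff.1 this v (mem_univ _)
    have hp2 : ∀ v, ρ v (p.2 v) ≠ 0 := fun v => by
      have := right_ne_zero_of_mul hp
      exact prod_ne_zero_iff.1 this v (mem_univ _)
    set C := c.cluster i j p.1 p.2 with hC
    have hCc : c.cluster i j p.2 p.1 = C := c.cluster_congr i j _ _ _ _ (c.pairLev_comm _ _)
    have hw1 : ∀ v, ρ v (C.piecewise p.2 p.1 v) ≠ 0 := fun v => by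
      by_cases h : v ∈ C
      · rw [piecewise_eq_of_mem _ _ _ h]; exact hp2 v
      · rw [piecewise_eq_of_notMem _ _ _ h]; exact hp1 v
    have hw2 : ∀ v, ρ v (C.piecewise p.1 p.2 v) ≠ 0 := fun v => by
      by_cases h : v ∈ C
      · rw [piecewise_eq_of_mem _ _ _ h]; exact hp1 v
      · rw [piecewise_eq_of_notMem _ _ _ h]; exact hp2 v
    have e1 : ∀ v, c.out (C.piecewise p.2 p.1) v = C.piecewise (c.out p.2) (c.out p.1) v :=
      c.out_piecewise i j p.1 p.2 (hreg _ hp1) (hreg _ hp2) (hreg _ hw1)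
    have e2 := c.out_piecewise i j p.2 p.1 (hreg _ hp2) (hreg _ hp1)
      (by rw [hCc]; exact hreg _ hw2)
    rw [hCc] at e2
    have hs : c.swap i j p = (C.piecewise p.2 p.1, C.piecewise p.1 p.2) := if_neg hr
    have hjC : j ∈ C := c.mem_cluster_self i j _ _
    have hiC : i ∉ C := c.notMem_cluster i j _ _ hr
    rw [hs]
    simp only [hEA, hEB]
    simp only [e1, e2]
    simp only [Set.piecewise, mem_insert, mem_singleton, not_or]
    constructor
    · rintro ⟨h1, h2⟩
      constructor
      · intro v hv
        by_cases hvC : v ∈ C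
        · have hvi : v ≠ i := fun h => hiC (h ▸ hvC)
          have := h2 v ⟨hvi, hv⟩; rwa [if_pos hvC] at this
        · have := h1 v; rwa [if_neg hvC] at this
      · intro v hv
        by_cases hvC : v ∈ C
        · have := h1 v; rwa [if_pos hvC] at this
        · have hvj : v ≠ j := fun h => hvC (h ▸ hjC)
          have := h2 v ⟨hv, hvj⟩; rwa [if_neg hvC] at this
    · rintro ⟨h1, h2⟩
      constructor
      · intro v
        split_ifs with hvC
        · exact h2 v fun h => hiC (h ▸ hvC)
        · exact h1 v fun h => hvC (h ▸ hjC)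
      · rintro v ⟨hvi, hvj⟩
        split_ifs with hvC
        · exact h1 v hvj
        · exact h2 v hvi
  have hRs : ∀ p, R (c.swap i j p) ↔ R p := fun p => by simp only [hR, c.graph_swap i j p]
  have hWs : ∀ p, W2 (c.swap i j p) = W2 p := fun p => c.prod_swap ρ i j p
  have hcancel : ∀ m, (∑ p, if ¬ R p ∧ EA m p then W2 p else 0) =
      ∑ p, if ¬ R p ∧ EB m p then W2 p else 0 := by
    intro m
    rw [← Equiv.sum_comp (Function.Involutive.toPerm (c.swap i j) (c.swap_swap i j))]
    refine sum_congr rfl fun p _ => ?_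
    change (if ¬ R (c.swap i j p) ∧ EA m (c.swap i j p) then W2 (c.swap i j p) else 0) = _
    rw [hWs]
    by_cases hp : W2 p = 0
    · simp [hp]
    by_cases hr : R p
    · simp [hr, hRs]
    · simp only [hRs, hswapE m p hp hr]
  have hnum : ∀ m, |c.prAgree ρ ∅ m * c.prAgree ρ {i, j} m -
      c.prAgree ρ {i} m * c.prAgree ρ {j} m| ≤
      ∑ p, ((if R p ∧ EA m p then W2 p else 0) + if R p ∧ EB m p then W2 p else 0) := by
    intro m
    have s1 : ∀ (F : (V → Ω) × (V → Ω) → Prop) [DecidablePred F], (∑ p, if F p then W2 p else 0) =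
        (∑ p, if R p ∧ F p then W2 p else 0) + ∑ p, if ¬ R p ∧ F p then W2 p else 0 := by
      intro F _
      rw [← sum_add_distrib]
      refine sum_congr rfl fun p _ => ?_
      by_cases hr : R p <;> by_cases hf : F p <;> simp [hr, hf]
    have n1 : 0 ≤ ∑ p, if R p ∧ EA m p then W2 p else 0 :=
      sum_nonneg fun p _ => by split_ifs; exacts [hW0 p, le_rfl]
    have n2 : 0 ≤ ∑ p, if R p ∧ EB m p then W2 p else 0 :=
      sum_nonneg fun p _ => by split_ifs; exacts [hW0 p, le_rfl]
    rw [hA, hB, s1, s1 (EB m), hcancel, sum_add_distrib, abs_le]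
    constructor <;> linarith
  -- each pair of inputs contributes to at most one `m`
  have hdiv : ∀ p, ∑ m ∈ A, ((if R p ∧ EA m p then W2 p else 0) +
      if R p ∧ EB m p then W2 p else 0) / c.prAgree ρ {i, j} m ≤
      2 * (c.pairLaw ρ {i, j} p.1 p.2 * if R p then 1 else 0) := by
    intro p
    by_cases hr : R p
    swap
    · simp [hr]
    have single : ∀ (F : (V → ℕ) → Prop) [DecidablePred F] (m0 : V → ℕ), (∀ m, F m → m = m0) →
        (F m0 → ∀ v, v ∉ ({i, j} : Finset V) → c.out p.2 v = c.out p.1 v) →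
        (F m0 → ∀ v, v ∉ ({i, j} : Finset V) → m0 v = c.out p.1 v) →
        ∑ m ∈ A, (if F m then W2 p else 0) / c.prAgree ρ {i, j} m ≤
          c.pairLaw ρ {i, j} p.1 p.2 := by
      intro F _ m0 h1 h2 h3
      by_cases hF : F m0
      · have hval : c.pairLaw ρ {i, j} p.1 p.2 = W2 p / c.prAgree ρ {i, j} m0 := by
          rw [pairLaw, if_pos (h2 hF), c.prAgree_congr ρ {i, j} m0 _ (h3 hF)]
        calc _ ≤ ∑ m ∈ A, if m = m0 then c.pairLaw ρ {i, j} p.1 p.2 else 0 := by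
              refine sum_le_sum fun m _ => ?_
              by_cases hm : m = m0
              · subst hm; rw [if_pos hF, if_pos rfl, hval]
              · rw [if_neg fun h => hm (h1 m h), if_neg hm, zero_div]
          _ ≤ _ := by
              rw [Finset.sum_ite_eq']
              split_ifs
              · exact le_rfl
              · exact c.pairLaw_nonneg ρ hρ _ _ _
      · refine le_trans (le_of_eq (sum_eq_zero fun m _ => ?_))
          (c.pairLaw_nonneg ρ hρ _ _ _)
        rw [if_neg, zero_div]
        intro h; exact hF (h1 m h ▸ h)
    simp only [hr, true_and, if_true, mul_one]
    simp_rw [add_div]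
    rw [sum_add_distrib, two_mul]
    refine add_le_add ?_ ?_
    · refine single (fun m => EA m p) (c.out p.1) (fun m h => funext fun v => (h.1 v).symm)
        (fun h v hv => h.2 v hv) (fun h v hv => rfl)
    · refine single (fun m => EB m p) (fun v => if v = j then c.out p.2 v else c.out p.1 v)
        (fun m h => funext fun v => ?_) (fun h v hv => ?_) (fun h v hv => ?_)
      · split_ifs with hv
        · exact (h.2 v (by rw [hv]; exact hij.symm)).symm
        · exact (h.1 v hv).symm
      · simp at hv
        have := h.2 v hv.1
        simpa [hv.2] using this
      · simp at hv; simp [hv.2]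
  calc _ ≤ ∑ m ∈ A, (∑ p, ((if R p ∧ EA m p then W2 p else 0) +
        if R p ∧ EB m p then W2 p else 0)) / c.prAgree ρ {i, j} m :=
        sum_le_sum fun m _ =>
          div_le_div_of_nonneg_right (hnum m) (c.prAgree_nonneg ρ hρ _ _)
    _ = ∑ p, ∑ m ∈ A, ((if R p ∧ EA m p then W2 p else 0) +
        if R p ∧ EB m p then W2 p else 0) / c.prAgree ρ {i, j} m := by
        simp_rw [sum_div]
        rw [sum_comm]
    _ ≤ ∑ p : (V → Ω) × (V → Ω), 2 * (c.pairLaw ρ {i, j} p.1 p.2 * if R p then 1 else 0) :=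
        sum_le_sum fun p _ => hdiv p
    _ = 2 * ∑ u, ∑ u', c.pairLaw ρ {i, j} u u' *
        (if (c.graph i j u u').Reachable j i then (1 : ℝ) else 0) := by
        rw [← mul_sum, Fintype.sum_prod_type]
    _ ≤ 2 * (2 * E ^ 2 * Cs * exp (-(c.D j i : ℝ) / 2)) := by
        refine mul_le_mul_of_nonneg_left ?_ (by norm_num)
        exact sum_reachable_le c.D c.D_symm c.D_tri c.D_self Cs hCs ρ hρ hsum _
          (fun u u' => c.pairLaw_nonneg ρ hρ _ u u') (fun u => c.sum_pairLaw_le ρ hρ _ u)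
          (fun u' => by
            simp_rw [c.pairLaw_symm ρ _ _ u']
            exact c.sum_pairLaw_le ρ hρ _ u') c.lev c.rad i j hij g E hg hE hgC
    _ = _ := by ring

end Coding

/-- Tail weights of the level distribution. -/
def tailW (θ x : ℝ) (L k : ℕ) : ℝ := if k < L then 2 * θ * x ^ k else 0

/-- The level distribution. -/
def levW (θ x : ℝ) (L : ℕ) : ℕ → ℝ
  | 0 => 1 - tailW θ x L 0
  | k + 1 => tailW θ x L k - tailW θ x L (k + 1)

lemma sum_levW (θ x : ℝ) (L : ℕ) (n : ℕ) :
    ∑ k ∈ range (n + 1), levW θ x L k = 1 - tailW θ x L n := by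
  induction n with
  | zero => simp [levW]
  | succ n ih => rw [sum_range_succ, ih, levW]; ring

lemma levW_pos (θ x : ℝ) (hθ : 0 < θ) (hθ1 : θ ≤ 1 / 4) (hx : 0 < x) (hx1 : x ≤ 1 / 2) (L : ℕ)
    (k : ℕ) (hk : k ≤ L) : 0 < levW θ x L k := by
  cases k with
  | zero => unfold levW tailW; split_ifs <;> simp; linarith
  | succ k =>
    show 0 < tailW θ x L k - tailW θ x L (k + 1)
    unfold tailW
    rw [if_pos (by omega : k < L)]
    have : 0 < 2 * θ * x ^ k := by positivity
    split_ifs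
    · rw [pow_succ]; nlinarith
    · linarith

lemma levW_succ_le (θ x : ℝ) (hθ : 0 < θ) (hx : 0 < x) (L k : ℕ) :
    levW θ x L (k + 1) ≤ 2 * θ * x ^ k := by
  have h1 : tailW θ x L k ≤ 2 * θ * x ^ k := by
    unfold tailW; split_ifs
    · exact le_rfl
    · positivity
  have h2 : 0 ≤ tailW θ x L (k + 1) := by unfold tailW; split_ifs <;> positivity
  unfold levW; linarith

lemma exists_layers {P α : Type*} [Fintype P] [Fintype α] (R : ℕ → P → P → Prop)
    (hrefl : ∀ k p, R k p p) (hsymm : ∀ k p p', R k p p' → R k p' p)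
    (htrans : ∀ k p p' p'', R k p p' → R k p' p'' → R k p p'')
    (hanti : ∀ k p p', R (k + 1) p p' → R k p p') (L : ℕ) (hL : 1 ≤ L)
    (q : P → α → ℝ) (hq0 : ∀ p a, 0 ≤ q p a) (hq1 : ∀ p, ∑ a, q p a = 1)
    (hqL : ∀ p p', R L p p' → q p = q p') (θ x : ℝ) (hθ : 0 < θ) (hθ1 : θ ≤ 1 / 4) (hx : 0 < x)
    (hx1 : x ≤ 1 / 2)
    (h0 : ∀ p p' a, R 0 p p' → (1 - θ / 2) * q p a ≤ q p' a)
    (hk : ∀ k p p' a, R k p p' → (1 - θ * x ^ k) * q p a ≤ q p' a)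
    (safe : α → P → Prop)
    (hsafe : ∀ p, ∑ a, (if ∃ p', R 0 p p' ∧ ¬ safe a p' then q p a else 0) ≤ θ / 2) :
    ∃ Rk : ℕ → P → α → ℝ, (∀ k ≤ L, ∀ p a, 0 ≤ Rk k p a) ∧ (∀ k ≤ L, ∀ p, ∑ a, Rk k p a = 1) ∧
      (∀ k p p', R k p p' → Rk k p = Rk k p') ∧
      (∀ p a, ∑ k ∈ range (L + 1), levW θ x L k * Rk k p a = q p a) ∧
      (∀ p a, Rk 0 p a ≠ 0 → safe a p) := by
  have hne : ∀ k p, (univ.filter (R k p)).Nonempty := fun k p => ⟨p, by simp [hrefl]⟩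
  set A' : ℕ → P → α → ℝ := fun k p a => (univ.filter (R k p)).inf' (hne k p) fun p' => q p' a
    with hA'
  set A : ℕ → P → α → ℝ := fun k p a =>
    if k = 0 ∧ ∃ p', R 0 p p' ∧ ¬ safe a p' then 0 else A' k p a with hA
  have hA'0 : ∀ k p a, 0 ≤ A' k p a := fun k p a => le_inf' _ _ fun p' _ => hq0 p' a
  have hA0 : ∀ k p a, 0 ≤ A k p a := fun k p a => by
    simp only [hA]; split_ifs; exacts [le_rfl, hA'0 k p a]
  have hAA' : ∀ k p a, A k p a ≤ A' k p a := fun k p a => by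
    simp only [hA]; split_ifs; exacts [hA'0 k p a, le_rfl]
  have hA'q : ∀ k p a, A' k p a ≤ q p a := fun k p a =>
    Finset.inf'_le _ (by simp [hrefl])
  have hcongr : ∀ k p p', R k p p' → A k p = A k p' := by
    intro k p p' h
    have e : ∀ z, R k p z ↔ R k p' z := fun z =>
      ⟨fun H => htrans k _ _ _ (hsymm k _ _ h) H, fun H => htrans k _ _ _ h H⟩
    funext a
    simp only [hA, hA']
    by_cases hk0 : k = 0
    · subst hk0; simp only [e]
    · simp only [hk0, false_and, if_false, e]
  have hmono : ∀ k p a, A k p a ≤ A (k + 1) p a := by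
    intro k p a
    have : A (k + 1) p a = A' (k + 1) p a := by simp [hA]
    rw [this]
    refine (hAA' k p a).trans (Finset.inf'_mono _ (fun p' hp' => ?_) _)
    simp only [mem_filter, mem_univ, true_and] at hp' ⊢
    exact hanti k _ _ hp'
  have hAL : ∀ p a, A L p a = q p a := by
    intro p a
    have : A L p a = A' L p a := by simp [hA]; intro h; omega
    rw [this]
    refine le_antisymm (hA'q L p a) (le_inf' _ _ fun p' hp' => ?_)
    simp only [mem_filter, mem_univ, true_and] at hp'
    rw [hqL p p' hp']
  set m : ℕ → P → ℝ := fun k p => ∑ a, A k p a with hm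
  have hm1 : ∀ k p, m k p ≤ 1 := fun k p => by
    rw [← hq1 p]
    exact sum_le_sum fun a _ => (hAA' k p a).trans (hA'q k p a)
  have hmθ : ∀ k p, 1 - θ * x ^ k ≤ m k p := by
    intro k p
    rcases Nat.eq_zero_or_pos k with rfl | hkpos
    · have h1 : ∀ a, (1 - θ / 2) * (q p a - if ∃ p', R 0 p p' ∧ ¬ safe a p' then q p a else 0) ≤
          A 0 p a := by
        intro a
        simp only [hA, true_and]
        split_ifs
        · simp
        · rw [sub_zero]
          refine le_inf' _ _ fun p' hp' => h0 _ _ _ (by simpa using hp')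
      have h2 := sum_le_sum fun a (_ : a ∈ univ) => h1 a
      rw [← mul_sum, sum_sub_distrib, hq1] at h2
      have h3 := hsafe p
      have : m 0 p = ∑ a, A 0 p a := rfl
      nlinarith
    · have h1 : ∀ a, (1 - θ * x ^ k) * q p a ≤ A k p a := by
        intro a
        have : A k p a = A' k p a := by simp [hA]; intro h; omega
        rw [this]
        exact le_inf' _ _ fun p' hp' => hk _ _ _ _ (by simpa using hp')
      have h2 := sum_le_sum fun a (_ : a ∈ univ) => h1 a
      rwa [← mul_sum, hq1, mul_one] at h2
  have hxk : ∀ k, x ^ k ≤ 1 := fun k => pow_le_one₀ hx.le (by linarith)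
  have hmpos : ∀ k p, 0 < m k p := fun k p => by
    have := hmθ k p; have := hxk k; nlinarith
  set Λ : ℕ → P → α → ℝ := fun k p a => A k p a * ((1 - tailW θ x L k) / m k p) with hΛ
  have htail : ∀ k, tailW θ x L k ≤ 1 / 2 := fun k => by
    unfold tailW; split_ifs
    · have := hxk k; nlinarith
    · norm_num
  have hΛ0 : ∀ k p a, 0 ≤ Λ k p a := fun k p a =>
    mul_nonneg (hA0 k p a) (div_nonneg (by have := htail k; linarith) (hmpos k p).le)
  have hΛsum : ∀ k p, ∑ a, Λ k p a = 1 - tailW θ x L k := by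
    intro k p
    simp only [hΛ]
    rw [← sum_mul]
    exact mul_div_cancel₀ _ (hmpos k p).ne'
  have hΛmono : ∀ k, k < L → ∀ p a, Λ k p a ≤ Λ (k + 1) p a := by
    intro k hkL p a
    refine mul_le_mul (hmono k p a) ?_ (div_nonneg (by have := htail k; linarith) (hmpos k p).le)
      (hA0 _ p a)
    have hstep : (1 - tailW θ x L k) ≤ (1 - θ * x ^ k) * (1 - tailW θ x L (k + 1)) := by
      have hpk : 0 < θ * x ^ k := by positivity
      have e1 : tailW θ x L k = 2 * (θ * x ^ k) := by unfold tailW; rw [if_pos hkL]; ring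
      have e2 : tailW θ x L (k + 1) ≤ θ * x ^ k := by
        unfold tailW; split_ifs
        · rw [pow_succ]; nlinarith
        · exact hpk.le
      rw [e1]
      have h3 : θ * x ^ k ≤ 1 := by have := hxk k; nlinarith
      nlinarith [mul_nonneg (sub_nonneg.2 h3) (sub_nonneg.2 e2), sq_nonneg (θ * x ^ k)]
    have h1 : 0 ≤ 1 - tailW θ x L (k + 1) := by have := htail (k + 1); linarith
    calc (1 - tailW θ x L k) / m k p ≤ 1 - tailW θ x L (k + 1) := by
          rw [div_le_iff₀ (hmpos k p)]
          exact hstep.trans (by rw [mul_comm]; exact mul_le_mul_of_nonneg_left (hmθ k p) h1)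
      _ ≤ _ := by
          rw [le_div_iff₀ (hmpos _ p)]
          exact mul_le_of_le_one_right h1 (hm1 _ p)
  set Rk : ℕ → P → α → ℝ := fun k p a => match k with
    | 0 => Λ 0 p a / levW θ x L 0
    | k + 1 => (Λ (k + 1) p a - Λ k p a) / levW θ x L (k + 1) with hRk
  have hw := levW_pos θ x hθ hθ1 hx hx1 L
  refine ⟨Rk, ?_, ?_, ?_, ?_, ?_⟩
  · intro k hkL p a
    cases k with
    | zero => exact div_nonneg (hΛ0 0 p a) (hw 0 hkL).le
    | succ k => exact div_nonneg (sub_nonneg.2 (hΛmono k (by omega) p a)) (hw _ hkL).le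
  · intro k hkL p
    cases k with
    | zero =>
      simp only [hRk]
      rw [← sum_div, hΛsum]
      exact div_self (hw 0 hkL).ne'
    | succ k =>
      simp only [hRk]
      rw [← sum_div, sum_sub_distrib, hΛsum, hΛsum]
      have : 1 - tailW θ x L (k + 1) - (1 - tailW θ x L k) = levW θ x L (k + 1) := by
        rw [levW]; ring
      rw [this]
      exact div_self (hw _ hkL).ne'
  · intro k p p' h
    have hΛc : ∀ k, R k p p' → Λ k p = Λ k p' := fun k h => by
      funext a; simp only [hΛ, hm, hcongr k p p' h]
    funext a
    cases k with
    | zero => simp only [hRk, hΛc 0 h]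
    | succ k => simp only [hRk, hΛc _ h, hΛc k (hanti k _ _ h)]
  · intro p a
    have : ∀ n ≤ L, ∑ k ∈ range (n + 1), levW θ x L k * Rk k p a = Λ n p a := by
      intro n hn
      induction n with
      | zero =>
        simp only [zero_add, Finset.sum_range_one, hRk]
        exact mul_div_cancel₀ _ (hw 0 hn).ne'
      | succ n ih =>
        rw [sum_range_succ, ih (by omega)]
        simp only [hRk]
        rw [mul_div_cancel₀ _ (hw _ hn).ne']; ring
    rw [this L le_rfl]
    simp only [hΛ, hm, hAL, hq1]
    simp [tailW]
  · intro p a h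
    by_contra hs
    apply h
    have : A 0 p a = 0 := by
      simp only [hA, true_and]; rw [if_pos ⟨p, hrefl 0 p, hs⟩]
    simp only [hRk, hΛ, this, zero_mul, zero_div]

/-- The weights of the field obtained by drawing hidden variables sequentially from the kernels
`p` and then observations from `W`, the observations in `S` being summed out. -/
def fieldLaw {V α : Type*} [Fintype V] [Fintype α] (p : V → (V → α) → α → ℝ)
    (W : V → α → ℕ → ℝ) (S : Finset V) (m : V → ℕ) : ℝ :=
  ∑ s : V → α, (∏ t, p t s (s t)) * ∏ v, if v ∈ S then 1 else W v (s v) (m v)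

/-- Agreement of two past configurations near a vertex. -/
def Geom.Near {V : Type*} (c : Geom V) {α : Type*} (t : V) (k : ℕ) (s s' : V → α) : Prop :=
  ∀ x, c.rk x < c.rk t → c.D t x ≤ 2 + k → s x = s' x

/-- The part of a past configuration near a vertex. -/
def Geom.trunc {V : Type*} (c : Geom V) {α : Type*} [Nonempty α] (t : V) (k : ℕ) (s : V → α) :
    V → α :=
  fun x => if c.rk x < c.rk t ∧ c.D t x ≤ 2 + k then s x else Classical.arbitrary α

lemma Geom.near_trunc {V : Type*} (c : Geom V) {α : Type*} [Nonempty α] (t : V) (k : ℕ)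
    (s : V → α) : c.Near t k (c.trunc t k s) s := fun x h1 h2 => by
  simp only [trunc, h1, h2, and_self, if_true]

lemma Geom.trunc_eq {V : Type*} (c : Geom V) {α : Type*} [Nonempty α] (t : V) (k : ℕ)
    (s s' : V → α) (h : c.Near t k s s') : c.trunc t k s = c.trunc t k s' := by
  funext x
  simp only [trunc]
  split_ifs with hx
  · exact h x hx.1 hx.2
  · rfl

lemma sum_pi_prod_eq_one {V Ω : Type*} [DecidableEq V] [Fintype V] [Fintype Ω] (ρ : V → Ω → ℝ)
    (hsum : ∀ v, ∑ ω, ρ v ω = 1) : ∑ u : V → Ω, ∏ v, ρ v (u v) = 1 := by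
  have := sum_pi_prod_mul_prod ρ hsum ∅ fun _ _ => 1
  simp only [Finset.prod_empty, mul_one] at this
  convert this

lemma sum_pi_prod_mul_apply {V Ω : Type*} [DecidableEq V] [Fintype V] [Fintype Ω] (ρ : V → Ω → ℝ)
    (hsum : ∀ v, ∑ ω, ρ v ω = 1) (v : V) (h : Ω → ℝ) :
    ∑ u : V → Ω, (∏ v, ρ v (u v)) * h (u v) = ∑ ω, ρ v ω * h ω := by
  have := sum_pi_prod_mul_prod ρ hsum {v} fun _ => h
  simp only [Finset.prod_singleton] at this
  convert this

/-- The input space of the coding built from layered kernels. -/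
abbrev LayerInput (V α : Type*) (L M : ℕ) :=
  Fin (L + 1) × ((V → α) → α) × Bool × Fin (M + 1) × (α → Fin (M + 1))

/-- The level of an input. -/
def inputLev {V α : Type*} {L M : ℕ} (ω : LayerInput V α L M) : ℕ :=
  if (ω.1 : ℕ) = 0 ∧ ω.2.2.1 = true then 0 else ω.1 + 1

/-- The law of the observation given that it is not read off the common part. -/
def remW (W : ℕ → ℝ) (w0 : ℕ → ℝ) (ε : ℝ) (g : Prop) [Decidable g] (m : ℕ) : ℝ :=
  if g then (W m - w0 m) / ε else W m

/-- The law of the input at a vertex. -/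
def inputLaw {V α : Type*} [Fintype V] [Fintype α] {L M : ℕ} (lw : ℕ → ℝ)
    (Rk : ℕ → (V → α) → α → ℝ) (W : α → ℕ → ℝ) (w0 : ℕ → ℝ) (ε : ℝ) (good : α → Prop)
    (ω : LayerInput V α L M) : ℝ :=
  lw ω.1 * ((∏ p, Rk ω.1 p (ω.2.1 p)) * ((if ω.2.2.1 then 1 - ε else ε) *
    ((w0 ω.2.2.2.1 / (1 - ε)) * ∏ a, remW (W a) w0 ε (good a) (ω.2.2.2.2 a))))

section

variable {V α : Type*} [Fintype V] [Fintype α] {L M : ℕ} (lw : ℕ → ℝ)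
    (Rk : ℕ → (V → α) → α → ℝ) (W : α → ℕ → ℝ) (w0 : ℕ → ℝ) (ε : ℝ) (good : α → Prop)

lemma sum_fin_range (M : ℕ) (f : ℕ → ℝ) : ∑ m : Fin (M + 1), f m = ∑ m ∈ range (M + 1), f m :=
  Fin.sum_univ_eq_sum_range f (M + 1)

lemma sum_remW (hε : 0 < ε) (hW : ∀ a, ∑ m ∈ range (M + 1), W a m = 1)
    (hw : ∑ m ∈ range (M + 1), w0 m = 1 - ε) (a : α) :
    ∑ m : Fin (M + 1), remW (W a) w0 ε (good a) m = 1 := by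
  rw [sum_fin_range M]
  unfold remW
  split_ifs
  · rw [← sum_div, sum_sub_distrib, hW, hw, sub_sub_cancel, div_self hε.ne']
  · exact hW a

lemma sum_inputLaw (hε : 0 < ε) (hε1 : ε < 1) (hR : ∀ k ≤ L, ∀ p, ∑ a, Rk k p a = 1)
    (hW : ∀ a, ∑ m ∈ range (M + 1), W a m = 1)
    (hw : ∑ m ∈ range (M + 1), w0 m = 1 - ε) (h : ℕ → Bool → ℝ) :
    ∑ ω : LayerInput V α L M, inputLaw lw Rk W w0 ε good ω * h ω.1 ω.2.2.1 =
      ∑ k ∈ range (L + 1), lw k * ((1 - ε) * h k true + ε * h k false) := by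
  have e1 : ∑ m0 : Fin (M + 1), w0 m0 / (1 - ε) = 1 := by
    rw [← sum_div, sum_fin_range M, hw, div_self (by linarith)]
  have e2 := sum_pi_prod_eq_one _ (sum_remW (M := M) W w0 ε good hε hW hw)
  rw [← sum_fin_range L fun k => lw k * ((1 - ε) * h k true + ε * h k false)]
  simp only [Fintype.sum_prod_type]
  refine sum_congr rfl fun k _ => ?_
  have e3 := sum_pi_prod_eq_one (fun p a => Rk k p a) (hR k (by omega))
  have : ∀ (r : (V → α) → α) (o : Bool) (m0 : Fin (M + 1)) (r' : α → Fin (M + 1)),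
      inputLaw lw Rk W w0 ε good ((k, r, o, m0, r') : LayerInput V α L M) * h k o =
      lw k * ((∏ p, Rk k p (r p)) * (((if o then 1 - ε else ε) * h k o) *
        ((w0 m0 / (1 - ε)) * ∏ a, remW (W a) w0 ε (good a) (r' a)))) := by
    intro r o m0 r'; unfold inputLaw; ring
  simp only [this, ← mul_sum, ← sum_mul, e1, e2, e3, mul_one, one_mul]
  simp

lemma sum_inputLaw_resp (hε : 0 < ε) (hε1 : ε < 1) (hR : ∀ k ≤ L, ∀ p, ∑ a, Rk k p a = 1)
    (hW : ∀ a, ∑ m ∈ range (M + 1), W a m = 1)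
    (hw : ∑ m ∈ range (M + 1), w0 m = 1 - ε) (tr : ℕ → V → α) (q : ℝ) (a : α)
    (hq : ∑ k ∈ range (L + 1), lw k * Rk k (tr k) a = q) (h : ℕ → ℝ) :
    ∑ ω : LayerInput V α L M, inputLaw lw Rk W w0 ε good ω *
      ((if ω.2.1 (tr ω.1) = a then 1 else 0) *
        h (if good a ∧ ω.2.2.1 = true then ω.2.2.2.1 else ω.2.2.2.2 a)) =
      q * ∑ m ∈ range (M + 1), W a m * h m := by
  have e1 : ∑ m0 : Fin (M + 1), w0 m0 / (1 - ε) = 1 := by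
    rw [← sum_div, sum_fin_range M, hw, div_self (by linarith)]
  have e2 := sum_pi_prod_eq_one _ (sum_remW (M := M) W w0 ε good hε hW hw)
  have e4 : ∀ f : ℕ → ℝ, ∑ r' : α → Fin (M + 1), (∏ a, remW (W a) w0 ε (good a) (r' a)) * f (r' a) =
      ∑ m : Fin (M + 1), remW (W a) w0 ε (good a) m * f m := fun f =>
    sum_pi_prod_mul_apply (fun a (m : Fin (M + 1)) => remW (W a) w0 ε (good a) m)
      (sum_remW (M := M) W w0 ε good hε hW hw) a fun m => f m
  rw [← hq, ← sum_fin_range L fun k => lw k * Rk k (tr k) a, sum_mul]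
  simp only [Fintype.sum_prod_type]
  refine sum_congr rfl fun k _ => ?_
  have e3 : ∑ r : (V → α) → α, (∏ p, Rk k p (r p)) * (if r (tr k) = a then (1:ℝ) else 0) =
      Rk k (tr k) a := by
    rw [sum_pi_prod_mul_apply (fun p a => Rk k p a) (hR k (by omega)) (tr k)
      fun b => if b = a then 1 else 0]
    simp
  have : ∀ (r : (V → α) → α) (o : Bool) (m0 : Fin (M + 1)) (r' : α → Fin (M + 1)),
      inputLaw lw Rk W w0 ε good ((k, r, o, m0, r') : LayerInput V α L M) *
        ((if r (tr k) = a then 1 else 0) * h (if good a ∧ o = true then (m0 : ℕ) else r' a)) =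
      lw k * (((∏ p, Rk k p (r p)) * (if r (tr k) = a then 1 else 0)) *
        ((if o then 1 - ε else ε) *
        ((w0 m0 / (1 - ε)) * ((∏ a, remW (W a) w0 ε (good a) (r' a)) *
          h (if good a ∧ o = true then (m0 : ℕ) else r' a))))) := by
    intro r o m0 r'; unfold inputLaw; ring
  simp only [this, ← mul_sum, ← sum_mul, e3]
  rw [mul_assoc]
  congr 2
  simp only [Fintype.sum_bool, if_true, Bool.false_eq_true, if_false, and_false, and_true]
  by_cases hg : good a
  · simp only [hg, if_true, ← sum_mul, e2, e4 h, one_mul, e1]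
    simp only [remW, if_true]
    rw [sum_fin_range M fun m => w0 m / (1 - ε) * h m, sum_fin_range M fun m => (W a m - w0 m) / ε * h m,
      mul_sum, mul_sum, ← sum_add_distrib]
    refine sum_congr rfl fun m _ => ?_
    have : 1 - ε ≠ 0 := by linarith
    field_simp
    ring
  · simp only [hg, if_false, e4 h, ← sum_mul, e1, one_mul]
    simp only [remW, if_false]
    rw [sum_fin_range M fun m => W a m * h m]
    ring

end

/-- The hidden field determined by the inputs. -/
def solve {V Ω α : Type*} [Nonempty α] (rk : V → ℕ) (resp : V → Ω → (V → α) → α) (u : V → Ω)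
    (v : V) : α :=
  resp v (u v) fun x => if rk x < rk v then solve rk resp u x else Classical.arbitrary α
termination_by rk v

lemma eq_solve {V Ω α : Type*} [Nonempty α] (rk : V → ℕ) (resp : V → Ω → (V → α) → α)
    (hloc : ∀ v ω p p', (∀ x, rk x < rk v → p x = p' x) → resp v ω p = resp v ω p') (u : V → Ω)
    (v : V) : solve rk resp u v = resp v (u v) (solve rk resp u) := by
  rw [solve]
  exact hloc _ _ _ _ fun x hx => by simp [hx]

lemma solve_unique {V Ω α : Type*} [Nonempty α] (rk : V → ℕ) (resp : V → Ω → (V → α) → α)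
    (hloc : ∀ v ω p p', (∀ x, rk x < rk v → p x = p' x) → resp v ω p = resp v ω p') (u : V → Ω)
    (s : V → α) (hs : ∀ v, resp v (u v) s = s v) : solve rk resp u = s := by
  funext v
  induction hn : rk v using Nat.strong_induction_on generalizing v with
  | _ n ih =>
  subst hn
  rw [eq_solve rk resp hloc, ← hs v]
  exact hloc _ _ _ _ fun x hx => ih _ hx x rfl

section

variable {V α : Type*} [Fintype V] [Fintype α] [Nonempty α] (geo : Geom V) (L M : ℕ)
  (good : V → α → Prop)

/-- The coding of a field given by layered kernels. -/
def layerCoding : Coding V (LayerInput V α L M) α where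
  toGeom := geo
  lev := inputLev
  resp := fun v ω s => ω.2.1 (geo.trunc v ω.1 s)
  resp_local := fun v ω p p' h => by
    rw [geo.trunc_eq v ω.1 p p' fun x h1 h2 => h x h1 (h2.trans ?_)]
    have : (ω.1 : ℕ) ≤ inputLev ω := by unfold inputLev; split_ifs <;> omega
    omega
  code := solve geo.rk fun v (ω : LayerInput V α L M) s => ω.2.1 (geo.trunc v ω.1 s)
  code_eq := fun u v => eq_solve geo.rk _ (fun v ω p p' h => by
    rw [geo.trunc_eq v ω.1 p p' fun x h1 _ => h x h1]) u v
  obs := fun v ω a => if good v a ∧ ω.2.2.1 = true then ω.2.2.2.1 else ω.2.2.2.2 a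
  obs0 := fun _ ω => ω.2.2.2.1

lemma layerCoding_code_eq_iff (u : V → LayerInput V α L M) (s : V → α) :
    (layerCoding geo L M good).code u = s ↔ ∀ v, (u v).2.1 (geo.trunc v (u v).1 s) = s v := by
  constructor
  · rintro rfl v
    exact ((layerCoding geo L M good).code_eq u v).symm
  · intro h
    exact solve_unique geo.rk _ (fun v ω p p' h => by
      rw [geo.trunc_eq v ω.1 p p' fun x h1 _ => h x h1]) u s h

lemma prAgree_layerCoding (ρ : V → LayerInput V α L M → ℝ) (p : V → (V → α) → α → ℝ)
    (W : V → α → ℕ → ℝ) (hW : ∀ v a, ∑ m ∈ range (M + 1), W v a m = 1)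
    (hWM : ∀ v a m, M < m → W v a m = 0)
    (h : ∀ v s (f : ℕ → ℝ), ∑ ω, ρ v ω * ((if ω.2.1 (geo.trunc v ω.1 s) = s v then 1 else 0) *
        f (if good v (s v) ∧ ω.2.2.1 = true then ω.2.2.2.1 else ω.2.2.2.2 (s v))) =
      p v s (s v) * ∑ m ∈ range (M + 1), W v (s v) m * f m) (S : Finset V) (m : V → ℕ) :
    (layerCoding geo L M good).prAgree ρ S m = fieldLaw p W S m := by
  have key : ∀ u : V → LayerInput V α L M,
      (if ∀ v, v ∉ S → (layerCoding geo L M good).out u v = m v then ∏ v, ρ v (u v) else 0) =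
      ∑ s : V → α, ∏ v, ρ v (u v) * ((if (u v).2.1 (geo.trunc v (u v).1 s) = s v then 1 else 0) *
        if v ∈ S ∨ (if good v (s v) ∧ (u v).2.2.1 = true then ((u v).2.2.2.1 : ℕ) else
          (u v).2.2.2.2 (s v)) = m v then 1 else 0) := by
    intro u
    rw [sum_eq_single ((layerCoding geo L M good).code u)]
    · have := (layerCoding_code_eq_iff geo L M good u _).1 rfl
      simp only [this, if_true, one_mul, prod_mul_distrib]
      rw [Finset.prod_ite_zero]
      split_ifs with h1 h2 h2
      · simp
      · exact absurd (fun v _ => by by_cases hv : v ∈ S; exacts [Or.inl hv, Or.inr (h1 v hv)]) h2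
      · exact absurd (fun v hv => (h2 v (mem_univ v)).resolve_left hv) h1
      · simp
    · intro s _ hs
      have : ¬ ∀ v, (u v).2.1 (geo.trunc v (u v).1 s) = s v := fun h =>
        hs ((layerCoding_code_eq_iff geo L M good u s).2 h).symm
      push Not at this
      obtain ⟨v, hv⟩ := this
      exact Finset.prod_eq_zero (mem_univ v) (by simp [hv])
    · simp
  rw [Coding.prAgree, sum_congr rfl fun u _ => key u, sum_comm, fieldLaw]
  refine sum_congr rfl fun s _ => ?_
  rw [← prod_mul_distrib]
  have e := (Finset.prod_univ_sum (fun _ : V => (univ : Finset (LayerInput V α L M)))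
    (fun v ω => ρ v ω * ((if ω.2.1 (geo.trunc v ω.1 s) = s v then 1 else 0) *
        if v ∈ S ∨ (if good v (s v) ∧ ω.2.2.1 = true then (ω.2.2.2.1 : ℕ) else
          ω.2.2.2.2 (s v)) = m v then 1 else 0))).symm
  rw [Fintype.piFinset_univ] at e
  rw [e]
  refine prod_congr rfl fun v _ => ?_
  rw [h v s fun n => if v ∈ S ∨ n = m v then 1 else 0]
  congr 1
  split_ifs with hv
  · simp [hv, hW]
  · simp only [hv, false_or, mul_ite, mul_one, mul_zero, Finset.sum_ite_eq', mem_range]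
    split_ifs with hm
    · rfl
    · exact (hWM v _ _ (by omega)).symm

end

lemma remW_nonneg (W w0 : ℕ → ℝ) (ε : ℝ) (hε : 0 < ε) (g : Prop) (hW : ∀ m, 0 ≤ W m)
    (h : g → ∀ m, w0 m ≤ W m) (m : ℕ) : 0 ≤ remW W w0 ε g m := by
  unfold remW
  split_ifs with hg
  · exact div_nonneg (sub_nonneg.2 (h hg m)) hε.le
  · exact hW m

lemma sum_geom_half_le (y : ℝ) (hy0 : 0 ≤ y) (hy : y ≤ 1 / 2) (n : ℕ) :
    ∑ k ∈ range n, y ^ k ≤ 2 := by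
  have h1 : ∀ n, ∑ k ∈ range n, y ^ k ≤ 2 - 2 * y ^ n := by
    intro n
    induction n with
    | zero => simp
    | succ n ih =>
      rw [sum_range_succ, pow_succ]
      have : 0 ≤ y ^ n := pow_nonneg hy0 n
      nlinarith
  have := pow_nonneg hy0 n
  linarith [h1 n]

lemma level_moment_le (θ x ε r : ℝ) (L : ℕ) (hθ : 0 < θ) (hθ1 : θ ≤ 1 / 4) (hx : 0 < x)
    (hx1 : x ≤ 1 / 2) (hxe : x * exp 4 ≤ 1 / 2) (hε : 0 < ε) :
    ∑ k ∈ range (L + 1), levW θ x L k *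
      ((1 - ε) * (if k = 0 then 0 else exp (2 * (r + (k + 1))) ^ 2) +
        ε * exp (2 * (r + (k + 1))) ^ 2) ≤ exp (4 * r + 8) * (4 * θ + ε) := by
  have hsq : ∀ k : ℝ, exp (2 * (r + (k + 1))) ^ 2 =
      exp (4 * r + 4) * exp (4 * k) := fun k => by
    rw [← exp_nat_mul, ← exp_add]; congr 1; push_cast; ring
  rw [Finset.sum_range_succ']
  have h48 : exp (4 * r + 4) ≤ exp (4 * r + 8) := exp_le_exp.2 (by linarith)
  have h0 : levW θ x L 0 ≤ 1 := by
    show 1 - tailW θ x L 0 ≤ 1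
    have : 0 ≤ tailW θ x L 0 := by unfold tailW; split_ifs <;> positivity
    linarith
  have hw0 := levW_pos θ x hθ hθ1 hx hx1 L 0 (Nat.zero_le _)
  have e1 : ∑ k ∈ range L, levW θ x L (k + 1) *
      ((1 - ε) * (if k + 1 = 0 then 0 else exp (2 * (r + ((k + 1 : ℕ) + 1))) ^ 2) +
        ε * exp (2 * (r + ((k + 1 : ℕ) + 1))) ^ 2) ≤
      exp (4 * r + 8) * (2 * θ * 2) := by
    calc _ ≤ ∑ k ∈ range L, exp (4 * r + 8) * (2 * θ * (x * exp 4) ^ k) := by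
          refine sum_le_sum fun k _ => ?_
          rw [if_neg (Nat.succ_ne_zero k), ← add_mul, sub_add_cancel, one_mul, hsq]
          calc _ ≤ 2 * θ * x ^ k * (exp (4 * r + 4) * exp (4 * ((k + 1 : ℕ) : ℝ))) :=
                mul_le_mul_of_nonneg_right (levW_succ_le θ x hθ hx L k) (by positivity)
            _ = _ := by
              have : exp (4 * r + 4) * exp (4 * ((k + 1 : ℕ) : ℝ)) =
                  exp (4 * r + 8) * exp 4 ^ k := by
                rw [← exp_nat_mul, ← exp_add, ← exp_add]
                congr 1; push_cast; ring
              rw [this, mul_pow]; ring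
      _ ≤ _ := by
          rw [← mul_sum, ← mul_sum]
          have := sum_geom_half_le (x * exp 4) (by positivity) hxe L
          gcongr
  have e2 : levW θ x L 0 * ((1 - ε) * (if (0:ℕ) = 0 then 0 else
      exp (2 * (r + ((0 : ℕ) + 1))) ^ 2) + ε * exp (2 * (r + ((0 : ℕ) + 1))) ^ 2) ≤
      exp (4 * r + 8) * ε := by
    rw [if_pos rfl, mul_zero, zero_add, hsq, Nat.cast_zero, mul_zero, exp_zero, mul_one]
    calc _ ≤ 1 * (ε * exp (4 * r + 4)) := by gcongr
      _ ≤ _ := by rw [one_mul, mul_comm]; gcongr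
  calc _ ≤ exp (4 * r + 8) * (2 * θ * 2) + exp (4 * r + 8) * ε := add_le_add e1 e2
    _ = _ := by ring

/-- Decay of conditional dependence for a field given by kernels which depend weakly on remote
hidden variables, and whose observations have a large common part. -/
theorem fieldLaw_decay {V α : Type*} [Fintype V] [Fintype α] [Nonempty α] (geo : Geom V)
    (L M : ℕ) (hL : 1 ≤ L) (hD : ∀ x y, geo.D x y ≤ 2 + L)
    (p : V → (V → α) → α → ℝ) (hp0 : ∀ t s a, 0 ≤ p t s a) (hp1 : ∀ t s, ∑ a, p t s a = 1)
    (hploc : ∀ t s s', (∀ x, geo.rk x < geo.rk t → s x = s' x) → p t s = p t s')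
    (W : V → α → ℕ → ℝ) (hW0 : ∀ v a m, 0 ≤ W v a m)
    (hW : ∀ v a, ∑ m ∈ range (M + 1), W v a m = 1)
    (hWM : ∀ v a m, M < m → W v a m = 0) (θ x ε : ℝ) (hθ : 0 < θ) (hx : 0 < x)
    (hxe : x * exp 4 ≤ 1 / 2) (hε : 0 < ε) (hθε : 4 * θ + ε < 1)
    (h0 : ∀ t s s' a, geo.Near t 0 s s' → (1 - θ / 2) * p t s a ≤ p t s' a)
    (hk : ∀ t k s s' a, geo.Near t k s s' → (1 - θ * x ^ k) * p t s a ≤ p t s' a)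
    (safe : V → α → (V → α) → Prop)
    (hsafe : ∀ t s, ∑ a, (if ∃ s', geo.Near t 0 s s' ∧ ¬ safe t a s' then p t s a else 0) ≤ θ / 2)
    (good : V → α → Prop)
    (hgood : ∀ v (s : V → α), (∀ t, geo.D v t ≤ 1 → safe t (s t) s) → good v (s v))
    (w0 : V → ℕ → ℝ) (hw0 : ∀ v m, 0 ≤ w0 v m) (hw0W : ∀ v a m, good v a → w0 v m ≤ W v a m)
    (hw01 : ∀ v, ∑ m ∈ range (M + 1), w0 v m = 1 - ε) (Cs : ℝ)
    (hCs : ∀ x, ∑ y, exp (-(geo.D x y : ℝ) / 2) ≤ Cs)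
    (hsmall : 2 * sqrt (exp (4 * ((2 * geo.K + 2 : ℕ) : ℝ) + 8) * (4 * θ + ε)) * Cs
      ≤ 1 / 2)
    (i j : V) (hij : i ≠ j) (A : Finset (V → ℕ)) :
    ∑ m ∈ A, |fieldLaw p W ∅ m * fieldLaw p W {i, j} m -
        fieldLaw p W {i} m * fieldLaw p W {j} m| / fieldLaw p W {i, j} m ≤
      32 * exp (4 * ((2 * geo.K + 2 : ℕ) : ℝ) + 8) * Cs *
        exp (-(geo.D j i : ℝ) / 2) := by
  have hθ1 : θ ≤ 1 / 4 := by linarith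
  have hε1 : ε < 1 := by linarith
  have he4 : 1 ≤ exp 4 := one_le_exp (by norm_num)
  have hx1 : x ≤ 1 / 2 := by nlinarith
  choose Rk hR0 hR1 hRc hRq hRs using fun t => exists_layers (geo.Near (α := α) t)
    (fun k s x _ _ => rfl) (fun k s s' h x h1 h2 => (h x h1 h2).symm)
    (fun k s s' s'' h h' x h1 h2 => (h x h1 h2).trans (h' x h1 h2))
    (fun k s s' h x h1 h2 => h x h1 (by omega)) L hL (p t) (hp0 t) (hp1 t)
    (fun s s' h => hploc t s s' fun x h1 => h x h1 (hD t x)) θ x hθ hθ1 hx hx1 (h0 t) (hk t)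
    (safe t) (hsafe t)
  set c := layerCoding geo L M good with hc
  set ρ : V → LayerInput V α L M → ℝ := fun v =>
    inputLaw (levW θ x L) (Rk v) (W v) (w0 v) ε (good v) with hρdef
  have hρ0 : ∀ v ω, 0 ≤ ρ v ω := by
    intro v ω
    refine mul_nonneg (levW_pos θ x hθ hθ1 hx hx1 L _ (by omega)).le (mul_nonneg
      (prod_nonneg fun p _ => hR0 v _ (by omega) _ _) (mul_nonneg ?_ (mul_nonneg
      (div_nonneg (hw0 v _) (by linarith)) (prod_nonneg fun a _ =>
        remW_nonneg _ _ ε hε _ (hW0 v a) (fun hg m => hw0W v a m hg) _))))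
    split_ifs <;> linarith
  have hitg := fun v => sum_inputLaw (L := L) (M := M) (levW θ x L) (Rk v) (W v) (w0 v) ε (good v)
    hε hε1 (hR1 v) (hW v) (hw01 v)
  have hρ1 : ∀ v, ∑ ω, ρ v ω = 1 := by
    intro v
    have := hitg v fun _ _ => 1
    simp only [mul_one, sub_add_cancel, sum_levW] at this
    rw [this]; simp [tailW]
  have hpr : ∀ S m, c.prAgree ρ S m = fieldLaw p W S m :=
    prAgree_layerCoding geo L M good ρ p W hW hWM fun v s f =>
      sum_inputLaw_resp (L := L) (M := M) (levW θ x L) (Rk v) (W v) (w0 v) ε (good v)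
        hε hε1 (hR1 v) (hW v) (hw01 v) (fun k => geo.trunc v k s) _ (s v) (by
          rw [← hRq v s (s v)]
          exact sum_congr rfl fun k _ => by rw [hRc v k _ _ (geo.near_trunc v k s)]) f
  have hreg : ∀ u, (∀ v, ρ v (u v) ≠ 0) → c.Regular u := by
    intro u hu v hv
    have hlev : ∀ t, c.lev (u t) = 0 → ((u t).1 : ℕ) = 0 ∧ (u t).2.2.1 = true := by
      intro t ht
      have ht' : inputLev (u t) = 0 := ht
      unfold inputLev at ht'
      split_ifs at ht' with h
      exact h
    have hg : good v (c.code u v) := by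
      refine hgood v _ fun t ht => ?_
      have hk0 := (hlev t (hv t ht)).1
      have hut := hu t
      simp only [hρdef, inputLaw, hk0] at hut
      have h2 := (mul_ne_zero_iff.1 (mul_ne_zero_iff.1 hut).2).1
      have h3 := prod_ne_zero_iff.1 h2 (geo.trunc t 0 (c.code u)) (mem_univ _)
      rw [hRc t 0 _ _ (geo.near_trunc t 0 (c.code u))] at h3
      have h4 := hRs t _ _ h3
      have h5 := (layerCoding_code_eq_iff geo L M good u _).1 rfl t
      rw [hk0] at h5
      rwa [h5] at h4
    have hvv := (hlev v (hv v (by rw [c.D_self]; exact Nat.zero_le _))).2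
    show (if good v (c.code u v) ∧ (u v).2.2.1 = true then _ else _) = _
    rw [if_pos ⟨hg, hvv⟩]
    rfl
  have hrad : (c.rad : ℝ) = ((2 * geo.K + 2 : ℕ) : ℝ) := rfl
  have hm := level_moment_le θ x ε (c.rad : ℝ) L hθ hθ1 hx hx1 hxe hε
  have hlevc : ∀ ω : LayerInput V α L M, (c.lev ω : ℝ) =
      if (ω.1 : ℕ) = 0 ∧ ω.2.2.1 = true then 0 else ((ω.1 : ℕ) : ℝ) + 1 := fun ω => by
    show ((inputLev ω : ℕ) : ℝ) = _
    unfold inputLev; split_ifs <;> simp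
  have hmom1 : ∀ v, ∑ ω, ρ v ω *
      (if 1 ≤ c.lev ω then exp (2 * ((c.rad : ℝ) + c.lev ω)) else 0) ^ 2 ≤
      exp (4 * (c.rad : ℝ) + 8) * (4 * θ + ε) := by
    intro v
    refine le_trans (le_of_eq ?_) hm
    have := hitg v fun k o => if k = 0 ∧ o = true then 0 else
      exp (2 * ((c.rad : ℝ) + ((k : ℝ) + 1))) ^ 2
    simp only [and_true, Bool.false_eq_true, and_false, if_false] at this
    rw [← this]
    refine sum_congr rfl fun ω _ => ?_
    congr 1
    rw [hlevc ω]
    have e : 1 ≤ c.lev ω ↔ ¬ ((ω.1 : ℕ) = 0 ∧ ω.2.2.1 = true) := by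
      show 1 ≤ inputLev ω ↔ _
      unfold inputLev
      by_cases h : (ω.1 : ℕ) = 0 ∧ ω.2.2.1 = true
      · simp [h]
      · rw [if_neg h]; exact ⟨fun _ => h, fun _ => by omega⟩
    by_cases h : (ω.1 : ℕ) = 0 ∧ ω.2.2.1 = true
    · rw [if_neg (by rw [e]; exact fun H => H h), if_pos h]; norm_num
    · rw [if_pos (e.2 h), if_neg h, if_neg h]
  have hmom2 : ∀ v, ∑ ω, ρ v ω * exp (2 * ((c.rad : ℝ) + c.lev ω)) ^ 2 ≤
      2 * exp (4 * (c.rad : ℝ) + 8) := by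
    intro v
    have h1 : ∀ ω, ρ v ω * exp (2 * ((c.rad : ℝ) + c.lev ω)) ^ 2 ≤
        ρ v ω * exp (4 * (c.rad : ℝ) + 8) + ρ v ω *
          (if 1 ≤ c.lev ω then exp (2 * ((c.rad : ℝ) + c.lev ω)) else 0) ^ 2 := by
      intro ω
      rw [← mul_add]
      refine mul_le_mul_of_nonneg_left ?_ (hρ0 v ω)
      split_ifs with h
      · exact le_add_of_nonneg_left (exp_pos _).le
      · have : c.lev ω = 0 := by omega
        rw [this, ← exp_nat_mul]
        refine (exp_le_exp.2 ?_).trans (le_add_of_nonneg_right (by norm_num))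
        push_cast; linarith
    refine (sum_le_sum fun ω _ => h1 ω).trans ?_
    rw [sum_add_distrib, ← sum_mul, hρ1]
    have := hmom1 v
    have hpos := exp_pos (4 * (c.rad : ℝ) + 8)
    nlinarith
  have := c.conditional_decay ρ hρ0 hρ1 hreg Cs hCs i j hij _ _
    (fun v => mul_le_mul_of_nonneg_left (Real.sqrt_le_sqrt (hmom1 v)) (by norm_num))
    (fun v => mul_le_mul_of_nonneg_left (Real.sqrt_le_sqrt (hmom2 v)) (by norm_num))
    (by rw [hrad]; exact hsmall) A
  simp only [hpr] at this
  refine this.trans (le_of_eq ?_)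
  rw [mul_pow, sq_sqrt (by positivity), ← hrad]
  show _ = 32 * _ * Cs * exp (-(c.D j i : ℝ) / 2)
  ring

section lattice

variable {d : ℕ}

lemma supD_comm (x y : ZLat d) : supD x y = supD y x := by
  unfold supD
  congr 1; funext i
  rw [← Int.natAbs_neg, neg_sub]

lemma supD_le_iff (x y : ZLat d) (n : ℕ) : supD x y ≤ n ↔ ∀ k, |x k - y k| ≤ n := by
  simp only [supD, Finset.sup_le_iff, mem_univ, true_imp_iff]
  refine forall_congr' fun k => ?_
  rw [Int.abs_eq_natAbs]; exact Nat.cast_le.symm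

lemma abs_sub_le_supD (x y : ZLat d) (k : Fin d) : |x k - y k| ≤ supD x y :=
  (supD_le_iff x y _).1 le_rfl k

lemma supD_self (x : ZLat d) : supD x x = 0 :=
  Nat.le_zero.1 ((supD_le_iff x x 0).2 fun k => by simp)

lemma supD_tri (x y z : ZLat d) : supD x z ≤ supD x y + supD y z := by
  rw [supD_le_iff]
  intro k
  have h1 := abs_sub_le_supD x y k
  have h2 := abs_sub_le_supD y z k
  have := abs_sub_le (x k) (y k) (z k)
  push_cast; linarith

lemma supD_eq_zero (x y : ZLat d) (h : supD x y = 0) : x = y := by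
  funext k
  have := (supD_le_iff x y 0).1 h.le k
  have h2 : |x k - y k| = 0 := le_antisymm (by simpa using this) (abs_nonneg _)
  exact sub_eq_zero.1 (abs_eq_zero.1 h2)

lemma supD_pos (x y : ZLat d) (h : x ≠ y) : 1 ≤ supD x y := by
  by_contra h1
  exact h (supD_eq_zero x y (by omega))

lemma supD_add (x y z : ZLat d) : supD (x + z) (y + z) = supD x y := by
  unfold supD; simp

/-- The ball of radius `n` about `x`. -/
def box (x : ZLat d) (n : ℕ) : ℱ[d] :=
  Fintype.piFinset fun k => Icc (x k - n) (x k + n)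

lemma mem_box (x y : ZLat d) (n : ℕ) : y ∈ box x n ↔ supD x y ≤ n := by
  simp only [box, Fintype.mem_piFinset, mem_Icc, supD_le_iff, abs_le]
  refine forall_congr' fun k => ?_
  constructor <;> rintro ⟨h1, h2⟩ <;> constructor <;> linarith

lemma card_box (x : ZLat d) (n : ℕ) : (box x n).card = (2 * n + 1) ^ d := by
  simp only [box, Fintype.card_piFinset, Int.card_Icc]
  rw [prod_congr rfl fun k _ => (by congr 1; ring :
    (x k + n + 1 - (x k - n)).toNat = (2 * (n : ℤ) + 1).toNat)]
  simp only [prod_const, Finset.card_univ, Fintype.card_fin]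
  congr 1

end lattice

section gibbs

variable {d : ℕ} (Φ : ℱ[d] → GConf d → ℝ)

/-- The two configurations agree off `Λ`. -/
def AgreeOff (Λ : ℱ[d]) (τ η : GConf d) : Prop := ∀ x, x ∉ Λ → η x = τ x

lemma agreeOff_override (Λ : ℱ[d]) (σ : ↥Λ → Bool) (τ : GConf d) :
    AgreeOff Λ τ (override Λ σ τ) := fun x hx => by simp [override, hx]

lemma override_congr (Λ : ℱ[d]) (σ : ↥Λ → Bool) (τ τ' : GConf d)
    (h : AgreeOff Λ τ τ') : override Λ σ τ' = override Λ σ τ := by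
  funext x
  unfold override
  split_ifs with hx
  · rfl
  · exact h x hx

/-- The sum of a function over the configurations in `Λ`. -/
def cfgSum (Λ : ℱ[d]) (τ : GConf d) (f : GConf d → ℝ) : ℝ :=
  ∑ σ : ↥Λ → Bool, f (override Λ σ τ)

lemma cfgSum_congr_bc (Λ : ℱ[d]) (τ τ' : GConf d) (h : AgreeOff Λ τ τ')
    (f : GConf d → ℝ) : cfgSum Λ τ' f = cfgSum Λ τ f := by
  unfold cfgSum
  exact sum_congr rfl fun σ _ => by rw [override_congr Λ σ τ τ' h]

lemma cfgSum_congr (Λ : ℱ[d]) (τ : GConf d) (f g : GConf d → ℝ)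
    (h : ∀ η, AgreeOff Λ τ η → f η = g η) : cfgSum Λ τ f = cfgSum Λ τ g :=
  sum_congr rfl fun σ _ => h _ (agreeOff_override Λ σ τ)

lemma cfgSum_sdiff (Λ Δ : ℱ[d]) (hΔ : Δ ⊆ Λ) (τ : GConf d) (f : GConf d → ℝ) :
    cfgSum Λ τ f = cfgSum (Λ \ Δ) τ fun ξ => cfgSum Δ ξ f := by
  unfold cfgSum
  rw [← Fintype.sum_prod_type' (f := fun (a : ↥(Λ \ Δ) → Bool) (b : ↥Δ → Bool) =>
    f (override Δ b (override (Λ \ Δ) a τ)))]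
  refine Finset.sum_bij' (fun σ _ => (fun x => σ ⟨x, (mem_sdiff.1 x.2).1⟩,
      fun x => σ ⟨x, hΔ x.2⟩))
    (fun p _ x => if h : (x : ZLat d) ∈ Δ then p.2 ⟨x, h⟩ else
      p.1 ⟨x, mem_sdiff.2 ⟨x.2, h⟩⟩) (fun _ _ => mem_univ _)
    (fun _ _ => mem_univ _) ?_ ?_ ?_
  · intro σ _
    funext x
    dsimp only
    split_ifs <;> rfl
  · rintro ⟨p1, p2⟩ _
    ext x
    · have := (mem_sdiff.1 x.2).2
      simp [this]
    · simp
  · intro σ _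
    congr 1
    funext x
    unfold override
    by_cases h1 : x ∈ Δ
    · simp [h1, hΔ h1]
    · by_cases h2 : x ∈ Λ <;> simp [h1, h2]

lemma cfgSum_swap (Λ Δ : ℱ[d]) (hΔ : Δ ⊆ Λ) (τ : GConf d)
    (F : GConf d → GConf d → ℝ) :
    cfgSum Λ τ (fun η => cfgSum Δ η fun ζ => F η ζ) =
      cfgSum Λ τ (fun η => cfgSum Δ η fun ζ => F ζ η) := by
  rw [cfgSum_sdiff Λ Δ hΔ, cfgSum_sdiff Λ Δ hΔ]
  congr 1
  funext ξ
  have h : ∀ F : GConf d → GConf d → ℝ, cfgSum Δ ξ (fun η => cfgSum Δ η fun ζ => F η ζ) =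
      ∑ a : ↥Δ → Bool, ∑ b : ↥Δ → Bool, F (override Δ a ξ) (override Δ b ξ) := by
    intro F
    refine sum_congr rfl fun a _ => ?_
    exact cfgSum_congr_bc Δ ξ _ (agreeOff_override Δ a ξ) _
  rw [h, h fun η ζ => F ζ η, sum_comm]

lemma partFun_eq (Λ : ℱ[d]) (τ : GConf d) :
    partFun Φ Λ τ = cfgSum Λ τ fun η => exp (hamil Φ Λ η) := rfl

lemma gibbsExp_eq (Λ : ℱ[d]) (τ : GConf d) (f : GConf d → ℝ) :
    gibbsExp Φ Λ τ f = cfgSum Λ τ (fun η => exp (hamil Φ Λ η) * f η) / partFun Φ Λ τ := rfl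

lemma partFun_pos (Λ : ℱ[d]) (τ : GConf d) : 0 < partFun Φ Λ τ :=
  sum_pos (fun _ _ => exp_pos _) univ_nonempty

lemma gibbsExp_congr_bc (Λ : ℱ[d]) (τ τ' : GConf d) (h : AgreeOff Λ τ τ')
    (f : GConf d → ℝ) : gibbsExp Φ Λ τ' f = gibbsExp Φ Λ τ f := by
  rw [gibbsExp_eq, gibbsExp_eq, partFun_eq, partFun_eq, cfgSum_congr_bc Λ τ τ' h,
    cfgSum_congr_bc Λ τ τ' h]

lemma gibbsExp_congr (Λ : ℱ[d]) (τ : GConf d) (f g : GConf d → ℝ)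
    (h : ∀ η, AgreeOff Λ τ η → f η = g η) : gibbsExp Φ Λ τ f = gibbsExp Φ Λ τ g := by
  rw [gibbsExp_eq, gibbsExp_eq, cfgSum_congr Λ τ _ _ fun η hη => by rw [h η hη]]

lemma gibbsExp_const (Λ : ℱ[d]) (τ : GConf d) (c : ℝ) :
    gibbsExp Φ Λ τ (fun _ => c) = c := by
  rw [gibbsExp_eq]
  unfold cfgSum
  rw [← sum_mul]
  exact mul_div_cancel_left₀ _ (partFun_pos Φ Λ τ).ne'

lemma gibbsExp_add (Λ : ℱ[d]) (τ : GConf d) (f g : GConf d → ℝ) :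
    gibbsExp Φ Λ τ (fun η => f η + g η) = gibbsExp Φ Λ τ f + gibbsExp Φ Λ τ g := by
  simp only [gibbsExp_eq, cfgSum, mul_add, sum_add_distrib, add_div]

lemma gibbsExp_const_mul (Λ : ℱ[d]) (τ : GConf d) (c : ℝ) (f : GConf d → ℝ) :
    gibbsExp Φ Λ τ (fun η => c * f η) = c * gibbsExp Φ Λ τ f := by
  simp only [gibbsExp_eq, cfgSum, mul_left_comm _ c, ← mul_sum, mul_div_assoc]

lemma gibbsExp_sub (Λ : ℱ[d]) (τ : GConf d) (f g : GConf d → ℝ) :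
    gibbsExp Φ Λ τ (fun η => f η - g η) = gibbsExp Φ Λ τ f - gibbsExp Φ Λ τ g := by
  simp only [gibbsExp_eq, cfgSum, mul_sub, sum_sub_distrib, sub_div]

lemma gibbsExp_sum {ι : Type*} (s : Finset ι) (Λ : ℱ[d]) (τ : GConf d)
    (f : ι → GConf d → ℝ) :
    gibbsExp Φ Λ τ (fun η => ∑ i ∈ s, f i η) = ∑ i ∈ s, gibbsExp Φ Λ τ (f i) := by
  simp only [gibbsExp_eq, cfgSum, mul_sum]
  rw [sum_comm, sum_div]

lemma gibbsExp_mono (Λ : ℱ[d]) (τ : GConf d) (f g : GConf d → ℝ)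
    (h : ∀ η, AgreeOff Λ τ η → f η ≤ g η) : gibbsExp Φ Λ τ f ≤ gibbsExp Φ Λ τ g := by
  rw [gibbsExp_eq, gibbsExp_eq]
  refine div_le_div_of_nonneg_right (sum_le_sum fun σ _ => ?_) (partFun_pos Φ Λ τ).le
  exact mul_le_mul_of_nonneg_left (h _ (agreeOff_override Λ σ τ)) (exp_pos _).le

lemma gibbsExp_nonneg (Λ : ℱ[d]) (τ : GConf d) (f : GConf d → ℝ)
    (h : ∀ η, 0 ≤ f η) : 0 ≤ gibbsExp Φ Λ τ f := by
  rw [← gibbsExp_const Φ Λ τ 0]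
  exact gibbsExp_mono Φ Λ τ _ _ fun η _ => h η

lemma abs_gibbsExp_le_abs (Λ : ℱ[d]) (τ : GConf d) (f : GConf d → ℝ) :
    |gibbsExp Φ Λ τ f| ≤ gibbsExp Φ Λ τ fun η => |f η| := by
  rw [abs_le]
  constructor
  · have := gibbsExp_mono Φ Λ τ (fun η => (-1) * |f η|) f fun η _ => by
      have := neg_abs_le (f η); linarith
    rw [gibbsExp_const_mul] at this; linarith
  · exact gibbsExp_mono Φ Λ τ _ _ fun η _ => le_abs_self _

lemma abs_gibbsExp_le (Λ : ℱ[d]) (τ : GConf d) (f : GConf d → ℝ) (c : ℝ)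
    (h : ∀ η, |f η| ≤ c) : |gibbsExp Φ Λ τ f| ≤ c := by
  refine (abs_gibbsExp_le_abs Φ Λ τ f).trans ?_
  rw [← gibbsExp_const Φ Λ τ c]
  exact gibbsExp_mono Φ Λ τ _ _ fun η _ => h η

lemma gibbsExp_mul_outer (Λ : ℱ[d]) (τ : GConf d) (h f : GConf d → ℝ)
    (hh : ∀ η, AgreeOff Λ τ η → h η = h τ) :
    gibbsExp Φ Λ τ (fun η => h η * f η) = h τ * gibbsExp Φ Λ τ f := by
  rw [← gibbsExp_const_mul]
  exact gibbsExp_congr Φ Λ τ _ _ fun η hη => by rw [hh η hη]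

lemma gibbsExp_mul_sq_le (Λ : ℱ[d]) (τ : GConf d) (f g : GConf d → ℝ) :
    gibbsExp Φ Λ τ (fun η => f η * g η) ^ 2 ≤
      gibbsExp Φ Λ τ (fun η => f η ^ 2) * gibbsExp Φ Λ τ (fun η => g η ^ 2) := by
  have hZ := partFun_pos Φ Λ τ
  simp only [gibbsExp_eq, cfgSum]
  rw [div_pow, div_mul_div_comm, sq (partFun Φ Λ τ)]
  refine div_le_div_of_nonneg_right ?_ (mul_self_nonneg _)
  have := Finset.sum_mul_sq_le_sq_mul_sq (univ : Finset (↥Λ → Bool))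
    (fun σ => sqrt (exp (hamil Φ Λ (override Λ σ τ))) * f (override Λ σ τ))
    (fun σ => sqrt (exp (hamil Φ Λ (override Λ σ τ))) * g (override Λ σ τ))
  simp only [mul_pow, sq_sqrt (exp_pos _).le] at this
  refine le_trans (le_of_eq ?_) this
  congr 1
  refine sum_congr rfl fun σ _ => ?_
  rw [mul_mul_mul_comm, mul_self_sqrt (exp_pos _).le]

end gibbs

section hamiltonian

variable {d : ℕ} (G : LatticeGas d)

lemma gasPotH_local (X : ℱ[d]) : LocalOn (gasPotH G X) X := by
  intro σ τ h
  unfold gasPotH gasPot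
  split_ifs
  · exact sum_congr rfl fun x hx => by rw [h x hx]
  · exact G.Ulocal X σ τ h

lemma gasPotH_range (X : ℱ[d]) (x y : ZLat d) (hx : x ∈ X) (hy : y ∈ X)
    (h : G.r < supD x y) : gasPotH G X = 0 := by
  funext σ
  unfold gasPotH gasPot
  rw [if_neg, G.Urange X x hx y hy h]
  intro h1
  obtain ⟨a, rfl⟩ := Finset.card_eq_one.1 h1
  rw [mem_singleton.1 hx, mem_singleton.1 hy, supD_self] at h
  omega

lemma gasPotH_subset_box (X : ℱ[d]) (x : ZLat d) (hx : x ∈ X)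
    (h : gasPotH G X ≠ 0) : X ⊆ box x G.r := by
  intro y hy
  rw [mem_box]
  by_contra h1
  exact h (gasPotH_range G X x y hx hy (not_le.1 h1))

lemma gasPotH_trans (X : ℱ[d]) (i : ZLat d) (σ : GConf d) :
    gasPotH G (X.image (· + i)) σ = gasPotH G X fun x => σ (x + i) := by
  unfold gasPotH gasPot
  rw [Finset.card_image_of_injective _ (add_left_injective i)]
  split_ifs
  · rw [sum_image fun _ _ _ _ h => add_left_injective i h]
  · exact G.UtransInv X i σ

lemma summable_hamil (Λ : ℱ[d]) (σ : GConf d) :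
    Summable fun X : ℱ[d] => if (X ∩ Λ).Nonempty then gasPotH G X σ else 0 := by
  refine summable_of_ne_finset_zero (s := (Λ.biUnion fun x => box x G.r).powerset) fun X hX => ?_
  split_ifs with h
  · obtain ⟨x, hx⟩ := h
    rw [mem_inter] at hx
    by_contra h1
    refine hX (mem_powerset.2 fun y hy => mem_biUnion.2 ⟨x, hx.2, ?_⟩)
    exact gasPotH_subset_box G X x hx.1 (fun h2 => h1 (by rw [h2]; rfl)) hy
  · rfl

lemma hamil_sub (Λ : ℱ[d]) (σ τ : GConf d) :
    hamil (gasPotH G) Λ σ - hamil (gasPotH G) Λ τ = ∑' X : ℱ[d],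
      if (X ∩ Λ).Nonempty then gasPotH G X σ - gasPotH G X τ else 0 := by
  unfold hamil
  rw [← (summable_hamil G Λ σ).tsum_sub (summable_hamil G Λ τ)]
  congr 1
  funext X
  split_ifs <;> simp

lemma hamil_sub_eq (Λ Δ : ℱ[d]) (hΔ : Δ ⊆ Λ) (σ τ : GConf d)
    (h : AgreeOff Δ σ τ) :
    hamil (gasPotH G) Λ σ - hamil (gasPotH G) Λ τ =
      hamil (gasPotH G) Δ σ - hamil (gasPotH G) Δ τ := by
  rw [hamil_sub, hamil_sub]
  congr 1
  funext X
  by_cases h1 : (X ∩ Δ).Nonempty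
  · rw [if_pos h1, if_pos (h1.mono (Finset.inter_subset_inter_left hΔ))]
  · rw [if_neg h1]
    split_ifs
    · rw [gasPotH_local G X σ τ, sub_self]
      intro x hx
      refine (h x fun h2 => h1 ⟨x, mem_inter.2 ⟨hx, h2⟩⟩).symm
    · rfl

lemma hamil_congr (Λ : ℱ[d]) (σ τ : GConf d)
    (h : ∀ x ∈ Λ, ∀ y, supD x y ≤ G.r → σ y = τ y) :
    hamil (gasPotH G) Λ σ = hamil (gasPotH G) Λ τ := by
  unfold hamil
  congr 1
  funext X
  split_ifs with h1
  · obtain ⟨x, hx⟩ := h1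
    rw [mem_inter] at hx
    by_cases h2 : gasPotH G X = 0
    · rw [h2]; rfl
    · refine gasPotH_local G X σ τ fun y hy => h x hx.2 y ?_
      exact (mem_box _ _ _).1 (gasPotH_subset_box G X x hx.1 h2 hy)
  · rfl

/-- A bound for the potential on `X`. -/
def potBound (X : ℱ[d]) : ℝ :=
  ∑ s : ↥X → Bool, |gasPotH G X (override X s fun _ => false)|

lemma potBound_nonneg (X : ℱ[d]) : 0 ≤ potBound G X :=
  sum_nonneg fun _ _ => abs_nonneg _

lemma abs_gasPotH_le (X : ℱ[d]) (σ : GConf d) : |gasPotH G X σ| ≤ potBound G X := by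
  rw [gasPotH_local G X σ (override X (fun x => σ x) fun _ => false)]
  · exact single_le_sum (f := fun s : ↥X → Bool =>
      |gasPotH G X (override X s fun _ => false)|) (fun _ _ => abs_nonneg _) (mem_univ _)
  · intro x hx
    simp [override, hx]

/-- The maximal energy change produced by altering one site. -/
def eBound : ℝ := ∑ X ∈ (box (0 : ZLat d) G.r).powerset, 2 * potBound G X

lemma eBound_nonneg : 0 ≤ eBound G :=
  sum_nonneg fun _ _ => mul_nonneg (by norm_num) (potBound_nonneg G _)

lemma abs_hamil_sub_le (Λ : ℱ[d]) (y : ZLat d) (σ τ : GConf d)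
    (h : AgreeOff {y} σ τ) :
    |hamil (gasPotH G) Λ σ - hamil (gasPotH G) Λ τ| ≤ eBound G := by
  rw [hamil_sub, tsum_eq_sum (s := (box (0 : ZLat d) G.r).powerset.image
    fun X => X.image (· + y))]
  · refine (abs_sum_le_sum_abs _ _).trans ?_
    rw [sum_image]
    · refine sum_le_sum fun X _ => ?_
      split_ifs
      · rw [gasPotH_trans, gasPotH_trans]
        refine (abs_sub _ _).trans ?_
        have h1 := abs_gasPotH_le G X fun x => σ (x + y)
        have h2 := abs_gasPotH_le G X fun x => τ (x + y)
        linarith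
      · rw [abs_zero]
        exact mul_nonneg (by norm_num) (potBound_nonneg G _)
    · intro A _ B _ hAB
      exact Finset.image_injective (add_left_injective y) hAB
  · intro X hX
    split_ifs
    · by_cases hy : y ∈ X
      · by_cases h2 : gasPotH G X = 0
        · rw [h2]; simp
        · exfalso
          refine hX (mem_image.2 ⟨X.image (· + -y), mem_powerset.2 ?_, ?_⟩)
          · intro z hz
            obtain ⟨w, hw, rfl⟩ := mem_image.1 hz
            have := (mem_box _ _ _).1 (gasPotH_subset_box G X y hy h2 hw)
            rw [mem_box]
            rw [← supD_add _ _ y]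
            simpa using this
          · rw [Finset.image_image]
            rw [show ((fun x : ZLat d => x + y) ∘ fun x => x + -y) = id by funext z; simp]
            exact image_id
      · rw [gasPotH_local G X σ τ, sub_self]
        intro x hx
        refine (h x ?_).symm
        rw [mem_singleton]
        rintro rfl; exact hy hx
    · rfl

lemma hamil_sub_congr (Λ : ℱ[d]) (y : ZLat d) (σ τ σ' τ' : GConf d)
    (h : AgreeOff {y} σ τ) (h' : AgreeOff {y} σ' τ')
    (hσ : ∀ x ∈ box y G.r, σ x = σ' x) (hτ : ∀ x ∈ box y G.r, τ x = τ' x) :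
    hamil (gasPotH G) Λ σ - hamil (gasPotH G) Λ τ =
      hamil (gasPotH G) Λ σ' - hamil (gasPotH G) Λ τ' := by
  rw [hamil_sub, hamil_sub]
  congr 1
  funext X
  split_ifs
  · by_cases hy : y ∈ X
    · by_cases h2 : gasPotH G X = 0
      · rw [h2]; simp
      · have := gasPotH_subset_box G X y hy h2
        rw [gasPotH_local G X σ σ' fun x hx => hσ x (this hx),
          gasPotH_local G X τ τ' fun x hx => hτ x (this hx)]
    · have hne : ∀ x ∈ X, x ∉ ({y} : ℱ[d]) := by
        intro x hx hxy
        rw [mem_singleton] at hxy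
        exact hy (hxy ▸ hx)
      rw [gasPotH_local G X σ τ fun x hx => (h x (hne x hx)).symm,
        gasPotH_local G X σ' τ' fun x hx => (h' x (hne x hx)).symm, sub_self, sub_self]
  · rfl

lemma gibbsExp_gibbsExp (Λ Δ : ℱ[d]) (hΔ : Δ ⊆ Λ) (τ : GConf d)
    (f : GConf d → ℝ) :
    𝔼[G] Λ τ (fun η => 𝔼[G] Δ η f) =
      𝔼[G] Λ τ f := by
  rw [gibbsExp_eq, gibbsExp_eq]
  congr 1
  have h1 : cfgSum Λ τ (fun η => exp (hamil (gasPotH G) Λ η) *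
      𝔼[G] Δ η f) = cfgSum Λ τ (fun η => cfgSum Δ η fun ζ =>
        exp (hamil (gasPotH G) Λ η) * exp (hamil (gasPotH G) Δ ζ) *
          f ζ / partFun (gasPotH G) Δ η) := by
    congr 1; funext η
    rw [gibbsExp_eq]
    simp only [cfgSum, mul_sum, sum_div]
    refine sum_congr rfl fun s _ => ?_
    ring
  rw [h1, cfgSum_swap Λ Δ hΔ]
  congr 1; funext η
  have h2 : cfgSum Δ η (fun ζ => exp (hamil (gasPotH G) Λ ζ) *
      exp (hamil (gasPotH G) Δ η) * f η / partFun (gasPotH G) Δ ζ) =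
      cfgSum Δ η (fun ζ => (exp (hamil (gasPotH G) Λ η) * f η /
        partFun (gasPotH G) Δ η) * exp (hamil (gasPotH G) Δ ζ)) := by
    refine cfgSum_congr _ _ _ _ fun ζ hζ => ?_
    have h3 : partFun (gasPotH G) Δ ζ = partFun (gasPotH G) Δ η := by
      rw [partFun_eq, partFun_eq, cfgSum_congr_bc Δ η ζ hζ]
    have h4 := hamil_sub_eq G Λ Δ hΔ η ζ hζ
    have h5 : exp (hamil (gasPotH G) Λ ζ) * exp (hamil (gasPotH G) Δ η) =
        exp (hamil (gasPotH G) Λ η) * exp (hamil (gasPotH G) Δ ζ) := by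
      rw [← exp_add, ← exp_add]
      congr 1; linarith
    rw [h3, h5]; ring
  rw [h2]
  have h6 : cfgSum Δ η (fun ζ => (exp (hamil (gasPotH G) Λ η) * f η /
        partFun (gasPotH G) Δ η) * exp (hamil (gasPotH G) Δ ζ)) =
      (exp (hamil (gasPotH G) Λ η) * f η /
        partFun (gasPotH G) Δ η) * partFun (gasPotH G) Δ η := by
    rw [partFun_eq]
    unfold cfgSum
    rw [mul_sum]
  rw [h6, div_mul_cancel₀ _ (partFun_pos _ Δ η).ne']

lemma gibbsExp_mul_gibbsExp (Λ Δ : ℱ[d]) (hΔ : Δ ⊆ Λ) (τ : GConf d)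
    (h f : GConf d → ℝ) (hh : ∀ η ζ, AgreeOff Δ η ζ → h ζ = h η) :
    𝔼[G] Λ τ (fun η => h η * 𝔼[G] Δ η f) =
      𝔼[G] Λ τ (fun η => h η * f η) := by
  rw [← gibbsExp_gibbsExp G Λ Δ hΔ τ fun η => h η * f η]
  congr 1
  funext η
  rw [gibbsExp_mul_outer _ Δ η h f fun ζ hζ => hh η ζ hζ]

lemma gibbsExp_congr_near (Δ : ℱ[d]) (f : GConf d → ℝ) (ξ ξ' : GConf d)
    (hf : ∀ s, f (override Δ s ξ) = f (override Δ s ξ'))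
    (h : ∀ x ∈ Δ, ∀ y, y ∉ Δ → supD x y ≤ G.r → ξ y = ξ' y) :
    𝔼[G] Δ ξ f = 𝔼[G] Δ ξ' f := by
  have hH : ∀ s, hamil (gasPotH G) Δ (override Δ s ξ) = hamil (gasPotH G) Δ (override Δ s ξ') := by
    intro s
    refine hamil_congr G Δ _ _ fun x hx y hy => ?_
    unfold override
    split_ifs with h1
    · rfl
    · exact h x hx y h1 hy
  unfold gibbsExp partFun
  simp only [hf, hH]

lemma gibbsExp_tilt (Δ : ℱ[d]) (y : ZLat d) (hy : y ∉ Δ) (ξ ξ' : GConf d)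
    (f : GConf d → ℝ)
    (hf : ∀ η, AgreeOff Δ ξ η → f (update η y (ξ' y)) = f η)
    (h : AgreeOff {y} ξ ξ') :
    𝔼[G] Δ ξ' f = 𝔼[G] Δ ξ (fun η =>
        f η * exp (hamil (gasPotH G) Δ (update η y (ξ' y)) -
          hamil (gasPotH G) Δ η)) /
      𝔼[G] Δ ξ (fun η =>
        exp (hamil (gasPotH G) Δ (update η y (ξ' y)) -
          hamil (gasPotH G) Δ η)) := by
  have hov : ∀ s : ↥Δ → Bool, override Δ s ξ' = update (override Δ s ξ) y (ξ' y) := by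
    intro s
    funext x
    by_cases hx : x = y
    · subst hx; simp [override, hy]
    · rw [update_of_ne hx]
      unfold override
      split_ifs
      · rfl
      · exact h x (by simpa using hx)
  have key : ∀ f : GConf d → ℝ, (∀ η, AgreeOff Δ ξ η → f (update η y (ξ' y)) = f η) →
      cfgSum Δ ξ' (fun η => exp (hamil (gasPotH G) Δ η) * f η) =
      𝔼[G] Δ ξ (fun η =>
        f η * exp (hamil (gasPotH G) Δ (update η y (ξ' y)) -
          hamil (gasPotH G) Δ η)) * partFun (gasPotH G) Δ ξ := by
    intro f hf
    rw [gibbsExp_eq, div_mul_cancel₀ _ (partFun_pos _ Δ ξ).ne']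
    unfold cfgSum
    refine sum_congr rfl fun s _ => ?_
    rw [hov]
    dsimp only
    rw [hf _ (agreeOff_override Δ s ξ), Real.exp_sub]
    field_simp
  have h1 := key f hf
  have h2 := key (fun _ => 1) fun _ _ => rfl
  simp only [mul_one, one_mul] at h2
  rw [gibbsExp_eq, partFun_eq, h1, h2]
  rw [mul_div_mul_right _ _ (partFun_pos _ Δ ξ).ne']

end hamiltonian

section expsum

variable {d : ℕ}

/-- The interaction `∑_{x ∈ T, y ∈ Y} e^{-b|x-y|}` of two finite sets. -/
def Jsum (b : ℝ) (T Y : ℱ[d]) : ℝ :=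
  ∑ x ∈ T, ∑ y ∈ Y, exp (-b * supD x y)

lemma Jsum_nonneg (b : ℝ) (T Y : ℱ[d]) : 0 ≤ Jsum b T Y :=
  sum_nonneg fun _ _ => sum_nonneg fun _ _ => (exp_pos _).le

lemma Jsum_comm (b : ℝ) (T Y : ℱ[d]) : Jsum b T Y = Jsum b Y T := by
  unfold Jsum
  rw [sum_comm]
  simp only [supD_comm]

lemma Jsum_mono (b : ℝ) {T T' Y Y' : ℱ[d]} (hT : T ⊆ T') (hY : Y ⊆ Y') :
    Jsum b T Y ≤ Jsum b T' Y' := by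
  unfold Jsum
  refine (sum_le_sum fun x _ => Finset.sum_le_sum_of_subset_of_nonneg hY
    fun _ _ _ => (exp_pos _).le).trans ?_
  exact Finset.sum_le_sum_of_subset_of_nonneg hT
    fun _ _ _ => sum_nonneg fun _ _ => (exp_pos _).le

/-- The constant bounding `∑_y e^{-c|x-y|}`. -/
def expConst (d : ℕ) (c : ℝ) : ℝ := ∑' n : ℕ, ((2 * n + 1 : ℕ) : ℝ) ^ d * exp (-c * n)

lemma summable_expConst (c : ℝ) (hc : 0 < c) :
    Summable fun n : ℕ => ((2 * n + 1 : ℕ) : ℝ) ^ d * exp (-c * n) := by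
  have h := (summable_nat_add_iff 1).2 (Real.summable_pow_mul_exp_neg_nat_mul d hc)
  refine Summable.of_nonneg_of_le (fun n => by positivity) (fun n => ?_)
    (h.mul_left (2 ^ d * exp c))
  have h1 : ((2 * n + 1 : ℕ) : ℝ) ^ d ≤ 2 ^ d * ((n + 1 : ℕ) : ℝ) ^ d := by
    rw [← mul_pow]
    refine pow_le_pow_left₀ (by positivity) ?_ d
    push_cast; linarith
  have h2 : exp (-c * n) = exp c * exp (-c * ((n + 1 : ℕ) : ℝ)) := by
    rw [← exp_add]; congr 1; push_cast; ring
  rw [h2]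
  calc _ ≤ 2 ^ d * ((n + 1 : ℕ) : ℝ) ^ d * (exp c * exp (-c * ((n + 1 : ℕ) : ℝ))) :=
        mul_le_mul_of_nonneg_right h1 (by positivity)
    _ = _ := by ring

lemma expConst_nonneg (c : ℝ) : 0 ≤ expConst d c :=
  tsum_nonneg fun _ => by positivity

lemma sum_exp_le (c : ℝ) (hc : 0 < c) (x : ZLat d) (S : ℱ[d]) :
    ∑ y ∈ S, exp (-c * supD x y) ≤ expConst d c := by
  have hs := summable_expConst (d := d) c hc
  rw [← Finset.sum_fiberwise_of_maps_to (t := S.image fun y => supD x y)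
    (g := fun y => supD x y) fun y hy => mem_image_of_mem _ hy]
  refine le_trans (sum_le_sum fun n _ => ?_) (hs.sum_le_tsum _ fun n _ => by positivity)
  rw [sum_congr rfl (g := fun _ => exp (-c * n)) fun y hy => by
    rw [(mem_filter.1 hy).2]]
  rw [sum_const, nsmul_eq_mul]
  refine mul_le_mul_of_nonneg_right ?_ (exp_pos _).le
  rw [← Nat.cast_pow, ← card_box x n]
  refine Nat.cast_le.2 (card_le_card fun y hy => ?_)
  rw [mem_box, (mem_filter.1 hy).2]

lemma Jsum_le_card (b : ℝ) (hb : 0 < b) (T Y : ℱ[d]) :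
    Jsum b T Y ≤ T.card * expConst d b := by
  unfold Jsum
  refine (sum_le_sum fun x _ => sum_exp_le b hb x Y).trans ?_
  rw [sum_const, nsmul_eq_mul]

lemma Jsum_le_of_dist (b : ℝ) (hb : 0 < b) (T Y : ℱ[d]) (ρ : ℝ)
    (h : ∀ x ∈ T, ∀ y ∈ Y, ρ ≤ supD x y) :
    Jsum b T Y ≤ T.card * expConst d (b / 2) * exp (-(b / 2) * ρ) := by
  have h1 : Jsum b T Y ≤ exp (-(b / 2) * ρ) * Jsum (b / 2) T Y := by
    unfold Jsum
    rw [mul_sum]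
    refine sum_le_sum fun x hx => ?_
    rw [mul_sum]
    refine sum_le_sum fun y hy => ?_
    rw [← exp_add]
    refine exp_le_exp.2 ?_
    have := mul_le_mul_of_nonneg_left (h x hx y hy) (by linarith : 0 ≤ b / 2)
    linarith
  have h2 := Jsum_le_card (b / 2) (by linarith) T Y
  calc _ ≤ _ := h1
    _ ≤ exp (-(b / 2) * ρ) * (T.card * expConst d (b / 2)) :=
        mul_le_mul_of_nonneg_left h2 (exp_pos _).le
    _ = _ := by ring

lemma Jsum_box_le (b : ℝ) (hb : 0 < b) (T : ℱ[d]) (y : ZLat d) (r : ℕ) :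
    Jsum b T (box y r) ≤ (2 * r + 1) ^ d * exp (b * r) * Jsum b T {y} := by
  unfold Jsum
  rw [mul_sum]
  refine sum_le_sum fun x _ => ?_
  rw [sum_singleton]
  calc ∑ z ∈ box y r, exp (-b * supD x z)
      ≤ ∑ z ∈ box y r, exp (b * r) * exp (-b * supD x y) := by
        refine sum_le_sum fun z hz => ?_
        rw [← exp_add]
        refine exp_le_exp.2 ?_
        have h1 := (mem_box _ _ _).1 hz
        have h2 := supD_tri x z y
        rw [supD_comm z y] at h2
        have h3 : (supD x y : ℝ) ≤ supD x z + r := by exact_mod_cast h2.trans (by omega)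
        nlinarith
    _ = _ := by
        rw [sum_const, card_box, nsmul_eq_mul]; push_cast; ring

lemma Jsum_insert (b : ℝ) (T Y : ℱ[d]) (y : ZLat d) (hy : y ∉ Y) :
    Jsum b T (insert y Y) = Jsum b T {y} + Jsum b T Y := by
  unfold Jsum
  rw [← sum_add_distrib]
  refine sum_congr rfl fun x _ => ?_
  rw [sum_insert hy, sum_singleton]

lemma exists_fDist (A C : ℱ[d]) (hA : A.Nonempty) (hC : C.Nonempty) :
    ∃ x ∈ A, ∃ y ∈ C, fDist A C = supD x y := by
  unfold fDist
  have hne : ((fun p : ZLat d × ZLat d => (supD p.1 p.2 : ℝ)) ''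
      {p | p.1 ∈ A ∧ p.2 ∈ C}).Nonempty := by
    obtain ⟨x, hx⟩ := hA
    obtain ⟨y, hy⟩ := hC
    exact ⟨_, ⟨(x, y), ⟨hx, hy⟩, rfl⟩⟩
  have hfin : ((fun p : ZLat d × ZLat d => (supD p.1 p.2 : ℝ)) ''
      {p | p.1 ∈ A ∧ p.2 ∈ C}).Finite := by
    refine Set.Finite.image _ ?_
    refine ((A ×ˢ C).finite_toSet).subset fun p hp => ?_
    exact mem_coe.2 (mem_product.2 hp)
  obtain ⟨p, hp, h⟩ := hne.csInf_mem hfin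
  exact ⟨p.1, hp.1, p.2, hp.2, h.symm⟩

end expsum

section mixing

variable {d : ℕ} (G : LatticeGas d)

/-- Finite unions of elementary cubes. -/
def Reg (ℓ0 : ℕ) (Δ : ℱ[d]) : Prop := ∃ I, Δ = cubesRegion ℓ0 I

lemma supNorm_le {f : GConf d → ℝ} {F : ℝ} (h : ∀ η, |f η| ≤ F) : supNorm f ≤ F :=
  ciSup_le h

lemma supNorm_nonneg (f : GConf d → ℝ) : 0 ≤ supNorm f :=
  Real.iSup_nonneg fun _ => abs_nonneg _

lemma SM.cov_le {ℓ0 : ℕ} {b B : ℝ} (hB : 0 < B) (hSM : SM (gasPotH G) ℓ0 b B)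
    (Δ : ℱ[d]) (hΔ : Reg ℓ0 Δ) (τ : GConf d) (f g : GConf d → ℝ)
    (T S : ℱ[d]) (hf : LocalOn f T) (hg : LocalOn g S) (F H : ℝ)
    (hF : ∀ η, |f η| ≤ F) (hH : ∀ η, |g η| ≤ H) :
    |𝔼[G] Δ τ (fun η => f η * g η) -
        𝔼[G] Δ τ f * 𝔼[G] Δ τ g| ≤
      (B + 2) * F * H * S.card * Jsum b T S := by
  have hF0 : 0 ≤ F := (abs_nonneg _).trans (hF τ)
  have hH0 : 0 ≤ H := (abs_nonneg _).trans (hH τ)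
  have hR0 : 0 ≤ (B + 2) * F * H * S.card * Jsum b T S :=
    mul_nonneg (by positivity) (Jsum_nonneg _ _ _)
  set fr : GConf d → GConf d := fun η x => if x ∈ Δ then η x else τ x with hfr
  have hfreq : ∀ η, AgreeOff Δ τ η → fr η = η := by
    intro η hη; funext x
    simp only [hfr]
    split_ifs with h
    · rfl
    · exact (hη x h).symm
  have loc : ∀ (u : GConf d → ℝ) (A : ℱ[d]), LocalOn u A →
      LocalOn (fun η => u (fr η)) (A ∩ Δ) := by
    intro u A hu σ ζ h
    refine hu _ _ fun x hx => ?_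
    simp only [hfr]
    split_ifs with h1
    · exact h x (mem_inter.2 ⟨hx, h1⟩)
    · rfl
  have e1 : 𝔼[G] Δ τ (fun η => f η * g η) =
      𝔼[G] Δ τ (fun η => f (fr η) * g (fr η)) :=
    gibbsExp_congr _ _ _ _ _ fun η hη => by rw [hfreq η hη]
  have e2 : 𝔼[G] Δ τ f = 𝔼[G] Δ τ (fun η => f (fr η)) :=
    gibbsExp_congr _ _ _ _ _ fun η hη => by rw [hfreq η hη]
  have e3 : 𝔼[G] Δ τ g = 𝔼[G] Δ τ (fun η => g (fr η)) :=
    gibbsExp_congr _ _ _ _ _ fun η hη => by rw [hfreq η hη]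
  rw [e1, e2, e3]
  have hlf := loc f T hf
  have hlg := loc g S hg
  rcases Finset.eq_empty_or_nonempty (T ∩ Δ) with hT | hT
  · have hc : ∀ η, f (fr η) = f (fr τ) := fun η => hlf η τ (by simp [hT])
    simp only [hc]
    rw [gibbsExp_const_mul, gibbsExp_const, sub_self, abs_zero]
    exact hR0
  rcases Finset.eq_empty_or_nonempty (S ∩ Δ) with hS | hS
  · have hc : ∀ η, g (fr η) = g (fr τ) := fun η => hlg η τ (by simp [hS])
    simp only [hc, mul_comm _ (g (fr τ))]
    rw [gibbsExp_const_mul, gibbsExp_const, mul_comm, sub_self, abs_zero]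
    exact hR0
  have hmain : |𝔼[G] Δ τ (fun η => f (fr η) * g (fr η)) -
      𝔼[G] Δ τ (fun η => f (fr η)) *
        𝔼[G] Δ τ (fun η => g (fr η))| ≤
      (B + 2) * F * H * ((min (T ∩ Δ).card (S ∩ Δ).card : ℝ) *
        exp (-b * fDist (T ∩ Δ) (S ∩ Δ))) := by
    by_cases hm : (min (T ∩ Δ).card (S ∩ Δ).card : ℝ) *
        exp (-b * fDist (T ∩ Δ) (S ∩ Δ)) ≤ 1
    · obtain ⟨I, rfl⟩ := hΔ
      have h := hSM I _ _ _ _ hlf hlg Finset.inter_subset_right Finset.inter_subset_right hm τ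
      refine h.trans ?_
      have h1 := supNorm_le fun η => hF (fr η)
      have h2 := supNorm_le fun η => hH (fr η)
      rw [mul_assoc (B * _ * _)]
      refine mul_le_mul_of_nonneg_right ?_ (by positivity)
      exact mul_le_mul (mul_le_mul (by linarith) h1 (supNorm_nonneg _) (by linarith)) h2
        (supNorm_nonneg _) (by positivity)
    · have hm := (not_le.1 hm).le
      have h1 : |𝔼[G] Δ τ (fun η => f (fr η) * g (fr η))| ≤ F * H :=
        abs_gibbsExp_le _ _ _ _ _ fun η => by
          rw [abs_mul]; exact mul_le_mul (hF _) (hH _) (abs_nonneg _) hF0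
      have h2 := abs_gibbsExp_le (gasPotH G) Δ τ _ F fun η => hF (fr η)
      have h3 := abs_gibbsExp_le (gasPotH G) Δ τ _ H fun η => hH (fr η)
      have h4 := mul_le_mul h2 h3 (abs_nonneg _) hF0
      rw [← abs_mul] at h4
      refine (abs_sub _ _).trans ?_
      have h5 : 0 ≤ F * H := mul_nonneg hF0 hH0
      have h6 : (B + 2) * F * H * 1 ≤ (B + 2) * F * H *
          ((min (T ∩ Δ).card (S ∩ Δ).card : ℝ) * exp (-b * fDist (T ∩ Δ) (S ∩ Δ))) :=
        mul_le_mul_of_nonneg_left hm (by positivity)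
      nlinarith
  refine hmain.trans ?_
  obtain ⟨x, hx, y, hy, hxy⟩ := exists_fDist _ _ hT hS
  rw [hxy, mul_assoc _ (S.card : ℝ)]
  refine mul_le_mul_of_nonneg_left ?_ (by positivity)
  refine mul_le_mul ?_ ?_ (exp_pos _).le (Nat.cast_nonneg _)
  · exact (min_le_right _ _).trans (Nat.cast_le.2 (card_le_card Finset.inter_subset_left))
  · unfold Jsum
    refine le_trans ?_ (single_le_sum (f := fun x => ∑ y ∈ S, exp (-b * supD x y))
      (fun _ _ => sum_nonneg fun _ _ => (exp_pos _).le) (mem_inter.1 hx).1)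
    exact single_le_sum (f := fun y => exp (-b * supD x y))
      (fun _ _ => (exp_pos _).le) (mem_inter.1 hy).1

/-- The tilting factor for a change at `y`. -/
def tiltF (Δ : ℱ[d]) (y : ZLat d) (v : Bool) (η : GConf d) : ℝ :=
  exp (hamil (gasPotH G) Δ (update η y v) - hamil (gasPotH G) Δ η)

lemma agreeOff_update (η : GConf d) (y : ZLat d) (v : Bool) :
    AgreeOff {y} η (update η y v) := fun x hx =>
  update_of_ne (by simpa using hx) _ _

lemma agreeOff_symm {Λ : ℱ[d]} {η ζ : GConf d} (h : AgreeOff Λ η ζ) :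
    AgreeOff Λ ζ η := fun x hx => (h x hx).symm

lemma tiltF_local (Δ : ℱ[d]) (y : ZLat d) (v : Bool) :
    LocalOn (tiltF G Δ y v) (box y G.r) := by
  intro σ τ h
  unfold tiltF
  rw [hamil_sub_congr G Δ y _ _ (update τ y v) τ (agreeOff_symm (agreeOff_update _ _ _))
    (agreeOff_symm (agreeOff_update _ _ _)) _ h]
  intro x hx
  by_cases hxy : x = y
  · subst hxy; simp
  · rw [update_of_ne hxy, update_of_ne hxy, h x hx]

lemma tiltF_le (Δ : ℱ[d]) (y : ZLat d) (v : Bool) (η : GConf d) :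
    tiltF G Δ y v η ≤ exp (eBound G) :=
  exp_le_exp.2 ((le_abs_self _).trans
    (abs_hamil_sub_le G Δ y _ _ (agreeOff_symm (agreeOff_update _ _ _))))

lemma le_tiltF (Δ : ℱ[d]) (y : ZLat d) (v : Bool) (η : GConf d) :
    exp (-eBound G) ≤ tiltF G Δ y v η :=
  exp_le_exp.2 (neg_le.1 ((neg_le_abs _).trans
    (abs_hamil_sub_le G Δ y _ _ (agreeOff_symm (agreeOff_update _ _ _)))))

lemma abs_tiltF_le (Δ : ℱ[d]) (y : ZLat d) (v : Bool) (η : GConf d) :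
    |tiltF G Δ y v η| ≤ exp (eBound G) := by
  rw [abs_of_pos (show 0 < tiltF G Δ y v η from exp_pos _)]; exact tiltF_le G Δ y v η

lemma exp_le_gibbsExp_tiltF (Δ Δ' : ℱ[d]) (ξ : GConf d) (y : ZLat d) (v : Bool) :
    exp (-eBound G) ≤ 𝔼[G] Δ' ξ (tiltF G Δ y v) := by
  rw [← gibbsExp_const (gasPotH G) Δ' ξ (exp _)]
  exact gibbsExp_mono _ _ _ _ _ fun η _ => le_tiltF G Δ y v η

lemma localOn_update {f : GConf d → ℝ} {T : ℱ[d]} (hf : LocalOn f T) {y : ZLat d}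
    (hy : y ∉ T) (η : GConf d) (v : Bool) : f (update η y v) = f η :=
  hf _ _ fun x hx => update_of_ne (ne_of_mem_of_not_mem hx hy) _ _

/-- Weak dependence of expectations on the boundary condition. -/
theorem exists_bc_influence {ℓ0 : ℕ} {b B : ℝ} (hb : 0 < b) (hB : 0 < B)
    (hSM : SM (gasPotH G) ℓ0 b B) :
    ∃ C : ℝ, 0 ≤ C ∧ ∀ (Δ : ℱ[d]), Reg ℓ0 Δ → ∀ (f : GConf d → ℝ)
      (T Y : ℱ[d]) (F : ℝ) (ξ ξ' : GConf d), LocalOn f T → (∀ η, |f η| ≤ F) →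
      Disjoint T Y → AgreeOff Y ξ ξ' →
      |𝔼[G] Δ ξ' f - 𝔼[G] Δ ξ f| ≤ C * F * Jsum b T Y := by
  set N : ℝ := (2 * G.r + 1) ^ d with hN
  set E := exp (eBound G) with hE
  have hE0 : 0 < E := exp_pos _
  set C := E * ((B + 2) * E * N * (N * exp (b * G.r))) with hC
  have hC0 : 0 ≤ C := by positivity
  refine ⟨C, hC0, ?_⟩
  intro Δ hΔ f T Y F ξ ξ' hf hF
  have hF0 : 0 ≤ F := (abs_nonneg _).trans (hF ξ)
  revert ξ ξ'
  induction Y using induction_on with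
  | empty =>
    intro ξ ξ' _ h
    rw [show ξ' = ξ from funext fun x => h x (notMem_empty x), sub_self, abs_zero]
    exact mul_nonneg (mul_nonneg hC0 hF0) (Jsum_nonneg _ _ _)
  | insert y Y hy ih =>
    intro ξ ξ' hdis h
    have hyT : y ∉ T := fun h1 => disjoint_left.1 hdis h1 (mem_insert_self _ _)
    set ζ := update ξ' y (ξ y) with hζ
    have h1 : AgreeOff Y ξ ζ := by
      intro x hx
      by_cases hxy : x = y
      · subst hxy; simp [hζ]
      · rw [hζ, update_of_ne hxy]
        exact h x (by simp [hxy, hx])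
    have h2 := ih ξ ζ (disjoint_of_subset_right (subset_insert _ _) hdis) h1
    have h3 : |𝔼[G] Δ ξ' f - 𝔼[G] Δ ζ f| ≤
        C * F * Jsum b T {y} := by
      have h4 : AgreeOff {y} ζ ξ' := agreeOff_symm (agreeOff_update _ _ _)
      by_cases hyΔ : y ∈ Δ
      · rw [gibbsExp_congr_bc (gasPotH G) Δ ζ ξ' _ f, sub_self, abs_zero]
        · exact mul_nonneg (mul_nonneg hC0 hF0) (Jsum_nonneg _ _ _)
        · intro x hx
          exact h4 x (fun h => hx (by rw [mem_singleton.1 h]; exact hyΔ))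
      · rw [gibbsExp_tilt G Δ y hyΔ ζ ξ' f (fun η _ => localOn_update hf hyT η _) h4]
        have hc := SM.cov_le G hB hSM Δ hΔ ζ f (tiltF G Δ y (ξ' y)) T (box y G.r) hf
          (tiltF_local G Δ y _) F E hF (abs_tiltF_le G Δ y _)
        have hpos := exp_le_gibbsExp_tiltF G Δ Δ ζ y (ξ' y)
        have hpos' : 0 < 𝔼[G] Δ ζ (tiltF G Δ y (ξ' y)) :=
          (exp_pos _).trans_le hpos
        change |𝔼[G] Δ ζ (fun η => f η * tiltF G Δ y (ξ' y) η) /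
          𝔼[G] Δ ζ (tiltF G Δ y (ξ' y)) - 𝔼[G] Δ ζ f| ≤ _
        rw [div_sub' hpos'.ne', abs_div, abs_of_pos hpos', div_le_iff₀ hpos',
          mul_comm (𝔼[G] Δ ζ (tiltF G Δ y (ξ' y)))]
        refine hc.trans ?_
        have hJ := Jsum_box_le b hb T y G.r
        have hJ0 := Jsum_nonneg b T {y}
        calc (B + 2) * F * E * (box y G.r).card * Jsum b T (box y G.r)
            ≤ (B + 2) * F * E * N * (N * exp (b * G.r) * Jsum b T {y}) := by
              rw [card_box]
              push_cast
              exact mul_le_mul_of_nonneg_left hJ (by positivity)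
          _ = C * F * Jsum b T {y} * E⁻¹ := by
              rw [hC]; field_simp
          _ ≤ _ := by
              rw [hE, ← Real.exp_neg]
              exact mul_le_mul_of_nonneg_left hpos (by positivity)
    rw [Jsum_insert b T Y y hy]
    have := abs_sub_le (𝔼[G] Δ ξ' f) (𝔼[G] Δ ζ f)
      (𝔼[G] Δ ξ f)
    linarith

/-- Multiplicative weak dependence on the boundary condition. -/
theorem exists_bc_ratio {ℓ0 : ℕ} {b B : ℝ} (hb : 0 < b) (hB : 0 < B)
    (hSM : SM (gasPotH G) ℓ0 b B) :
    ∃ C : ℝ, 0 ≤ C ∧ ∀ (Δ S : ℱ[d]), Reg ℓ0 (Δ \ S) → S ⊆ Δ → ∀ (f : GConf d → ℝ)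
      (Y : ℱ[d]) (ξ ξ' : GConf d), LocalOn f S → (∀ η, 0 ≤ f η) →
      Disjoint Δ Y → AgreeOff Y ξ ξ' →
      (1 - C * Jsum b S Y) * 𝔼[G] Δ ξ f ≤ 𝔼[G] Δ ξ' f := by
  obtain ⟨C1, hC1, hinf⟩ := exists_bc_influence G hb hB hSM
  set N : ℝ := (2 * G.r + 1) ^ d with hN
  set E := exp (eBound G) with hE
  have hE0 : 0 < E := exp_pos _
  set C := exp (b * G.r) + E * (C1 * E * (N * exp (b * G.r))) with hC
  have hC0 : 0 ≤ C := by positivity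
  refine ⟨C, hC0, ?_⟩
  intro Δ S hreg hSΔ f Y ξ ξ' hf hf0
  revert ξ ξ'
  induction Y using induction_on with
  | empty =>
    intro ξ ξ' _ h
    rw [show ξ' = ξ from funext fun x => h x (notMem_empty x)]
    simp [Jsum]
  | insert y Y hy ih =>
    intro ξ ξ' hdis h
    have hyΔ : y ∉ Δ := fun h1 => disjoint_left.1 hdis h1 (mem_insert_self _ _)
    have hyS : y ∉ S := fun h => hyΔ (hSΔ h)
    set ζ := update ξ' y (ξ y) with hζ
    have h1 : AgreeOff Y ξ ζ := by
      intro x hx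
      by_cases hxy : x = y
      · subst hxy; simp [hζ]
      · rw [hζ, update_of_ne hxy]
        exact h x (by simp [hxy, hx])
    have h2 := ih ξ ζ (disjoint_of_subset_right (subset_insert _ _) hdis) h1
    have hEf := gibbsExp_nonneg (gasPotH G) Δ ζ f hf0
    have hEf1 := gibbsExp_nonneg (gasPotH G) Δ ξ f hf0
    have hEf' := gibbsExp_nonneg (gasPotH G) Δ ξ' f hf0
    have hJy := Jsum_nonneg b S {y}
    have hJY := Jsum_nonneg b S Y
    have h3 : (1 - C * Jsum b S {y}) * 𝔼[G] Δ ζ f ≤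
        𝔼[G] Δ ξ' f := by
      by_cases hnear : ∃ x ∈ S, supD x y ≤ G.r
      · obtain ⟨x, hx, hxy⟩ := hnear
        refine le_trans (mul_nonpos_of_nonpos_of_nonneg ?_ hEf) hEf'
        have h5 : exp (-b * G.r) ≤ Jsum b S {y} := by
          unfold Jsum
          simp only [sum_singleton]
          refine le_trans ?_ (single_le_sum (f := fun x => exp (-b * supD x y))
            (fun _ _ => (exp_pos _).le) hx)
          refine exp_le_exp.2 ?_
          have : (supD x y : ℝ) ≤ G.r := by exact_mod_cast hxy
          nlinarith
        have h6 : exp (b * G.r) * exp (-b * G.r) = 1 := by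
          rw [← exp_add]; simp
        have h7 : exp (b * G.r) * exp (-b * G.r) ≤ C * Jsum b S {y} :=
          mul_le_mul (by
            have h8 : 0 ≤ E * (C1 * E * (N * exp (b * G.r))) := by positivity
            rw [hC]; linarith) h5 (exp_pos _).le hC0
        linarith
      · push Not at hnear
        have h4 : AgreeOff {y} ζ ξ' := agreeOff_symm (agreeOff_update _ _ _)
        rw [gibbsExp_tilt G Δ y hyΔ ζ ξ' f (fun η _ => localOn_update hf hyS η _) h4]
        set g := tiltF G Δ y (ξ' y) with hg
        have hpos := exp_le_gibbsExp_tiltF G Δ Δ ζ y (ξ' y)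
        have hpos' : 0 < 𝔼[G] Δ ζ g := (exp_pos _).trans_le hpos
        change _ ≤ 𝔼[G] Δ ζ (fun η => f η * g η) / 𝔼[G] Δ ζ g
        rw [le_div_iff₀ hpos']
        set δ := C1 * E * Jsum b (box y G.r) S with hδ
        have hdisj : Disjoint (box y G.r) S := by
          rw [disjoint_left]
          intro x hx hxS
          rw [mem_box, supD_comm] at hx
          exact absurd hx (not_le.2 (hnear x hxS))
        have hosc : ∀ η η', AgreeOff Δ ζ η → AgreeOff Δ ζ η' →
            𝔼[G] (Δ \ S) η' g - δ ≤ 𝔼[G] (Δ \ S) η g := by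
          intro η η' hη hη'
          set ω : GConf d := fun x => if x ∈ S then η x else η' x with hω
          have ha : 𝔼[G] (Δ \ S) η g = 𝔼[G] (Δ \ S) ω g := by
            refine (gibbsExp_congr_bc _ _ _ _ (fun x hx => ?_) _).symm
            simp only [hω]
            split_ifs with hxS
            · rfl
            · have hxΔ : x ∉ Δ := fun h => hx (mem_sdiff.2 ⟨h, hxS⟩)
              rw [hη x hxΔ, hη' x hxΔ]
          have hb' := hinf (Δ \ S) hreg g (box y G.r) S E ω η' (tiltF_local G Δ y _)
            (abs_tiltF_le G Δ y _) hdisj (fun x hx => by simp [hω, hx])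
          have := (abs_le.1 hb').2
          rw [ha]; linarith
        have hlow : ∀ η, AgreeOff Δ ζ η → 𝔼[G] Δ ζ g - δ ≤
            𝔼[G] (Δ \ S) η g := by
          intro η hη
          rw [← gibbsExp_gibbsExp G Δ (Δ \ S) sdiff_subset ζ g]
          rw [sub_le_iff_le_add, ← gibbsExp_const (gasPotH G) Δ ζ
            (𝔼[G] (Δ \ S) η g + δ)]
          refine gibbsExp_mono _ _ _ _ _ fun η' hη' => ?_
          have := hosc η η' hη hη'
          linarith
        have hfg : (𝔼[G] Δ ζ g - δ) * 𝔼[G] Δ ζ f ≤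
            𝔼[G] Δ ζ (fun η => f η * g η) := by
          rw [← gibbsExp_mul_gibbsExp G Δ (Δ \ S) sdiff_subset ζ f g]
          · rw [← gibbsExp_const_mul]
            refine gibbsExp_mono _ _ _ _ _ fun η hη => ?_
            rw [mul_comm]
            exact mul_le_mul_of_nonneg_left (hlow η hη) (hf0 η)
          · intro η η' hη
            refine hf _ _ fun x hx => hη x ?_
            simp [hx]
        refine le_trans ?_ hfg
        have hδle : δ ≤ C * Jsum b S {y} * 𝔼[G] Δ ζ g := by
          have hJ := Jsum_box_le b hb S y G.r
          calc δ ≤ C1 * E * (N * exp (b * G.r) * Jsum b S {y}) := by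
                rw [hδ, Jsum_comm]
                exact mul_le_mul_of_nonneg_left hJ (by positivity)
            _ = E * (C1 * E * (N * exp (b * G.r))) * Jsum b S {y} * E⁻¹ := by
                field_simp
            _ ≤ _ := by
                refine mul_le_mul ?_ (by rw [hE, ← Real.exp_neg]; exact hpos) (by positivity)
                  (by positivity)
                refine mul_le_mul_of_nonneg_right ?_ hJy
                rw [hC]; linarith [exp_pos (b * G.r)]
        nlinarith
    rw [Jsum_insert b S Y y hy]
    by_cases hneg : 1 - C * Jsum b S {y} ≤ 0
    · refine le_trans (mul_nonpos_of_nonpos_of_nonneg ?_ hEf1) hEf'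
      nlinarith [mul_nonneg hC0 hJY]
    · push Not at hneg
      have h5 := mul_le_mul_of_nonneg_left h2 hneg.le
      refine le_trans ?_ (h5.trans h3)
      have h6 := mul_nonneg (mul_nonneg (mul_nonneg hC0 hJy) (mul_nonneg hC0 hJY)) hEf1
      nlinarith

/-- The variance of the number of particles in `T` is at most proportional to `|T|`. -/
theorem SM.var_le {ℓ0 : ℕ} {b B : ℝ} (hb : 0 < b) (hB : 0 < B) (hSM : SM (gasPotH G) ℓ0 b B)
    (Δ : ℱ[d]) (hΔ : Reg ℓ0 Δ) (τ : GConf d) (T : ℱ[d]) :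
    𝔼[G] Δ τ (fun η => (∑ x ∈ T, occ x η -
        𝔼[G] Δ τ (fun η => ∑ x ∈ T, occ x η)) ^ 2) ≤
      (B + 2) * expConst d b * T.card := by
  set m := 𝔼[G] Δ τ (fun η => ∑ x ∈ T, occ x η) with hm
  have h1 : 𝔼[G] Δ τ (fun η => (∑ x ∈ T, occ x η - m) ^ 2) =
      𝔼[G] Δ τ (fun η => ∑ x ∈ T, ∑ y ∈ T, occ x η * occ y η) - m * m := by
    have : (fun η : GConf d => (∑ x ∈ T, occ x η - m) ^ 2) = fun η =>
        ((∑ x ∈ T, ∑ y ∈ T, occ x η * occ y η) - (2 * m) * ∑ x ∈ T, occ x η) + m * m := by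
      funext η
      rw [← sum_mul_sum]; ring
    rw [this, gibbsExp_add, gibbsExp_sub, gibbsExp_const_mul, gibbsExp_const, ← hm]; ring
  rw [h1, gibbsExp_sum]
  simp only [gibbsExp_sum]
  rw [hm, gibbsExp_sum, sum_mul_sum, ← sum_sub_distrib]
  calc _ ≤ ∑ x ∈ T, (B + 2) * expConst d b := by
        refine sum_le_sum fun x _ => ?_
        rw [← sum_sub_distrib]
        have hb1 := sum_exp_le b hb x T
        refine le_trans ?_ (mul_le_mul_of_nonneg_left hb1 (by linarith))
        rw [mul_sum]
        refine sum_le_sum fun y _ => (le_abs_self _).trans ?_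
        have hocc : ∀ x : ZLat d, ∀ η, |occ x η| ≤ 1 := by
          intro x η; unfold occ; split_ifs <;> simp
        have hloc : ∀ x : ZLat d, LocalOn (occ x) {x} := by
          intro x σ τ h; unfold occ; rw [h x (mem_singleton_self _)]
        refine (SM.cov_le G hB hSM Δ hΔ τ _ _ _ _ (hloc x) (hloc y) 1 1 (hocc x)
          (hocc y)).trans (le_of_eq ?_)
        simp [Jsum]
    _ = _ := by rw [sum_const, nsmul_eq_mul]; ring

end mixing

section singleSite

variable {d : ℕ} (G : LatticeGas d)

lemma cfgSum_singleton (x : ZLat d) (τ : GConf d) (f : GConf d → ℝ) :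
    cfgSum {x} τ f = f (update τ x true) + f (update τ x false) := by
  have h : ∀ s : ↥({x} : ℱ[d]) → Bool, override {x} s τ =
      update τ x (s ⟨x, mem_singleton_self x⟩) := by
    intro s; funext y
    by_cases hy : y = x
    · subst hy; simp [override]
    · simp [override, hy]
  have : Unique ↥({x} : ℱ[d]) :=
    ⟨⟨⟨x, mem_singleton_self x⟩⟩, fun y => Subtype.ext (mem_singleton.1 y.2)⟩
  unfold cfgSum
  simp only [h]
  rw [Fintype.sum_equiv (Equiv.funUnique ↥({x} : ℱ[d]) Bool)
    (fun s => f (update τ x (s ⟨x, mem_singleton_self x⟩)))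
    (fun v => f (update τ x v)) fun s =>
      congrArg f (congrArg _ (congrArg s (Subsingleton.elim _ _)))]
  simp

/-- Lower bound for the conditional single-site probabilities. -/
def pMin : ℝ := exp (-eBound G) / 2

lemma pMin_pos : 0 < pMin G := by unfold pMin; positivity

lemma pMin_le_one : pMin G ≤ 1 := by
  have := Real.exp_le_one_iff.2 (neg_nonpos.2 (eBound_nonneg G))
  unfold pMin; linarith

lemma pMin_le_site (x : ZLat d) (τ : GConf d) (v : Bool) :
    pMin G ≤ 𝔼[G] {x} τ fun η => if η x = v then 1 else 0 := by
  rw [gibbsExp_eq, le_div_iff₀ (partFun_pos _ _ _), partFun_eq, cfgSum_singleton,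
    cfgSum_singleton]
  have key : ∀ u w : Bool, exp (-eBound G) *
      exp (hamil (gasPotH G) {x} (update τ x u)) ≤
      exp (hamil (gasPotH G) {x} (update τ x w)) := by
    intro u w
    rw [← exp_add]
    refine exp_le_exp.2 ?_
    have := (abs_le.1 (abs_hamil_sub_le G {x} x (update τ x w) (update τ x u)
      fun y hy => by
        have : y ≠ x := by simpa using hy
        rw [update_of_ne this, update_of_ne this])).1
    linarith
  have h1 := key true v
  have h2 := key false v
  unfold pMin
  cases v <;> simp <;> linarith

lemma pMin_pow_le (Q : ℱ[d]) (τ σ : GConf d) :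
    pMin G ^ Q.card ≤ 𝔼[G] Q τ fun η => if ∀ x ∈ Q, η x = σ x then 1 else 0 := by
  induction Q using induction_on generalizing τ with
  | empty =>
    simp only [notMem_empty, false_imp_iff, implies_true, if_true, gibbsExp_const]
    simp
  | insert y Q hy ih =>
    have h1 : 𝔼[G] (insert y Q) τ
        (fun η => if ∀ x ∈ insert y Q, η x = σ x then (1 : ℝ) else 0) =
        𝔼[G] (insert y Q) τ (fun η => (if η y = σ y then (1 : ℝ) else 0) *
          (if ∀ x ∈ Q, η x = σ x then (1 : ℝ) else 0)) := by
      congr 1; funext η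
      simp only [Finset.forall_mem_insert]
      by_cases h1 : η y = σ y <;> simp [h1]
    rw [h1, ← gibbsExp_mul_gibbsExp G _ Q (subset_insert _ _)]
    · rw [Finset.card_insert_of_notMem hy, pow_succ]
      calc _ ≤ pMin G ^ Q.card * 𝔼[G] (insert y Q) τ
            (fun η => if η y = σ y then (1 : ℝ) else 0) := by
            refine mul_le_mul_of_nonneg_left ?_ (pow_nonneg (pMin_pos G).le _)
            rw [← gibbsExp_gibbsExp G (insert y Q) {y} (by simp),
              ← gibbsExp_const (gasPotH G) (insert y Q) τ (pMin G)]
            exact gibbsExp_mono _ _ _ _ _ fun η _ => pMin_le_site G y η (σ y)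
        _ ≤ _ := by
            rw [← gibbsExp_const_mul]
            refine gibbsExp_mono _ _ _ _ _ fun η _ => ?_
            rw [mul_comm]
            refine mul_le_mul_of_nonneg_left (ih η) ?_
            split_ifs <;> norm_num
    · intro η ζ h
      rw [h y hy]

end singleSite

section stein

variable {d : ℕ} (G : LatticeGas d)

/-- `h` does not depend on the configuration in `T`. -/
def InvOn (T : ℱ[d]) (h : GConf d → ℝ) : Prop := ∀ η ζ, AgreeOff T η ζ → h ζ = h η

lemma InvOn.mono {T T' : ℱ[d]} {h : GConf d → ℝ} (hh : InvOn T h) (hT : T' ⊆ T) :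
    InvOn T' h := fun η ζ hηζ => hh η ζ fun x hx => hηζ x fun h' => hx (hT h')

/-- The conditional probability of an occupied site. -/
def pS (x : ZLat d) (η : GConf d) : ℝ := 𝔼[G] {x} η (occ x)

/-- The centered occupation number. -/
def zS (x : ZLat d) (η : GConf d) : ℝ := occ x η - pS G x η

lemma pS_le (x : ZLat d) (η : GConf d) : pMin G ≤ pS G x η ∧ pS G x η ≤ 1 - pMin G := by
  constructor
  · refine (pMin_le_site G x η true).trans (le_of_eq ?_)
    unfold pS; congr 1
  · have h := pMin_le_site G x η false
    have h1 : 𝔼[G] {x} η (fun ζ => if ζ x = false then (1 : ℝ) else 0) =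
        1 - pS G x η := by
      unfold pS
      rw [← gibbsExp_const (gasPotH G) {x} η 1, ← gibbsExp_sub, gibbsExp_const]
      congr 1; funext ζ; unfold occ
      cases ζ x <;> simp
    linarith

lemma pS_inv (T : ℱ[d]) (hT : ∀ x ∈ T, ∀ y ∈ T, x ≠ y → G.r < supD x y)
    (x : ZLat d) (hx : x ∈ T) : InvOn T (pS G x) := by
  intro η ζ h
  unfold pS
  refine gibbsExp_congr_near G {x} _ _ _ (fun s => ?_) fun z hz y hy hzy => ?_
  · simp [occ, override]
  · rw [mem_singleton] at hz hy
    subst hz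
    refine h y fun hyT => ?_
    exact absurd (hT z hx y hyT (Ne.symm hy)) (not_lt.2 hzy)

variable (Δ : ℱ[d]) (τ : GConf d)

lemma gibbsExp_mul_zS (x : ZLat d) (hx : x ∈ Δ) (h : GConf d → ℝ) (hh : InvOn {x} h) :
    𝔼[G] Δ τ (fun η => h η * zS G x η) = 0 := by
  have h1 := gibbsExp_mul_gibbsExp G Δ {x} (by simpa using hx) τ h (occ x) hh
  have h2 : (fun η => h η * zS G x η) = fun η => h η * occ x η -
      h η * 𝔼[G] {x} η (occ x) := by
    funext η; unfold zS pS; ring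
  rw [h2, gibbsExp_sub, h1, sub_self]

/-- The conditional variance of the bath. -/
def thS (T : ℱ[d]) (η : GConf d) : ℝ := ∑ x ∈ T, pS G x η * (1 - pS G x η)

lemma thS_inv (T : ℱ[d]) (hT : ∀ x ∈ T, ∀ y ∈ T, x ≠ y → G.r < supD x y)
    (T' : ℱ[d]) (hT' : T' ⊆ T) : InvOn T (thS G T') := by
  intro η ζ h
  unfold thS
  exact sum_congr rfl fun x hx => by rw [pS_inv G T hT x (hT' hx) η ζ h]

lemma le_thS (T : ℱ[d]) (η : GConf d) : T.card * pMin G ^ 2 ≤ thS G T η := by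
  unfold thS
  rw [← nsmul_eq_mul, ← sum_const]
  refine sum_le_sum fun x _ => ?_
  have h := pS_le G x η
  have := pMin_pos G
  nlinarith

lemma zS_sq (x : ZLat d) (η : GConf d) :
    zS G x η ^ 2 = pS G x η * (1 - pS G x η) + (1 - 2 * pS G x η) * zS G x η := by
  unfold zS occ
  split_ifs <;> ring

lemma gibbsExp_bath_sq (T : ℱ[d]) (hTΔ : T ⊆ Δ)
    (hT : ∀ x ∈ T, ∀ y ∈ T, x ≠ y → G.r < supD x y) (ω : GConf d → ℝ) (hω : InvOn T ω)
    (hω0 : ∀ η, 0 ≤ ω η) (c : ZLat d → GConf d → ℝ) (hc : ∀ x ∈ T, InvOn T (c x))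
    (hc1 : ∀ x η, |c x η| ≤ 1) :
    𝔼[G] Δ τ (fun η => ω η * (∑ x ∈ T, c x η * zS G x η) ^ 2) ≤
      𝔼[G] Δ τ (fun η => ω η * thS G T η) := by
  have h1 : (fun η => ω η * (∑ x ∈ T, c x η * zS G x η) ^ 2) = fun η =>
      ∑ x ∈ T, ∑ y ∈ T, ω η * (c x η * zS G x η * (c y η * zS G y η)) := by
    funext η
    rw [sq, sum_mul_sum, mul_sum]
    exact sum_congr rfl fun x _ => by rw [mul_sum]
  rw [h1, gibbsExp_sum]
  simp only [gibbsExp_sum, thS, mul_sum]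
  refine sum_le_sum fun x hx => ?_
  have hpx := pS_inv G T hT x hx
  have hsing : ({x} : ℱ[d]) ⊆ T := by simpa using hx
  rw [sum_eq_single x]
  · have h2 : (fun η => ω η * (c x η * zS G x η * (c x η * zS G x η))) = fun η =>
        ω η * (c x η ^ 2 * (pS G x η * (1 - pS G x η))) +
          (ω η * c x η ^ 2 * (1 - 2 * pS G x η)) * zS G x η := by
      funext η
      have := zS_sq G x η
      calc _ = ω η * c x η ^ 2 * zS G x η ^ 2 := by ring
        _ = _ := by rw [this]; ring
    rw [h2, gibbsExp_add, gibbsExp_mul_zS G Δ τ x (hTΔ hx), add_zero]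
    · refine gibbsExp_mono _ _ _ _ _ fun η _ => mul_le_mul_of_nonneg_left ?_ (hω0 η)
      have h3 := pS_le G x η
      have h4 := pMin_pos G
      have h5 : c x η ^ 2 ≤ 1 := by
        have := hc1 x η
        rw [← sq_abs]; nlinarith [abs_nonneg (c x η)]
      have h6 : 0 ≤ pS G x η * (1 - pS G x η) := mul_nonneg (by linarith) (by linarith)
      nlinarith
    · intro η ζ h
      have h' : AgreeOff T η ζ := fun y hy => h y fun hy' => hy (hsing hy')
      simp only [hω η ζ h', hc x hx η ζ h', hpx η ζ h']
  · intro y hy hyx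
    have h2 : (fun η => ω η * (c x η * zS G x η * (c y η * zS G y η))) = fun η =>
        (ω η * (c x η * (c y η * zS G y η))) * zS G x η := by
      funext η; ring
    rw [h2]
    refine gibbsExp_mul_zS G Δ τ x (hTΔ hx) _ fun η ζ h => ?_
    have h' : AgreeOff T η ζ := fun y hy => h y fun hy' => hy (hsing hy')
    have h3 : zS G y ζ = zS G y η := by
      unfold zS occ
      rw [pS_inv G T hT y hy η ζ h', h y (by simpa using hyx)]
    simp only [hω η ζ h', hc x hx η ζ h', hc y hy η ζ h', h3]
  · intro h; exact absurd hx h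

/-- The counting property: adding a particle in `T` increases `N` by one. -/
def Counts (T : ℱ[d]) (N : GConf d → ℕ) : Prop :=
  ∀ x ∈ T, ∀ η, N (update η x true) = N (update η x false) + 1

lemma stein_identity (T : ℱ[d]) (hTΔ : T ⊆ Δ)
    (hT : ∀ x ∈ T, ∀ y ∈ T, x ≠ y → G.r < supD x y) (ω : GConf d → ℝ) (hω : InvOn T ω)
    (N : GConf d → ℕ) (hN : Counts T N) (H : ℕ → ℝ) :
    𝔼[G] Δ τ (fun η => ω η * thS G T η * (H (N η + 1) - H (N η))) =
      𝔼[G] Δ τ (fun η => ω η * (∑ x ∈ T, (1 - pS G x η) * zS G x η) * H (N η)) +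
      𝔼[G] Δ τ (fun η => ω η * (∑ x ∈ T, pS G x η * zS G x η) *
        H (N η + 1)) := by
  have h0 : ∀ x ∈ T, 𝔼[G] Δ τ (fun η =>
      (ω η * H (N (update η x true))) * zS G x η) = 0 := by
    intro x hx
    refine gibbsExp_mul_zS G Δ τ x (hTΔ hx) _ fun η ζ h => ?_
    have h1 : update ζ x true = update η x true := by
      funext y
      by_cases hy : y = x
      · subst hy; simp
      · rw [update_of_ne hy, update_of_ne hy, h y (by simpa using hy)]
    have h' : AgreeOff T η ζ := fun y hy => h y fun hy' => hy (by
      rw [mem_singleton.1 hy']; exact hx)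
    simp only [h1, hω η ζ h']
  have h1 := sum_congr (rfl : T = T) h0
  rw [← gibbsExp_sum, Finset.sum_const_zero] at h1
  rw [← gibbsExp_add, ← sub_eq_zero, ← gibbsExp_sub, ← neg_eq_zero, ← h1, ← neg_one_mul,
    ← gibbsExp_const_mul (gasPotH G) Δ τ (-1)]
  congr 1; funext η
  unfold thS
  rw [mul_sum, mul_sum, mul_sum, sum_mul, sum_mul,
    sum_mul, ← sum_add_distrib, ← sum_sub_distrib, mul_sum]
  refine sum_congr rfl fun x hx => ?_
  have hc := hN x hx η
  by_cases hηx : η x = true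
  · have e1 : update η x true = η := by rw [← hηx, update_eq_self]
    rw [e1]
    unfold zS occ
    rw [if_pos hηx]; ring
  · have hf : η x = false := by simpa using hηx
    have e1 : update η x false = η := by rw [← hf, update_eq_self]
    rw [hc, e1]
    unfold zS occ
    rw [if_neg hηx]; ring

/-- Smoothing by the bath, first order. -/
theorem bath_first (T : ℱ[d]) (hTΔ : T ⊆ Δ)
    (hT : ∀ x ∈ T, ∀ y ∈ T, x ≠ y → G.r < supD x y) (ω : GConf d → ℝ) (hω : InvOn T ω)
    (N : GConf d → ℕ) (hN : Counts T N) (H : ℕ → ℝ) (M : ℝ) (hM : ∀ n, |H n| ≤ M)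
    (Θ : ℝ) (hΘ : 0 < Θ) (hΘT : Θ ≤ T.card * pMin G ^ 2) :
    |𝔼[G] Δ τ (fun η => ω η * (H (N η + 1) - H (N η)))| ≤
      2 * M / sqrt Θ * 𝔼[G] Δ τ (fun η => |ω η|) := by
  have hM0 : 0 ≤ M := (abs_nonneg _).trans (hM 0)
  have hth : ∀ η, Θ ≤ thS G T η := fun η => hΘT.trans (le_thS G T η)
  have hth0 : ∀ η, 0 < thS G T η := fun η => hΘ.trans_le (hth η)
  have hthi := thS_inv G T hT T subset_rfl
  have hω' : InvOn T fun η => ω η / thS G T η := fun η ζ h => by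
    simp only [hω η ζ h, hthi η ζ h]
  have hst := stein_identity G Δ τ T hTΔ hT (fun η => ω η / thS G T η) hω' N hN H
  have e0 : (fun η => ω η / thS G T η * thS G T η * (H (N η + 1) - H (N η))) = fun η =>
      ω η * (H (N η + 1) - H (N η)) := by
    funext η; rw [div_mul_cancel₀ _ (hth0 η).ne']
  rw [e0] at hst
  rw [hst]
  set Ew := 𝔼[G] Δ τ (fun η => |ω η|) with hEw
  have hEw0 : 0 ≤ Ew := gibbsExp_nonneg _ _ _ _ fun _ => abs_nonneg _
  have part : ∀ (c : ZLat d → GConf d → ℝ) (K : GConf d → ℝ), (∀ x ∈ T, InvOn T (c x)) →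
      (∀ x η, |c x η| ≤ 1) → (∀ η, |K η| ≤ M) →
      |𝔼[G] Δ τ (fun η => ω η / thS G T η * (∑ x ∈ T, c x η * zS G x η) * K η)| ≤
        M / sqrt Θ * Ew := by
    intro c K hc hc1 hK
    have h1 : |𝔼[G] Δ τ (fun η => ω η / thS G T η *
        (∑ x ∈ T, c x η * zS G x η) * K η)| ≤ M * 𝔼[G] Δ τ (fun η =>
          sqrt |ω η| * (sqrt |ω η| / thS G T η * |∑ x ∈ T, c x η * zS G x η|)) := by
      refine (abs_gibbsExp_le_abs _ _ _ _).trans ?_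
      rw [← gibbsExp_const_mul]
      refine gibbsExp_mono _ _ _ _ _ fun η _ => ?_
      rw [abs_mul, abs_mul, abs_div, abs_of_pos (hth0 η), mul_comm]
      refine (mul_le_mul_of_nonneg_right (hK η) (mul_nonneg (div_nonneg (abs_nonneg _)
        (hth0 η).le) (abs_nonneg _))).trans (le_of_eq ?_)
      nth_rewrite 1 [← mul_self_sqrt (abs_nonneg (ω η))]
      ring
    have h2 := gibbsExp_mul_sq_le (gasPotH G) Δ τ (fun η => sqrt |ω η|) (fun η =>
      sqrt |ω η| / thS G T η * |∑ x ∈ T, c x η * zS G x η|)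
    have h3 : 𝔼[G] Δ τ (fun η => (sqrt |ω η| / thS G T η *
        |∑ x ∈ T, c x η * zS G x η|) ^ 2) ≤ Ew / Θ := by
      have h4 := gibbsExp_bath_sq G Δ τ T hTΔ hT (fun η => |ω η| / thS G T η ^ 2)
        (fun η ζ h => by simp only [hω η ζ h, hthi η ζ h])
        (fun η => div_nonneg (abs_nonneg _) (sq_nonneg _)) c hc hc1
      refine le_trans (le_of_eq ?_) (h4.trans ?_)
      · congr 1; funext η
        rw [mul_pow, div_pow, sq_abs, sq_sqrt (abs_nonneg _)]
      · rw [hEw, div_eq_inv_mul, ← gibbsExp_const_mul]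
        refine gibbsExp_mono _ _ _ _ _ fun η _ => ?_
        have := hth0 η
        have e : |ω η| / thS G T η ^ 2 * thS G T η = (thS G T η)⁻¹ * |ω η| := by
          field_simp
        rw [e]
        exact mul_le_mul_of_nonneg_right (inv_anti₀ hΘ (hth η)) (abs_nonneg _)
    simp only [sq_sqrt (abs_nonneg _)] at h2
    have h5 := h2.trans (mul_le_mul_of_nonneg_left h3 hEw0)
    have h6 : Ew * (Ew / Θ) = (Ew / sqrt Θ) ^ 2 := by
      rw [div_pow, sq_sqrt hΘ.le]; ring
    rw [h6] at h5
    have h7 := abs_le_of_sq_le_sq h5 (by positivity)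
    refine h1.trans ?_
    rw [div_mul_eq_mul_div, mul_div_assoc]
    exact mul_le_mul_of_nonneg_left ((le_abs_self _).trans h7) hM0
  have hp : ∀ x η, |pS G x η| ≤ 1 ∧ |1 - pS G x η| ≤ 1 := by
    intro x η
    have := pS_le G x η
    have := pMin_pos G
    constructor <;> rw [abs_le] <;> constructor <;> linarith
  have hA := part (fun x η => 1 - pS G x η) (fun η => H (N η))
    (fun x hx η ζ h => by simp only [pS_inv G T hT x hx η ζ h]) (fun x η => (hp x η).2)
    fun η => hM _
  have hB := part (pS G) (fun η => H (N η + 1)) (fun x hx => pS_inv G T hT x hx)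
    (fun x η => (hp x η).1) fun η => hM _
  refine (abs_add_le _ _).trans ((add_le_add hA hB).trans (le_of_eq ?_))
  ring

/-- Smoothing by the bath, second order. -/
theorem bath_second (T₁ T₂ : ℱ[d]) (hTΔ : T₁ ∪ T₂ ⊆ Δ) (hdis : Disjoint T₁ T₂)
    (hT : ∀ x ∈ T₁ ∪ T₂, ∀ y ∈ T₁ ∪ T₂, x ≠ y → G.r < supD x y)
    (N : GConf d → ℕ) (hN : Counts (T₁ ∪ T₂) N) (Θ : ℝ) (hΘ : 0 < Θ)
    (hΘ1 : Θ ≤ T₁.card * pMin G ^ 2) (hΘ2 : Θ ≤ T₂.card * pMin G ^ 2) (k : ℕ) :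
    |𝔼[G] Δ τ (fun η => if N η = k + 1 then 1 else 0) -
      𝔼[G] Δ τ 𝟙[N, k]| ≤ 4 / Θ := by
  set F : ℕ → ℝ := fun n => if n = k + 1 then 1 else 0 with hF
  set H : ℕ → ℝ := fun n => if n ≤ k + 1 then 1 else 0 with hH
  have hHF : ∀ n, H (n + 1) - H n = -F n := by
    intro n
    simp only [hH, hF]
    rcases lt_trichotomy n (k + 1) with h | h | h
    · rw [if_pos (by omega), if_pos (by omega), if_neg (by omega)]; norm_num
    · rw [if_neg (by omega), if_pos (by omega), if_pos (by omega)]; norm_num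
    · rw [if_neg (by omega), if_neg (by omega), if_neg (by omega)]; norm_num
  have hT1 : ∀ x ∈ T₁, ∀ y ∈ T₁, x ≠ y → G.r < supD x y := fun x hx y hy =>
    hT x (mem_union_left _ hx) y (mem_union_left _ hy)
  have hT2 : ∀ x ∈ T₂, ∀ y ∈ T₂, x ≠ y → G.r < supD x y := fun x hx y hy =>
    hT x (mem_union_right _ hx) y (mem_union_right _ hy)
  have hN1 : Counts T₁ N := fun x hx => hN x (mem_union_left _ hx)
  have hN2 : Counts T₂ N := fun x hx => hN x (mem_union_right _ hx)
  have hth : ∀ η, Θ ≤ thS G T₁ η := fun η => hΘ1.trans (le_thS G T₁ η)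
  have hth0 : ∀ η, 0 < thS G T₁ η := fun η => hΘ.trans_le (hth η)
  have hthi := thS_inv G _ hT T₁ subset_union_left
  have hst := stein_identity G Δ τ T₁ (subset_union_left.trans hTΔ) hT1
    (fun η => 1 / thS G T₁ η) (fun η ζ h => by
      simp only [thS_inv G T₁ hT1 T₁ subset_rfl η ζ h]) N hN1 F
  have part : ∀ (c : ZLat d → GConf d → ℝ) (s : ℕ), (∀ x ∈ T₁, InvOn (T₁ ∪ T₂) (c x)) →
      (∀ x η, |c x η| ≤ 1) →
      |𝔼[G] Δ τ (fun η => 1 / thS G T₁ η * (∑ x ∈ T₁, c x η * zS G x η) *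
        F (N η + s))| ≤ 2 / Θ := by
    intro c s hc hc1
    set ω : GConf d → ℝ := fun η => 1 / thS G T₁ η * (∑ x ∈ T₁, c x η * zS G x η) with hω
    have h1 := bath_first G Δ τ T₂ (Finset.subset_union_right.trans hTΔ) hT2 ω ?_ N hN2
      (fun n => H (n + s)) 1 ?_ Θ hΘ hΘ2
    · have h2 : (fun η => ω η * (H (N η + 1 + s) - H (N η + s))) =
          fun η => (-1) * (ω η * F (N η + s)) := by
        funext η
        rw [show N η + 1 + s = (N η + s) + 1 by ring, hHF]; ring
      rw [h2, gibbsExp_const_mul, abs_mul, abs_neg, abs_one, one_mul] at h1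
      refine h1.trans ?_
      have h3 : 𝔼[G] Δ τ (fun η => |ω η|) ≤ 1 / sqrt Θ := by
        have h4 := gibbsExp_mul_sq_le (gasPotH G) Δ τ (fun _ => 1) (fun η => |ω η|)
        simp only [one_pow, gibbsExp_const, one_mul] at h4
        refine abs_le_of_sq_le_sq' (h4.trans ?_) (by positivity) |>.2
        have h5 := gibbsExp_bath_sq G Δ τ T₁ (subset_union_left.trans hTΔ) hT1
          (fun η => 1 / thS G T₁ η ^ 2)
          (fun η ζ h => by simp only [thS_inv G T₁ hT1 T₁ subset_rfl η ζ h])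
          (fun η => by positivity) c
          (fun x hx => (hc x hx).mono subset_union_left) hc1
        refine le_trans (le_of_eq ?_) (h5.trans ?_)
        · congr 1; funext η
          rw [sq_abs, hω]
          ring
        · rw [div_pow, sq_sqrt hΘ.le, one_pow,
            ← gibbsExp_const (gasPotH G) Δ τ (1 / Θ)]
          refine gibbsExp_mono _ _ _ _ _ fun η _ => ?_
          have := hth0 η
          have e : 1 / thS G T₁ η ^ 2 * thS G T₁ η = 1 / thS G T₁ η := by field_simp
          rw [e]
          exact one_div_le_one_div_of_le hΘ (hth η)
      calc _ ≤ 2 * 1 / sqrt Θ * (1 / sqrt Θ) :=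
            mul_le_mul_of_nonneg_left h3 (by positivity)
        _ = 2 / Θ := by
            rw [div_mul_div_comm, mul_self_sqrt hΘ.le]; norm_num
    · intro η ζ h
      have h' : AgreeOff (T₁ ∪ T₂) η ζ := fun x hx => h x fun hx' =>
        hx (mem_union_right _ hx')
      simp only [hω]
      rw [hthi η ζ h']
      congr 1
      refine sum_congr rfl fun x hx => ?_
      unfold zS occ
      rw [hc x hx η ζ h', pS_inv G _ hT x (mem_union_left _ hx) η ζ h',
        h x (disjoint_left.1 hdis hx)]
    · intro n
      simp only [hH]
      split_ifs <;> simp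
  have hp : ∀ x η, |pS G x η| ≤ 1 ∧ |1 - pS G x η| ≤ 1 := by
    intro x η
    have := pS_le G x η
    have := pMin_pos G
    constructor <;> rw [abs_le] <;> constructor <;> linarith
  have hA := part (fun x η => 1 - pS G x η) 0
    (fun x hx η ζ h => by
      simp only [pS_inv G _ hT x (mem_union_left _ hx) η ζ h]) (fun x η => (hp x η).2)
  have hB := part (pS G) 1 (fun x hx => pS_inv G _ hT x (mem_union_left _ hx))
    (fun x η => (hp x η).1)
  rw [abs_sub_comm, ← gibbsExp_sub]
  have e0 : (fun η => 1 / thS G T₁ η * thS G T₁ η * (F (N η + 1) - F (N η))) = fun η =>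
      (if N η = k then (1 : ℝ) else 0) - (if N η = k + 1 then (1 : ℝ) else 0) := by
    funext η
    rw [div_mul_cancel₀ _ (hth0 η).ne', one_mul]
    simp only [hF, add_left_inj]
  rw [e0] at hst
  rw [hst]
  refine (abs_add_le _ _).trans ((add_le_add hA hB).trans (le_of_eq ?_))
  ring

end stein

section blocks

variable {d : ℕ}

/-- A family of disjoint blocks `S v ∪ Bk v` in the volume `Λ`, each made of a shell `S v`
and a bulk `Bk v`, with block counts `N v`. -/
structure BlockSys (G : LatticeGas d) (V α : Type) (Λ : ℱ[d]) (τ : GConf d) where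
  S : V → ℱ[d]
  Bk : V → ℱ[d]
  rd : V → GConf d → α
  conf : (V → α) → GConf d
  N : V → GConf d → ℕ
  rd_conf : ∀ s v, rd v (conf s) = s v
  rd_iff : ∀ v η ζ, rd v η = rd v ζ ↔ ∀ x ∈ S v, η x = ζ x
  conf_off : ∀ s x, (∀ v, x ∉ S v) → conf s x = τ x
  subS : ∀ v, S v ⊆ Λ
  subB : ∀ v, Bk v ⊆ Λ
  disjSB : ∀ v w, Disjoint (S v) (Bk w)
  disjS : ∀ v w, v ≠ w → Disjoint (S v) (S w)
  disjB : ∀ v w, v ≠ w → Disjoint (Bk v) (Bk w)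
  near : ∀ v, ∀ x ∈ Bk v, ∀ y, y ∉ Bk v → supD x y ≤ G.r → y ∈ S v
  N_local : ∀ v η ζ, (∀ x ∈ S v ∪ Bk v, η x = ζ x) → N v η = N v ζ

variable {G : LatticeGas d} {V α : Type} [Fintype V] [Fintype α]
  {Λ : ℱ[d]} {τ : GConf d} (bs : BlockSys G V α Λ τ) (rk : V → ℕ)

namespace BlockSys

/-- The sites of the shells of a set of blocks. -/
def shells (A : Finset V) : ℱ[d] := A.biUnion bs.S

lemma rd_eq_iff (v : V) (s : V → α) (η : GConf d) :
    bs.rd v η = s v ↔ ∀ x ∈ bs.S v, η x = bs.conf s x := by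
  rw [← bs.rd_iff, bs.rd_conf]

lemma conf_agree (A : Finset V) (s s' : V → α) (h : ∀ v, v ∉ A → s v = s' v) :
    AgreeOff (bs.shells A) (bs.conf s) (bs.conf s') := by
  intro x hx
  by_cases hv : ∃ v, x ∈ bs.S v
  · obtain ⟨v, hv⟩ := hv
    have hvA : v ∉ A := fun hA => hx (mem_biUnion.2 ⟨v, hA, hv⟩)
    refine (bs.rd_iff v (bs.conf s') (bs.conf s)).1 ?_ x hv
    rw [bs.rd_conf, bs.rd_conf, h v hvA]
  · push Not at hv
    rw [bs.conf_off _ _ hv, bs.conf_off _ _ hv]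

/-- The volume left after the shells of rank below `k` have been revealed. -/
def lv (k : ℕ) : ℱ[d] := Λ \ bs.shells (univ.filter fun v => rk v < k)

/-- The conditional law of a shell given the shells of smaller rank. -/
def pL (t : V) (s : V → α) (a : α) : ℝ :=
  𝔼[G] (bs.lv rk (rk t)) (bs.conf s) fun η => if bs.rd t η = a then 1 else 0

/-- The law of a block count given its shell. -/
def WL (v : V) (a : α) (m : ℕ) : ℝ :=
  𝔼[G] (bs.Bk v) (bs.conf fun _ => a) fun η => if bs.N v η = m then 1 else 0

lemma S_sub_lv (t : V) : bs.S t ⊆ bs.lv rk (rk t) := by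
  intro x hx
  refine mem_sdiff.2 ⟨bs.subS t hx, fun h => ?_⟩
  obtain ⟨v, hv, hxv⟩ := mem_biUnion.1 h
  have hne : v ≠ t := fun e => by subst e; simp at hv
  exact disjoint_left.1 (bs.disjS v t hne) hxv hx

lemma lv_succ_of_rank (hrk : Injective rk) (t : V) :
    bs.lv rk (rk t + 1) = bs.lv rk (rk t) \ bs.S t := by
  unfold lv shells
  rw [sdiff_sdiff_left]
  congr 1
  ext x
  simp only [mem_biUnion, mem_filter, mem_univ, true_and,
    mem_union, Finset.sup_eq_union, Order.lt_add_one_iff]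
  constructor
  · rintro ⟨v, hv, hx⟩
    rcases hv.lt_or_eq with h | h
    · exact Or.inl ⟨v, h, hx⟩
    · rw [hrk h] at hx; exact Or.inr hx
  · rintro (⟨v, hv, hx⟩ | hx)
    · exact ⟨v, hv.le, hx⟩
    · exact ⟨t, le_rfl, hx⟩

lemma lv_succ_of_not_rank (k : ℕ) (hk : ∀ t, rk t ≠ k) : bs.lv rk (k + 1) = bs.lv rk k := by
  unfold lv
  congr 2
  ext v
  have := hk v
  simp only [mem_filter, mem_univ, true_and]
  omega

lemma gibbsExp_cond (Δ : ℱ[d]) (t : V) (hΔ : bs.S t ⊆ Δ) (s : V → α) (a : α)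
    (F : GConf d → ℝ) :
    𝔼[G] Δ (bs.conf s) (fun η => (if bs.rd t η = a then 1 else 0) * F η) =
      𝔼[G] Δ (bs.conf s) (fun η => if bs.rd t η = a then 1 else 0) *
        𝔼[G] (Δ \ bs.S t) (bs.conf (update s t a)) F := by
  have h1 := gibbsExp_mul_gibbsExp G Δ (Δ \ bs.S t) sdiff_subset (bs.conf s)
    (fun η => if bs.rd t η = a then 1 else 0) F (fun η ζ h => by
      have : bs.rd t ζ = bs.rd t η := (bs.rd_iff t ζ η).2 fun x hx => h x fun hx' =>
        (mem_sdiff.1 hx').2 hx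
      simp only [this])
  rw [← h1, mul_comm, ← gibbsExp_const_mul]
  refine gibbsExp_congr _ _ _ _ _ fun η hη => ?_
  by_cases h : bs.rd t η = a
  · rw [if_pos h, one_mul, mul_one]
    refine gibbsExp_congr_bc _ _ _ _ (fun x hx => ?_) F
    by_cases hxS : x ∈ bs.S t
    · refine (bs.rd_eq_iff t (update s t a) η).1 ?_ x hxS
      rw [h, Function.update_self]
    · have hxΔ : x ∉ Δ := fun h' => hx (mem_sdiff.2 ⟨h', hxS⟩)
      rw [hη x hxΔ]
      refine (bs.conf_agree {t} s (update s t a) (fun v hv => ?_) x ?_).symm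
      · rw [update_of_ne (by simpa using hv)]
      · simpa [shells] using hxS
  · rw [if_neg h]; ring

lemma sum_rd (t : V) (η : GConf d) : ∑ a : α, (if bs.rd t η = a then (1 : ℝ) else 0) = 1 := by
  rw [sum_ite_eq]; simp

lemma gibbsExp_eq_sum_shell (Δ : ℱ[d]) (t : V) (hΔ : bs.S t ⊆ Δ) (s : V → α)
    (F : GConf d → ℝ) :
    𝔼[G] Δ (bs.conf s) F =
      ∑ a, 𝔼[G] Δ (bs.conf s) (fun η => if bs.rd t η = a then 1 else 0) *
        𝔼[G] (Δ \ bs.S t) (bs.conf (update s t a)) F := by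
  rw [← sum_congr rfl fun a _ => bs.gibbsExp_cond Δ t hΔ s a F, ← gibbsExp_sum]
  congr 1; funext η
  rw [← sum_mul, bs.sum_rd, one_mul]

lemma pL_nonneg (t : V) (s : V → α) (a : α) : 0 ≤ bs.pL rk t s a :=
  gibbsExp_nonneg _ _ _ _ fun η => by split_ifs <;> norm_num

lemma pL_sum (t : V) (s : V → α) : ∑ a, bs.pL rk t s a = 1 := by
  unfold pL
  rw [← gibbsExp_sum]
  simp only [bs.sum_rd, gibbsExp_const]

lemma pL_local (t : V) (s s' : V → α) (h : ∀ x, rk x < rk t → s x = s' x) :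
    bs.pL rk t s = bs.pL rk t s' := by
  funext a
  unfold pL
  refine (gibbsExp_congr_bc _ _ _ _ (fun x hx => ?_) _).symm
  by_cases hx' : x ∈ bs.shells (univ.filter fun v => rk v < rk t)
  · obtain ⟨v, hv, hxv⟩ := mem_biUnion.1 hx'
    refine (bs.rd_iff v (bs.conf s') (bs.conf s)).1 ?_ x hxv
    rw [bs.rd_conf, bs.rd_conf, h v (by simpa using hv)]
  · have hxΛ : x ∉ Λ := fun h' => hx (mem_sdiff.2 ⟨h', hx'⟩)
    have hxS : ∀ v, x ∉ bs.S v := fun v hv => hxΛ (bs.subS v hv)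
    rw [bs.conf_off _ _ hxS, bs.conf_off _ _ hxS]

lemma gibbsExp_chain (hrk : Injective rk) (s : V → α) (k : ℕ) (F : GConf d → ℝ) :
    𝔼[G] Λ τ (fun η => (∏ v, if rk v < k then
        (if bs.rd v η = s v then (1 : ℝ) else 0) else 1) * F η) =
      (∏ v, if rk v < k then bs.pL rk v s (s v) else 1) *
        𝔼[G] (bs.lv rk k) (bs.conf s) F := by
  induction k generalizing F with
  | zero =>
    have e : bs.lv rk 0 = Λ := by simp [lv, shells]
    simp only [Nat.not_lt_zero, if_false, prod_const_one, one_mul, e]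
    refine (gibbsExp_congr_bc _ _ _ _ (fun x hx => ?_) _).symm
    exact bs.conf_off _ _ fun v hv => hx (bs.subS v hv)
  | succ k ih =>
    by_cases hk : ∃ t, rk t = k
    · obtain ⟨t, rfl⟩ := hk
      have split : ∀ f : V → ℝ, (∏ v, if rk v < rk t + 1 then f v else 1) =
          (∏ v, if rk v < rk t then f v else 1) * f t := by
        intro f
        rw [← Finset.mul_prod_erase _ _ (mem_univ t),
          ← Finset.mul_prod_erase _ (fun v => if rk v < rk t then f v else 1)
            (mem_univ t), if_pos (Nat.lt_succ_self _), if_neg (lt_irrefl _), one_mul,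
          mul_comm]
        congr 1
        refine prod_congr rfl fun v hv => ?_
        have hne : rk v ≠ rk t := fun e => (Finset.ne_of_mem_erase hv) (hrk e)
        by_cases h : rk v < rk t
        · rw [if_pos h, if_pos (by omega)]
        · rw [if_neg h, if_neg (by omega)]
      simp only [split, mul_assoc]
      rw [ih, bs.gibbsExp_cond _ t (bs.S_sub_lv rk t), update_eq_self,
        ← bs.lv_succ_of_rank rk hrk t]
      rfl
    · push Not at hk
      rw [bs.lv_succ_of_not_rank rk k hk]
      have e : ∀ v, rk v < k + 1 ↔ rk v < k := fun v => by have := hk v; omega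
      have he : ∀ f : V → ℝ, (∏ v, if rk v < k + 1 then f v else 1) =
          ∏ v, if rk v < k then f v else 1 := fun f =>
        prod_congr rfl fun v _ => if_congr (e v) rfl rfl
      simp only [he]
      exact ih F

lemma gibbsExp_bulk (v : V) (s : V → α) (η : GConf d) (hη : ∀ x ∈ bs.S v, η x = bs.conf s x)
    (H : ℕ → ℝ) :
    𝔼[G] (bs.Bk v) η (fun ζ => H (bs.N v ζ)) =
      𝔼[G] (bs.Bk v) (bs.conf fun _ => s v) (fun ζ => H (bs.N v ζ)) := by
  have h1 : ∀ x ∈ bs.S v, η x = bs.conf (fun _ => s v) x := fun x hx => by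
    rw [hη x hx]
    refine (bs.rd_iff v (bs.conf s) (bs.conf fun _ => s v)).1 ?_ x hx
    rw [bs.rd_conf, bs.rd_conf]
  refine gibbsExp_congr_near G _ _ _ _ (fun σ => ?_) fun x hx y hy hxy =>
    h1 y (bs.near v x hx y hy hxy)
  congr 1
  refine bs.N_local v _ _ fun x hx => ?_
  by_cases hxB : x ∈ bs.Bk v
  · simp [override, hxB]
  · have hxS : x ∈ bs.S v := (mem_union.1 hx).resolve_right hxB
    simp [override, hxB, h1 x hxS]

lemma Bk_sub (A : Finset V) (v : V) : bs.Bk v ⊆ Λ \ bs.shells A := by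
  intro x hx
  refine mem_sdiff.2 ⟨bs.subB v hx, fun h => ?_⟩
  obtain ⟨w, _, hw⟩ := mem_biUnion.1 h
  exact disjoint_left.1 (bs.disjSB w v) hw hx

lemma gibbsExp_bulks (s : V → α) (h : V → ℕ → ℝ) (T : Finset V) :
    𝔼[G] (Λ \ bs.shells univ) (bs.conf s)
        (fun η => ∏ v ∈ T, h v (bs.N v η)) =
      ∏ v ∈ T, 𝔼[G] (bs.Bk v) (bs.conf fun _ => s v)
        fun η => h v (bs.N v η) := by
  induction T using induction_on with
  | empty => simp [gibbsExp_const]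
  | insert v T hv ih =>
    rw [Finset.prod_insert hv, ← ih, ← gibbsExp_const_mul]
    simp only [Finset.prod_insert hv]
    have h1 := gibbsExp_mul_gibbsExp G (Λ \ bs.shells univ) (bs.Bk v)
      (bs.Bk_sub _ v) (bs.conf s) (fun η => ∏ w ∈ T, h w (bs.N w η)) (fun η => h v (bs.N v η))
      (fun η ζ hηζ => prod_congr rfl fun w hw => by
        have hne : w ≠ v := fun e => hv (e ▸ hw)
        congr 1
        refine bs.N_local w _ _ fun x hx => hηζ x fun hxv => ?_
        rcases mem_union.1 hx with hx | hx
        · exact disjoint_left.1 (bs.disjSB w v) hx hxv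
        · exact disjoint_left.1 (bs.disjB w v hne) hx hxv)
    simp only [mul_comm (h v _)]
    rw [← h1]
    refine gibbsExp_congr _ _ _ _ _ fun η hη => ?_
    rw [bs.gibbsExp_bulk v s η, mul_comm]
    intro x hx
    refine hη x fun hx' => (mem_sdiff.1 hx').2 ?_
    exact mem_biUnion.2 ⟨v, mem_univ v, hx⟩

/-- The joint law of the block counts is a field with the conditional shell laws. -/
theorem fieldLaw_eq (hrk : Injective rk) (A : Finset V) (m : V → ℕ) :
    fieldLaw (bs.pL rk) bs.WL A m = 𝔼[G] Λ τ fun η =>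
      ∏ v, if v ∈ A then 1 else if bs.N v η = m v then 1 else 0 := by
  obtain ⟨k, hk⟩ : ∃ k, ∀ v, rk v < k :=
    ⟨univ.sup rk + 1, fun v => Nat.lt_succ_of_le (le_sup (mem_univ v))⟩
  have hlv : bs.lv rk k = Λ \ bs.shells univ := by simp [lv, hk]
  set F : GConf d → ℝ := fun η => ∏ v, if v ∈ A then 1 else if bs.N v η = m v then 1 else 0
    with hF
  have h1 : ∀ η, ∑ s : V → α, (∏ v, if bs.rd v η = s v then (1 : ℝ) else 0) = 1 := by
    intro η
    have := Finset.prod_univ_sum (fun _ : V => (univ : Finset α))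
      fun v a => if bs.rd v η = a then (1 : ℝ) else 0
    rw [Fintype.piFinset_univ] at this
    rw [← this]
    simp only [bs.sum_rd, prod_const_one]
  have h2 : 𝔼[G] Λ τ F = ∑ s : V → α, 𝔼[G] Λ τ (fun η =>
      (∏ v, if bs.rd v η = s v then (1 : ℝ) else 0) * F η) := by
    rw [← gibbsExp_sum]
    congr 1; funext η
    rw [← sum_mul, h1, one_mul]
  rw [h2]
  unfold fieldLaw
  refine sum_congr rfl fun s _ => ?_
  have h3 := bs.gibbsExp_chain rk hrk s k F
  simp only [hk, if_true, hlv] at h3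
  rw [h3]
  congr 1
  have h4 := bs.gibbsExp_bulks s (fun v n => if v ∈ A then 1 else if n = m v then 1 else 0)
    univ
  rw [hF, h4]
  refine prod_congr rfl fun v _ => ?_
  by_cases hv : v ∈ A
  · simp only [if_pos hv, gibbsExp_const]
  · simp only [if_neg hv]; rfl

end BlockSys

end blocks

lemma sum_range_ind (f : ℕ → ℝ) (Y K : ℕ) (h : Y ≤ K) :
    ∑ j ∈ range K, (if j < Y then f j else 0) = ∑ j ∈ range Y, f j := by
  rw [← sum_filter]
  congr 1
  ext j; simp only [mem_filter, mem_range]; omega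

lemma telescope_ind (f : ℕ → ℝ) (Y c K : ℕ) (hY : Y ≤ K) (hc : c ≤ K) :
    f Y - f c = ∑ j ∈ range K,
      ((if j < Y then 1 else 0) - (if j < c then (1 : ℝ) else 0)) * (f (j + 1) - f j) := by
  have h : ∀ Z, Z ≤ K → f Z - f 0 = ∑ j ∈ range K,
      (if j < Z then (1 : ℝ) else 0) * (f (j + 1) - f j) := by
    intro Z hZ
    simp only [ite_mul, one_mul, zero_mul]
    rw [sum_range_ind (fun j => f (j + 1) - f j) Z K hZ, Finset.sum_range_sub]
  simp only [sub_mul]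
  rw [sum_sub_distrib]
  rw [← h Y hY, ← h c hc]; ring

lemma sum_abs_ind (Y c K : ℕ) (hY : Y ≤ K) (hc : c ≤ K) :
    ∑ j ∈ range K, |(if j < Y then 1 else 0) - (if j < c then (1 : ℝ) else 0)| =
      |(Y : ℝ) - c| := by
  have h : ∀ Z, Z ≤ K → ∑ j ∈ range K, (if j < Z then (1 : ℝ) else 0) = Z := by
    intro Z hZ
    rw [sum_range_ind (fun _ => (1 : ℝ)) Z K hZ]; simp
  have key : ∀ a b : ℕ, a ≤ b → ∀ j : ℕ,
      |(if j < b then 1 else 0) - (if j < a then (1 : ℝ) else 0)| =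
        (if j < b then 1 else 0) - (if j < a then (1 : ℝ) else 0) := by
    intro a b hab j
    apply abs_of_nonneg
    by_cases h1 : j < a
    · rw [if_pos h1, if_pos (by omega)]; simp
    · rw [if_neg h1]; split_ifs <;> norm_num
  rcases le_total c Y with h1 | h1
  · simp only [key c Y h1]
    rw [sum_sub_distrib, h Y hY, h c hc, abs_of_nonneg]
    have : (c : ℝ) ≤ Y := by exact_mod_cast h1
    linarith
  · simp only [abs_sub_comm _ (if _ < c then (1 : ℝ) else 0), key Y c h1]
    rw [sum_sub_distrib, h Y hY, h c hc, abs_sub_comm, abs_of_nonneg]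
    have : (Y : ℝ) ≤ c := by exact_mod_cast h1
    linarith

section jump

variable {d : ℕ} (G : LatticeGas d)

/-- Boundary influence with constant `C`. -/
def Infl (ℓ0 : ℕ) (b C : ℝ) : Prop :=
  ∀ (Δ : ℱ[d]), Reg ℓ0 Δ → ∀ (f : GConf d → ℝ)
      (T Y : ℱ[d]) (F : ℝ) (ξ ξ' : GConf d), LocalOn f T → (∀ η, |f η| ≤ F) →
      Disjoint T Y → AgreeOff Y ξ ξ' →
      |𝔼[G] Δ ξ' f - 𝔼[G] Δ ξ f| ≤ C * F * Jsum b T Y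

lemma bath_shift (Δ : ℱ[d]) (ξ : GConf d) (T : ℱ[d]) (hTΔ : T ⊆ Δ)
    (hT : ∀ x ∈ T, ∀ y ∈ T, x ≠ y → G.r < supD x y) (ω : GConf d → ℝ) (hω : InvOn T ω)
    (hω0 : ∀ η, 0 ≤ ω η)
    (N Y : GConf d → ℕ) (hN : Counts T N) (hY : ∀ η ζ, AgreeOff T η ζ → Y ζ = Y η)
    (K c : ℕ) (hYK : ∀ η, Y η ≤ K) (hcK : c ≤ K) (H : ℕ → ℝ) (hH : ∀ n, |H n| ≤ 1)
    (Θ : ℝ) (hΘ : 0 < Θ) (hΘT : Θ ≤ T.card * pMin G ^ 2) :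
    |𝔼[G] Δ ξ (fun η => ω η * (H (N η + Y η) - H (N η + c)))| ≤
      2 / sqrt Θ * 𝔼[G] Δ ξ (fun η => ω η * |(Y η : ℝ) - c|) := by
  have e1 : (fun η => ω η * (H (N η + Y η) - H (N η + c))) = fun η =>
      ∑ j ∈ range K, (ω η * ((if j < Y η then 1 else 0) -
        (if j < c then (1 : ℝ) else 0))) * (H (N η + 1 + j) - H (N η + j)) := by
    funext η
    rw [telescope_ind (fun j => H (N η + j)) (Y η) c K (hYK η) hcK, mul_sum]
    refine sum_congr rfl fun j _ => ?_
    rw [show N η + (j + 1) = N η + 1 + j by ring]; ring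
  have e2 : (fun η => ω η * |(Y η : ℝ) - c|) = fun η => ∑ j ∈ range K,
      |ω η * ((if j < Y η then 1 else 0) - (if j < c then (1 : ℝ) else 0))| := by
    funext η
    rw [← sum_abs_ind (Y η) c K (hYK η) hcK, mul_sum]
    refine sum_congr rfl fun j _ => ?_
    rw [abs_mul, abs_of_nonneg (hω0 η)]
  rw [e1, e2, gibbsExp_sum, gibbsExp_sum, mul_sum]
  refine (abs_sum_le_sum_abs _ _).trans (sum_le_sum fun j _ => ?_)
  have := bath_first G Δ ξ T hTΔ hT (fun η => ω η * ((if j < Y η then 1 else 0) -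
    (if j < c then (1 : ℝ) else 0))) (fun η ζ h => by simp only [hω η ζ h, hY η ζ h]) N hN
    (fun n => H (n + j)) 1 (fun n => hH _) Θ hΘ hΘT
  rw [mul_one] at this
  exact this

lemma exists_test (Δ Δ' : ℱ[d]) (ξ ξ' : GConf d) (N : GConf d → ℕ) (M : ℕ) :
    ∃ H : ℕ → ℝ, (∀ n, |H n| ≤ 1) ∧ ∑ n ∈ range (M + 1),
      |𝔼[G] Δ' ξ' 𝟙[N, n] -
        𝔼[G] Δ ξ 𝟙[N, n]| =
      𝔼[G] Δ' ξ' (fun η => H (N η)) -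
        𝔼[G] Δ ξ (fun η => H (N η)) := by
  set D : ℕ → ℝ := fun n => 𝔼[G] Δ' ξ' 𝟙[N, n] -
        𝔼[G] Δ ξ 𝟙[N, n] with hD
  set c : ℕ → ℝ := fun n => if 0 ≤ D n then 1 else -1 with hc
  refine ⟨fun n => if n ∈ range (M + 1) then c n else 0, fun n => ?_, ?_⟩
  · simp only [hc]; split_ifs <;> norm_num
  · have e : (fun η => (fun n => if n ∈ range (M + 1) then c n else 0) (N η)) =
        fun η => ∑ n ∈ range (M + 1), c n * (if N η = n then 1 else 0) := by
      funext η
      simp only [mul_ite, mul_one, mul_zero]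
      rw [sum_ite_eq]
    rw [e, gibbsExp_sum, gibbsExp_sum, ← sum_sub_distrib]
    refine sum_congr rfl fun n _ => ?_
    rw [gibbsExp_const_mul, gibbsExp_const_mul, ← mul_sub]
    change |D n| = c n * D n
    simp only [hc]
    split_ifs with h
    · rw [abs_of_nonneg h, one_mul]
    · rw [abs_of_neg (not_le.1 h)]; ring

lemma tv_le_of_test (Δ Δ' : ℱ[d]) (ξ ξ' : GConf d) (N : GConf d → ℕ) (M : ℕ) (e : ℝ)
    (h : ∀ H : ℕ → ℝ, (∀ n, |H n| ≤ 1) → |𝔼[G] Δ' ξ' (fun η => H (N η)) -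
        𝔼[G] Δ ξ (fun η => H (N η))| ≤ e) :
    ∑ n ∈ range (M + 1),
      |𝔼[G] Δ' ξ' 𝟙[N, n] -
        𝔼[G] Δ ξ 𝟙[N, n]| ≤ e := by
  obtain ⟨H, hH, hs⟩ := exists_test G Δ Δ' ξ ξ' N M
  rw [hs]
  exact (le_abs_self _).trans (h H hH)

variable {G} {V α : Type} [Fintype V] [Fintype α]
  {Λ : ℱ[d]} {τ : GConf d} (bs : BlockSys G V α Λ τ)

/-- The change of the law of a count when a shell is revealed. -/
def BlockSys.jump (Δ : ℱ[d]) (N : GConf d → ℕ) (M : ℕ) (t : V) (s : V → α) (a : α) : ℝ :=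
  ∑ n ∈ range (M + 1), |𝔼[G] (Δ \ bs.S t)
      (bs.conf (update s t a)) 𝟙[N, n] -
    𝔼[G] Δ (bs.conf s) 𝟙[N, n]|

lemma BlockSys.jump_nonneg (Δ : ℱ[d]) (N : GConf d → ℕ) (M : ℕ) (t : V) (s : V → α)
    (a : α) : 0 ≤ bs.jump Δ N M t s a := sum_nonneg fun _ _ => abs_nonneg _

theorem BlockSys.mean_jump_le {ℓ0 : ℕ} {b C : ℝ} (hC : Infl G ℓ0 b C)
    (Δ : ℱ[d]) (t : V) (hS : bs.S t ⊆ Δ) (hreg : Reg ℓ0 (Δ \ bs.S t)) (s : V → α)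
    (N Y : GConf d → ℕ) (T deep : ℱ[d]) (hTΔ : T ⊆ Δ)
    (hT : ∀ x ∈ T, ∀ y ∈ T, x ≠ y → G.r < supD x y) (hTS : Disjoint (bs.S t) T)
    (hdS : Disjoint deep (bs.S t)) (hNdeep : ∀ η ζ, (∀ x ∈ deep, η x = ζ x) → N η = N ζ)
    (hN : Counts T N) (hY : ∀ η ζ, AgreeOff T η ζ → Y ζ = Y η)
    (K c M : ℕ) (hYK : ∀ η, Y η ≤ K) (hcK : c ≤ K)
    (Θ : ℝ) (hΘ : 0 < Θ) (hΘT : Θ ≤ T.card * pMin G ^ 2) :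
    ∑ a, 𝔼[G] Δ (bs.conf s) (fun η => if bs.rd t η = a then 1 else 0) *
        bs.jump Δ (fun η => N η + Y η) M t s a ≤
      4 / sqrt Θ * 𝔼[G] Δ (bs.conf s) (fun η => |(Y η : ℝ) - c|) +
        C * Jsum b deep (bs.S t) := by
  set E : (GConf d → ℝ) → ℝ := 𝔼[G] Δ (bs.conf s) with hE
  set E' : α → (GConf d → ℝ) → ℝ := fun a =>
    𝔼[G] (Δ \ bs.S t) (bs.conf (update s t a)) with hE'
  set p : α → ℝ := fun a => E (fun η => if bs.rd t η = a then 1 else 0) with hp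
  have hp0 : ∀ a, 0 ≤ p a := fun a => gibbsExp_nonneg _ _ _ _ fun η => by
    split_ifs <;> norm_num
  have hp1 : ∑ a, p a = 1 := by
    simp only [hp, hE]
    rw [← gibbsExp_sum]
    simp only [bs.sum_rd, gibbsExp_const]
  choose H hH hs using fun a => exists_test G Δ (Δ \ bs.S t) (bs.conf s)
    (bs.conf (update s t a)) (fun η => N η + Y η) M
  have hcond : ∀ a F, p a * E' a F = E (fun η => (if bs.rd t η = a then 1 else 0) * F η) :=
    fun a F => (bs.gibbsExp_cond Δ t hS s a F).symm
  set q := 2 / sqrt Θ with hq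
  set Yc : GConf d → ℝ := fun η => |(Y η : ℝ) - c| with hYc
  have hdiff : ∀ h a a', |E' a' (fun η => H h (N η + c)) - E' a (fun η => H h (N η + c))| ≤
      C * Jsum b deep (bs.S t) := by
    intro h a a'
    have := hC (Δ \ bs.S t) hreg (fun η => H h (N η + c)) deep (bs.S t) 1
      (bs.conf (update s t a)) (bs.conf (update s t a'))
      (fun η ζ h => by simp only [hNdeep η ζ h]) (fun η => hH h _) hdS
      (by
        have h1 := bs.conf_agree {t} (update s t a) (update s t a')
          (fun v hv => by
            have : v ≠ t := by simpa using hv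
            rw [update_of_ne this, update_of_ne this])
        simpa [BlockSys.shells] using h1)
    rw [mul_one] at this
    exact this
  have hterm : ∀ a, p a * bs.jump Δ (fun η => N η + Y η) M t s a ≤
      q * E (fun η => (if bs.rd t η = a then 1 else 0) * Yc η) + p a * (q * E Yc) +
        p a * (C * Jsum b deep (bs.S t)) := by
    intro a
    have h1 : |E (fun η => (if bs.rd t η = a then 1 else 0) *
        (H a (N η + Y η) - H a (N η + c)))| ≤
        q * E (fun η => (if bs.rd t η = a then 1 else 0) * Yc η) := by
      refine bath_shift G Δ (bs.conf s) T hTΔ hT (fun η => if bs.rd t η = a then 1 else 0)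
        (fun η ζ h => ?_) (fun η => by split_ifs <;> norm_num) N Y hN hY K c hYK hcK
        (H a) (hH a) Θ hΘ hΘT
      have : bs.rd t ζ = bs.rd t η := (bs.rd_iff t ζ η).2 fun x hx =>
        h x (disjoint_left.1 hTS hx)
      simp only [this]
    have h2 : |E (fun η => 1 * (H a (N η + Y η) - H a (N η + c)))| ≤
        q * E (fun η => 1 * Yc η) :=
      bath_shift G Δ (bs.conf s) T hTΔ hT (fun η => 1)
        (fun η ζ h => rfl) (fun η => zero_le_one) N Y hN hY K c hYK hcK
        (H a) (hH a) Θ hΘ hΘT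
    simp only [one_mul] at h2
    have h3 : |E' a (fun η => H a (N η + c)) - E (fun η => H a (N η + c))| ≤
        C * Jsum b deep (bs.S t) := by
      have e : E (fun η => H a (N η + c)) = ∑ a', p a' * E' a' (fun η => H a (N η + c)) :=
        bs.gibbsExp_eq_sum_shell Δ t hS s _
      have e' : E' a (fun η => H a (N η + c)) - E (fun η => H a (N η + c)) =
          ∑ a', p a' * (E' a (fun η => H a (N η + c)) - E' a' (fun η => H a (N η + c))) := by
        simp only [mul_sub]
        rw [sum_sub_distrib, ← sum_mul, hp1, one_mul, e]
      rw [e']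
      refine (abs_sum_le_sum_abs _ _).trans ?_
      refine (sum_le_sum (g := fun a' => p a' * (C * Jsum b deep (bs.S t)))
        fun a' _ => ?_).trans ?_
      · rw [abs_mul, abs_of_nonneg (hp0 a')]
        exact mul_le_mul_of_nonneg_left (hdiff a a' a) (hp0 a')
      · rw [← sum_mul, hp1, one_mul]
    have e4 : p a * bs.jump Δ (fun η => N η + Y η) M t s a =
        E (fun η => (if bs.rd t η = a then 1 else 0) * (H a (N η + Y η) - H a (N η + c))) -
        p a * E (fun η => H a (N η + Y η) - H a (N η + c)) +
        p a * (E' a (fun η => H a (N η + c)) - E (fun η => H a (N η + c))) := by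
      unfold BlockSys.jump
      rw [hs a, mul_sub, mul_sub]
      have c1 := hcond a (fun η => H a (N η + Y η))
      have c2 := hcond a (fun η => H a (N η + c))
      simp only [hE', hE] at c1 c2 ⊢
      rw [c1, c2, gibbsExp_sub]
      simp only [mul_sub]
      rw [gibbsExp_sub]
      ring
    rw [e4]
    have h5 := mul_le_mul_of_nonneg_left h3 (hp0 a)
    have h6 := mul_le_mul_of_nonneg_left h2 (hp0 a)
    have h7 := mul_le_mul_of_nonneg_left (le_abs_self (E' a (fun η => H a (N η + c)) -
      E (fun η => H a (N η + c)))) (hp0 a)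
    have h8 := mul_le_mul_of_nonneg_left (neg_abs_le
      (E (fun η => H a (N η + Y η) - H a (N η + c)))) (hp0 a)
    have h9 := le_abs_self (E (fun η => (if bs.rd t η = a then 1 else 0) *
        (H a (N η + Y η) - H a (N η + c))))
    linarith
  refine (sum_le_sum fun a _ => hterm a).trans (le_of_eq ?_)
  rw [sum_add_distrib, sum_add_distrib, ← sum_mul, ← sum_mul, hp1,
    ← mul_sum]
  have e5 : ∑ a, E (fun η => (if bs.rd t η = a then 1 else 0) * Yc η) = E Yc := by
    simp only [hE]
    rw [← gibbsExp_sum]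
    congr 1; funext η
    rw [← sum_mul, bs.sum_rd, one_mul]
  rw [e5, hq]; ring

end jump

lemma exists_common_mass {ι : Type*} [Fintype ι] (good : ι → Prop) (W : ι → ℕ → ℝ) (w : ℕ → ℝ)
    (M A : ℕ) (hA : 0 < A) (δ e : ℝ) (Win : Finset ℕ)
    (hW0 : ∀ a n, 0 ≤ W a n) (hw0 : ∀ n, 0 ≤ w n)
    (hWM : ∀ a n, M < n → W a n = 0) (hwM : ∀ n, M < n → w n = 0)
    (hWδ : ∀ a n, |W a (n + 1) - W a n| ≤ δ) (hwδ : ∀ n, |w (n + 1) - w n| ≤ δ) (he : 0 ≤ e)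
    (hgood : ∀ a, good a → ∑ n ∈ range (M + 1), |W a n - w n| ≤ e) :
    ∃ w0 : ℕ → ℝ, (∀ n, 0 ≤ w0 n) ∧ (∀ n, w0 n ≤ w n) ∧ (∀ a n, good a → w0 n ≤ W a n) ∧
      ∑ n ∈ range (M + 1), (w n - w0 n) ≤
        Win.card * (e / A + 2 * A * δ) + ∑ n ∈ range (M + 1) \ Win, w n := by
  have hδ0 : 0 ≤ δ := (abs_nonneg _).trans (hwδ 0)
  have hA' : (0 : ℝ) < A := by exact_mod_cast hA
  set val : ℕ → Option ι → ℝ := fun n o => o.elim 0 fun a => if good a then w n - W a n else 0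
    with hval
  set g : ℕ → ℝ := fun n => univ.sup' univ_nonempty (val n) with hg
  have hle : ∀ n o, val n o ≤ g n := fun n o => Finset.le_sup' (val n) (mem_univ o)
  have hg0 : ∀ n, 0 ≤ g n := fun n => hle n none
  have hex : ∀ n, g n = 0 ∨ ∃ a, good a ∧ g n = w n - W a n := by
    intro n
    obtain ⟨o, _, ho⟩ := Finset.exists_mem_eq_sup' univ_nonempty (val n)
    rcases o with _ | a
    · exact Or.inl ho
    · by_cases ha : good a
      · right; refine ⟨a, ha, ?_⟩
        have : g n = val n (some a) := ho
        rw [this]; simp [hval, ha]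
      · left
        have : g n = val n (some a) := ho
        rw [this]; simp [hval, ha]
  have hgw : ∀ n, g n ≤ w n := by
    intro n
    rcases hex n with h | ⟨a, _, h⟩
    · rw [h]; exact hw0 n
    · rw [h]; linarith [hW0 a n]
  have hsmall : ∀ n, g n ≤ e / A + 2 * A * δ := by
    intro n
    rcases hex n with h | ⟨a, ha, h⟩
    · rw [h]; positivity
    · have hk : ∀ k : ℕ, g n - 2 * k * δ ≤ w (n + k) - W a (n + k) := by
        intro k
        induction k with
        | zero => simp [h]
        | succ k ih =>
          have h1 := abs_le.1 (hWδ a (n + k))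
          have h2 := abs_le.1 (hwδ (n + k))
          rw [← add_assoc]; push_cast
          linarith [h1.1, h1.2, h2.1, h2.2]
      have hsum : ∑ k ∈ range A, |W a (n + k) - w (n + k)| ≤ e := by
        refine le_trans ?_ (hgood a ha)
        rw [← sum_image (s := range A) (g := fun k => n + k)
          (f := fun m => |W a m - w m|) (fun _ _ _ _ h => by simpa using h)]
        rw [← Finset.sum_filter_add_sum_filter_not _ (fun m => m ∈ range (M + 1))]
        have hz : ∑ m ∈ ((range A).image fun k => n + k).filter
            (fun m => ¬ m ∈ range (M + 1)), |W a m - w m| = 0 := by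
          refine sum_eq_zero fun m hm => ?_
          have hm' : M < m := by
            have := (mem_filter.1 hm).2
            simp only [mem_range] at this; omega
          rw [hWM a m hm', hwM m hm']; simp
        rw [hz, add_zero]
        exact Finset.sum_le_sum_of_subset_of_nonneg (fun m hm => (mem_filter.1 hm).2)
          fun _ _ _ => abs_nonneg _
      have hlow : (A : ℝ) * (g n - 2 * A * δ) ≤ e := by
        refine le_trans ?_ hsum
        rw [← nsmul_eq_mul, ← card_range A, ← sum_const, card_range]
        refine sum_le_sum fun k hk' => ?_
        have hkA : (k : ℝ) ≤ A := by exact_mod_cast (mem_range.1 hk').le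
        have h1 := hk k
        have h2 := neg_abs_le (W a (n + k) - w (n + k))
        nlinarith
      have : g n - 2 * A * δ ≤ e / A := by rw [le_div_iff₀ hA']; linarith
      linarith
  refine ⟨fun n => w n - g n, fun n => by linarith [hgw n], fun n => by linarith [hg0 n],
    fun a n ha => ?_, ?_⟩
  · have := hle n (some a)
    simp only [hval, Option.elim_some, if_pos ha] at this
    linarith
  · simp only [sub_sub_cancel]
    rw [← Finset.sum_inter_add_sum_sdiff _ Win]
    refine add_le_add ?_ (sum_le_sum fun n _ => hgw n)
    refine (sum_le_sum fun n _ => hsmall n).trans ?_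
    rw [sum_const, nsmul_eq_mul]
    refine mul_le_mul_of_nonneg_right ?_ (by positivity)
    exact_mod_cast card_le_card Finset.inter_subset_right

section geometry

variable {d : ℕ}

lemma mem_cube (ℓ : ℕ) (v x : ZLat d) :
    x ∈ cube ℓ v ↔ ∀ k, (ℓ : ℤ) * v k ≤ x k ∧ x k < (ℓ : ℤ) * v k + ℓ := by
  simp [cube, Fintype.mem_piFinset]

/-- The cube without its boundary layer of thickness `h`. -/
def inner (ℓ h : ℕ) (v : ZLat d) : ℱ[d] :=
  Fintype.piFinset fun k => Ico ((ℓ : ℤ) * v k + h) ((ℓ : ℤ) * v k + ℓ - h)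

lemma mem_inner (ℓ h : ℕ) (v x : ZLat d) :
    x ∈ inner ℓ h v ↔ ∀ k, (ℓ : ℤ) * v k + h ≤ x k ∧ x k < (ℓ : ℤ) * v k + ℓ - h := by
  simp [inner, Fintype.mem_piFinset]

lemma inner_zero (ℓ : ℕ) (v : ZLat d) : inner ℓ 0 v = cube ℓ v := by
  ext x; rw [mem_inner, mem_cube]; simp

lemma inner_mono (ℓ : ℕ) {h h' : ℕ} (hh : h ≤ h') (v : ZLat d) :
    inner ℓ h' v ⊆ inner ℓ h v := by
  intro x hx
  rw [mem_inner] at hx ⊢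
  intro k
  have := hx k
  constructor <;> omega

lemma inner_subset_cube (ℓ h : ℕ) (v : ZLat d) : inner ℓ h v ⊆ cube ℓ v := by
  rw [← inner_zero]; exact inner_mono ℓ (Nat.zero_le h) v

/-- The boundary layer of thickness `h` of the cube. -/
def shell (ℓ h : ℕ) (v : ZLat d) : ℱ[d] := cube ℓ v \ inner ℓ h v

lemma card_cube (ℓ : ℕ) (v : ZLat d) : (cube ℓ v).card = ℓ ^ d := by
  simp [cube, Fintype.card_piFinset]

lemma card_inner (ℓ h : ℕ) (hh : 2 * h ≤ ℓ) (v : ZLat d) :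
    (inner ℓ h v).card = (ℓ - 2 * h) ^ d := by
  unfold inner
  rw [Fintype.card_piFinset]
  have : ∀ k : Fin d, (Ico ((ℓ : ℤ) * v k + h) ((ℓ : ℤ) * v k + ℓ - h)).card =
      ℓ - 2 * h := by
    intro k
    rw [Int.card_Ico]
    omega
  simp [this]

lemma exists_coord (v w : ZLat d) (h : v ≠ w) : ∃ k, (supD v w : ℤ) = |v k - w k| := by
  by_contra hc
  push Not at hc
  have h1 := supD_pos v w h
  have : supD v w ≤ supD v w - 1 := by
    refine (supD_le_iff v w _).2 fun k => ?_
    have h2 := abs_sub_le_supD v w k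
    have h3 := hc k
    rw [Nat.cast_sub h1]
    push_cast
    omega
  omega

lemma supD_cubes (ℓ : ℕ) (v w x y : ZLat d) (hx : x ∈ cube ℓ v)
    (hy : y ∈ cube ℓ w) : ℓ * supD v w ≤ supD x y + ℓ := by
  by_cases hvw : v = w
  · subst hvw; rw [supD_self]; simp
  obtain ⟨k, hk⟩ := exists_coord v w hvw
  have h1 := abs_sub_le_supD x y k
  have hx' := (mem_cube ℓ v x).1 hx k
  have hy' := (mem_cube ℓ w y).1 hy k
  have h1' := abs_le.1 h1
  zify
  rw [hk]
  rcases abs_cases (v k - w k) with ⟨e, _⟩ | ⟨e, _⟩ <;> rw [e] <;> ring_nf at * <;> linarith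

lemma cube_disjoint (ℓ : ℕ) (v w : ZLat d) (h : v ≠ w) : Disjoint (cube ℓ v) (cube ℓ w) := by
  rw [disjoint_left]
  intro x hx hy
  obtain ⟨k, hk⟩ : ∃ k, v k ≠ w k := by
    by_contra hc; push Not at hc; exact h (funext hc)
  have hx' := (mem_cube ℓ v x).1 hx k
  have hy' := (mem_cube ℓ w x).1 hy k
  rcases lt_or_gt_of_ne hk with hlt | hlt
  · nlinarith
  · nlinarith

lemma ediv_eq_of_mem_cube (ℓ : ℕ) (v x : ZLat d) (hx : x ∈ cube ℓ v) (k : Fin d) :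
    x k / (ℓ : ℤ) = v k := by
  have h := (mem_cube ℓ v x).1 hx k
  have ha : (0 : ℤ) < ℓ := by linarith
  rw [mul_comm] at h
  exact le_antisymm (Int.lt_add_one_iff.1 ((Int.ediv_lt_iff_lt_mul ha).2 (by linarith)))
    ((Int.le_ediv_iff_mul_le ha).2 h.1)

lemma reg_iff (ℓ0 : ℕ) (h0 : 0 < ℓ0) (Δ : ℱ[d]) :
    Reg ℓ0 Δ ↔ ∀ x y, (∀ k, x k / (ℓ0 : ℤ) = y k / (ℓ0 : ℤ)) → x ∈ Δ → y ∈ Δ := by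
  have hz : (0 : ℤ) < ℓ0 := by exact_mod_cast h0
  have hmem : ∀ x : ZLat d, x ∈ cube ℓ0 fun k => x k / (ℓ0 : ℤ) := by
    intro x
    rw [mem_cube]
    intro k
    have h1 := Int.emod_add_mul_ediv (x k) ℓ0
    have h2 := Int.emod_nonneg (x k) hz.ne'
    have h3 := Int.emod_lt_of_pos (x k) hz
    constructor <;> linarith
  constructor
  · rintro ⟨I, rfl⟩ x y hxy hx
    obtain ⟨i, hi, hxi⟩ := mem_biUnion.1 hx
    refine mem_biUnion.2 ⟨i, hi, ?_⟩
    have : i = fun k => y k / (ℓ0 : ℤ) := by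
      funext k
      rw [← hxy k, ediv_eq_of_mem_cube ℓ0 i x hxi k]
    rw [this]
    exact hmem y
  · intro h
    refine ⟨Δ.image fun x k => x k / (ℓ0 : ℤ), ?_⟩
    ext x
    simp only [cubesRegion, mem_biUnion, mem_image, exists_exists_and_eq_and]
    constructor
    · intro hx
      exact ⟨x, hx, hmem x⟩
    · rintro ⟨y, hy, hxy⟩
      exact h y x (fun k => (ediv_eq_of_mem_cube ℓ0 _ x hxy k).symm) hy

lemma Reg.sdiff {ℓ0 : ℕ} (h0 : 0 < ℓ0) {Δ Δ' : ℱ[d]} (h : Reg ℓ0 Δ)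
    (h' : Reg ℓ0 Δ') : Reg ℓ0 (Δ \ Δ') := by
  rw [reg_iff ℓ0 h0] at *
  intro x y hxy hx
  rw [mem_sdiff] at *
  exact ⟨h x y hxy hx.1, fun hy => hx.2 (h' y x (fun k => (hxy k).symm) hy)⟩

lemma Reg.biUnion {ℓ0 : ℕ} (h0 : 0 < ℓ0) {ι : Type*} (A : Finset ι) (f : ι → ℱ[d])
    (h : ∀ i ∈ A, Reg ℓ0 (f i)) : Reg ℓ0 (A.biUnion f) := by
  rw [reg_iff ℓ0 h0]
  intro x y hxy hx
  obtain ⟨i, hi, hxi⟩ := mem_biUnion.1 hx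
  exact mem_biUnion.2 ⟨i, hi, (reg_iff ℓ0 h0 _).1 (h i hi) x y hxy hxi⟩

lemma reg_inner (ℓ0 : ℕ) (h0 : 0 < ℓ0) (ℓ h : ℕ) (hℓ : ℓ0 ∣ ℓ) (hh : ℓ0 ∣ h) (v : ZLat d) :
    Reg ℓ0 (inner ℓ h v) := by
  have hz : (0 : ℤ) < ℓ0 := by exact_mod_cast h0
  obtain ⟨n, rfl⟩ := hℓ
  obtain ⟨m, rfl⟩ := hh
  rw [reg_iff ℓ0 h0]
  intro x y hxy hx
  rw [mem_inner] at *
  intro k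
  have h1 := hx k
  push_cast at h1 ⊢
  have e1 : (ℓ0 : ℤ) * n * v k + ℓ0 * m = (n * v k + m) * ℓ0 := by ring
  have e2 : (ℓ0 : ℤ) * n * v k + ℓ0 * n - ℓ0 * m = (n * v k + n - m) * ℓ0 := by ring
  rw [e1, e2] at h1 ⊢
  rw [← Int.le_ediv_iff_mul_le hz, ← Int.ediv_lt_iff_lt_mul hz, ← hxy k,
    Int.le_ediv_iff_mul_le hz, Int.ediv_lt_iff_lt_mul hz]
  exact h1

lemma reg_shell (ℓ0 : ℕ) (h0 : 0 < ℓ0) (ℓ h : ℕ) (hℓ : ℓ0 ∣ ℓ) (hh : ℓ0 ∣ h) (v : ZLat d) :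
    Reg ℓ0 (shell ℓ h v) := by
  unfold shell
  rw [← inner_zero]
  exact (reg_inner ℓ0 h0 ℓ 0 hℓ (dvd_zero _) v).sdiff h0 (reg_inner ℓ0 h0 ℓ h hℓ hh v)

lemma shell_shift (ℓ h : ℕ) (v x : ZLat d) :
    (fun k => x k - (ℓ : ℤ) * v k) ∈ shell ℓ h 0 ↔ x ∈ shell ℓ h v := by
  have e : ∀ h, (fun k => x k - (ℓ : ℤ) * v k) ∈ inner ℓ h 0 ↔ x ∈ inner ℓ h v := by
    intro h
    rw [mem_inner, mem_inner]
    refine forall_congr' fun k => ?_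
    simp only [Pi.zero_apply, mul_zero, zero_add]
    constructor <;> rintro ⟨h1, h2⟩ <;> constructor <;> linarith
  unfold shell
  rw [mem_sdiff, mem_sdiff, e, ← inner_zero, e, ← inner_zero]

/-- The number of occupied sites in a finite set. -/
def cnt (A : ℱ[d]) (η : GConf d) : ℕ := (A.filter fun x => η x = true).card

lemma cnt_congr (A : ℱ[d]) (η ζ : GConf d) (h : ∀ x ∈ A, η x = ζ x) :
    cnt A η = cnt A ζ := by
  unfold cnt
  congr 1
  exact Finset.filter_congr fun x hx => by rw [h x hx]

lemma cnt_le (A : ℱ[d]) (η : GConf d) : cnt A η ≤ A.card := Finset.card_filter_le _ _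

lemma cnt_eq_sum (A : ℱ[d]) (η : GConf d) : (cnt A η : ℝ) = ∑ x ∈ A, occ x η := by
  unfold cnt occ
  rw [Finset.sum_ite]; simp

lemma cnt_union (A B : ℱ[d]) (h : Disjoint A B) (η : GConf d) :
    cnt (A ∪ B) η = cnt A η + cnt B η := by
  unfold cnt
  rw [Finset.filter_union, Finset.card_union_of_disjoint (Finset.disjoint_filter_filter h)]

lemma counts_cnt (T A : ℱ[d]) (h : T ⊆ A) : Counts T (cnt A) := by
  intro x hx η
  have hxA := h hx
  have e : A = insert x (A.erase x) := (Finset.insert_erase hxA).symm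
  have h1 : ∀ v, cnt (A.erase x) (update η x v) = cnt (A.erase x) η := fun v =>
    cnt_congr _ _ _ fun y hy => update_of_ne (Finset.ne_of_mem_erase hy) _ _
  have hd : Disjoint {x} (A.erase x) := by simp
  rw [e, Finset.insert_eq, cnt_union _ _ hd, cnt_union _ _ hd, h1, h1]
  simp [cnt, Finset.filter_singleton]
  ring

lemma shell_read_aux {ℓ h : ℕ} {Γ : ℱ[d]} (s : ↥Γ → ↥(shell ℓ h (0 : ZLat d)) → Bool)
    (x : ↥(shell ℓ h (0 : ZLat d))) (v w : ↥Γ) (e : w = v)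
    (hw : (fun k => (x.1 k + (ℓ : ℤ) * v.1 k) - (ℓ : ℤ) * w.1 k) ∈ shell ℓ h 0) :
    s w ⟨_, hw⟩ = s v x := by
  subst e
  congr 1
  ext k; simp

/-- The block system of the cubes with index in `Γ`. -/
def cubeSys (G : LatticeGas d) (ℓ h : ℕ) (hr : G.r ≤ h) (Γ Λ : ℱ[d]) (τ : GConf d)
    (hΓ : ∀ v ∈ Γ, cube ℓ v ⊆ Λ) :
    BlockSys G ↥Γ (↥(shell ℓ h (0 : ZLat d)) → Bool) Λ τ where
  S v := shell ℓ h v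
  Bk v := inner ℓ h v
  rd v η := fun x => η fun k => x.1 k + (ℓ : ℤ) * v.1 k
  conf s x := if hx : ∃ v : ↥Γ, x ∈ shell ℓ h v.1 then
    s hx.choose ⟨_, (shell_shift ℓ h hx.choose.1 x).2 hx.choose_spec⟩ else τ x
  N v := cnt (cube ℓ v)
  rd_conf s v := by
    funext x
    have hx : (fun k => x.1 k + (ℓ : ℤ) * v.1 k) ∈ shell ℓ h v.1 := by
      rw [← shell_shift]; simp
    have hex : ∃ w : ↥Γ, (fun k => x.1 k + (ℓ : ℤ) * v.1 k) ∈ shell ℓ h w.1 := ⟨v, hx⟩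
    dsimp only
    rw [dif_pos hex]
    refine shell_read_aux s x v hex.choose ?_ _
    by_contra hne
    exact disjoint_left.1 (cube_disjoint ℓ hex.choose.1 v.1 fun e => hne (Subtype.ext e))
      (mem_sdiff.1 hex.choose_spec).1 (mem_sdiff.1 hx).1
  rd_iff v η ζ := by
    constructor
    · intro hh x hx
      have := congrFun hh ⟨_, (shell_shift ℓ h v.1 x).2 hx⟩
      simpa using this
    · intro hh
      funext x
      refine hh _ ?_
      rw [← shell_shift]; simp
  conf_off s x hx := dif_neg (by push Not; exact hx)
  subS v := sdiff_subset.trans (hΓ v.1 v.2)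
  subB v := (inner_subset_cube ℓ h v.1).trans (hΓ v.1 v.2)
  disjSB v w := by
    rw [disjoint_left]
    intro x hx hx'
    by_cases e : v = w
    · subst e; exact (mem_sdiff.1 hx).2 hx'
    · exact disjoint_left.1 (cube_disjoint ℓ v.1 w.1 fun e' => e (Subtype.ext e'))
        (mem_sdiff.1 hx).1 (inner_subset_cube ℓ h w.1 hx')
  disjS v w hvw := disjoint_of_subset_left sdiff_subset
    (disjoint_of_subset_right sdiff_subset
      (cube_disjoint ℓ v.1 w.1 fun e' => hvw (Subtype.ext e')))
  disjB v w hvw := disjoint_of_subset_left (inner_subset_cube ℓ h v.1)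
    (disjoint_of_subset_right (inner_subset_cube ℓ h w.1)
      (cube_disjoint ℓ v.1 w.1 fun e' => hvw (Subtype.ext e')))
  near v x hx y hy hxy := by
    refine mem_sdiff.2 ⟨?_, hy⟩
    rw [mem_cube]
    intro k
    have h1 := abs_le.1 ((supD_le_iff x y _).1 hxy k)
    have h2 := (mem_inner ℓ h v.1 x).1 hx k
    have h3 : (G.r : ℤ) ≤ h := by exact_mod_cast hr
    constructor <;> linarith
  N_local v η ζ hh := by
    refine cnt_congr _ _ _ fun x hx => hh x ?_
    by_cases hx' : x ∈ inner ℓ h v.1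
    · exact mem_union_right _ hx'
    · exact mem_union_left _ (mem_sdiff.2 ⟨hx, hx'⟩)

/-- A sparse cubic grid of sites. -/
def grid (ℓ R r a m : ℕ) (v : ZLat d) : ℱ[d] :=
  (Fintype.piFinset fun _ : Fin d => Ico a (a + m)).image fun j k =>
    (ℓ : ℤ) * v k + R + (r + 1 : ℕ) * (j k : ℤ)

lemma card_grid (ℓ R r a m : ℕ) (v : ZLat d) : (grid ℓ R r a m v).card = m ^ d := by
  unfold grid
  rw [Finset.card_image_of_injective]
  · simp [Fintype.card_piFinset]
  · intro j j' hjj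
    funext k
    have := congrFun hjj k
    simp only [add_right_inj, mul_eq_mul_left_iff, Nat.cast_inj, Nat.cast_eq_zero] at this
    rcases this with h | h
    · exact h
    · omega

lemma grid_subset (ℓ R r a m : ℕ) (v : ZLat d) (h : (r + 1) * (a + m) + 2 * R ≤ ℓ) :
    grid ℓ R r a m v ⊆ inner ℓ R v := by
  intro x hx
  obtain ⟨j, hj, rfl⟩ := mem_image.1 hx
  rw [mem_inner]
  intro k
  have h1 := mem_Ico.1 (Fintype.mem_piFinset.1 hj k)
  have h2 : (r + 1) * j k + 1 ≤ (r + 1) * (a + m) := by nlinarith [h1.2]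
  have h3 : ((r + 1 : ℕ) : ℤ) * (j k : ℤ) + 1 + 2 * R ≤ ℓ := by exact_mod_cast by omega
  have h4 : 0 ≤ ((r + 1 : ℕ) : ℤ) * (j k : ℤ) := by positivity
  constructor <;> linarith

lemma grid_sub_grid (ℓ R r a m m' : ℕ) (v : ZLat d) :
    grid ℓ R r a m v ∪ grid ℓ R r (a + m) m' v ⊆ grid ℓ R r a (m + m') v := by
  intro x hx
  rcases mem_union.1 hx with hx | hx <;>
  · obtain ⟨j, hj, rfl⟩ := mem_image.1 hx
    refine mem_image.2 ⟨j, Fintype.mem_piFinset.2 fun k => ?_, rfl⟩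
    have h1 := mem_Ico.1 (Fintype.mem_piFinset.1 hj k)
    rw [mem_Ico]; omega

lemma grid_disjoint (hd : 0 < d) (ℓ R r a m m' : ℕ) (v : ZLat d) :
    Disjoint (grid ℓ R r a m v) (grid ℓ R r (a + m) m' v) := by
  rw [disjoint_left]
  intro x hx hx'
  obtain ⟨j, hj, rfl⟩ := mem_image.1 hx
  obtain ⟨j', hj', e⟩ := mem_image.1 hx'
  have := congrFun e ⟨0, hd⟩
  have h1 := mem_Ico.1 (Fintype.mem_piFinset.1 hj ⟨0, hd⟩)
  have h2 := mem_Ico.1 (Fintype.mem_piFinset.1 hj' ⟨0, hd⟩)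
  simp only [add_right_inj, mul_eq_mul_left_iff, Nat.cast_inj, Nat.cast_eq_zero] at this
  omega

lemma grid_sparse (ℓ R r a m : ℕ) (v : ZLat d) : ∀ x ∈ grid ℓ R r a m v,
    ∀ y ∈ grid ℓ R r a m v, x ≠ y → r < supD x y := by
  intro x hx y hy hxy
  obtain ⟨j, hj, rfl⟩ := mem_image.1 hx
  obtain ⟨j', hj', rfl⟩ := mem_image.1 hy
  obtain ⟨k, hk⟩ : ∃ k, j k ≠ j' k := by
    by_contra hc; push Not at hc; exact hxy (by funext k; simp only [hc k])
  refine Nat.lt_of_add_one_le ?_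
  refine Int.ofNat_le.1 (le_trans ?_ (abs_sub_le_supD _ _ k))
  have e : ((ℓ : ℤ) * v k + R + (r + 1 : ℕ) * (j k : ℤ)) -
      ((ℓ : ℤ) * v k + R + (r + 1 : ℕ) * (j' k : ℤ)) = (r + 1 : ℕ) * ((j k : ℤ) - j' k) := by ring
  rw [e, abs_mul, Nat.abs_cast]
  have h1 : 1 ≤ |(j k : ℤ) - j' k| :=
    Int.one_le_abs (sub_ne_zero.2 (by exact_mod_cast hk))
  have h2 : (0 : ℤ) ≤ ((r + 1 : ℕ) : ℤ) := by positivity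
  nlinarith

end geometry

section jumps

variable {d : ℕ} {G : LatticeGas d} {ℓ0 : ℕ} {b C : ℝ}

lemma abs_sub_mean_le {ι : Type*} [Fintype ι] (p : ι → ℝ) (hp0 : ∀ a, 0 ≤ p a)
    (hp1 : ∑ a, p a = 1) (x : ℝ) (y : ι → ℝ) :
    |x - ∑ a, p a * y a| ≤ ∑ a, p a * |x - y a| := by
  have e : x - ∑ a, p a * y a = ∑ a, p a * (x - y a) := by
    simp only [mul_sub]
    rw [sum_sub_distrib, ← sum_mul, hp1, one_mul]
  rw [e]
  refine (abs_sum_le_sum_abs _ _).trans (sum_le_sum fun a _ => ?_)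
  rw [abs_mul, abs_of_nonneg (hp0 a)]

lemma sum_abs_quad {ι : Type*} (S : Finset ι) (p p' q q' : ι → ℝ) :
    ∑ n ∈ S, |p' n - q' n| ≤
      ∑ n ∈ S, |p n - q n| + ∑ n ∈ S, |q' n - q n| + ∑ n ∈ S, |p' n - p n| := by
  rw [← sum_add_distrib, ← sum_add_distrib]
  refine sum_le_sum fun n _ => ?_
  have e : p' n - q' n = (p n - q n) + -(q' n - q n) + (p' n - p n) := by ring
  rw [e]
  refine (abs_add_le _ _).trans (add_le_add ((abs_add_le _ _).trans (add_le_add le_rfl ?_)) le_rfl)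
  rw [abs_neg]

lemma Infl.tv_le (hC : Infl G ℓ0 b C) (Δ : ℱ[d]) (hreg : Reg ℓ0 Δ)
    (N : GConf d → ℕ) (M : ℕ) (T Y : ℱ[d])
    (hN : ∀ η ζ, (∀ x ∈ T, η x = ζ x) → N η = N ζ) (hTY : Disjoint T Y) (ξ ξ' : GConf d)
    (h : ∀ x, x ∉ Δ → x ∉ Y → ξ' x = ξ x) :
    ∑ n ∈ range (M + 1),
      |𝔼[G] Δ ξ' 𝟙[N, n] -
        𝔼[G] Δ ξ 𝟙[N, n]| ≤ C * Jsum b T Y := by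
  refine tv_le_of_test G Δ Δ ξ ξ' N M _ fun H hH => ?_
  set ξ'' : GConf d := fun x => if x ∈ Δ then ξ x else ξ' x with hξ
  have h1 : AgreeOff Δ ξ'' ξ' := fun x hx => by simp [hξ, hx]
  rw [gibbsExp_congr_bc _ Δ ξ'' ξ' h1]
  have h2 : AgreeOff Y ξ ξ'' := fun x hx => by
    by_cases hxΔ : x ∈ Δ
    · simp [hξ, hxΔ]
    · simp [hξ, hxΔ, h x hxΔ hx]
  have := hC Δ hreg (fun η => H (N η)) T Y 1 ξ ξ'' (fun σ τ hh => by
    simp only [hN σ τ hh]) (fun η => hH _) hTY h2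
  rwa [mul_one] at this

variable {V α : Type} [Fintype V] [Fintype α]
  {Λ : ℱ[d]} {τ : GConf d} (bs : BlockSys G V α Λ τ) (rk : V → ℕ)

lemma BlockSys.conf_congr (s s' : V → α) (x : ZLat d) (h : ∀ v, x ∈ bs.S v → s v = s' v) :
    bs.conf s x = bs.conf s' x := by
  by_cases hv : ∃ v, x ∈ bs.S v
  · obtain ⟨v, hv⟩ := hv
    refine (bs.rd_iff v (bs.conf s) (bs.conf s')).1 ?_ x hv
    rw [bs.rd_conf, bs.rd_conf, h v hv]
  · push Not at hv
    rw [bs.conf_off s x hv, bs.conf_off s' x hv]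

lemma BlockSys.jump_far (hC : Infl G ℓ0 b C) (Δ : ℱ[d]) (t : V) (hS : bs.S t ⊆ Δ)
    (hreg : Reg ℓ0 (Δ \ bs.S t)) (N : GConf d → ℕ) (M : ℕ) (T : ℱ[d])
    (hN : ∀ η ζ, (∀ x ∈ T, η x = ζ x) → N η = N ζ) (hTY : Disjoint T (bs.S t)) (s : V → α)
    (a : α) : bs.jump Δ N M t s a ≤ C * Jsum b T (bs.S t) := by
  have hp0 : ∀ a', 0 ≤ 𝔼[G] Δ (bs.conf s)
      (fun η => if bs.rd t η = a' then 1 else 0) := fun a' => gibbsExp_nonneg _ _ _ _ fun η => by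
    split_ifs <;> norm_num
  have hp1 : ∑ a', 𝔼[G] Δ (bs.conf s)
      (fun η => if bs.rd t η = a' then 1 else 0) = 1 := by
    rw [← gibbsExp_sum]
    simp only [bs.sum_rd, gibbsExp_const]
  have h1 : ∀ n, |𝔼[G] (Δ \ bs.S t)
      (bs.conf (update s t a)) 𝟙[N, n] -
      𝔼[G] Δ (bs.conf s) 𝟙[N, n]| ≤
      ∑ a', 𝔼[G] Δ (bs.conf s) (fun η => if bs.rd t η = a' then 1 else 0) *
        |𝔼[G] (Δ \ bs.S t)
          (bs.conf (update s t a)) 𝟙[N, n] -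
        𝔼[G] (Δ \ bs.S t)
          (bs.conf (update s t a')) 𝟙[N, n]| := by
    intro n
    rw [bs.gibbsExp_eq_sum_shell Δ t hS s 𝟙[N, n]]
    exact abs_sub_mean_le _ hp0 hp1 _ _
  refine (sum_le_sum fun n _ => h1 n).trans ?_
  rw [sum_comm]
  simp only [← mul_sum]
  calc _ ≤ ∑ a', (𝔼[G] Δ (bs.conf s)
      (fun η => if bs.rd t η = a' then 1 else 0)) * (C * Jsum b T (bs.S t)) :=
        sum_le_sum fun a' _ => mul_le_mul_of_nonneg_left
          (hC.tv_le _ hreg N M T (bs.S t) hN hTY _ _ fun x _ hx =>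
            bs.conf_congr _ _ _ fun v hv => by
              have : v ≠ t := fun e => hx (e ▸ hv)
              rw [update_of_ne this, update_of_ne this]) (hp0 a')
    _ = _ := by rw [← sum_mul, hp1, one_mul]

lemma BlockSys.jump_sub_le (hC : Infl G ℓ0 b C) (Δ : ℱ[d]) (t : V)
    (hreg : Reg ℓ0 Δ) (hreg' : Reg ℓ0 (Δ \ bs.S t)) (N : GConf d → ℕ) (M : ℕ)
    (T : ℱ[d]) (hN : ∀ η ζ, (∀ x ∈ T, η x = ζ x) → N η = N ζ) (A : Finset V)
    (hTA : Disjoint T (bs.shells A)) (s s' : V → α)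
    (h : ∀ v, bs.S v ⊆ Δ ∨ v ∈ A ∨ s' v = s v) (a : α) :
    bs.jump Δ N M t s' a ≤ bs.jump Δ N M t s a + 2 * (C * Jsum b T (bs.shells A)) := by
  have h1 := hC.tv_le Δ hreg N M T (bs.shells A) hN hTA (bs.conf s) (bs.conf s')
    fun x hx hx' => bs.conf_congr _ _ _ fun v hv => by
      rcases h v with h | h | h
      · exact absurd (h hv) hx
      · exact absurd (mem_biUnion.2 ⟨v, h, hv⟩) hx'
      · exact h
  have h2 := hC.tv_le _ hreg' N M T (bs.shells A) hN hTA (bs.conf (update s t a))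
    (bs.conf (update s' t a))
    fun x hx hx' => bs.conf_congr _ _ _ fun v hv => by
      by_cases e : v = t
      · subst e; simp
      rw [update_of_ne e, update_of_ne e]
      rcases h v with h | h | h
      · exact absurd (mem_sdiff.2 ⟨h hv, disjoint_left.1 (bs.disjS v t e) hv⟩) hx
      · exact absurd (mem_biUnion.2 ⟨v, h, hv⟩) hx'
      · exact h
  have h3 := sum_abs_quad (range (M + 1))
    (fun n => 𝔼[G] (Δ \ bs.S t)
      (bs.conf (update s t a)) 𝟙[N, n])
    (fun n => 𝔼[G] (Δ \ bs.S t)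
      (bs.conf (update s' t a)) 𝟙[N, n])
    (fun n => 𝔼[G] Δ (bs.conf s) 𝟙[N, n])
    (fun n => 𝔼[G] Δ (bs.conf s') 𝟙[N, n])
  unfold BlockSys.jump
  linarith

lemma BlockSys.tv_le_sum_jump (hrk : Injective rk) (v : V) (M : ℕ) (s : V → α) :
    ∑ n ∈ range (M + 1), |bs.WL v (s v) n -
        𝔼[G] Λ τ (fun η => if bs.N v η = n then 1 else 0)| ≤
      ∑ t, bs.jump (bs.lv rk (rk t)) (bs.N v) M t s (s t) := by
  set Lk : ℕ → ℕ → ℝ := fun k n =>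
    𝔼[G] (bs.lv rk k) (bs.conf s) (fun η => if bs.N v η = n then 1 else 0) with hLk
  set X : ℕ := (univ.sup rk) + 1 with hX
  have hend : ∀ n, bs.WL v (s v) n = Lk X n := by
    intro n
    have hlv : bs.lv rk X = Λ \ bs.shells univ := by
      unfold BlockSys.lv
      congr 2
      refine Finset.filter_true_of_mem fun w _ => ?_
      exact Nat.lt_succ_of_le (le_sup (f := rk) (mem_univ w))
    have hsub : bs.Bk v ⊆ bs.lv rk X := hlv ▸ bs.Bk_sub univ v
    simp only [hLk]
    rw [← gibbsExp_gibbsExp G _ (bs.Bk v) hsub]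
    rw [gibbsExp_congr _ _ _ _ (fun _ => bs.WL v (s v) n), gibbsExp_const]
    intro η hη
    exact bs.gibbsExp_bulk v s η (fun x hx => hη x fun hx' => by
      rw [hlv] at hx'
      exact (mem_sdiff.1 hx').2 (mem_biUnion.2 ⟨v, mem_univ _, hx⟩))
      fun k => if k = n then 1 else 0
  have hbeg : ∀ n, 𝔼[G] Λ τ (fun η => if bs.N v η = n then 1 else 0) = Lk 0 n := by
    intro n
    have : bs.lv rk 0 = Λ := by simp [BlockSys.lv, BlockSys.shells]
    simp only [hLk, this]
    refine (gibbsExp_congr_bc _ Λ τ (bs.conf s) (fun x hx => ?_) _).symm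
    exact bs.conf_off s x fun w hw => hx (bs.subS w hw)
  have hjump : ∀ t, ∑ n ∈ range (M + 1), |Lk (rk t + 1) n - Lk (rk t) n| =
      bs.jump (bs.lv rk (rk t)) (bs.N v) M t s (s t) := by
    intro t
    unfold BlockSys.jump
    rw [update_eq_self, ← bs.lv_succ_of_rank rk hrk]
  have htel : ∀ n, |Lk X n - Lk 0 n| ≤ ∑ k ∈ range X, |Lk (k + 1) n - Lk k n| := by
    intro n
    rw [← Finset.sum_range_sub (fun k => Lk k n)]
    exact abs_sum_le_sum_abs _ _
  calc _ ≤ ∑ n ∈ range (M + 1), ∑ k ∈ range X, |Lk (k + 1) n - Lk k n| :=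
        sum_le_sum fun n _ => by rw [hend, hbeg]; exact htel n
    _ = ∑ k ∈ range X, ∑ n ∈ range (M + 1), |Lk (k + 1) n - Lk k n| :=
        sum_comm
    _ = ∑ k ∈ univ.image rk, ∑ n ∈ range (M + 1), |Lk (k + 1) n - Lk k n| := by
        symm
        refine Finset.sum_subset (fun k hk => ?_) fun k _ hk => ?_
        · obtain ⟨t, _, rfl⟩ := mem_image.1 hk
          exact mem_range.2 (Nat.lt_succ_of_le (le_sup (f := rk) (mem_univ t)))
        · refine sum_eq_zero fun n _ => ?_
          simp only [hLk]
          rw [bs.lv_succ_of_not_rank rk k fun t e => hk (mem_image.2 ⟨t, mem_univ _, e⟩)]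
          simp
    _ = _ := by
        rw [sum_image hrk.injOn]
        exact sum_congr rfl fun t _ => hjump t

end jumps

section cubes

variable {d : ℕ}

lemma Jsum_shells_le (b : ℝ) (hb : 0 < b) (ℓ : ℕ) {Γ : ℱ[d]} (S : ↥Γ → ℱ[d])
    (hS : ∀ w, S w ⊆ cube ℓ w.1) (v : ZLat d) (T : ℱ[d]) (hT : T ⊆ cube ℓ v)
    (A : Finset ↥Γ) (k : ℕ) (hA : ∀ w ∈ A, k + 1 ≤ supD v w.1) :
    Jsum b T (A.biUnion S) ≤
      (ℓ : ℝ) ^ d * expConst d (b / 2) * exp (-(b / 2) * (k * ℓ)) := by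
  refine (Jsum_le_of_dist b hb T _ (k * ℓ) fun x hx y hy => ?_).trans ?_
  · obtain ⟨w, hw, hyw⟩ := mem_biUnion.1 hy
    have h1 := supD_cubes ℓ v w.1 x y (hT hx) (hS w hyw)
    have h2 : ℓ * (k + 1) ≤ ℓ * supD v w.1 := Nat.mul_le_mul_left _ (hA w hw)
    have h3 : k * ℓ ≤ supD x y := by nlinarith
    exact_mod_cast h3
  · have h1 : (T.card : ℝ) ≤ (ℓ : ℝ) ^ d := by
      have := card_le_card hT
      rw [card_cube] at this
      exact_mod_cast this
    exact mul_le_mul_of_nonneg_right (mul_le_mul_of_nonneg_right h1 (expConst_nonneg _))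
      (exp_pos _).le

lemma supD_inner (ℓ h R : ℕ) (v x y : ZLat d) (hx : x ∈ inner ℓ R v)
    (hy : y ∉ inner ℓ h v) : (R : ℤ) - h ≤ supD x y := by
  rw [mem_inner] at hx hy
  push Not at hy
  obtain ⟨k, hk⟩ := hy
  have h1 := abs_le.1 (abs_sub_le_supD x y k)
  have h2 := hx k
  by_cases h3 : (ℓ : ℤ) * v k + h ≤ y k
  · have := hk h3; linarith
  · linarith

lemma exists_geom (Γ : ℱ[d]) : ∃ geo : Geom ↥Γ,
    (∀ v w, geo.D v w = supD v.1 w.1) ∧ geo.K = Fintype.card (Fin d → ZMod 3) ∧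
      Injective geo.rk := by
  set e := Fintype.equivFin (Fin d → ZMod 3)
  set e' := Fintype.equivFin ↥Γ
  set col : ↥Γ → ℕ := fun v => (e fun k => ((v.1 k : ℤ) : ZMod 3)).val with hcol
  set n := Fintype.card ↥Γ with hn
  have hidx : ∀ v : ↥Γ, (e' v).val < n := fun v => (e' v).isLt
  have hrk : ∀ x y : ↥Γ, col x * n + (e' x).val < col y * n + (e' y).val → col x ≤ col y := by
    intro x y h
    by_contra hc
    push Not at hc
    have h1 := hidx x
    have h2 := hidx y
    have h3 : (col y + 1) * n ≤ col x * n := Nat.mul_le_mul_right _ hc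
    nlinarith
  refine ⟨{ D := fun v w => supD v.1 w.1
            D_symm := fun v w => supD_comm _ _
            D_tri := fun u v w => supD_tri _ _ _
            D_self := fun v => supD_self _
            K := Fintype.card (Fin d → ZMod 3)
            col := col
            rk := fun v => col v * n + (e' v).val
            col_lt := fun v => (e _).isLt
            col_mono := hrk
            col_sep := fun x y hxy hne => ?_ }, fun v w => rfl, rfl, fun x y hxy => ?_⟩
  · have h1 := e.injective (Fin.ext hxy)
    obtain ⟨k, hk⟩ : ∃ k, x.1 k ≠ y.1 k := by
      by_contra hc; push Not at hc; exact hne (Subtype.ext (funext hc))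
    have h2 := congrFun h1 k
    have h3 := (ZMod.intCast_eq_intCast_iff_dvd_sub _ _ 3).1 h2
    have h4 : (3 : ℤ) ≤ |y.1 k - x.1 k| :=
      Int.le_of_dvd (abs_pos.2 (sub_ne_zero.2 (Ne.symm hk))) ((dvd_abs _ _).2 h3)
    have h5 := abs_sub_le_supD y.1 x.1 k
    rw [supD_comm]
    omega
  · dsimp only at hxy
    have h1 : col x = col y := by
      by_contra hc
      have h1 := hidx x
      have h2 := hidx y
      rcases lt_or_gt_of_ne hc with h | h
      · have h3 : (col x + 1) * n ≤ col y * n := Nat.mul_le_mul_right _ h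
        nlinarith
      · have h3 : (col y + 1) * n ≤ col x * n := Nat.mul_le_mul_right _ h
        nlinarith
    rw [h1] at hxy
    exact e'.injective (Fin.ext (by omega))

lemma card_near (Γ : ℱ[d]) (t : ↥Γ) :
    (univ.filter fun v : ↥Γ => supD v.1 t.1 ≤ 1).card ≤ 3 ^ d := by
  have h1 := card_box t.1 1
  rw [show 2 * 1 + 1 = 3 from rfl] at h1
  rw [← h1]
  refine Finset.card_le_card_of_injOn (fun v => v.1) (fun v hv => ?_)
    Subtype.val_injective.injOn
  have := (mem_filter.1 (mem_coe.1 hv)).2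
  rw [supD_comm] at this
  exact mem_coe.2 ((mem_box _ _ _).2 this)

/-- The bound on positive ratios of finite volume expectations under a change of the boundary
condition. -/
def Ratio (G : LatticeGas d) (ℓ0 : ℕ) (b C : ℝ) : Prop :=
  ∀ (Δ S : ℱ[d]), Reg ℓ0 (Δ \ S) → S ⊆ Δ → ∀ (f : GConf d → ℝ)
    (Y : ℱ[d]) (ξ ξ' : GConf d), LocalOn f S → (∀ η, 0 ≤ f η) →
    Disjoint Δ Y → AgreeOff Y ξ ξ' →
    (1 - C * Jsum b S Y) * 𝔼[G] Δ ξ f ≤ 𝔼[G] Δ ξ' f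

variable {G : LatticeGas d} {V α : Type} [Fintype V] [Fintype α]
  {Λ : ℱ[d]} {τ : GConf d}

/-- A block system whose blocks sit on the vertices of a geometry with spacing `ℓ`. -/
structure BlockSys.Spaced (bs : BlockSys G V α Λ τ) (geo : Geom V) (ℓ0 : ℕ) (b J ℓ : ℝ) :
    Prop where
  posℓ0 : 0 < ℓ0
  regΛ : Reg ℓ0 Λ
  regS : ∀ v, Reg ℓ0 (bs.S v)
  inj : Injective geo.rk
  J0 : 0 ≤ J
  jsum : ∀ v (A : Finset V) (k : ℕ), (∀ w ∈ A, k + 1 ≤ geo.D v w) →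
    Jsum b (bs.S v ∪ bs.Bk v) (bs.shells A) ≤ J * exp (-(b / 2) * (k * ℓ))
  near : ∀ t, (univ.filter fun v => geo.D v t ≤ 1).card ≤ 3 ^ d

variable {bs : BlockSys G V α Λ τ} {geo : Geom V} {ℓ0 : ℕ} {b J ℓ C : ℝ}

lemma BlockSys.Spaced.reg_lv (hs : bs.Spaced geo ℓ0 b J ℓ) (k : ℕ) :
    Reg ℓ0 (bs.lv geo.rk k) :=
  hs.regΛ.sdiff hs.posℓ0 (Reg.biUnion hs.posℓ0 _ _ fun v _ => hs.regS v)

lemma BlockSys.Spaced.reg_lv_sdiff (hs : bs.Spaced geo ℓ0 b J ℓ) (k : ℕ) (t : V) :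
    Reg ℓ0 (bs.lv geo.rk k \ bs.S t) :=
  (hs.reg_lv k).sdiff hs.posℓ0 (hs.regS t)

lemma BlockSys.Spaced.pL_le (hsp : bs.Spaced geo ℓ0 b J ℓ) (hC0 : 0 ≤ C) (hC : Ratio G ℓ0 b C)
    (t : V) (k : ℕ) (s s' : V → α) (hs : geo.Near t k s s') (a : α) :
    (1 - C * (J * exp (-(b / 2) * ((2 + k : ℕ) * ℓ)))) * bs.pL geo.rk t s a ≤
      bs.pL geo.rk t s' a := by
  set A : Finset V := univ.filter fun v => geo.rk v < geo.rk t ∧ 2 + k < geo.D t v with hA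
  set s'' : V → α := fun v => if geo.rk v < geo.rk t then s' v else s v with hs''
  have h1 : bs.pL geo.rk t s' = bs.pL geo.rk t s'' :=
    bs.pL_local geo.rk t s' s'' fun x hx => by simp [hs'', hx]
  have h2 : ∀ v, v ∉ A → s v = s'' v := by
    intro v hv
    simp only [hs'']
    split_ifs with hv'
    · refine hs v hv' ?_
      by_contra hc
      exact hv (mem_filter.2 ⟨mem_univ _, hv', by omega⟩)
    · rfl
  have hdis : Disjoint (bs.lv geo.rk (geo.rk t)) (bs.shells A) := by
    refine disjoint_of_subset_right ?_ Finset.sdiff_disjoint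
    refine Finset.biUnion_subset_biUnion_of_subset_left _ fun v hv => ?_
    exact mem_filter.2 ⟨mem_univ _, (mem_filter.1 hv).2.1⟩
  have h3 := hC (bs.lv geo.rk (geo.rk t)) (bs.S t) (hsp.reg_lv_sdiff (geo.rk t) t)
    (bs.S_sub_lv geo.rk t) (fun η => if bs.rd t η = a then 1 else 0) (bs.shells A) (bs.conf s)
    (bs.conf s'') (fun σ τ hh => by
      have : bs.rd t σ = bs.rd t τ := (bs.rd_iff t σ τ).2 hh
      simp only [this]) (fun η => by split_ifs <;> norm_num) hdis
    (bs.conf_agree A s s'' h2)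
  rw [h1]
  refine le_trans (mul_le_mul_of_nonneg_right ?_ (bs.pL_nonneg geo.rk t s a)) h3
  have h4 := (Jsum_mono b subset_union_left (Finset.Subset.refl _)).trans
    (hsp.jsum t A (2 + k) fun w hw => (mem_filter.1 hw).2.2)
  have := mul_le_mul_of_nonneg_left h4 hC0
  linarith

end cubes

section spaced

variable {d : ℕ} {G : LatticeGas d} {V α : Type} [Fintype V] [Fintype α]
  {Λ : ℱ[d]} {τ : GConf d} {bs : BlockSys G V α Λ τ} {geo : Geom V} {ℓ0 : ℕ}
  {b J ℓ C : ℝ}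

lemma Jsum_biUnion {ι : Type*} (b : ℝ) (T : ℱ[d]) (A : Finset ι)
    (S : ι → ℱ[d]) (hS : ∀ v ∈ A, ∀ w ∈ A, v ≠ w → Disjoint (S v) (S w)) :
    Jsum b T (A.biUnion S) = ∑ v ∈ A, Jsum b T (S v) := by
  unfold Jsum
  rw [sum_comm]
  rw [Finset.sum_biUnion fun v hv w hw hvw => hS v hv w hw hvw]
  exact sum_congr rfl fun v _ => sum_comm

lemma BlockSys.disj_cell (v w : V) (h : v ≠ w) : Disjoint (bs.S v ∪ bs.Bk v) (bs.S w) :=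
  Finset.disjoint_union_left.2 ⟨bs.disjS v w h, (bs.disjSB w v).symm⟩

lemma BlockSys.S_sub_lv_of_le (rk : V → ℕ) (k : ℕ) (v : V) (h : k ≤ rk v) :
    bs.S v ⊆ bs.lv rk k := by
  intro x hx
  refine mem_sdiff.2 ⟨bs.subS v hx, fun hx' => ?_⟩
  obtain ⟨w, hw, hxw⟩ := mem_biUnion.1 hx'
  have hne : w ≠ v := fun e => by
    subst e
    have := (mem_filter.1 hw).2
    omega
  exact disjoint_left.1 (bs.disjS w v hne) hxw hx

lemma BlockSys.Spaced.tv_le_of_jump_le (hsp : bs.Spaced geo ℓ0 b J ℓ) (hC0 : 0 ≤ C)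
    (hC : Infl G ℓ0 b C) (v : V) (M : ℕ) (s : V → α) (u : ℝ) (hu : 0 ≤ u)
    (h : ∀ t, geo.D v t ≤ 1 → bs.jump (bs.lv geo.rk (geo.rk t)) (bs.N v) M t s (s t) ≤ u) :
    ∑ n ∈ range (M + 1), |bs.WL v (s v) n -
        𝔼[G] Λ τ (fun η => if bs.N v η = n then 1 else 0)| ≤
      3 ^ d * u + C * (J * exp (-(b / 2) * ℓ)) := by
  refine (bs.tv_le_sum_jump geo.rk hsp.inj v M s).trans ?_
  rw [← Finset.sum_filter_add_sum_filter_not univ fun t => geo.D t v ≤ 1]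
  refine add_le_add ?_ ?_
  · refine (sum_le_sum (g := fun _ => u) fun t ht => ?_).trans ?_
    · exact h t (by rw [geo.D_symm]; exact (mem_filter.1 ht).2)
    · rw [sum_const, nsmul_eq_mul]
      exact mul_le_mul_of_nonneg_right (by exact_mod_cast hsp.near v) hu
  · set F := univ.filter fun t => ¬ geo.D t v ≤ 1 with hF
    have hne : ∀ t ∈ F, v ≠ t := by
      rintro t ht rfl
      exact (mem_filter.1 ht).2 (by rw [geo.D_self]; omega)
    calc _ ≤ ∑ t ∈ F, C * Jsum b (bs.S v ∪ bs.Bk v) (bs.S t) :=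
          sum_le_sum fun t ht => bs.jump_far hC _ t (bs.S_sub_lv geo.rk t)
            (hsp.reg_lv_sdiff _ t) (bs.N v) M _ (bs.N_local v) (bs.disj_cell v t (hne t ht)) s _
      _ = C * Jsum b (bs.S v ∪ bs.Bk v) (bs.shells F) := by
          rw [← mul_sum]
          congr 1
          exact (Jsum_biUnion b _ F bs.S fun v _ w _ hvw => bs.disjS v w hvw).symm
      _ ≤ _ := by
          have h1 := hsp.jsum v F 1 fun w hw => by
            have := (mem_filter.1 hw).2
            rw [geo.D_symm]; omega
          rw [Nat.cast_one, one_mul] at h1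
          exact mul_le_mul_of_nonneg_left h1 hC0

lemma BlockSys.Spaced.unsafe_le (hsp : bs.Spaced geo ℓ0 b J ℓ) (hC0 : 0 ≤ C)
    (hC : Infl G ℓ0 b C) (M : ℕ) (u ε : ℝ) (hu : 0 < u)
    (hε : ∀ v t s, ∑ a, bs.pL geo.rk t s a *
      bs.jump (bs.lv geo.rk (geo.rk t)) (bs.N v) M t s a ≤ ε)
    (hJu : 2 * (C * (J * exp (-(b / 2) * ℓ))) ≤ u / 2) (t : V) (s : V → α) :
    ∑ a, (if ∃ s', geo.Near t 0 s s' ∧ ¬ ∀ v, geo.D v t ≤ 1 →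
        bs.jump (bs.lv geo.rk (geo.rk t)) (bs.N v) M t s' a ≤ u then bs.pL geo.rk t s a else 0) ≤
      3 ^ d * (2 / u * ε) := by
  set jp : V → (V → α) → α → ℝ := fun v s a =>
    bs.jump (bs.lv geo.rk (geo.rk t)) (bs.N v) M t s a with hjp
  have hjp0 : ∀ v s a, 0 ≤ jp v s a := fun v s a => bs.jump_nonneg _ _ _ _ _ _
  set F := univ.filter fun v => geo.D v t ≤ 1 with hF
  have hp0 := bs.pL_nonneg geo.rk t s
  have key : ∀ a, (if ∃ s', geo.Near t 0 s s' ∧ ¬ ∀ v, geo.D v t ≤ 1 → jp v s' a ≤ u then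
      bs.pL geo.rk t s a else 0) ≤ ∑ v ∈ F, 2 / u * (bs.pL geo.rk t s a * jp v s a) := by
    intro a
    have hnn : ∀ v ∈ F, 0 ≤ 2 / u * (bs.pL geo.rk t s a * jp v s a) := fun v _ =>
      mul_nonneg (by positivity) (mul_nonneg (hp0 a) (hjp0 v s a))
    split_ifs with hex
    · obtain ⟨s', hs', hv⟩ := hex
      push Not at hv
      obtain ⟨v, hvt, hv⟩ := hv
      set A : Finset V := univ.filter fun w => geo.rk w < geo.rk t ∧ 2 < geo.D t w with hA
      have hAD : ∀ w ∈ A, 1 + 1 ≤ geo.D v w := fun w hw => by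
        have h1 := (mem_filter.1 hw).2.2
        have h2 := geo.D_tri t v w
        rw [geo.D_symm t v] at h2
        omega
      have hdis : Disjoint (bs.S v ∪ bs.Bk v) (bs.shells A) := by
        refine (Finset.disjoint_biUnion_right _ _ _).2 fun w hw => bs.disj_cell v w ?_
        rintro rfl
        have := hAD _ hw
        rw [geo.D_self] at this
        omega
      have h1 := bs.jump_sub_le hC (bs.lv geo.rk (geo.rk t)) t (hsp.reg_lv _)
        (hsp.reg_lv_sdiff _ t) (bs.N v) M _ (bs.N_local v) A hdis s s' (fun w => by
          by_cases hw : geo.rk w < geo.rk t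
          · right
            by_cases hw' : 2 < geo.D t w
            · exact Or.inl (mem_filter.2 ⟨mem_univ _, hw, hw'⟩)
            · exact Or.inr (hs' w hw (by omega)).symm
          · exact Or.inl (bs.S_sub_lv_of_le _ _ _ (by omega))) a
      have h2 := hsp.jsum v A 1 hAD
      rw [Nat.cast_one, one_mul] at h2
      have h3 := mul_le_mul_of_nonneg_left h2 hC0
      have h4 : u / 2 ≤ jp v s a := by
        simp only [hjp] at hv ⊢
        linarith
      have h5 : bs.pL geo.rk t s a ≤ 2 / u * (bs.pL geo.rk t s a * jp v s a) := by
        have h6 : 1 ≤ 2 / u * jp v s a := by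
          rw [div_mul_eq_mul_div, le_div_iff₀ hu]; linarith
        calc bs.pL geo.rk t s a = bs.pL geo.rk t s a * 1 := (mul_one _).symm
          _ ≤ bs.pL geo.rk t s a * (2 / u * jp v s a) := mul_le_mul_of_nonneg_left h6 (hp0 a)
          _ = _ := by ring
      exact h5.trans (single_le_sum hnn
        (mem_filter.2 ⟨mem_univ _, hvt⟩))
    · exact sum_nonneg hnn
  refine (sum_le_sum fun a _ => key a).trans ?_
  rw [sum_comm]
  simp only [← mul_sum]
  have hε0 : 0 ≤ ε := (sum_nonneg fun a _ => mul_nonneg (hp0 a) (hjp0 t s a)).trans (hε t t s)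
  rw [mul_left_comm]
  refine mul_le_mul_of_nonneg_left ?_ (by positivity)
  refine (sum_le_sum (g := fun _ => ε) fun v _ => hε v t s).trans ?_
  rw [sum_const, nsmul_eq_mul]
  exact mul_le_mul_of_nonneg_right (by exact_mod_cast hsp.near t) hε0

end spaced

section spaced

variable {d : ℕ} {G : LatticeGas d} {V α : Type} [Fintype V] [Fintype α] [Nonempty α]
  {Λ : ℱ[d]} {τ : GConf d} {bs : BlockSys G V α Λ τ} {geo : Geom V} {ℓ0 : ℕ}
  {b J ℓ C₁ C₂ : ℝ}

lemma sum_ite_eq_one_of_le {β : Type*} (N : β → ℕ) (M : ℕ) (hN : ∀ η, N η ≤ M) (η : β) :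
    ∑ n ∈ range (M + 1), (if N η = n then (1 : ℝ) else 0) = 1 := by
  rw [sum_ite_eq, if_pos (mem_range.2 (Nat.lt_succ_of_le (hN η)))]

lemma gibbsExp_count_sum (Δ : ℱ[d]) (ξ : GConf d) (N : GConf d → ℕ) (M : ℕ)
    (hN : ∀ η, N η ≤ M) : ∑ n ∈ range (M + 1),
      𝔼[G] Δ ξ 𝟙[N, n] = 1 := by
  rw [← gibbsExp_sum]
  simp only [sum_ite_eq_one_of_le N M hN, gibbsExp_const]

lemma gibbsExp_count_zero (Δ : ℱ[d]) (ξ : GConf d) (N : GConf d → ℕ) (M : ℕ)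
    (hN : ∀ η, N η ≤ M) (n : ℕ) (hn : M < n) :
    𝔼[G] Δ ξ 𝟙[N, n] = 0 := by
  have : (fun η : GConf d => if N η = n then (1 : ℝ) else 0) = fun _ => 0 := by
    funext η
    have := hN η
    rw [if_neg (by omega)]
  rw [this, gibbsExp_const]

lemma gibbsExp_count_nonneg (Δ : ℱ[d]) (ξ : GConf d) (N : GConf d → ℕ) (n : ℕ) :
    0 ≤ 𝔼[G] Δ ξ 𝟙[N, n] :=
  gibbsExp_nonneg _ _ _ _ fun η => by split_ifs <;> norm_num

/-- Decay of correlations for block counts from estimates on a single block. -/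
theorem BlockSys.Spaced.decay (hsp : bs.Spaced geo ℓ0 b J ℓ) (hC₁0 : 0 ≤ C₁)
    (hC₁ : Infl G ℓ0 b C₁) (hC₂0 : 0 ≤ C₂) (hC₂ : Ratio G ℓ0 b C₂) (M : ℕ)
    (hM : ∀ v η, bs.N v η ≤ M) (θ ε u e γ Cs : ℝ) (hθ : 0 < θ) (hε : 0 < ε)
    (hθε : 4 * θ + ε < 1) (hxe : exp (-(b / 2) * ℓ) * exp 4 ≤ 1 / 2)
    (hratio : C₂ * (J * exp (-(b / 2) * (2 * ℓ))) ≤ θ / 2) (hu : 0 < u)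
    (hγ : ∀ v t s, ∑ a, bs.pL geo.rk t s a *
      bs.jump (bs.lv geo.rk (geo.rk t)) (bs.N v) M t s a ≤ γ)
    (hJu : 2 * (C₁ * (J * exp (-(b / 2) * ℓ))) ≤ u / 2)
    (hγθ : 3 ^ d * (2 / u * γ) ≤ θ / 2)
    (he : 3 ^ d * u + C₁ * (J * exp (-(b / 2) * ℓ)) ≤ e)
    (hw : ∀ v, ∃ w0 : ℕ → ℝ, (∀ m, 0 ≤ w0 m) ∧
      (∀ a m, ∑ n ∈ range (M + 1), |bs.WL v a n -
        𝔼[G] Λ τ (fun η => if bs.N v η = n then 1 else 0)| ≤ e →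
          w0 m ≤ bs.WL v a m) ∧ ∑ m ∈ range (M + 1), w0 m = 1 - ε)
    (hCs : ∀ x, ∑ y, exp (-(geo.D x y : ℝ) / 2) ≤ Cs)
    (hsmall : 2 * sqrt (exp (4 * ((2 * geo.K + 2 : ℕ) : ℝ) + 8) * (4 * θ + ε)) * Cs
      ≤ 1 / 2)
    (i j : V) (hij : i ≠ j) (A : Finset (V → ℕ)) (P : Finset V → (V → ℕ) → ℝ)
    (hP : ∀ S m, P S m = 𝔼[G] Λ τ fun η =>
      ∏ v, if v ∈ S then 1 else if bs.N v η = m v then 1 else 0) :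
    ∑ m ∈ A, |P ∅ m * P {i, j} m - P {i} m * P {j} m| / P {i, j} m ≤
      32 * exp (4 * ((2 * geo.K + 2 : ℕ) : ℝ) + 8) * Cs *
        exp (-(geo.D j i : ℝ) / 2) := by
  choose w0 hw0 hw0W hw01 using hw
  have hPf : ∀ S m, P S m = fieldLaw (bs.pL geo.rk) bs.WL S m := fun S m =>
    (hP S m).trans (bs.fieldLaw_eq geo.rk hsp.inj S m).symm
  simp only [hPf]
  have hpow : ∀ k : ℕ, exp (-(b / 2) * ((2 + k : ℕ) * ℓ)) =
      exp (-(b / 2) * (2 * ℓ)) * exp (-(b / 2) * ℓ) ^ k := fun k => by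
    rw [← exp_nat_mul, ← exp_add]
    congr 1; push_cast; ring
  have hbound : ∀ k : ℕ, C₂ * (J * exp (-(b / 2) * ((2 + k : ℕ) * ℓ))) ≤
      θ / 2 * exp (-(b / 2) * ℓ) ^ k := fun k => by
    rw [hpow]
    have := mul_le_mul_of_nonneg_right hratio
      (pow_nonneg (exp_pos (-(b / 2) * ℓ)).le k)
    linarith
  have hPL : ∀ (L : ℕ), 1 ≤ L → (∀ x y, geo.D x y ≤ 2 + L) → _ := fun L hL hD =>
    fieldLaw_decay geo L M hL hD (bs.pL geo.rk) (bs.pL_nonneg geo.rk) (bs.pL_sum geo.rk)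
      (bs.pL_local geo.rk) bs.WL (fun v a m => gibbsExp_count_nonneg _ _ _ _)
      (fun v a => gibbsExp_count_sum _ _ _ M (hM v))
      (fun v a m hm => gibbsExp_count_zero _ _ _ M (hM v) m hm) θ (exp (-(b / 2) * ℓ)) ε hθ
      (exp_pos _) hxe hε hθε
  refine hPL ((univ.sup fun p : V × V => geo.D p.1 p.2) + 1) (by omega)
    (fun x y => ?_) (fun t s s' a hs => ?_) (fun t k s s' a hs => ?_)
    (fun t a s => ∀ v, geo.D v t ≤ 1 →
        bs.jump (bs.lv geo.rk (geo.rk t)) (bs.N v) M t s a ≤ u)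
    (fun t s => ?_)
    (fun v a => ∑ n ∈ range (M + 1), |bs.WL v a n -
        𝔼[G] Λ τ (fun η => if bs.N v η = n then 1 else 0)| ≤ e)
    (fun v s hs => ?_) w0 hw0 (fun v a m h => hw0W v a m h) hw01 Cs hCs hsmall i j hij A
  · have := le_sup (f := fun p : V × V => geo.D p.1 p.2) (mem_univ (x, y))
    dsimp only at this
    omega
  · refine le_trans (mul_le_mul_of_nonneg_right ?_ (bs.pL_nonneg geo.rk t s a))
      (hsp.pL_le hC₂0 hC₂ t 0 s s' hs a)
    have := hbound 0
    rw [pow_zero] at this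
    linarith
  · refine le_trans (mul_le_mul_of_nonneg_right ?_ (bs.pL_nonneg geo.rk t s a))
      (hsp.pL_le hC₂0 hC₂ t k s s' hs a)
    have h1 := hbound k
    have h2 : 0 ≤ θ / 2 * exp (-(b / 2) * ℓ) ^ k := by positivity
    linarith
  · have h := (hsp.unsafe_le hC₁0 hC₁ M u γ hu hγ hJu t s).trans hγθ
    refine le_trans (le_of_eq (sum_congr rfl fun a _ => ?_)) h
    congr!
  · exact (hsp.tv_le_of_jump_le hC₁0 hC₁ v M s u hu.le fun t ht => hs t ht v ht).trans he

end spaced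

section spaced

variable {d : ℕ} {G : LatticeGas d} {V α : Type} [Fintype V] [Fintype α] [Nonempty α]
  {Λ : ℱ[d]} {τ : GConf d} {bs : BlockSys G V α Λ τ} {geo : Geom V} {ℓ0 : ℕ}
  {b B J ℓ C₁ : ℝ}

lemma SM.var_cnt_le (hb : 0 < b) (hB : 0 < B) (hSM : SM (gasPotH G) ℓ0 b B)
    (Δ : ℱ[d]) (hΔ : Reg ℓ0 Δ) (ξ : GConf d) (T : ℱ[d]) :
    𝔼[G] Δ ξ (fun η => ((cnt T η : ℝ) -
      𝔼[G] Δ ξ (fun η => (cnt T η : ℝ))) ^ 2) ≤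
      (B + 2) * expConst d b * T.card := by
  simp only [cnt_eq_sum]
  exact SM.var_le G hb hB hSM Δ hΔ ξ T

lemma SM.mean_abs_le (hb : 0 < b) (hB : 0 < B) (hSM : SM (gasPotH G) ℓ0 b B)
    (Δ : ℱ[d]) (hΔ : Reg ℓ0 Δ) (ξ : GConf d) (T : ℱ[d]) :
    ∃ c : ℕ, c ≤ T.card ∧ 𝔼[G] Δ ξ (fun η => |(cnt T η : ℝ) - c|) ≤
      sqrt ((B + 2) * expConst d b * T.card) + 1 := by
  set E := 𝔼[G] Δ ξ with hE
  set m := E fun η => (cnt T η : ℝ) with hm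
  have hm0 : 0 ≤ m := gibbsExp_nonneg _ _ _ _ fun η => Nat.cast_nonneg _
  have hmT : m ≤ T.card := by
    have : m ≤ E fun _ => (T.card : ℝ) :=
      gibbsExp_mono _ _ _ _ _ fun η _ => by exact_mod_cast cnt_le T η
    rwa [hE, gibbsExp_const] at this
  refine ⟨⌊m⌋₊, Nat.floor_le_of_le hmT, ?_⟩
  have h1 : E (fun η => |(cnt T η : ℝ) - m|) ≤ sqrt ((B + 2) * expConst d b * T.card) := by
    refine Real.le_sqrt_of_sq_le ?_
    have h2 := gibbsExp_mul_sq_le (gasPotH G) Δ ξ (fun η => |(cnt T η : ℝ) - m|) fun _ => 1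
    simp only [mul_one, one_pow, sq_abs, gibbsExp_const] at h2
    exact h2.trans (SM.var_cnt_le hb hB hSM Δ hΔ ξ T)
  calc E (fun η => |(cnt T η : ℝ) - ⌊m⌋₊|) ≤ E (fun η => |(cnt T η : ℝ) - m| + 1) := by
        refine gibbsExp_mono _ _ _ _ _ fun η _ => ?_
        have h3 := Nat.floor_le hm0
        have h4 := Nat.lt_floor_add_one m
        have h5 : |m - ⌊m⌋₊| ≤ 1 := abs_le.2 ⟨by linarith, by linarith⟩
        have h6 := abs_add_le ((cnt T η : ℝ) - m) (m - ⌊m⌋₊)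
        rw [sub_add_sub_cancel] at h6
        linarith
    _ = E (fun η => |(cnt T η : ℝ) - m|) + 1 := by
        rw [hE, gibbsExp_add, gibbsExp_const]
    _ ≤ _ := by linarith

/-- The expected change of the law of a block count when a shell is revealed. -/
theorem BlockSys.Spaced.mean_jump (hsp : bs.Spaced geo ℓ0 b J ℓ) (hC₁0 : 0 ≤ C₁)
    (hC₁ : Infl G ℓ0 b C₁) (hb : 0 < b) (hB : 0 < B) (hSM : SM (gasPotH G) ℓ0 b B) (M : ℕ)
    (v t : V) (s : V → α) (Q D T : ℱ[d]) (hN : bs.N v = cnt Q) (hDQ : D ⊆ Q)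
    (hTD : T ⊆ D) (hDB : D ⊆ bs.Bk v) (hT : ∀ x ∈ T, ∀ y ∈ T, x ≠ y → G.r < supD x y)
    (ρ : ℝ) (hρ : ∀ x ∈ D, ∀ y, y ∉ bs.Bk v → ρ ≤ supD x y)
    (Θ : ℝ) (hΘ : 0 < Θ) (hΘT : Θ ≤ T.card * pMin G ^ 2) :
    ∑ a, bs.pL geo.rk t s a * bs.jump (bs.lv geo.rk (geo.rk t)) (bs.N v) M t s a ≤
      4 / sqrt Θ * (sqrt ((B + 2) * expConst d b * (Q \ D).card) + 1) +
        C₁ * (D.card * expConst d (b / 2) * exp (-(b / 2) * ρ)) := by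
  obtain ⟨c, hc, hcE⟩ := SM.mean_abs_le hb hB hSM (bs.lv geo.rk (geo.rk t)) (hsp.reg_lv _)
    (bs.conf s) (Q \ D)
  have hDS : Disjoint D (bs.S t) :=
    disjoint_of_subset_left hDB (bs.disjSB t v).symm
  have hNN : bs.N v = fun η => cnt D η + cnt (Q \ D) η := by
    funext η
    rw [hN, ← cnt_union _ _ Finset.disjoint_sdiff, union_sdiff_of_subset hDQ]
  rw [hNN]
  refine (bs.mean_jump_le hC₁ (bs.lv geo.rk (geo.rk t)) t (bs.S_sub_lv geo.rk t)
    (hsp.reg_lv_sdiff _ _) s (cnt D) (cnt (Q \ D)) T D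
    ((hTD.trans hDB).trans (bs.Bk_sub _ v)) hT
    (disjoint_of_subset_left hTD hDS).symm hDS (cnt_congr D) (counts_cnt T D hTD)
    (fun η ζ h => cnt_congr _ _ _ fun x hx => h x fun hxT =>
      (mem_sdiff.1 hx).2 (hTD hxT)) (Q \ D).card c M (cnt_le _) hc Θ hΘ hΘT).trans ?_
  refine add_le_add (mul_le_mul_of_nonneg_left hcE (by positivity))
    (mul_le_mul_of_nonneg_left ?_ hC₁0)
  refine Jsum_le_of_dist b hb D (bs.S t) ρ fun x hx y hy => hρ x hx y fun hyB => ?_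
  exact disjoint_left.1 (bs.disjSB t v) hy hyB

lemma card_window_le (m X : ℝ) (hm : 0 ≤ m) (hX : 0 ≤ X) (S : Finset ℕ) :
    ((S.filter fun n : ℕ => |(n : ℝ) - m| ≤ X).card : ℝ) ≤ 2 * X + 1 := by
  have hsub : (S.filter fun n : ℕ => |(n : ℝ) - m| ≤ X) ⊆ Icc ⌈m - X⌉₊ ⌊m + X⌋₊ := by
    intro n hn
    have h := abs_le.1 (mem_filter.1 hn).2
    exact mem_Icc.2 ⟨Nat.ceil_le.2 (by linarith), Nat.le_floor (by linarith)⟩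
  have h1 := card_le_card hsub
  rw [Nat.card_Icc] at h1
  have h2 : ((⌊m + X⌋₊ : ℕ) : ℝ) ≤ m + X := Nat.floor_le (by positivity)
  have h3 : m - X ≤ (⌈m - X⌉₊ : ℝ) := Nat.le_ceil _
  by_cases h4 : ⌈m - X⌉₊ ≤ ⌊m + X⌋₊ + 1
  · have h5 : (((⌊m + X⌋₊ + 1 - ⌈m - X⌉₊ : ℕ)) : ℝ) = ⌊m + X⌋₊ + 1 - ⌈m - X⌉₊ := by
      rw [Nat.cast_sub h4]; push_cast; ring
    have h6 : ((S.filter fun n : ℕ => |(n : ℝ) - m| ≤ X).card : ℝ) ≤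
      ((⌊m + X⌋₊ + 1 - ⌈m - X⌉₊ : ℕ) : ℝ) := by exact_mod_cast h1
    linarith
  · rw [show ⌊m + X⌋₊ + 1 - ⌈m - X⌉₊ = 0 by omega] at h1
    rw [Nat.le_zero.1 h1]
    push_cast; linarith

lemma gibbsExp_tail_le (Δ : ℱ[d]) (ξ : GConf d) (N : GConf d → ℕ) (m X : ℝ)
    (hX : 0 < X) (S : Finset ℕ) :
    ∑ n ∈ S \ (S.filter fun n : ℕ => |(n : ℝ) - m| ≤ X),
      𝔼[G] Δ ξ 𝟙[N, n] ≤
      𝔼[G] Δ ξ (fun η => ((N η : ℝ) - m) ^ 2) / X ^ 2 := by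
  rw [← gibbsExp_sum, div_eq_inv_mul, ← gibbsExp_const_mul]
  refine gibbsExp_mono _ _ _ _ _ fun η _ => ?_
  rw [sum_ite_eq]
  split_ifs with h
  · have h1 := mem_sdiff.1 h
    have h2 : X < |(N η : ℝ) - m| := by
      by_contra h3
      exact h1.2 (mem_filter.2 ⟨h1.1, not_lt.1 h3⟩)
    rw [← div_eq_inv_mul, one_le_div (by positivity), ← sq_abs ((N η : ℝ) - m)]
    gcongr
  · positivity

/-- The laws of a block count given the typical shells have a large common part. -/
theorem BlockSys.Spaced.common_mass (hsp : bs.Spaced geo ℓ0 b J ℓ)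
    (hb : 0 < b) (hB : 0 < B) (hSM : SM (gasPotH G) ℓ0 b B) (M : ℕ)
    (v : V) (Q T₁ T₂ : ℱ[d]) (hN : bs.N v = cnt Q) (hTQ : T₁ ∪ T₂ ⊆ Q)
    (hTB : T₁ ∪ T₂ ⊆ bs.Bk v) (hdis : Disjoint T₁ T₂)
    (hT : ∀ x ∈ T₁ ∪ T₂, ∀ y ∈ T₁ ∪ T₂, x ≠ y → G.r < supD x y) (hM : Q.card ≤ M)
    (Θ : ℝ) (hΘ : 0 < Θ) (hΘ1 : Θ ≤ T₁.card * pMin G ^ 2) (hΘ2 : Θ ≤ T₂.card * pMin G ^ 2)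
    (A : ℕ) (hA : 0 < A) (e X ε : ℝ) (he : 0 ≤ e) (hX : 0 < X) (hε1 : ε < 1)
    (hε : (2 * X + 1) * (e / A + 2 * A * (4 / Θ)) +
      (B + 2) * expConst d b * Q.card / X ^ 2 ≤ ε) :
    ∃ w0 : ℕ → ℝ, (∀ m, 0 ≤ w0 m) ∧
      (∀ a m, ∑ n ∈ range (M + 1), |bs.WL v a n -
        𝔼[G] Λ τ (fun η => if bs.N v η = n then 1 else 0)| ≤ e →
          w0 m ≤ bs.WL v a m) ∧ ∑ m ∈ range (M + 1), w0 m = 1 - ε := by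
  have hNM : ∀ η, bs.N v η ≤ M := fun η => by rw [hN]; exact (cnt_le _ _).trans hM
  have hcount : Counts (T₁ ∪ T₂) (bs.N v) := by rw [hN]; exact counts_cnt _ _ hTQ
  set m := 𝔼[G] Λ τ fun η => (cnt Q η : ℝ) with hm
  have hm0 : 0 ≤ m := gibbsExp_nonneg _ _ _ _ fun η => Nat.cast_nonneg _
  set w : ℕ → ℝ := fun n =>
    𝔼[G] Λ τ (fun η => if bs.N v η = n then 1 else 0) with hw
  obtain ⟨w0, h0, h1, h2, h3⟩ := exists_common_mass
    (fun a => ∑ n ∈ range (M + 1), |bs.WL v a n - w n| ≤ e) (bs.WL v) w M A hA (4 / Θ) e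
    ((range (M + 1)).filter fun n : ℕ => |(n : ℝ) - m| ≤ X)
    (fun a n => gibbsExp_count_nonneg _ _ _ _) (fun n => gibbsExp_count_nonneg _ _ _ _)
    (fun a n hn => gibbsExp_count_zero _ _ _ M hNM n hn)
    (fun n hn => gibbsExp_count_zero _ _ _ M hNM n hn)
    (fun a n => bath_second G _ _ T₁ T₂ hTB hdis hT _ hcount Θ hΘ hΘ1 hΘ2 n)
    (fun n => bath_second G _ _ T₁ T₂ (hTB.trans (bs.subB v)) hdis hT _ hcount Θ hΘ hΘ1 hΘ2 n)
    he (fun a ha => ha)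
  have hw1 : ∑ n ∈ range (M + 1), w n = 1 := gibbsExp_count_sum _ _ _ M hNM
  have hvar := SM.var_cnt_le hb hB hSM Λ hsp.regΛ τ Q
  have htail := gibbsExp_tail_le (G := G) Λ τ (bs.N v) m X hX (range (M + 1))
  rw [hN] at htail
  have htail' : ∑ n ∈ range (M + 1) \
      ((range (M + 1)).filter fun n : ℕ => |(n : ℝ) - m| ≤ X), w n ≤
      (B + 2) * expConst d b * Q.card / X ^ 2 := by
    simp only [hw, hN]
    exact htail.trans (div_le_div_of_nonneg_right hvar (by positivity))
  have hcard := card_window_le m X hm0 hX.le (range (M + 1))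
  have hcard' : (((range (M + 1)).filter fun n : ℕ => |(n : ℝ) - m| ≤ X).card : ℝ) *
      (e / A + 2 * A * (4 / Θ)) ≤ (2 * X + 1) * (e / A + 2 * A * (4 / Θ)) :=
    mul_le_mul_of_nonneg_right hcard (by positivity)
  set s := ∑ n ∈ range (M + 1), w0 n with hs
  have hs1 : 1 - ε ≤ s := by
    rw [sum_sub_distrib, hw1] at h3
    linarith
  have hs0 : 0 < s := by linarith
  refine ⟨fun n => w0 n * ((1 - ε) / s), fun n => mul_nonneg (h0 n) (by
    apply div_nonneg <;> linarith), fun a n ha => ?_, ?_⟩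
  · refine le_trans (mul_le_of_le_one_right (h0 n) ?_) (h2 a n ha)
    rwa [div_le_one hs0]
  · rw [← sum_mul, ← hs, mul_div_cancel₀ _ hs0.ne']

end spaced

lemma exists_window_scale (V Θ₀ θ : ℝ) (hV : 0 ≤ V) (hΘ₀ : 0 < Θ₀) (hθ : 0 < θ) :
    ∃ e : ℝ, 0 < e ∧ ∃ L₀ : ℝ, ∀ L : ℝ, L₀ ≤ L → ∃ A : ℕ, 0 < A ∧ ∃ X : ℝ, 0 < X ∧
      (2 * X + 1) * (e / A + 2 * A * (4 / (Θ₀ * L))) + V * L / X ^ 2 ≤ θ := by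
  set x : ℝ := 1 + 2 * V / θ with hx
  have hx1 : 1 ≤ x := by rw [hx]; have : 0 ≤ 2 * V / θ := by positivity
                         linarith
  have hx0 : 0 < x := by linarith
  set a : ℝ := θ * Θ₀ / (192 * x) with ha
  have ha0 : 0 < a := by positivity
  set e : ℝ := θ * a / (12 * x) with he
  have he0 : 0 < e := by positivity
  refine ⟨e, he0, max 1 (1 / a ^ 2), fun L hL => ?_⟩
  have hL1 : 1 ≤ L := (le_max_left _ _).trans hL
  have hLa : 1 / a ^ 2 ≤ L := (le_max_right _ _).trans hL
  set s := sqrt L with hs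
  have hs1 : 1 ≤ s := Real.one_le_sqrt.2 hL1
  have hsL : s ^ 2 = L := sq_sqrt (by linarith)
  have has : 1 ≤ a * s := by
    have : 1 ≤ (a * s) ^ 2 := by
      rw [mul_pow, hsL]
      rwa [div_le_iff₀ (by positivity), mul_comm] at hLa
    nlinarith [mul_pos ha0 (by linarith : (0 : ℝ) < s)]
  refine ⟨⌈a * s⌉₊, Nat.ceil_pos.2 (by linarith), x * s, by positivity, ?_⟩
  set A : ℝ := (⌈a * s⌉₊ : ℝ) with hA
  have hA1 : a * s ≤ A := Nat.le_ceil _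
  have hA2 : A ≤ 2 * (a * s) := by
    have := Nat.ceil_lt_add_one (by linarith : 0 ≤ a * s)
    rw [hA]; linarith
  have hA0 : 0 < A := by linarith
  have h1 : e / A ≤ e / (a * s) := by gcongr
  have h2 : 2 * A * (4 / (Θ₀ * L)) ≤ 2 * (2 * (a * s)) * (4 / (Θ₀ * L)) := by gcongr
  have h3 : 2 * (x * s) + 1 ≤ 3 * (x * s) := by nlinarith
  have h4 : (2 * (x * s) + 1) * (e / A + 2 * A * (4 / (Θ₀ * L))) ≤
      3 * (x * s) * (e / (a * s) + 2 * (2 * (a * s)) * (4 / (Θ₀ * L))) := by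
    gcongr
  have h5 : 3 * (x * s) * (e / (a * s) + 2 * (2 * (a * s)) * (4 / (Θ₀ * L))) = θ / 2 := by
    rw [← hsL, he, ha]
    field_simp
    ring
  have h6 : V * L / (x * s) ^ 2 ≤ θ / 2 := by
    rw [mul_pow, hsL, mul_div_mul_right _ _ (by linarith : L ≠ 0), div_le_iff₀ (by positivity)]
    have : x ≤ x ^ 2 := by nlinarith
    have h7 : θ / 2 * x = θ / 2 + V := by rw [hx]; field_simp
    nlinarith
  linarith

lemma exists_fluctuation_scale (V Θ₀ γ : ℝ) (hV : 0 ≤ V) (hΘ₀ : 0 < Θ₀) (hγ : 0 < γ) :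
    ∃ δ : ℝ, 0 < δ ∧ ∃ L₀ : ℝ, ∀ L : ℝ, L₀ ≤ L → ∀ n : ℝ, n ≤ δ * L →
      4 / sqrt (Θ₀ * L) * (sqrt (V * n) + 1) ≤ γ := by
  set q := γ * sqrt Θ₀ / 8 with hq
  have hsΘ : 0 < sqrt Θ₀ := Real.sqrt_pos.2 hΘ₀
  have hq0 : 0 < q := by positivity
  refine ⟨q ^ 2 / (V + 1), by positivity, max 1 ((1 / q) ^ 2), fun L hL n hn => ?_⟩
  have hL1 : 1 ≤ L := (le_max_left _ _).trans hL
  set s := sqrt L with hs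
  have hs1 : 1 ≤ s := Real.one_le_sqrt.2 hL1
  have h1 : 1 ≤ q * s := by
    have : 1 / q ≤ s := Real.le_sqrt_of_sq_le ((le_max_right _ _).trans hL)
    rwa [div_le_iff₀ hq0, mul_comm] at this
  have h2 : sqrt (V * n) ≤ q * s := by
    rw [Real.sqrt_le_left (by positivity), mul_pow, hs, sq_sqrt (by linarith)]
    calc V * n ≤ V * (q ^ 2 / (V + 1) * L) := by gcongr
      _ = V / (V + 1) * (q ^ 2 * L) := by ring
      _ ≤ 1 * (q ^ 2 * L) := by
          refine mul_le_mul_of_nonneg_right ?_ (by positivity)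
          rw [div_le_one (by linarith)]; linarith
      _ = _ := one_mul _
  rw [Real.sqrt_mul hΘ₀.le]
  calc 4 / (sqrt Θ₀ * s) * (sqrt (V * n) + 1)
      ≤ 4 / (sqrt Θ₀ * s) * (q * s + q * s) := by gcongr
    _ = γ := by rw [hq]; field_simp; ring

lemma eventually_pow_mul_exp_le (d : ℕ) (K c a ε : ℝ) (hc : 0 < c) (hε : 0 < ε) :
    ∀ᶠ ℓ : ℕ in Filter.atTop, K * ((ℓ : ℝ) ^ d * exp (-c * ℓ + a)) ≤ ε := by
  have h1 : Filter.Tendsto (fun x : ℝ => x ^ d * exp (-c * x)) Filter.atTop (nhds 0) := by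
    have h := ((Real.tendsto_pow_mul_exp_neg_atTop_nhds_zero d).comp
      (Filter.tendsto_id.const_mul_atTop hc)).const_mul ((c ^ d)⁻¹)
    rw [mul_zero] at h
    refine h.congr fun x => ?_
    simp only [comp, id]
    rw [mul_pow, ← mul_assoc, ← mul_assoc, inv_mul_cancel₀ (pow_pos hc d).ne', one_mul, neg_mul]
  have h2 := ((h1.comp tendsto_natCast_atTop_atTop).const_mul (K * exp a))
  rw [mul_zero] at h2
  filter_upwards [h2.eventually (gt_mem_nhds hε)] with ℓ hℓ
  simp only [comp] at hℓ
  rw [exp_add]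
  linarith

lemma pow_sub_pow_le (d ℓ R : ℕ) (k : ℝ) (hℓ : 0 < ℓ) (hR : 2 * R ≤ ℓ)
    (hRk : (R : ℝ) ≤ k * ℓ) : (ℓ : ℝ) ^ d - ((ℓ - 2 * R : ℕ) : ℝ) ^ d ≤ 2 * d * k * ℓ ^ d := by
  have hℓ' : (0 : ℝ) < ℓ := by exact_mod_cast hℓ
  have hR' : 2 * (R : ℝ) ≤ ℓ := by exact_mod_cast hR
  have h1 : ((ℓ - 2 * R : ℕ) : ℝ) = ℓ * (1 + -(2 * R / ℓ)) := by
    rw [Nat.cast_sub hR]; push_cast; field_simp; ring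
  have h2 : (2 * (R : ℝ) / ℓ) ≤ 1 := by rw [div_le_one hℓ']; exact hR'
  have h3 := one_add_mul_le_pow (a := -(2 * (R : ℝ) / ℓ)) (by linarith) d
  rw [h1, mul_pow]
  have h4 : 2 * (R : ℝ) / ℓ ≤ 2 * k := by
    rw [div_le_iff₀ hℓ']; linarith
  have h5 : (d : ℝ) * (2 * R / ℓ) ≤ d * (2 * k) := by gcongr
  have h6 : (0 : ℝ) < ℓ ^ d := by positivity
  nlinarith

section cubes

variable {d : ℕ}

lemma exists_cubeSys (G : LatticeGas d) (ℓ h : ℕ) (hr : G.r ≤ h) (Γ Λ : ℱ[d])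
    (τ : GConf d) (hΓ : ∀ v ∈ Γ, cube ℓ v ⊆ Λ) :
    ∃ (α : Type) (_ : Fintype α) (_ : Nonempty α) (bs : BlockSys G ↥Γ α Λ τ),
      (∀ v, bs.S v = shell ℓ h v.1) ∧ (∀ v, bs.Bk v = inner ℓ h v.1) ∧
      ∀ v, bs.N v = cnt (cube ℓ v.1) :=
  ⟨_, inferInstance, inferInstance, cubeSys G ℓ h hr Γ Λ τ hΓ, fun _ => rfl, fun _ => rfl,
    fun _ => rfl⟩

lemma spaced_of_cubes {G : LatticeGas d} {ℓ0 ℓ h : ℕ} {b : ℝ} {Γ Λ : ℱ[d]}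
    {τ : GConf d} {α : Type} [Fintype α] (bs : BlockSys G ↥Γ α Λ τ)
    (hS : ∀ v, bs.S v = shell ℓ h v.1) (hBk : ∀ v, bs.Bk v = inner ℓ h v.1) (hb : 0 < b)
    (h0 : 0 < ℓ0) (hℓ : ℓ0 ∣ ℓ) (hh : ℓ0 ∣ h) (hΛ : Reg ℓ0 Λ) (geo : Geom ↥Γ)
    (hD : ∀ v w, geo.D v w = supD v.1 w.1) (hinj : Injective geo.rk) :
    bs.Spaced geo ℓ0 b ((ℓ : ℝ) ^ d * expConst d (b / 2)) ℓ where
  posℓ0 := h0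
  regΛ := hΛ
  regS v := by rw [hS]; exact reg_shell ℓ0 h0 ℓ h hℓ hh v.1
  inj := hinj
  J0 := mul_nonneg (by positivity) (expConst_nonneg _)
  jsum v A k hA := by
    refine Jsum_shells_le b hb ℓ bs.S (fun w => ?_) v.1 _ ?_ A k fun w hw => ?_
    · rw [hS]; exact sdiff_subset
    · rw [hS, hBk]
      exact Finset.union_subset sdiff_subset (inner_subset_cube ℓ h v.1)
    · rw [← hD]; exact hA w hw
  near t := by
    simp only [hD]
    exact card_near Γ t

lemma sum_exp_geom_le {Γ : ℱ[d]} (geo : Geom ↥Γ)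
    (hD : ∀ v w, geo.D v w = supD v.1 w.1) (x : ↥Γ) :
    ∑ y, exp (-(geo.D x y : ℝ) / 2) ≤ expConst d (1 / 2) := by
  have h1 := sum_exp_le (1 / 2) (by norm_num) x.1 Γ
  refine le_trans (le_of_eq ?_) h1
  rw [← Finset.sum_attach Γ]
  refine sum_congr rfl fun y _ => ?_
  rw [hD]
  congr 1; ring

lemma pow_div_le_grid (ℓ r d : ℕ) (P : ℝ) (hP : 0 ≤ P) (hℓ : 8 * (r + 1) ≤ ℓ) :
    P / (8 * (r + 1)) ^ d * (ℓ : ℝ) ^ d ≤ ((ℓ / (4 * (r + 1))) ^ d : ℕ) * P := by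
  have h1 : ℓ < 4 * (r + 1) * (ℓ / (4 * (r + 1)) + 1) := by
    have := Nat.div_add_mod ℓ (4 * (r + 1))
    have := Nat.mod_lt ℓ (show 0 < 4 * (r + 1) by omega)
    rw [mul_add]; omega
  have h2 : (ℓ : ℝ) / (8 * (r + 1)) ≤ (ℓ / (4 * (r + 1)) : ℕ) := by
    have h3 : (ℓ : ℝ) ≤ 4 * (r + 1) * ((ℓ / (4 * (r + 1)) : ℕ) + 1) := by exact_mod_cast h1.le
    have h4 : (8 * (r + 1) : ℝ) ≤ ℓ := by exact_mod_cast hℓ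
    rw [div_le_iff₀ (by positivity)]
    nlinarith
  calc P / (8 * (r + 1)) ^ d * (ℓ : ℝ) ^ d = ((ℓ : ℝ) / (8 * (r + 1))) ^ d * P := by
        rw [div_pow]; ring
    _ ≤ _ := by
        push_cast
        gcongr

lemma card_sdiff_inner_le (ℓ R : ℕ) (k : ℝ) (hℓ : 0 < ℓ) (hR : 2 * R ≤ ℓ)
    (hRk : (R : ℝ) ≤ k * ℓ) (v : ZLat d) :
    ((cube ℓ v \ inner ℓ R v).card : ℝ) ≤ 2 * d * k * (ℓ : ℝ) ^ d := by
  have h1 := Finset.card_sdiff_add_card_eq_card (inner_subset_cube ℓ R v)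
  rw [card_cube, card_inner ℓ R hR] at h1
  have h2 : ((cube ℓ v \ inner ℓ R v).card : ℝ) + ((ℓ - 2 * R : ℕ) : ℝ) ^ d = (ℓ : ℝ) ^ d := by
    rw [← Nat.cast_pow, ← Nat.cast_pow, ← h1, Nat.cast_add]
  have h3 := pow_sub_pow_le d ℓ R k hℓ hR hRk
  linarith

set_option maxHeartbeats 1000000 in
/-- Decay of correlations for the counts of the particles in large blocks, uniformly in the
finite volume and the boundary condition. -/
theorem block_decay (hd : 0 < d) (G : LatticeGas d) {ℓ0 : ℕ} (h0 : 0 < ℓ0) {b B : ℝ}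
    (hb : 0 < b) (hB : 0 < B) (hSM : SM (gasPotH G) ℓ0 b B) :
    ∃ (ℓ₁ : ℕ) (C : ℝ), 1 ≤ ℓ₁ ∧ 0 ≤ C ∧ ∀ ℓ : ℕ, ℓ₁ ≤ ℓ → ℓ0 ∣ ℓ →
      ∀ (Γ Λ : ℱ[d]) (τ : GConf d), Reg ℓ0 Λ → (∀ v ∈ Γ, cube ℓ v ⊆ Λ) →
      ∀ (i j : ↥Γ), i ≠ j → ∀ (A : Finset (↥Γ → ℕ)) (P : Finset ↥Γ → (↥Γ → ℕ) → ℝ),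
      (∀ S m, P S m = 𝔼[G] Λ τ fun η =>
        ∏ v : ↥Γ, if v ∈ S then 1 else if cnt (cube ℓ v.1) η = m v then 1 else 0) →
      ∑ m ∈ A, |P ∅ m * P {i, j} m - P {i} m * P {j} m| / P {i, j} m ≤
        C * exp (-(supD j.1 i.1 : ℝ) / 2) := by
  obtain ⟨C₁, hC₁0, hC₁⟩ := exists_bc_influence G hb hB hSM
  obtain ⟨C₂, hC₂0, hC₂⟩ := exists_bc_ratio G hb hB hSM
  set K := Fintype.card (Fin d → ZMod 3) with hK
  set q := exp (4 * ((2 * K + 2 : ℕ) : ℝ) + 8) with hq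
  have hq1 : 1 ≤ q := one_le_exp (by positivity)
  set Cs := expConst d (1 / 2) with hCs
  have hCs0 : 0 ≤ Cs := expConst_nonneg _
  set θ : ℝ := 1 / (80 * q * (Cs + 1) ^ 2) with hθ
  have hθ0 : 0 < θ := by positivity
  have hθ1 : 4 * θ + θ < 1 := by
    have : θ ≤ 1 / 80 := by
      rw [hθ]
      refine one_div_le_one_div_of_le (by norm_num) ?_
      nlinarith [mul_nonneg (by linarith : 0 ≤ q - 1) (sq_nonneg (Cs + 1)), sq_nonneg Cs]
    linarith
  have hsmall : 2 * sqrt (q * (4 * θ + θ)) * Cs ≤ 1 / 2 := by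
    have h1 : q * (4 * θ + θ) = (1 / (4 * (Cs + 1))) ^ 2 := by
      rw [hθ]; field_simp; ring
    rw [h1, Real.sqrt_sq (by positivity)]
    rw [← sub_nonneg]
    have : 1 / 2 - 2 * (1 / (4 * (Cs + 1))) * Cs = 1 / (2 * (Cs + 1)) := by field_simp; ring
    rw [this]; positivity
  set Ec := expConst d (b / 2) with hEc
  have hEc0 : 0 ≤ Ec := expConst_nonneg _
  set Vc := (B + 2) * expConst d b with hVc
  have hVc0 : 0 ≤ Vc := mul_nonneg (by linarith) (expConst_nonneg _)
  have hpm := pMin_pos G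
  set Θ₀ : ℝ := pMin G ^ 2 / (8 * (G.r + 1)) ^ d with hΘ₀
  have hΘ₀0 : 0 < Θ₀ := by positivity
  obtain ⟨e, he0, L₁, hL₁⟩ := exists_window_scale Vc Θ₀ θ hVc0 hΘ₀0 hθ0
  set u := e / (2 * 3 ^ d) with hu
  have hu0 : 0 < u := by positivity
  set γ := θ * u / (4 * 3 ^ d) with hγ
  have hγ0 : 0 < γ := by positivity
  obtain ⟨δ, hδ0, L₂, hL₂⟩ := exists_fluctuation_scale Vc Θ₀ (γ / 2) hVc0 hΘ₀0 (half_pos hγ0)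
  obtain ⟨k₀, hk₀⟩ := exists_nat_ge (4 + 2 * d / δ)
  have hk4 : 4 ≤ k₀ := by
    have : (0 : ℝ) ≤ 2 * d / δ := by positivity
    exact_mod_cast (by linarith : (4 : ℝ) ≤ k₀)
  have hk0 : (0 : ℝ) < k₀ := by exact_mod_cast (by omega : 0 < k₀)
  have hkδ : 2 * d * (1 / (k₀ : ℝ)) ≤ δ := by
    have : 2 * d / δ ≤ (k₀ : ℝ) := by linarith
    rw [div_le_iff₀ hδ0] at this
    rw [mul_one_div, div_le_iff₀ hk0]; linarith
  set h : ℕ := ℓ0 * (G.r + 1) with hh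
  have hrh : G.r ≤ h := by rw [hh]; nlinarith
  have hpow : Filter.Tendsto (fun ℓ : ℕ => (ℓ : ℝ) ^ d) Filter.atTop Filter.atTop :=
    (Filter.tendsto_pow_atTop hd.ne').comp tendsto_natCast_atTop_atTop
  have hev := (((((((eventually_pow_mul_exp_le 0 1 (b / 2) 4 (1 / 2) (by positivity)
    (by norm_num)).and (eventually_pow_mul_exp_le d (C₂ * Ec) b 0 (θ / 2) hb (by positivity))).and
    (eventually_pow_mul_exp_le d (C₁ * Ec) (b / 2) 0 (min (u / 4) (e / 2)) (by positivity)
    (by positivity))).and (eventually_pow_mul_exp_le d (C₁ * Ec) (b / (2 * k₀))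
    (b / 2 * (1 + h)) (γ / 2) (by positivity) (by positivity))).and
    (hpow.eventually_ge_atTop L₁)).and (hpow.eventually_ge_atTop L₂)).and
    (Filter.eventually_ge_atTop (k₀ * h + 8 * (G.r + 1))))
  obtain ⟨ℓ₁, hℓ₁⟩ := Filter.eventually_atTop.1 hev
  refine ⟨ℓ₁ + 1, 32 * q * Cs, by omega, by positivity, fun ℓ hℓ hdvd Γ Λ τ hΛ hΓ i j hij A P hP => ?_⟩
  obtain ⟨⟨⟨⟨⟨⟨hE1, hE2⟩, hE3⟩, hE4⟩, hE5⟩, hE6⟩, hE7⟩ := hℓ₁ ℓ (by omega)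
  have hℓ0 : 0 < ℓ := by omega
  have hℓ0' : (0 : ℝ) < ℓ := by exact_mod_cast hℓ0
  obtain ⟨α, iα1, iα2, bs, hS, hBk, hN⟩ := exists_cubeSys G ℓ h hrh Γ Λ τ hΓ
  obtain ⟨geo, hD, hgK, hinj⟩ := exists_geom Γ
  have hsp := spaced_of_cubes bs hS hBk hb h0 hdvd (Dvd.intro _ rfl) hΛ geo hD hinj
  set R := ℓ / k₀ with hR
  have hhR : h ≤ R := by
    rw [hR, Nat.le_div_iff_mul_le (by omega)]
    rw [mul_comm] at hE7; nlinarith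
  have hR4 : 4 * R ≤ ℓ := (Nat.mul_le_mul_right R hk4).trans (Nat.mul_div_le ℓ k₀)
  have hRk : (R : ℝ) ≤ 1 / k₀ * ℓ := by
    rw [hR, div_mul_eq_mul_div, one_mul]; exact Nat.cast_div_le
  have hRk' : (ℓ : ℝ) / k₀ - 1 ≤ R := by
    have h1 : ℓ < k₀ * (R + 1) := by
      rw [hR]; exact Nat.lt_mul_div_succ ℓ (by omega)
    have h2 : (ℓ : ℝ) ≤ k₀ * (R + 1) := by exact_mod_cast h1.le
    rw [sub_le_iff_le_add, div_le_iff₀ hk0]; linarith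
  set n := ℓ / (4 * (G.r + 1)) with hn
  have hn4 : n * (4 * (G.r + 1)) ≤ ℓ := Nat.div_mul_le_self _ _
  set T₁ : ZLat d → ℱ[d] := fun v => grid ℓ R G.r 0 n v with hT₁
  set T₂ : ZLat d → ℱ[d] := fun v => grid ℓ R G.r (0 + n) n v with hT₂
  have hTR : ∀ v, T₁ v ∪ T₂ v ⊆ inner ℓ R v := fun v =>
    (grid_sub_grid ℓ R G.r 0 n n v).trans (grid_subset ℓ R G.r 0 (n + n) v (by nlinarith))
  set Θ := Θ₀ * (ℓ : ℝ) ^ d with hΘ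
  have hΘ0 : 0 < Θ := by positivity
  have hΘn : Θ ≤ ((n ^ d : ℕ) : ℝ) * pMin G ^ 2 :=
    pow_div_le_grid ℓ G.r d (pMin G ^ 2) (by positivity) (by omega)
  have hRB : ∀ v : ↥Γ, inner ℓ R v.1 ⊆ bs.Bk v := fun v => by
    rw [hBk]; exact inner_mono ℓ hhR v.1
  have hcard : ∀ v : ZLat d, ((cube ℓ v \ inner ℓ R v).card : ℝ) ≤ δ * (ℓ : ℝ) ^ d := by
    intro v
    refine (card_sdiff_inner_le ℓ R (1 / k₀) hℓ0 (by omega) hRk v).trans ?_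
    gcongr
  obtain ⟨a, ha0, X, hX0, hX⟩ := hL₁ _ hE5
  have hE3a := hE3.trans (min_le_left _ _)
  have hE3b := hE3.trans (min_le_right _ _)
  have hgoal := hsp.decay hC₁0 hC₁ hC₂0 hC₂ (ℓ ^ d) (fun v η => by
      rw [hN]; exact (cnt_le _ _).trans (card_cube ℓ v.1).le) θ θ u e γ Cs hθ0 hθ0 hθ1 ?_ ?_ hu0
    (fun v t s => ?_) ?_ ?_ ?_ (fun v => ?_) (sum_exp_geom_le geo hD) (by rw [hgK]; exact hsmall)
    i j hij A P (fun S m => by rw [hP]; simp only [hN])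
  · rw [hgK, hD] at hgoal; convert hgoal
  · rw [pow_zero, one_mul, one_mul, exp_add] at hE1; exact hE1
  · rw [add_zero] at hE2
    rw [show -(b / 2) * (2 * (ℓ : ℝ)) = -b * ℓ by ring]
    linarith
  · refine (hsp.mean_jump hC₁0 hC₁ hb hB hSM (ℓ ^ d) v t s (cube ℓ v.1) (inner ℓ R v.1) (T₁ v.1)
      (hN v) (inner_subset_cube ℓ R v.1) (Finset.union_subset_left (hTR v.1)) (hRB v)
      (grid_sparse ℓ R G.r 0 n v.1) ((R : ℝ) - h) (fun x hx y hy => ?_) Θ hΘ0 ?_).trans ?_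
    · rw [hBk] at hy
      exact_mod_cast supD_inner ℓ h R v.1 x y hx hy
    · rw [hT₁]; dsimp only; rw [card_grid]; exact hΘn
    · have h1 := hL₂ _ hE6 _ (hcard v.1)
      have h2 : C₁ * ((inner ℓ R v.1).card * Ec * exp (-(b / 2) * ((R : ℝ) - h))) ≤
          C₁ * Ec * ((ℓ : ℝ) ^ d * exp (-(b / (2 * k₀)) * ℓ + b / 2 * (1 + h))) := by
        have h3 : ((inner ℓ R v.1).card : ℝ) ≤ (ℓ : ℝ) ^ d := by
          have := card_le_card (inner_subset_cube ℓ R v.1)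
          rw [card_cube] at this
          exact_mod_cast this
        have h4 : -(b / 2) * ((R : ℝ) - h) ≤ -(b / (2 * k₀)) * ℓ + b / 2 * (1 + h) := by
          have h5 : -(b / (2 * k₀)) * ℓ + b / 2 * (1 + h) = b / 2 * (1 + h - ℓ / k₀) := by
            field_simp; ring
          rw [h5]
          nlinarith
        calc _ ≤ C₁ * ((ℓ : ℝ) ^ d * Ec * exp (-(b / (2 * k₀)) * ℓ + b / 2 * (1 + h))) := by
              gcongr
          _ = _ := by ring
      linarith
  · rw [add_zero] at hE3a; linarith
  · rw [hγ]; apply le_of_eq; field_simp; ring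
  · rw [add_zero] at hE3b
    have : 3 ^ d * u = e / 2 := by rw [hu]; field_simp
    linarith
  · refine hsp.common_mass hb hB hSM (ℓ ^ d) v (cube ℓ v.1) (T₁ v.1) (T₂ v.1) (hN v)
      ((hTR v.1).trans (inner_subset_cube ℓ R v.1)) ((hTR v.1).trans (hRB v))
      (grid_disjoint hd ℓ R G.r 0 n n v.1) (fun x hx y hy => grid_sparse ℓ R G.r 0 (n + n) v.1 x
        (grid_sub_grid ℓ R G.r 0 n n v.1 hx) y (grid_sub_grid ℓ R G.r 0 n n v.1 hy))
      (card_cube ℓ v.1).le Θ hΘ0 ?_ ?_ a ha0 e X θ he0.le hX0 (by linarith) ?_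
    · rw [hT₁]; dsimp only; rw [card_grid]; exact hΘn
    · rw [hT₂]; dsimp only; rw [card_grid]; exact hΘn
    · rw [card_cube]; push_cast; exact hX

end cubes

section infinite

variable {d : ℕ}

lemma LocalOn.eq_override {f : GConf d → ℝ} {S : ℱ[d]} (h : LocalOn f S)
    (η : GConf d) : f η = f (override S (fun x => η x) fun _ => false) :=
  h _ _ fun x hx => by simp [override, hx]

lemma LocalOn.measurable {f : GConf d → ℝ} {S : ℱ[d]} (h : LocalOn f S) :
    Measurable f := by
  have h1 : f = (fun s : ↥S → Bool => f (override S s fun _ => false)) ∘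
      fun η (x : ↥S) => η x := funext fun η => h.eq_override η
  rw [h1]
  exact (Measurable.of_discrete).comp (measurable_pi_lambda _ fun x => measurable_pi_apply _)

lemma LocalOn.bounded {f : GConf d → ℝ} {S : ℱ[d]} (h : LocalOn f S) :
    ∃ F : ℝ, 0 ≤ F ∧ ∀ η, |f η| ≤ F := by
  refine ⟨∑ s : ↥S → Bool, |f (override S s fun _ => false)|,
    sum_nonneg fun _ _ => abs_nonneg _, fun η => ?_⟩
  rw [h.eq_override η]
  exact single_le_sum (f := fun s : ↥S → Bool => |f (override S s fun _ => false)|)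
    (fun _ _ => abs_nonneg _) (mem_univ _)

lemma LocalOn.integrable {f : GConf d → ℝ} {S : ℱ[d]} (h : LocalOn f S)
    (μ : Measure (GConf d)) [IsFiniteMeasure μ] : Integrable f μ := by
  obtain ⟨F, -, hF⟩ := h.bounded
  exact Integrable.of_bound h.measurable.aestronglyMeasurable F
    (Filter.Eventually.of_forall fun η => hF η)

variable (G : LatticeGas d)

lemma LocalOn.gibbsExp {f : GConf d → ℝ} {S : ℱ[d]} (h : LocalOn f S)
    (Λ : ℱ[d]) :
    LocalOn (fun τ => 𝔼[G] Λ τ f) (S ∪ Λ.biUnion fun x => box x G.r) := by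
  intro σ τ hστ
  refine gibbsExp_congr_near G Λ f σ τ (fun s => h _ _ fun x hx => ?_) fun x hx y _ hxy => ?_
  · unfold override
    split_ifs
    · rfl
    · exact hστ x (mem_union_left _ hx)
  · exact hστ y (mem_union_right _ (mem_biUnion.2 ⟨x, hx, (mem_box x y _).2 hxy⟩))

lemma box_subset_cubesRegion (ℓ0 : ℕ) (h0 : 0 < ℓ0) (n : ℕ) :
    box (0 : ZLat d) n ⊆ cubesRegion ℓ0 (box 0 n) := by
  intro x hx
  rw [mem_box, supD_le_iff] at hx
  have hz : (0 : ℤ) < ℓ0 := by exact_mod_cast h0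
  refine mem_biUnion.2 ⟨fun k => x k / (ℓ0 : ℤ), ?_, ?_⟩
  · rw [mem_box, supD_le_iff]
    intro k
    have h1 := abs_le.1 (hx k)
    simp only [Pi.zero_apply] at h1 ⊢
    rw [abs_le]
    have h2 : -(n : ℤ) ≤ x k / ℓ0 := by
      rw [Int.le_ediv_iff_mul_le hz]; nlinarith [Int.natCast_nonneg n]
    have h3 : x k / (ℓ0 : ℤ) ≤ n := by
      rw [← Int.lt_add_one_iff, Int.ediv_lt_iff_lt_mul hz]; nlinarith
    omega
  · rw [mem_cube]
    intro k
    have h1 := Int.emod_add_mul_ediv (x k) ℓ0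
    have h2 := Int.emod_nonneg (x k) hz.ne'
    have h3 := Int.emod_lt_of_pos (x k) hz
    omega

lemma exists_subset_box (S : ℱ[d]) : ∃ R : ℕ, S ⊆ box 0 R :=
  ⟨S.sup (supD 0), fun _ hx => (mem_box _ _ _).2
    (le_sup (f := supD 0) hx)⟩

lemma gibbsExp_sub_le {ℓ0 : ℕ} (h0 : 0 < ℓ0) {b C : ℝ} (hC0 : 0 ≤ C) (hb : 0 < b)
    (hC : Infl G ℓ0 b C) {f : GConf d → ℝ} {S : ℱ[d]} (h : LocalOn f S) (F : ℝ)
    (hF : ∀ η, |f η| ≤ F) (R n : ℕ) (hR : S ⊆ box 0 R) (hn : R ≤ n) (τ : GConf d) :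
    |𝔼[G] (cubesRegion ℓ0 (box 0 n)) τ f -
      𝔼[G] (cubesRegion ℓ0 (box 0 n)) (fun _ => false) f| ≤
      C * F * (S.card * expConst d (b / 2) * exp (-(b / 2) * ((n : ℝ) - R))) := by
  set Δ := cubesRegion ℓ0 (box (0 : ZLat d) n) with hΔ
  have hbox : box 0 n ⊆ Δ := box_subset_cubesRegion ℓ0 h0 n
  have hRn : box (0 : ZLat d) R ⊆ box 0 n := by
    intro x hx
    rw [mem_box] at hx ⊢
    omega
  set Y := (Δ.biUnion fun x => box x G.r) \ Δ with hY
  have h1 : 𝔼[G] Δ τ f =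
      𝔼[G] Δ (fun x => if x ∈ Y then τ x else false) f := by
    refine gibbsExp_congr_near G Δ f _ _ (fun s => h _ _ fun x hx => ?_) fun x hx y hy hxy => ?_
    · simp [override, hbox (hRn (hR hx))]
    · rw [if_pos]
      rw [hY, mem_sdiff]
      exact ⟨mem_biUnion.2 ⟨x, hx, (mem_box _ _ _).2 hxy⟩, hy⟩
  rw [h1]
  have hF0 : 0 ≤ F := (abs_nonneg _).trans (hF fun _ => false)
  refine (hC Δ ⟨_, hΔ⟩ f S Y F _ _ h hF ?_ ?_).trans ?_
  · rw [disjoint_left]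
    intro x hx hxY
    exact (mem_sdiff.1 hxY).2 (hbox (hRn (hR hx)))
  · intro x hx
    exact if_neg hx
  · refine mul_le_mul_of_nonneg_left (Jsum_le_of_dist b hb S Y _ fun x hx y hy => ?_)
      (by positivity)
    have h2 := (mem_box _ _ _).1 (hR hx)
    have h3 : ¬ supD 0 y ≤ n := fun h => (mem_sdiff.1 hy).2 (hbox ((mem_box _ _ _).2 h))
    have h4 := supD_tri 0 x y
    have h5 : n ≤ R + supD x y := by omega
    have h6 : (n : ℝ) ≤ R + supD x y := by exact_mod_cast h5
    linarith

/-- Finite volume expectations converge to the infinite volume ones. -/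
theorem IsGibbs.tendsto {ℓ0 : ℕ} (h0 : 0 < ℓ0) {b B : ℝ} (hb : 0 < b) (hB : 0 < B)
    (hSM : SM (gasPotH G) ℓ0 b B) (μ : Measure (GConf d)) [IsProbabilityMeasure μ]
    (hμ : IsGibbs (gasPotH G) μ) {f : GConf d → ℝ} {S : ℱ[d]} (h : LocalOn f S) :
    Filter.Tendsto (fun n : ℕ => Paper.gibbsExp (gasPotH G) (cubesRegion ℓ0 (box 0 n))
      (fun _ => false) f) Filter.atTop (nhds (∫ η, f η ∂μ)) := by
  obtain ⟨C, hC0, hC⟩ := exists_bc_influence G hb hB hSM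
  obtain ⟨F, hF0, hF⟩ := h.bounded
  obtain ⟨R, hR⟩ := exists_subset_box S
  rw [tendsto_iff_dist_tendsto_zero]
  refine squeeze_zero' (g := fun n : ℕ => C * F * (S.card * expConst d (b / 2) *
      exp (-(b / 2) * ((n : ℝ) - R)))) (Filter.Eventually.of_forall fun n => dist_nonneg)
    ?_ ?_
  · filter_upwards [Filter.eventually_ge_atTop R] with n hn
    rw [Real.dist_eq, ← hμ (cubesRegion ℓ0 (box 0 n)) f S h, abs_sub_comm]
    have hi := (h.gibbsExp G (cubesRegion ℓ0 (box 0 n))).integrable μ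
    set e := Paper.gibbsExp (gasPotH G) (cubesRegion ℓ0 (box 0 n)) (fun _ => false) f with he
    have h1 : (∫ τ, Paper.gibbsExp (gasPotH G) (cubesRegion ℓ0 (box 0 n)) τ f ∂μ) - e =
        ∫ τ, (Paper.gibbsExp (gasPotH G) (cubesRegion ℓ0 (box 0 n)) τ f - e) ∂μ := by
      rw [integral_sub hi (integrable_const _)]; simp
    rw [h1, ← Real.norm_eq_abs]
    refine (norm_integral_le_of_norm_le_const (Filter.Eventually.of_forall fun τ =>
      gibbsExp_sub_le G h0 hC0 hb hC h F hF R n hR hn τ)).trans ?_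
    simp
  · have h1 : Filter.Tendsto (fun n : ℕ => -(b / 2) * ((n : ℝ) - R)) Filter.atTop
        Filter.atBot := by
      refine Filter.Tendsto.const_mul_atTop_of_neg (by linarith) ?_
      exact Filter.tendsto_atTop_add_const_right _ _ tendsto_natCast_atTop_atTop
    have h2 := (Real.tendsto_exp_atBot.comp h1).const_mul (S.card * expConst d (b / 2))
    have h3 := h2.const_mul (C * F)
    simpa using h3

lemma gibbsExp_shift (Λ : ℱ[d]) (i : ZLat d) (τ : GConf d) (f : GConf d → ℝ) :
    𝔼[G] (Λ.image (· + i)) τ (fun η => f fun x => η (x + i)) =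
      𝔼[G] Λ (fun x => τ (x + i)) f := by
  have hmem : ∀ x : ZLat d, x + i ∈ Λ.image (· + i) ↔ x ∈ Λ := fun x => by simp
  have hH : ∀ η, hamil (gasPotH G) (Λ.image (· + i)) η =
      hamil (gasPotH G) Λ fun x => η (x + i) := by
    intro η
    unfold hamil
    let e : ℱ[d] ≃ ℱ[d] := (Equiv.addRight i).finsetCongr
    have he : ∀ X, e X = X.image (· + i) := fun X => by
      ext x; simp [e]
    rw [← e.tsum_eq]
    refine tsum_congr fun X => ?_
    rw [he, gasPotH_trans, ← Finset.image_inter _ _ (add_left_injective i)]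
    simp only [Finset.image_nonempty]
  let e : ↥Λ ≃ ↥(Λ.image (· + i)) :=
    (Equiv.addRight i).subtypeEquiv fun x => (hmem x).symm
  let E : (↥(Λ.image (· + i)) → Bool) ≃ (↥Λ → Bool) := e.symm.arrowCongr (Equiv.refl _)
  have hE : ∀ σ, (fun x => override (Λ.image (· + i)) σ τ (x + i)) =
      override Λ (E σ) fun x => τ (x + i) := by
    intro σ
    funext x
    unfold override
    by_cases hx : x ∈ Λ
    · rw [dif_pos ((hmem x).2 hx), dif_pos hx]; rfl
    · rw [dif_neg (fun h => hx ((hmem x).1 h)), dif_neg hx]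
  unfold gibbsExp partFun
  congr 1
  · refine Fintype.sum_equiv E _ _ fun σ => ?_
    dsimp only
    rw [hH, hE]
  · refine Fintype.sum_equiv E _ _ fun σ => ?_
    rw [hH, hE]

lemma measurable_shift (i : ZLat d) :
    Measurable fun (η : GConf d) (x : ZLat d) => η (x + i) :=
  measurable_pi_lambda _ fun _ => measurable_pi_apply _

lemma LocalOn.shift {f : GConf d → ℝ} {S : ℱ[d]} (h : LocalOn f S) (i : ZLat d) :
    LocalOn (fun η => f fun x => η (x + i)) (S.image (· + i)) := fun _ _ hst =>
  h _ _ fun _ hx => hst _ (mem_image_of_mem _ hx)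

/-- The infinite volume measure is translation invariant. -/
theorem IsGibbs.integral_shift {ℓ0 : ℕ} (h0 : 0 < ℓ0) {b B : ℝ} (hb : 0 < b) (hB : 0 < B)
    (hSM : SM (gasPotH G) ℓ0 b B) (μ : Measure (GConf d)) [IsProbabilityMeasure μ]
    (hμ : IsGibbs (gasPotH G) μ) {f : GConf d → ℝ} {S : ℱ[d]} (h : LocalOn f S)
    (i : ZLat d) : ∫ η, f (fun x => η (x + i)) ∂μ = ∫ η, f η ∂μ := by
  set μ' := μ.map fun (η : GConf d) (x : ZLat d) => η (x + i) with hμ'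
  have : IsProbabilityMeasure μ' :=
    Measure.isProbabilityMeasure_map (measurable_shift i).aemeasurable
  have hmap : ∀ {g : GConf d → ℝ} {T : ℱ[d]}, LocalOn g T →
      ∫ η, g η ∂μ' = ∫ η, g (fun x => η (x + i)) ∂μ := fun hg =>
    integral_map (measurable_shift i).aemeasurable hg.measurable.aestronglyMeasurable
  have hG' : IsGibbs (gasPotH G) μ' := by
    intro Λ g T hg
    rw [hmap (hg.gibbsExp G Λ), hmap hg, ← hμ (Λ.image (· + i)) _ _ (hg.shift i)]
    refine integral_congr_ae (Filter.Eventually.of_forall fun τ => ?_)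
    exact (gibbsExp_shift G Λ i τ g).symm
  rw [← hmap h]
  exact tendsto_nhds_unique (IsGibbs.tendsto G h0 hb hB hSM μ' hG' h)
    (IsGibbs.tendsto G h0 hb hB hSM μ hμ h)

end infinite

section cylinder

variable {d : ℕ}

/-- The probability of the cylinder of configurations agreeing with `m` on `Γ`. -/
def cyl (P : Measure 𝒩[d]) (Γ : ℱ[d]) (m : 𝒩[d]) : ℝ :=
  P.real {x | ∀ i ∈ Γ, x i = m i}

/-- Dependence on the coordinates in `U` only. -/
def LocalOnN {β : Type*} (g : 𝒩[d] → β) (U : ℱ[d]) : Prop :=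
  ∀ x y : ZLat d → ℕ, (∀ i ∈ U, x i = y i) → g x = g y

/-- Extension by zero. -/
def extZ (U : ℱ[d]) (m : ↥U → ℕ) : ZLat d → ℕ :=
  fun i => if h : i ∈ U then m ⟨i, h⟩ else 0

lemma extZ_mem (U : ℱ[d]) (m : ↥U → ℕ) (i : ↥U) : extZ U m i = m i := by
  simp [extZ]

lemma measurableSet_cyl (Γ : ℱ[d]) (m : 𝒩[d]) :
    MeasurableSet {x : ZLat d → ℕ | ∀ i ∈ Γ, x i = m i} := by
  have : {x : ZLat d → ℕ | ∀ i ∈ Γ, x i = m i} = ⋂ i ∈ Γ, {x | x i = m i} := by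
    ext x; simp
  rw [this]
  exact Finset.measurableSet_biInter _ fun i _ =>
    measurableSet_eq_fun (measurable_pi_apply i) measurable_const

lemma cyl_congr (P : Measure 𝒩[d]) (Γ : ℱ[d]) :
    LocalOnN (cyl P Γ) Γ := by
  intro x y h
  unfold cyl
  congr 1
  ext z
  exact forall₂_congr fun i hi => by rw [h i hi]

lemma cyl_anti (P : Measure 𝒩[d]) [IsFiniteMeasure P] {Γ Γ' : ℱ[d]}
    (h : Γ ⊆ Γ') (m : 𝒩[d]) : cyl P Γ' m ≤ cyl P Γ m :=
  measureReal_mono fun _ hx i hi => hx i (h hi)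

lemma cyl_empty (P : Measure 𝒩[d]) [IsProbabilityMeasure P] (m : 𝒩[d]) :
    cyl P ∅ m = 1 := by
  simp [cyl]

lemma LocalOnN.ae_eq_sum {P : Measure 𝒩[d]} {K : ℕ} (hK : ∀ᵐ x ∂P, ∀ i, x i ≤ K)
    {g : 𝒩[d] → ℝ} {U : ℱ[d]} (hg : LocalOnN g U) :
    g =ᵐ[P] fun x => ∑ m ∈ Fintype.piFinset fun _ : ↥U => range (K + 1),
      {x : ZLat d → ℕ | ∀ i ∈ U, x i = extZ U m i}.indicator (fun _ => g (extZ U m)) x := by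
  filter_upwards [hK] with x hx
  rw [sum_eq_single fun i : ↥U => x i]
  · rw [Set.indicator_of_mem]
    · exact hg _ _ fun i hi => (extZ_mem U (fun i : ↥U => x i) ⟨i, hi⟩).symm
    · intro i hi
      exact (extZ_mem U (fun i : ↥U => x i) ⟨i, hi⟩).symm
  · intro m _ hm
    refine Set.indicator_of_notMem (fun h => hm (funext fun i => ?_)) _
    rw [h i i.2, extZ_mem]
  · intro h
    refine (h (Fintype.mem_piFinset.2 fun i => mem_range.2 ?_)).elim
    exact Nat.lt_succ_of_le (hx i)

lemma LocalOnN.integrable {P : Measure 𝒩[d]} [IsFiniteMeasure P] {K : ℕ}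
    (hK : ∀ᵐ x ∂P, ∀ i, x i ≤ K) {g : 𝒩[d] → ℝ} {U : ℱ[d]}
    (hg : LocalOnN g U) : Integrable g P :=
  (integrable_finsetSum _ fun _ _ =>
    (integrable_const _).indicator (measurableSet_cyl U _)).congr (hg.ae_eq_sum hK).symm

lemma LocalOnN.integral_eq {P : Measure 𝒩[d]} [IsFiniteMeasure P] {K : ℕ}
    (hK : ∀ᵐ x ∂P, ∀ i, x i ≤ K) {g : 𝒩[d] → ℝ} {U : ℱ[d]}
    (hg : LocalOnN g U) : ∫ x, g x ∂P =
      ∑ m ∈ Fintype.piFinset fun _ : ↥U => range (K + 1),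
        cyl P U (extZ U m) * g (extZ U m) := by
  rw [integral_congr_ae (hg.ae_eq_sum hK), integral_finsetSum]
  · refine sum_congr rfl fun m _ => ?_
    rw [integral_indicator_const _ (measurableSet_cyl U _)]
    rfl
  · exact fun m _ => (integrable_const _).indicator (measurableSet_cyl U _)

/-- The properties of the law of the block variables used in constructing the potential. -/
structure BlockLaw (P : Measure 𝒩[d]) (K : ℕ) (κ C c : ℝ) : Prop where
  kpos : 0 < κ
  kone : κ ≤ 1
  Cnn : 0 ≤ C
  cpos : 0 < c
  prob : IsProbabilityMeasure P
  bdd : ∀ᵐ x ∂P, ∀ i, x i ≤ K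
  shift : ∀ (Γ : ℱ[d]) (i : ZLat d) (m : 𝒩[d]),
    cyl P (Γ.image (· + i)) m = cyl P Γ fun j => m (j + i)
  ins : ∀ (Γ : ℱ[d]) (i : ZLat d) (m : 𝒩[d]), m i ≤ K →
    κ * cyl P Γ m ≤ cyl P (insert i Γ) m
  decay : ∀ (Γ : ℱ[d]) (i j : ZLat d), i ∉ Γ → j ∉ Γ → i ≠ j →
    ∫ x, |(log (cyl P (insert i (insert j Γ)) x) - log (cyl P (insert j Γ) x)) -
      (log (cyl P (insert i Γ) x) - log (cyl P Γ x))| ∂P ≤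
      C * exp (-c * supD i j)

lemma abs_log_sub_log_le {a b e : ℝ} (ha : 0 < a) (hb : 0 < b) (hea : e ≤ a) (heb : e ≤ b)
    (he : 0 < e) : |log a - log b| ≤ |a - b| / e := by
  have key : ∀ {a b : ℝ}, 0 < a → 0 < b → e ≤ b → log a - log b ≤ |a - b| / e := by
    intro a b ha hb heb
    rw [← Real.log_div ha.ne' hb.ne']
    refine (Real.log_le_sub_one_of_pos (div_pos ha hb)).trans ?_
    rw [div_sub_one hb.ne']
    refine (div_le_div_of_nonneg_right (le_abs_self _) hb.le).trans ?_
    exact div_le_div_of_nonneg_left (abs_nonneg _) he heb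
  rw [abs_le]
  have h1 := key ha hb heb
  have h2 := key hb ha hea
  rw [abs_sub_comm] at h2
  constructor <;> linarith

end cylinder

section blocks

variable {d : ℕ}

/-- The block occupation numbers. -/
def blk (ℓ : ℕ) (η : GConf d) : ZLat d → ℕ := fun i => cnt (cube ℓ i) η

lemma measurable_cnt (A : ℱ[d]) : Measurable (cnt A) := by
  have h1 : cnt A = (fun s : ↥A → Bool => cnt A (override A s fun _ => false)) ∘
      fun η (x : ↥A) => η x := by
    funext η
    exact cnt_congr _ _ _ fun x hx => by simp [override, hx]
  rw [h1]
  exact (Measurable.of_discrete).comp (measurable_pi_lambda _ fun x => measurable_pi_apply _)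

lemma measurable_blk (ℓ : ℕ) : Measurable (blk (d := d) ℓ) :=
  measurable_pi_lambda _ fun _ => measurable_cnt _

/-- The indicator of the event that the block variables in `Γ` are given by `m`. -/
def blkInd (ℓ : ℕ) (Γ : ℱ[d]) (m : 𝒩[d]) (η : GConf d) : ℝ :=
  if ∀ i ∈ Γ, blk ℓ η i = m i then 1 else 0

lemma local_blkInd (ℓ : ℕ) (Γ : ℱ[d]) (m : 𝒩[d]) :
    LocalOn (blkInd ℓ Γ m) (Γ.biUnion (cube ℓ)) := by
  intro σ τ h
  have : ∀ i ∈ Γ, blk ℓ σ i = blk ℓ τ i := fun i hi =>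
    cnt_congr _ _ _ fun x hx => h x (mem_biUnion.2 ⟨i, hi, hx⟩)
  unfold blkInd
  congr 1
  exact propext (forall₂_congr fun i hi => by rw [this i hi])

lemma cyl_map (μ : Measure (GConf d)) (ℓ : ℕ) (Γ : ℱ[d]) (m : 𝒩[d]) :
    cyl (μ.map (blk ℓ)) Γ m = ∫ η, blkInd ℓ Γ m η ∂μ := by
  have h1 := measurable_blk (d := d) ℓ (measurableSet_cyl Γ m)
  have h2 : blkInd ℓ Γ m = (blk ℓ ⁻¹' {x | ∀ i ∈ Γ, x i = m i}).indicator 1 := by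
    funext η; simp only [blkInd, Set.indicator, Set.mem_preimage, Set.mem_ofPred_eq, Pi.one_apply]
  rw [cyl, map_measureReal_apply (measurable_blk ℓ) (measurableSet_cyl Γ m), h2,
    integral_indicator_one h1]

lemma blk_shift (ℓ : ℕ) (i j : ZLat d) (η : GConf d) :
    blk ℓ (fun x => η (x + (ℓ : ℤ) • i)) j = blk ℓ η (j + i) := by
  unfold blk cnt
  have h : cube ℓ (j + i) = (cube ℓ j).image (· + (ℓ : ℤ) • i) := by
    ext x
    simp only [mem_image, mem_cube, Pi.add_apply]
    constructor
    · intro h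
      refine ⟨x - (ℓ : ℤ) • i, fun k => ?_, by simp⟩
      have := h k
      simp only [Pi.sub_apply, Pi.smul_apply, smul_eq_mul]
      constructor <;> nlinarith
    · rintro ⟨y, hy, rfl⟩ k
      have := hy k
      simp only [Pi.add_apply, Pi.smul_apply, smul_eq_mul]
      constructor <;> nlinarith
  rw [h, Finset.filter_image, Finset.card_image_of_injective _ (add_left_injective _)]

variable (G : LatticeGas d)

lemma exists_cnt_eq (A : ℱ[d]) (k : ℕ) (hk : k ≤ A.card) :
    ∃ σ : GConf d, cnt A σ = k := by
  obtain ⟨T, hT, hc⟩ := Finset.exists_subset_card_eq hk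
  refine ⟨fun x => decide (x ∈ T), ?_⟩
  rw [← hc]
  unfold cnt
  congr 1
  ext x
  simp only [mem_filter, decide_eq_true_eq]
  exact ⟨fun h => h.2, fun h => ⟨hT h, h⟩⟩

lemma cyl_insert_ge (μ : Measure (GConf d)) [IsProbabilityMeasure μ]
    (hμ : IsGibbs (gasPotH G) μ) (ℓ : ℕ) (Γ : ℱ[d]) (i : ZLat d) (m : 𝒩[d])
    (hm : m i ≤ ℓ ^ d) :
    pMin G ^ ℓ ^ d * cyl (μ.map (blk ℓ)) Γ m ≤ cyl (μ.map (blk ℓ)) (insert i Γ) m := by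
  have hp0 : 0 ≤ pMin G ^ ℓ ^ d := pow_nonneg (pMin_pos G).le _
  by_cases hi : i ∈ Γ
  · rw [Finset.insert_eq_of_mem hi]
    exact mul_le_of_le_one_left (measureReal_nonneg) (pow_le_one₀ (pMin_pos G).le (pMin_le_one G))
  rw [cyl_map, cyl_map, ← integral_const_mul,
    ← hμ (cube ℓ i) _ _ (local_blkInd ℓ (insert i Γ) m)]
  refine integral_mono (((local_blkInd ℓ Γ m).integrable μ).const_mul _)
    (((local_blkInd ℓ (insert i Γ) m).gibbsExp G _).integrable μ) fun τ => ?_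
  obtain ⟨σ, hσ⟩ := exists_cnt_eq (cube ℓ i) (m i) (by rwa [card_cube])
  have h1 := pMin_pow_le G (cube ℓ i) τ σ
  rw [card_cube] at h1
  have hout : ∀ η, AgreeOff (cube ℓ i) τ η → blkInd ℓ Γ m η = blkInd ℓ Γ m τ := by
    intro η hη
    refine local_blkInd ℓ Γ m _ _ fun x hx => hη x fun hxi => ?_
    obtain ⟨j, hj, hxj⟩ := mem_biUnion.1 hx
    have hij : i ≠ j := fun h => hi (h ▸ hj)
    exact disjoint_left.1 (cube_disjoint ℓ i j hij) hxi hxj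
  have hnn : ∀ η, 0 ≤ blkInd ℓ Γ m η := fun η => by unfold blkInd; split_ifs <;> norm_num
  calc pMin G ^ ℓ ^ d * blkInd ℓ Γ m τ ≤ blkInd ℓ Γ m τ * 𝔼[G] (cube ℓ i) τ
        fun η => if ∀ x ∈ cube ℓ i, η x = σ x then 1 else 0 := by
        rw [mul_comm]; exact mul_le_mul_of_nonneg_left h1 (hnn τ)
    _ = _ := (gibbsExp_mul_outer _ _ _ _ _ hout).symm
    _ ≤ _ := by
        refine gibbsExp_mono _ _ _ _ _ fun η _ => ?_
        by_cases h : ∀ x ∈ cube ℓ i, η x = σ x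
        · rw [if_pos h, mul_one]
          have h3 : blk ℓ η i = m i := by rw [← hσ]; exact cnt_congr _ _ _ h
          unfold blkInd
          by_cases h4 : ∀ j ∈ Γ, blk ℓ η j = m j
          · rw [if_pos h4, if_pos]
            intro j hj
            rcases mem_insert.1 hj with rfl | hj
            · exact h3
            · exact h4 j hj
          · rw [if_neg h4]; split_ifs <;> norm_num
        · rw [if_neg h, mul_zero]
          unfold blkInd; split_ifs <;> norm_num

end blocks

section decayLimit

variable {d : ℕ}

lemma prod_eq_blkInd (ℓ : ℕ) (U W : ℱ[d]) (hW : W ⊆ U) (S : Finset ↥U)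
    (h : ∀ v : ↥U, v ∈ S ↔ v.1 ∉ W) (m : ↥U → ℕ) (η : GConf d) :
    (∏ v : ↥U, if v ∈ S then (1 : ℝ) else if cnt (cube ℓ v.1) η = m v then 1 else 0) =
      blkInd ℓ W (extZ U m) η := by
  have h1 : ∀ v : ↥U, (if v ∈ S then (1 : ℝ) else if cnt (cube ℓ v.1) η = m v then 1 else 0) =
      if v.1 ∈ W → blk ℓ η v.1 = extZ U m v.1 then 1 else 0 := by
    intro v
    rw [extZ_mem]
    by_cases hv : v ∈ S
    · rw [if_pos hv, if_pos fun h2 => ((h v).1 hv h2).elim]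
    · rw [if_neg hv]
      have h2 : v.1 ∈ W := by by_contra h3; exact hv ((h v).2 h3)
      by_cases h3 : cnt (cube ℓ v.1) η = m v
      · rw [if_pos h3]; exact (if_pos fun _ => h3).symm
      · rw [if_neg h3]; exact (if_neg fun h4 => h3 (h4 h2)).symm
  rw [prod_congr rfl fun v _ => h1 v, Finset.prod_ite_zero, prod_const_one]
  unfold blkInd
  congr 1
  refine propext ⟨fun h2 i hi => h2 ⟨i, hW hi⟩ (mem_univ _) hi, fun h2 v _ hv => h2 v.1 hv⟩

variable (G : LatticeGas d)

/-- The second order differences of the logarithms of the cylinder probabilities decay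
exponentially in mean. -/
theorem exists_cyl_decay (hd : 0 < d) {ℓ0 : ℕ} (h0 : 0 < ℓ0) {b B : ℝ} (hb : 0 < b) (hB : 0 < B)
    (hSM : SM (gasPotH G) ℓ0 b B) (μ : Measure (GConf d)) [IsProbabilityMeasure μ]
    (hμ : IsGibbs (gasPotH G) μ) :
    ∃ (ℓ₁ : ℕ) (C : ℝ), 1 ≤ ℓ₁ ∧ 0 ≤ C ∧ ∀ ℓ, ℓ₁ ≤ ℓ → ℓ0 ∣ ℓ →
      ∀ (Γ : ℱ[d]) (i j : ZLat d), i ∉ Γ → j ∉ Γ → i ≠ j →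
      ∑ m ∈ Fintype.piFinset fun _ : ↥(insert i (insert j Γ)) => range (ℓ ^ d + 1),
        |cyl (μ.map (blk ℓ)) (insert i (insert j Γ)) (extZ _ m) *
            cyl (μ.map (blk ℓ)) Γ (extZ _ m) -
          cyl (μ.map (blk ℓ)) (insert j Γ) (extZ _ m) *
            cyl (μ.map (blk ℓ)) (insert i Γ) (extZ _ m)| /
          cyl (μ.map (blk ℓ)) Γ (extZ _ m) ≤ C * exp (-(supD j i : ℝ) / 2) := by
  obtain ⟨ℓ₁, C, h1, hC0, hC⟩ := block_decay hd G h0 hb hB hSM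
  refine ⟨ℓ₁, C, h1, hC0, fun ℓ hℓ hdvd Γ i j hi hj hij => ?_⟩
  set U := insert i (insert j Γ) with hU
  have hiU : i ∈ U := mem_insert_self _ _
  have hjU : j ∈ U := mem_insert_of_mem (mem_insert_self _ _)
  set A := Fintype.piFinset fun _ : ↥U => range (ℓ ^ d + 1) with hA
  set Pn : ℕ → Finset ↥U → (↥U → ℕ) → ℝ := fun n S m =>
    𝔼[G] (cubesRegion ℓ0 (box 0 n)) (fun _ => false) fun η =>
      ∏ v : ↥U, if v ∈ S then 1 else if cnt (cube ℓ v.1) η = m v then 1 else 0 with hPn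
  have hlim : ∀ (W : ℱ[d]) (_ : W ⊆ U) (S : Finset ↥U)
      (_ : ∀ v : ↥U, v ∈ S ↔ v.1 ∉ W) (m : ↥U → ℕ),
      Filter.Tendsto (fun n => Pn n S m) Filter.atTop
        (nhds (cyl (μ.map (blk ℓ)) W (extZ U m))) := by
    intro W hW S hS m
    rw [cyl_map, hPn]
    simp only [prod_eq_blkInd ℓ U W hW S hS m]
    exact IsGibbs.tendsto G h0 hb hB hSM μ hμ (local_blkInd ℓ W (extZ U m))
  have hΓU : Γ ⊆ U := fun x hx => mem_insert_of_mem (mem_insert_of_mem hx)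
  have hjΓU : insert j Γ ⊆ U := subset_insert _ _
  have hiΓU : insert i Γ ⊆ U := insert_subset hiU hΓU
  have hpos : ∀ m ∈ A, cyl (μ.map (blk ℓ)) Γ (extZ U m) ≠ 0 := by
    intro m hm
    have : IsProbabilityMeasure (μ.map (blk ℓ)) :=
      Measure.isProbabilityMeasure_map (measurable_blk ℓ).aemeasurable
    have key : ∀ W : ℱ[d], W ⊆ U → 0 < cyl (μ.map (blk ℓ)) W (extZ U m) := by
      intro W
      induction W using induction_on with
      | empty => intro _; rw [cyl_empty]; exact one_pos
      | insert k W hk ih =>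
        intro hW
        have h2 := ih ((subset_insert k W).trans hW)
        have hkU := hW (mem_insert_self k W)
        refine lt_of_lt_of_le (mul_pos (pow_pos (pMin_pos G) _) h2)
          (cyl_insert_ge G μ hμ ℓ W k _ ?_)
        rw [extZ_mem U m ⟨k, hkU⟩]
        exact Nat.lt_succ_iff.1 (mem_range.1 (Fintype.mem_piFinset.1 hm _))
    exact (key Γ hΓU).ne'
  refine le_of_tendsto (x := Filter.atTop) (f := fun n => ∑ m ∈ A,
    |Pn n ∅ m * Pn n {⟨i, hiU⟩, ⟨j, hjU⟩} m - Pn n {⟨i, hiU⟩} m * Pn n {⟨j, hjU⟩} m| /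
      Pn n {⟨i, hiU⟩, ⟨j, hjU⟩} m) (tendsto_finsetSum _ fun m hm => ?_) ?_
  · have hl1 := hlim U subset_rfl ∅ (fun v => by simp) m
    have hl2 := hlim Γ hΓU {⟨i, hiU⟩, ⟨j, hjU⟩} (fun v => by
      obtain ⟨v, hv⟩ := v
      simp only [mem_insert, mem_singleton, Subtype.mk.injEq]
      rw [hU, mem_insert, mem_insert] at hv
      constructor
      · rintro (rfl | rfl) <;> assumption
      · intro h; tauto) m
    have hl3 := hlim (insert j Γ) hjΓU {⟨i, hiU⟩} (fun v => by
      obtain ⟨v, hv⟩ := v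
      simp only [mem_insert, mem_singleton, Subtype.mk.injEq]
      rw [hU, mem_insert, mem_insert] at hv
      constructor
      · rintro rfl; tauto
      · intro h; tauto) m
    have hl4 := hlim (insert i Γ) hiΓU {⟨j, hjU⟩} (fun v => by
      obtain ⟨v, hv⟩ := v
      simp only [mem_insert, mem_singleton, Subtype.mk.injEq]
      rw [hU, mem_insert, mem_insert] at hv
      constructor
      · rintro rfl h
        exact h.elim (fun h => hij h.symm) hj
      · intro h; tauto) m
    exact ((hl1.mul hl2).sub (hl3.mul hl4)).abs.div hl2 (hpos m hm)
  · obtain ⟨R, hR⟩ := exists_subset_box (U.biUnion (cube ℓ))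
    filter_upwards [Filter.eventually_ge_atTop R] with n hn
    refine hC ℓ hℓ hdvd U _ (fun _ => false) ⟨_, rfl⟩ (fun v hv x hx => ?_) ⟨i, hiU⟩ ⟨j, hjU⟩
      (fun h => hij (congrArg Subtype.val h)) A (Pn n) fun S m => rfl
    refine box_subset_cubesRegion ℓ0 h0 n ?_
    have := hR (mem_biUnion.2 ⟨v, hv, hx⟩)
    rw [mem_box] at this ⊢
    omega

/-- The law of the block variables satisfies the bounds used to construct the potential. -/
theorem exists_blockLaw (hd : 0 < d) {ℓ0 : ℕ} (h0 : 0 < ℓ0) {b B : ℝ} (hb : 0 < b) (hB : 0 < B)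
    (hSM : SM (gasPotH G) ℓ0 b B) (μ : Measure (GConf d)) [IsProbabilityMeasure μ]
    (hμ : IsGibbs (gasPotH G) μ) :
    ∃ ℓ₁ : ℕ, 1 ≤ ℓ₁ ∧ ∀ ℓ, ℓ₁ ≤ ℓ → ℓ0 ∣ ℓ →
      ∃ κ C c : ℝ, BlockLaw (μ.map (blk ℓ)) (ℓ ^ d) κ C c := by
  obtain ⟨ℓ₁, C, h1, hC0, hC⟩ := exists_cyl_decay G hd h0 hb hB hSM μ hμ
  refine ⟨ℓ₁, h1, fun ℓ hℓ hdvd => ⟨pMin G ^ ℓ ^ d, (pMin G ^ ℓ ^ d)⁻¹ * C, 1 / 2, ?_⟩⟩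
  set κ := pMin G ^ ℓ ^ d with hκ
  have hκ0 : 0 < κ := pow_pos (pMin_pos G) _
  have hκ1 : κ ≤ 1 := pow_le_one₀ (pMin_pos G).le (pMin_le_one G)
  have hP : IsProbabilityMeasure (μ.map (blk ℓ)) :=
    Measure.isProbabilityMeasure_map (measurable_blk ℓ).aemeasurable
  have hins := cyl_insert_ge G μ hμ ℓ
  have hbdd : ∀ᵐ x ∂μ.map (blk ℓ), ∀ i, x i ≤ ℓ ^ d := by
    rw [ae_all_iff]
    intro i
    rw [ae_map_iff (measurable_blk ℓ).aemeasurable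
      (measurableSet_le (measurable_pi_apply i) measurable_const)]
    exact Filter.Eventually.of_forall fun η => (cnt_le _ _).trans (card_cube ℓ i).le
  refine ⟨hκ0, hκ1, by positivity, by norm_num, hP, hbdd, fun Γ i m => ?_, hins,
    fun Γ i j hi hj hij => ?_⟩
  · rw [cyl_map, cyl_map, ← IsGibbs.integral_shift G h0 hb hB hSM μ hμ
      (local_blkInd ℓ Γ fun j => m (j + i)) ((ℓ : ℤ) • i)]
    refine integral_congr_ae (Filter.Eventually.of_forall fun η => ?_)
    simp only [blkInd, blk_shift, Finset.forall_mem_image]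
  · set P := μ.map (blk ℓ) with hPdef
    set U := insert i (insert j Γ) with hU
    have hΓU : Γ ⊆ U := fun x hx => mem_insert_of_mem (mem_insert_of_mem hx)
    have hjΓU : insert j Γ ⊆ U := subset_insert _ _
    have hiΓU : insert i Γ ⊆ U := insert_subset (mem_insert_self _ _) hΓU
    have hloc : LocalOnN (fun x => |(log (cyl P U x) - log (cyl P (insert j Γ) x)) -
        (log (cyl P (insert i Γ) x) - log (cyl P Γ x))|) U := by
      intro x y h
      simp only [cyl_congr P U x y h, cyl_congr P _ x y fun k hk => h k (hjΓU hk),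
        cyl_congr P _ x y fun k hk => h k (hiΓU hk), cyl_congr P _ x y fun k hk => h k (hΓU hk)]
    rw [hloc.integral_eq hbdd]
    have hexp : exp (-(1 / 2) * (supD i j : ℝ)) = exp (-(supD j i : ℝ) / 2) := by
      rw [supD_comm]; congr 1; ring
    rw [hexp, mul_assoc]
    refine le_trans ?_ (mul_le_mul_of_nonneg_left (hC ℓ hℓ hdvd Γ i j hi hj hij) (by positivity))
    rw [mul_sum]
    refine sum_le_sum fun m hm => ?_
    set y := extZ U m with hy
    have hyK : ∀ k, y k ≤ ℓ ^ d := by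
      intro k
      rw [hy, extZ]
      split_ifs with h
      · exact Nat.lt_succ_iff.1 (mem_range.1 (Fintype.mem_piFinset.1 hm _))
      · exact Nat.zero_le _
    have hpos : ∀ W : ℱ[d], 0 < cyl P W y := by
      intro W
      induction W using induction_on with
      | empty => rw [cyl_empty]; exact one_pos
      | insert k W hk ih => exact lt_of_lt_of_le (mul_pos hκ0 ih) (hins W k y (hyK k))
    have ha := hpos U
    have hb' := hpos Γ
    have hc := hpos (insert j Γ)
    have he := hpos (insert i Γ)
    have hlog : (log (cyl P U y) - log (cyl P (insert j Γ) y)) -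
        (log (cyl P (insert i Γ) y) - log (cyl P Γ y)) =
        log (cyl P U y * cyl P Γ y) -
          log (cyl P (insert j Γ) y * cyl P (insert i Γ) y) := by
      rw [log_mul ha.ne' hb'.ne', log_mul hc.ne' he.ne']; ring
    rw [hlog]
    have h3 : cyl P U y * (κ * cyl P Γ y) ≤ cyl P U y * cyl P Γ y :=
      mul_le_mul_of_nonneg_left (mul_le_of_le_one_left hb'.le hκ1) ha.le
    have h4 : cyl P U y * (κ * cyl P Γ y) ≤ cyl P (insert j Γ) y * cyl P (insert i Γ) y := by
      rw [mul_comm (cyl P (insert j Γ) y)]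
      exact mul_le_mul (cyl_anti P hiΓU y) (hins Γ j y (hyK j)) (by positivity) he.le
    refine (mul_le_mul_of_nonneg_left (abs_log_sub_log_le (mul_pos ha hb') (mul_pos hc he) h3 h4
      (by positivity)) ha.le).trans (le_of_eq ?_)
    change _ = κ⁻¹ * (|cyl P U y * cyl P Γ y - cyl P (insert j Γ) y * cyl P (insert i Γ) y| /
      cyl P Γ y)
    field_simp

end decayLimit

lemma ae_summable_of_integral_le {α ι : Type*} [MeasurableSpace α] [Countable ι] {P : Measure α}
    {F : ι → α → ℝ} {e : ι → ℝ} (hF : ∀ i, Integrable (F i) P) (he : ∀ i, ∫ x, |F i x| ∂P ≤ e i)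
    (hs : Summable e) : ∀ᵐ x ∂P, Summable fun i => |F i x| := by
  have hsum : ∑' i, ∫⁻ x, ‖F i x‖ₑ ∂P ≠ ⊤ := by
    have h1 : ∀ i, ∫⁻ x, ‖F i x‖ₑ ∂P = ENNReal.ofReal (∫ x, |F i x| ∂P) := fun i =>
      (ofReal_integral_norm_eq_lintegral_enorm (hF i)).symm
    have h2 := hs.tsum_ofReal_ne_top
    refine ne_top_of_le_ne_top h2 (ENNReal.tsum_le_tsum fun i => ?_)
    rw [h1]
    exact ENNReal.ofReal_le_ofReal (he i)
  rw [← lintegral_tsum fun i => (hF i).1.enorm] at hsum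
  filter_upwards [ae_lt_top' (AEMeasurable.tsum fun i => (hF i).1.enorm) hsum] with x hx
  have h3 : ∀ i, ‖F i x‖ₑ = ((‖F i x‖₊ : NNReal) : ENNReal) := fun i => rfl
  simp only [h3] at hx
  have h4 := ENNReal.tsum_coe_ne_top_iff_summable_coe.1 hx.ne
  simpa using h4

section potential

variable {d : ℕ}

/-- The pair consisting of a centre and a radius gives a box. -/
def bx (p : ZLat d × ℕ) : ℱ[d] := box p.1 p.2

lemma bx_injective (hd : 0 < d) : Injective (bx (d := d)) := by
  rintro ⟨i, n⟩ ⟨j, m⟩ h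
  have key : ∀ (i : ZLat d) (n : ℕ) (j : ZLat d) (m : ℕ), box i n ⊆ box j m →
      ∀ k, i k + n ≤ j k + m ∧ j k - m ≤ i k - n := by
    intro i n j m h k
    have h1 := h ((mem_box i (fun k => i k + n) n).2 ((supD_le_iff _ _ _).2 fun k => by simp))
    have h2 := h ((mem_box i (fun k => i k - n) n).2 ((supD_le_iff _ _ _).2 fun k => by simp))
    rw [mem_box, supD_le_iff] at h1 h2
    have h3 := abs_le.1 (h1 k)
    have h4 := abs_le.1 (h2 k)
    constructor <;> linarith
  have h1 := key i n j m (le_of_eq h)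
  have h2 := key j m i n (le_of_eq h.symm)
  have h3 : n = m := by
    have := h1 ⟨0, hd⟩
    have := h2 ⟨0, hd⟩
    omega
  subst h3
  congr 1
  funext k
  have := h1 k
  have := h2 k
  omega

lemma sum_radius_le (w : ℕ → ℝ) (hw : ∀ n, 0 ≤ w n)
    (hs : Summable fun n : ℕ => ((2 * n + 1 : ℕ) : ℝ) ^ d * w n) (i : ZLat d)
    (S : Finset (ZLat d × ℕ)) (hS : ∀ p ∈ S, i ∈ bx p) :
    ∑ p ∈ S, w p.2 ≤ ∑' n : ℕ, ((2 * n + 1 : ℕ) : ℝ) ^ d * w n := by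
  rw [← Finset.sum_fiberwise_of_maps_to (t := S.image Prod.snd) (g := Prod.snd)
    fun p hp => mem_image_of_mem _ hp]
  refine le_trans (sum_le_sum fun n _ => ?_) (hs.sum_le_tsum (S.image Prod.snd)
    fun n _ => mul_nonneg (by positivity) (hw n))
  rw [sum_congr rfl (g := fun _ => w n) fun p hp => by rw [(mem_filter.1 hp).2],
    sum_const, nsmul_eq_mul]
  refine mul_le_mul_of_nonneg_right ?_ (hw n)
  have h1 : (S.filter fun p => p.2 = n).card ≤ (box i n).card := by
    refine Finset.card_le_card_of_injOn Prod.fst (fun p hp => ?_) fun p hp p' hp' h => ?_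
    · have h2 := mem_filter.1 (mem_coe.1 hp)
      have h3 := hS p h2.1
      rw [bx, mem_box, h2.2] at h3
      rw [mem_coe, mem_box, supD_comm]
      exact h3
    · have h2 := mem_filter.1 (mem_coe.1 hp)
      have h3 := mem_filter.1 (mem_coe.1 hp')
      exact Prod.ext h (h2.2.trans h3.2.symm)
  rw [card_box] at h1
  exact_mod_cast h1

lemma summable_radius (w : ℕ → ℝ) (hw : ∀ n, 0 ≤ w n)
    (hs : Summable fun n : ℕ => ((2 * n + 1 : ℕ) : ℝ) ^ d * w n) (i : ZLat d) :
    Summable (fun p : ZLat d × ℕ => if i ∈ bx p then w p.2 else 0) ∧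
      ∑' p : ZLat d × ℕ, (if i ∈ bx p then w p.2 else 0) ≤
        ∑' n : ℕ, ((2 * n + 1 : ℕ) : ℝ) ^ d * w n := by
  have h1 : ∀ S : Finset (ZLat d × ℕ), ∑ p ∈ S, (if i ∈ bx p then w p.2 else 0) ≤
      ∑' n : ℕ, ((2 * n + 1 : ℕ) : ℝ) ^ d * w n := by
    intro S
    rw [← sum_filter]
    exact sum_radius_le w hw hs i _ fun p hp => (mem_filter.1 hp).2
  have h2 : Summable (fun p : ZLat d × ℕ => if i ∈ bx p then w p.2 else 0) :=
    summable_of_sum_le (fun p => by split_ifs; exacts [hw _, le_rfl]) h1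
  exact ⟨h2, h2.tsum_le_of_sum_le h1⟩

lemma summable_radius_inter (w : ℕ → ℝ) (hw : ∀ n, 0 ≤ w n)
    (hs : Summable fun n : ℕ => ((2 * n + 1 : ℕ) : ℝ) ^ d * w n) (J : ℱ[d]) :
    Summable (fun p : ZLat d × ℕ => if (bx p ∩ J).Nonempty then w p.2 else 0) := by
  refine Summable.of_nonneg_of_le (fun p => by split_ifs; exacts [hw _, le_rfl]) (fun p => ?_)
    (summable_sum (s := J) fun i _ => (summable_radius w hw hs i).1)
  have hnn : ∀ i ∈ J, (0 : ℝ) ≤ if i ∈ bx p then w p.2 else 0 := fun i _ => by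
    split_ifs; exacts [hw _, le_rfl]
  split_ifs with h
  · obtain ⟨i, hi⟩ := h
    rw [mem_inter] at hi
    refine le_trans (le_of_eq ?_) (single_le_sum hnn hi.2)
    rw [if_pos hi.1]
  · exact sum_nonneg hnn

/-- The increment of the logarithm of the cylinder probability when the site `i` is added. -/
def gInc (P : Measure 𝒩[d]) (i : ZLat d) (A : ℱ[d]) (x : 𝒩[d]) : ℝ :=
  log (cyl P (insert i A) x) - log (cyl P A x)

/-- The sites in `T` within distance `n` of `i` which precede `i` lexicographically. -/
def past (T : Set (ZLat d)) (i : ZLat d) (n : ℕ) : ℱ[d] :=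
  (box i n).filter fun j => toLex j < toLex i ∧ j ∈ T

lemma past_mono (T : Set (ZLat d)) (i : ZLat d) {n m : ℕ} (h : n ≤ m) :
    past T i n ⊆ past T i m := by
  intro j hj
  simp only [past, mem_filter, mem_box] at hj ⊢
  exact ⟨hj.1.trans h, hj.2⟩

lemma past_subset (T : Set (ZLat d)) (i : ZLat d) (n : ℕ) : past T i n ⊆ box i n :=
  Finset.filter_subset _ _

lemma notMem_past (T : Set (ZLat d)) (i : ZLat d) (n : ℕ) : i ∉ past T i n :=
  fun h => lt_irrefl _ (mem_filter.1 h).2.1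

/-- The contribution of the box of radius `n` about `i`. -/
def pot (P : Measure 𝒩[d]) (T : Set (ZLat d)) (p : ZLat d × ℕ) (x : 𝒩[d]) : ℝ :=
  gInc P p.1 (past T p.1 p.2) x - if p.2 = 0 then 0 else gInc P p.1 (past T p.1 (p.2 - 1)) x

lemma sum_pot (P : Measure 𝒩[d]) (T : Set (ZLat d)) (i : ZLat d) (n : ℕ)
    (x : 𝒩[d]) : ∑ k ∈ range (n + 1), pot P T (i, k) x = gInc P i (past T i n) x := by
  induction n with
  | zero => simp [pot]
  | succ n ih => rw [sum_range_succ, ih]; simp [pot]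

lemma gInc_local (P : Measure 𝒩[d]) (i : ZLat d) (A : ℱ[d]) :
    LocalOnN (gInc P i A) (insert i A) := by
  intro x y h
  unfold gInc
  rw [cyl_congr P _ x y h, cyl_congr P A x y fun j hj => h j (mem_insert_of_mem hj)]

lemma LocalOnN.mono {β : Type*} {g : 𝒩[d] → β} {U U' : ℱ[d]}
    (h : LocalOnN g U) (hU : U ⊆ U') : LocalOnN g U' :=
  fun x y hxy => h x y fun i hi => hxy i (hU hi)

lemma mem_box_self (i : ZLat d) (n : ℕ) : i ∈ box i n := (mem_box i i n).2 (by simp [supD_self])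

lemma pot_local (P : Measure 𝒩[d]) (T : Set (ZLat d)) (p : ZLat d × ℕ) :
    LocalOnN (pot P T p) (bx p) := by
  have h1 : ∀ m ≤ p.2, LocalOnN (gInc P p.1 (past T p.1 m)) (bx p) := fun m hm =>
    (gInc_local P p.1 _).mono (insert_subset (mem_box_self _ _)
      ((past_mono T p.1 hm).trans (past_subset T p.1 p.2)))
  intro x y h
  unfold pot
  rw [h1 _ le_rfl x y h, h1 _ (Nat.sub_le _ _) x y h]

variable {P : Measure 𝒩[d]} {K : ℕ} {κ C c : ℝ} (hP : BlockLaw P K κ C c)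

include hP

lemma BlockLaw.cyl_pos (Γ : ℱ[d]) (x : 𝒩[d]) (hx : ∀ i, x i ≤ K) :
    0 < cyl P Γ x := by
  have := hP.prob
  induction Γ using induction_on with
  | empty => rw [cyl_empty]; exact one_pos
  | insert i Γ hi ih => exact lt_of_lt_of_le (mul_pos hP.kpos ih) (hP.ins Γ i x (hx i))

lemma BlockLaw.abs_gInc_le (i : ZLat d) (A : ℱ[d]) (x : 𝒩[d])
    (hx : ∀ i, x i ≤ K) : |gInc P i A x| ≤ -log κ := by
  have := hP.prob
  have h1 := hP.cyl_pos A x hx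
  have h2 := hP.cyl_pos (insert i A) x hx
  have h3 := Real.log_le_log (mul_pos hP.kpos h1) (hP.ins A i x (hx i))
  have h4 := Real.log_le_log h2 (cyl_anti P (subset_insert i A) x)
  rw [log_mul hP.kpos.ne' h1.ne'] at h3
  unfold gInc
  rw [abs_of_nonpos (by linarith)]
  linarith

lemma BlockLaw.abs_pot_le (T : Set (ZLat d)) (p : ZLat d × ℕ) (x : 𝒩[d])
    (hx : ∀ i, x i ≤ K) : |pot P T p x| ≤ 2 * -log κ := by
  have h1 := hP.abs_gInc_le p.1 (past T p.1 p.2) x hx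
  have h2 := hP.abs_gInc_le p.1 (past T p.1 (p.2 - 1)) x hx
  unfold pot
  rw [abs_le] at *
  split_ifs
  · constructor <;> linarith
  · constructor <;> linarith

lemma BlockLaw.integral_gInc_sub_le (i : ZLat d) (A D : ℱ[d]) (n : ℕ)
    (hi : i ∉ A ∪ D) (hD : ∀ j ∈ D, n ≤ supD i j) :
    ∫ x, |gInc P i (A ∪ D) x - gInc P i A x| ∂P ≤ D.card * (C * exp (-c * n)) := by
  have := hP.prob
  have hitg : ∀ A B : ℱ[d], Integrable (fun x => |gInc P i A x - gInc P i B x|) P := by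
    intro A B
    refine LocalOnN.integrable hP.bdd (U := insert i A ∪ insert i B) fun x y h => ?_
    rw [gInc_local P i A x y fun k hk => h k (mem_union_left _ hk),
      gInc_local P i B x y fun k hk => h k (mem_union_right _ hk)]
  have hE : 0 ≤ C * exp (-c * n) := mul_nonneg hP.Cnn (exp_pos _).le
  induction D using induction_on with
  | empty => simp
  | insert j D hj ih =>
    have hi' : i ∉ A ∪ D := fun h => hi (by
      rw [union_insert]; exact mem_insert_of_mem h)
    have h1 := ih hi' fun k hk => hD k (mem_insert_of_mem hk)
    rw [Finset.card_insert_of_notMem hj, union_insert]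
    by_cases hjA : j ∈ A ∪ D
    · rw [Finset.insert_eq_of_mem hjA]
      refine h1.trans (mul_le_mul_of_nonneg_right ?_ hE)
      push_cast; linarith
    have hij : i ≠ j := fun h => hi (by rw [union_insert, h]; exact mem_insert_self _ _)
    have h2 := hP.decay (A ∪ D) i j hi' hjA hij
    have h3 : C * exp (-c * supD i j) ≤ C * exp (-c * n) := by
      refine mul_le_mul_of_nonneg_left (exp_le_exp.2 ?_) hP.Cnn
      have : (n : ℝ) ≤ supD i j := by exact_mod_cast hD j (mem_insert_self _ _)
      nlinarith [hP.cpos]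
    calc ∫ x, |gInc P i (insert j (A ∪ D)) x - gInc P i A x| ∂P ≤
        ∫ x, (|gInc P i (insert j (A ∪ D)) x - gInc P i (A ∪ D) x| +
          |gInc P i (A ∪ D) x - gInc P i A x|) ∂P :=
          integral_mono (hitg _ _) ((hitg _ _).add (hitg _ _)) fun x => abs_sub_le _ _ _
      _ ≤ C * exp (-c * n) + D.card * (C * exp (-c * n)) := by
          rw [integral_add (hitg _ _) (hitg _ _)]
          exact add_le_add (h2.trans h3) h1
      _ = _ := by push_cast; ring

/-- The bound on the mean of the contribution of a box of radius `n`. -/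
def potBd (d : ℕ) (κ C c : ℝ) (n : ℕ) : ℝ :=
  (C - log κ) * (((2 * n + 1 : ℕ) : ℝ) ^ d * exp (-c * n))

omit hP in

lemma potBd_exp (γ : ℝ) (n : ℕ) : ((2 * n + 1 : ℕ) : ℝ) ^ d * (exp (γ * n) *
    potBd d κ C c n) = (C - log κ) * (((2 * n + 1 : ℕ) : ℝ) ^ (d + d) *
      exp (-(c - γ) * n)) := by
  rw [potBd, show -(c - γ) * (n : ℝ) = γ * n + -c * n by ring, exp_add, pow_add]; ring

lemma BlockLaw.log_nonneg : 0 ≤ -log κ :=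
  neg_nonneg.2 (Real.log_nonpos hP.kpos.le hP.kone)

lemma BlockLaw.potBd_nonneg (n : ℕ) : 0 ≤ potBd d κ C c n := by
  have h1 := hP.log_nonneg
  have h2 := hP.Cnn
  exact mul_nonneg (by linarith) (by positivity)

lemma BlockLaw.summable_potBd (γ : ℝ) (hγ : γ < c) : Summable fun n : ℕ =>
    ((2 * n + 1 : ℕ) : ℝ) ^ d * (exp (γ * n) * potBd d κ C c n) := by
  simp only [potBd_exp]
  exact (summable_expConst (d := d + d) (c - γ) (by linarith)).mul_left _

lemma BlockLaw.integrable_pot (T : Set (ZLat d)) (p : ZLat d × ℕ) : Integrable (pot P T p) P := by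
  have := hP.prob
  exact (pot_local P T p).integrable hP.bdd

lemma BlockLaw.integral_pot_le (T : Set (ZLat d)) (p : ZLat d × ℕ) :
    ∫ x, |pot P T p x| ∂P ≤ potBd d κ C c p.2 := by
  have := hP.prob
  have hlog := hP.log_nonneg
  have hCnn := hP.Cnn
  obtain ⟨i, n⟩ := p
  rcases Nat.eq_zero_or_pos n with rfl | hn
  · have h1 : ∫ x, |pot P T (i, 0) x| ∂P ≤ ∫ _, -log κ ∂P := by
      refine integral_mono_ae (hP.integrable_pot T _).abs (integrable_const _) ?_
      filter_upwards [hP.bdd] with x hx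
      have := hP.abs_gInc_le i (past T i 0) x hx
      simpa [pot] using this
    refine h1.trans ?_
    simp [potBd, hCnn]
  · have hsub := past_mono T i (Nat.sub_le n 1)
    have h1 := hP.integral_gInc_sub_le i (past T i (n - 1)) (past T i n \ past T i (n - 1)) n
      (by rw [union_sdiff_of_subset hsub]; exact notMem_past T i n) (fun j hj => by
        rw [mem_sdiff] at hj
        by_contra h2
        refine hj.2 ?_
        have h3 := mem_filter.1 hj.1
        refine mem_filter.2 ⟨(mem_box i j _).2 ?_, h3.2⟩
        omega)
    rw [union_sdiff_of_subset hsub] at h1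
    have h2 : (fun x => |pot P T (i, n) x|) =
        fun x => |gInc P i (past T i n) x - gInc P i (past T i (n - 1)) x| := by
      funext x; simp only [pot, if_neg hn.ne']
    rw [h2]
    refine h1.trans ?_
    have h3 : ((past T i n \ past T i (n - 1)).card : ℝ) ≤ ((2 * n + 1 : ℕ) : ℝ) ^ d := by
      have := card_le_card (sdiff_subset.trans (past_subset T i n) :
        past T i n \ past T i (n - 1) ⊆ box i n)
      rw [card_box] at this
      exact_mod_cast this
    calc _ ≤ ((2 * n + 1 : ℕ) : ℝ) ^ d * (C * exp (-c * n)) :=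
          mul_le_mul_of_nonneg_right h3 (by positivity)
      _ ≤ _ := by
          unfold potBd
          have : 0 ≤ -log κ * (((2 * n + 1 : ℕ) : ℝ) ^ d * exp (-c * n)) := by positivity
          linarith

/-- Almost surely the contributions of the boxes containing a given site are exponentially
summable. -/
theorem BlockLaw.ae_summable (γ : ℝ) (hγ : γ < c) : ∀ᵐ x ∂P, ∀ i,
    Summable fun p : ZLat d × ℕ => if i ∈ bx p then exp (γ * p.2) * |pot P Set.univ p x|
      else 0 := by
  rw [ae_all_iff]
  intro i
  have h1 := summable_radius (fun n => exp (γ * n) * potBd d κ C c n)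
    (fun n => mul_nonneg (exp_pos _).le (hP.potBd_nonneg n)) (hP.summable_potBd γ hγ) i
  have h2 := ae_summable_of_integral_le (P := P) (F := fun (p : ZLat d × ℕ) x =>
    if i ∈ bx p then exp (γ * p.2) * pot P Set.univ p x else 0)
    (fun p => by
      split_ifs
      · exact (hP.integrable_pot _ p).const_mul _
      · exact integrable_zero _ _ _)
    (fun p => by
      split_ifs
      · simp only [abs_mul, abs_of_pos (exp_pos _)]
        rw [integral_const_mul]
        exact mul_le_mul_of_nonneg_left (hP.integral_pot_le _ p) (exp_pos _).le
      · simp) h1.1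
  filter_upwards [h2] with x hx
  refine hx.congr fun p => ?_
  split_ifs
  · rw [abs_mul, abs_of_pos (exp_pos _)]
  · rw [abs_zero]

end potential

section boxes

variable {d : ℕ}

lemma idxConnected_box (i : ZLat d) (n : ℕ) : IdxConnected (box i n) := by
  intro x hx y hy
  rw [mem_box, supD_le_iff] at hx hy
  refine ⟨supD x y, fun k t => max (x t - k) (min (x t + k) (y t)), ?_, ?_, fun k _ => ?_,
    fun k _ => ?_⟩
  · funext t
    have : x t - ((0 : ℕ) : ℤ) = x t := by simp
    simp only [Nat.cast_zero, sub_zero, add_zero]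
    omega
  · funext t
    have h := abs_le.1 (abs_sub_le_supD x y t)
    simp only
    omega
  · rw [mem_box, supD_le_iff]
    intro t
    have h1 := abs_le.1 (hx t)
    have h2 := abs_le.1 (hy t)
    refine abs_le.2 ⟨?_, ?_⟩ <;> simp only <;> omega
  · rw [supD_le_iff]
    intro t
    refine abs_le.2 ⟨?_, ?_⟩ <;> simp only <;> push_cast <;> omega

lemma image_sub_box (i j : ZLat d) (n : ℕ) : (box i n).image (· - j) = box (i - j) n := by
  ext x
  rw [mem_image, mem_box]
  constructor
  · rintro ⟨y, hy, rfl⟩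
    rw [mem_box] at hy
    rwa [← supD_add (i - j) (y - j) j, sub_add_cancel, sub_add_cancel]
  · intro h
    refine ⟨x + j, ?_, by simp⟩
    rw [mem_box]
    rwa [← supD_add (i - j) x j, sub_add_cancel] at h

lemma diamIdx_box_le (i : ZLat d) (n : ℕ) : diamIdx (box i n) ≤ 2 * n := by
  refine Finset.sup_le fun p hp => ?_
  rw [mem_product, mem_box, mem_box] at hp
  have := supD_tri p.1 i p.2
  rw [supD_comm p.1 i] at this
  omega

/-- The family indexed by finite sets which is given by `V` on boxes and vanishes otherwise. -/
def byBox (V : ZLat d × ℕ → 𝒩[d] → ℝ) (I : ℱ[d]) (x : 𝒩[d]) : ℝ :=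
  Function.extend bx (fun p => V p x) (fun _ => 0) I

lemma byBox_bx (hd : 0 < d) (V : ZLat d × ℕ → 𝒩[d] → ℝ) (p : ZLat d × ℕ)
    (x : 𝒩[d]) : byBox V (bx p) x = V p x :=
  (bx_injective hd).extend_apply _ _ _

lemma byBox_of_ne (V : ZLat d × ℕ → 𝒩[d] → ℝ) {I : ℱ[d]}
    (hI : ¬ ∃ p, bx p = I) (x : 𝒩[d]) : byBox V I x = 0 :=
  Function.extend_apply' _ _ _ hI

lemma byBox_local (hd : 0 < d) {V : ZLat d × ℕ → 𝒩[d] → ℝ}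
    (hV : ∀ p, LocalOnN (V p) (bx p)) (I : ℱ[d]) : LocalOnN (byBox V I) I := by
  intro x y h
  by_cases hI : ∃ p, bx p = I
  · obtain ⟨p, rfl⟩ := hI
    rw [byBox_bx hd, byBox_bx hd, hV p x y h]
  · rw [byBox_of_ne V hI, byBox_of_ne V hI]

lemma byBox_of_not_connected (V : ZLat d × ℕ → 𝒩[d] → ℝ) {I : ℱ[d]}
    (hI : ¬ IdxConnected I) (x : 𝒩[d]) : byBox V I x = 0 :=
  byBox_of_ne V (fun ⟨p, hp⟩ => hI (hp ▸ idxConnected_box p.1 p.2)) x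

lemma byBox_shift (hd : 0 < d) {V : ZLat d × ℕ → 𝒩[d] → ℝ} {j : ZLat d}
    {x : 𝒩[d]} (hV : ∀ p : ZLat d × ℕ, V (p.1 - j, p.2) (fun k => x (k + j)) = V p x)
    (I : ℱ[d]) : byBox V (I.image (· - j)) (fun k => x (k + j)) = byBox V I x := by
  by_cases hI : ∃ p, bx p = I
  · obtain ⟨p, rfl⟩ := hI
    have h1 : (bx p).image (· - j) = bx (p.1 - j, p.2) := image_sub_box p.1 j p.2
    rw [h1, byBox_bx hd, byBox_bx hd, hV]
  · have h0 : ¬ ∃ p, bx p = I.image (· - j) := by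
      rintro ⟨p, hp⟩
      refine hI ⟨(p.1 + j, p.2), ?_⟩
      have h1 : (bx (p.1 + j, p.2)).image (· - j) = bx p := by
        have := image_sub_box (p.1 + j) j p.2
        rwa [add_sub_cancel_right] at this
      refine Finset.image_injective (sub_left_injective (b := j)) ?_
      rw [h1, hp]
    rw [byBox_of_ne V hI, byBox_of_ne V h0]

lemma sum_byBox (hd : 0 < d) (V : ZLat d × ℕ → 𝒩[d] → ℝ) (g : ℱ[d] → ℝ)
    (F : Finset (ℱ[d])) (x : 𝒩[d]) :
    ∑ I ∈ F, g I * |byBox V I x| =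
      ∑ p ∈ F.preimage bx (bx_injective hd).injOn, g (bx p) * |V p x| := by
  rw [← Finset.sum_preimage bx F (bx_injective hd).injOn (fun I => g I * |byBox V I x|)]
  · exact sum_congr rfl fun p _ => by rw [byBox_bx hd]
  · intro I _ hI
    rw [byBox_of_ne V (fun ⟨p, hp⟩ => hI ⟨p, hp⟩), abs_zero, mul_zero]

lemma tsum_byBox (hd : 0 < d) (V : ZLat d × ℕ → 𝒩[d] → ℝ)
    (A : ℱ[d] → Prop) [DecidablePred A] (x : 𝒩[d]) :
    ∑' I : ℱ[d], (if A I then byBox V I x else 0) =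
      ∑' p : ZLat d × ℕ, if A (bx p) then V p x else 0 := by
  rw [← (bx_injective hd).tsum_eq]
  · exact tsum_congr fun p => by rw [byBox_bx hd]
  · intro I hI
    by_contra h
    refine hI ?_
    simp only
    rw [byBox_of_ne V (fun ⟨p, hp⟩ => h ⟨p, hp⟩), ite_self]

end boxes

section split

variable {d : ℕ}

/-- The uniformly small part of the potential. -/
def vPhi (P : Measure 𝒩[d]) (α : ℝ) (p : ZLat d × ℕ) (x : 𝒩[d]) : ℝ :=
  if |pot P Set.univ p x| ≤ exp (-α * p.2) then pot P Set.univ p x else 0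

/-- The large but sparse part of the potential. -/
def vPsi (P : Measure 𝒩[d]) (α : ℝ) (p : ZLat d × ℕ) (x : 𝒩[d]) : ℝ :=
  if |pot P Set.univ p x| ≤ exp (-α * p.2) then 0 else pot P Set.univ p x

lemma vPsi_add_vPhi (P : Measure 𝒩[d]) (α : ℝ) (p : ZLat d × ℕ) (x : 𝒩[d]) :
    vPsi P α p x + vPhi P α p x = pot P Set.univ p x := by
  unfold vPsi vPhi; split_ifs <;> simp

lemma abs_vPsi_le (P : Measure 𝒩[d]) (α : ℝ) (p : ZLat d × ℕ) (x : 𝒩[d]) :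
    |vPsi P α p x| ≤ |pot P Set.univ p x| := by
  unfold vPsi; split_ifs <;> simp

lemma abs_vPhi_le (P : Measure 𝒩[d]) (α : ℝ) (p : ZLat d × ℕ) (x : 𝒩[d]) :
    |vPhi P α p x| ≤ exp (-α * p.2) := by
  unfold vPhi
  split_ifs with h
  · exact h
  · rw [abs_zero]; exact (exp_pos _).le

lemma vPsi_local (P : Measure 𝒩[d]) (α : ℝ) (p : ZLat d × ℕ) :
    LocalOnN (vPsi P α p) (bx p) := fun x y h => by
  unfold vPsi; rw [pot_local P _ p x y h]

lemma vPhi_local (P : Measure 𝒩[d]) (α : ℝ) (p : ZLat d × ℕ) :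
    LocalOnN (vPhi P α p) (bx p) := fun x y h => by
  unfold vPhi; rw [pot_local P _ p x y h]

lemma past_univ_sub (i j : ZLat d) (n : ℕ) :
    past Set.univ (i - j) n = (past Set.univ i n).image (· - j) := by
  have h0 : ∀ a b : ZLat d, toLex (a - j) < toLex (b - j) ↔ toLex a < toLex b := by
    intro a b
    rw [toLex_sub, toLex_sub, sub_lt_sub_iff_right]
  ext x
  simp only [past, mem_filter, mem_image, Set.mem_univ, and_true,
    ← image_sub_box i j n]
  constructor
  · rintro ⟨⟨y, hy, rfl⟩, h⟩
    exact ⟨y, ⟨hy, (h0 y i).1 h⟩, rfl⟩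
  · rintro ⟨y, ⟨hy, h⟩, rfl⟩
    exact ⟨⟨y, hy, rfl⟩, (h0 y i).2 h⟩

lemma sum_vPhi_le (hd : 0 < d) (P : Measure 𝒩[d]) {α : ℝ} (hα : 0 < α)
    (x : 𝒩[d]) (i : ZLat d) (F : Finset (ℱ[d])) (hF : ∀ I ∈ F, i ∈ I) :
    ∑ I ∈ F, exp (α / 4 * diamIdx I) * |byBox (vPhi P α) I x| ≤ expConst d (α / 2) := by
  rw [sum_byBox hd (vPhi P α) (fun I => exp (α / 4 * diamIdx I))]
  refine (sum_le_sum (g := fun p : ZLat d × ℕ => exp (-(α / 2) * p.2))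
    fun p _ => ?_).trans
    (sum_radius_le (fun n => exp (-(α / 2) * n)) (fun n => (exp_pos _).le)
      (summable_expConst (α / 2) (by linarith)) i _ fun p hp => hF _ (Finset.mem_preimage.1 hp))
  have h1 : (diamIdx (bx p) : ℝ) ≤ 2 * p.2 := by exact_mod_cast diamIdx_box_le p.1 p.2
  calc exp (α / 4 * diamIdx (bx p)) * |vPhi P α p x| ≤
      exp (α / 4 * (2 * p.2)) * exp (-α * p.2) := by
        refine mul_le_mul (exp_le_exp.2 ?_) (abs_vPhi_le P α p x) (abs_nonneg _)
          (exp_pos _).le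
        exact mul_le_mul_of_nonneg_left h1 (by linarith)
    _ = exp (-(α / 2) * p.2) := by rw [← exp_add]; congr 1; ring

variable {P : Measure 𝒩[d]} {K : ℕ} {κ C c : ℝ} (hP : BlockLaw P K κ C c)

include hP

lemma BlockLaw.cyl_sub (Γ : ℱ[d]) (j : ZLat d) (x : 𝒩[d]) :
    cyl P (Γ.image (· - j)) (fun k => x (k + j)) = cyl P Γ x := by
  rw [← hP.shift, Finset.image_image]
  have h1 : ((fun k => k + j) ∘ fun k => k - j) = (id : ZLat d → ZLat d) := by
    funext k; simp
  rw [h1, image_id]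

lemma BlockLaw.pot_shift (j : ZLat d) (x : 𝒩[d]) (p : ZLat d × ℕ) :
    pot P Set.univ (p.1 - j, p.2) (fun k => x (k + j)) = pot P Set.univ p x := by
  have h1 : ∀ n, gInc P (p.1 - j) (past Set.univ (p.1 - j) n) (fun k => x (k + j)) =
      gInc P p.1 (past Set.univ p.1 n) x := by
    intro n
    have h2 := Finset.image_insert (fun k => k - j) p.1 (past Set.univ p.1 n)
    unfold gInc
    rw [past_univ_sub, ← h2, hP.cyl_sub, hP.cyl_sub]
  simp only [pot, h1]

lemma BlockLaw.vPsi_shift (α : ℝ) (j : ZLat d) (x : 𝒩[d]) (p : ZLat d × ℕ) :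
    vPsi P α (p.1 - j, p.2) (fun k => x (k + j)) = vPsi P α p x := by
  unfold vPsi; rw [hP.pot_shift]

lemma BlockLaw.vPhi_shift (α : ℝ) (j : ZLat d) (x : 𝒩[d]) (p : ZLat d × ℕ) :
    vPhi P α (p.1 - j, p.2) (fun k => x (k + j)) = vPhi P α p x := by
  unfold vPhi; rw [hP.pot_shift]

end split

lemma integral_le_of_le_tsum {α ι : Type*} [MeasurableSpace α] [Countable ι] {P : Measure α}
    {f : α → ℝ} {F : ι → α → ℝ} {e : ι → ℝ} (hF : ∀ i, Integrable (F i) P)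
    (hF0 : ∀ i x, 0 ≤ F i x) (he : ∀ i, ∫ x, F i x ∂P ≤ e i) (hs : Summable e)
    (hf0 : ∀ x, 0 ≤ f x) (hf : ∀ᵐ x ∂P, (Summable fun i => F i x) ∧ f x ≤ ∑' i, F i x) :
    ∫ x, f x ∂P ≤ ∑' i, e i := by
  have he0 : ∀ i, 0 ≤ e i := fun i => (integral_nonneg (hF0 i)).trans (he i)
  by_cases hfi : Integrable f P
  · rw [← ENNReal.ofReal_le_ofReal_iff (tsum_nonneg he0),
      ofReal_integral_eq_lintegral_ofReal hfi (Filter.Eventually.of_forall hf0),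
      ENNReal.ofReal_tsum_of_nonneg he0 hs]
    calc ∫⁻ x, ENNReal.ofReal (f x) ∂P ≤ ∫⁻ x, ∑' i, ENNReal.ofReal (F i x) ∂P := by
          refine lintegral_mono_ae ?_
          filter_upwards [hf] with x hx
          rw [← ENNReal.ofReal_tsum_of_nonneg (fun i => hF0 i x) hx.1]
          exact ENNReal.ofReal_le_ofReal hx.2
      _ = ∑' i, ∫⁻ x, ENNReal.ofReal (F i x) ∂P :=
          lintegral_tsum fun i => (hF i).1.aemeasurable.ennreal_ofReal
      _ ≤ ∑' i, ENNReal.ofReal (e i) := by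
          refine ENNReal.tsum_le_tsum fun i => ?_
          rw [← ofReal_integral_eq_lintegral_ofReal (hF i) (Filter.Eventually.of_forall (hF0 i))]
          exact ENNReal.ofReal_le_ofReal (he i)
  · rw [integral_undef hfi]; exact tsum_nonneg he0

section sparse

variable {d : ℕ}

lemma lt_of_vPsi_ne {P : Measure 𝒩[d]} {α β γ : ℝ} (hγ : γ = α + β)
    {p : ZLat d × ℕ} {x : 𝒩[d]} (h : vPsi P α p x ≠ 0) :
    exp (β * p.2) ≤ exp (γ * p.2) * |pot P Set.univ p x| := by
  have h1 : exp (-α * p.2) < |pot P Set.univ p x| := by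
    by_contra h2
    exact h (if_pos (not_lt.1 h2))
  calc exp (β * p.2) = exp (γ * p.2) * exp (-α * p.2) := by
        rw [← exp_add, hγ]; congr 1; ring
    _ ≤ _ := mul_le_mul_of_nonneg_left h1.le (exp_pos _).le

/-- Exponential summability of the contributions of the boxes containing any given site. -/
def ExpSummable (P : Measure 𝒩[d]) (γ : ℝ) (x : 𝒩[d]) : Prop :=
  ∀ i, Summable fun p : ZLat d × ℕ => if i ∈ bx p then exp (γ * p.2) *
    |pot P Set.univ p x| else 0

lemma ExpSummable.finite {P : Measure 𝒩[d]} {α β γ : ℝ} (hβ : 0 ≤ β) (hγ : γ = α + β)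
    {x : 𝒩[d]} (hx : ExpSummable P γ x) (i : ZLat d) :
    {p : ZLat d × ℕ | i ∈ bx p ∧ vPsi P α p x ≠ 0}.Finite := by
  have h1 := (hx i).tendsto_cofinite_zero.eventually (gt_mem_nhds (zero_lt_one' ℝ))
  rw [Filter.eventually_cofinite] at h1
  refine h1.subset fun p hp => ?_
  rw [Set.mem_ofPred_eq, if_pos hp.1, not_lt]
  refine le_trans ?_ (lt_of_vPsi_ne hγ hp.2)
  exact one_le_exp (by positivity)

lemma ExpSummable.summable_vPsi {P : Measure 𝒩[d]} {α γ : ℝ} (hγ : 0 ≤ γ)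
    {x : 𝒩[d]} (hx : ExpSummable P γ x) (i : ZLat d) :
    Summable fun p : ZLat d × ℕ => if i ∈ bx p then |vPsi P α p x| else 0 := by
  refine Summable.of_nonneg_of_le (fun p => by split_ifs <;> simp) (fun p => ?_) (hx i)
  split_ifs
  · refine (abs_vPsi_le P α p x).trans (le_mul_of_one_le_left (abs_nonneg _) ?_)
    exact one_le_exp (by positivity)
  · exact le_rfl

variable {P : Measure 𝒩[d]} {K : ℕ} {κ C c : ℝ} (hP : BlockLaw P K κ C c)

include hP

/-- Almost surely the sparse part has finite range at each site and is absolutely summable. -/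
theorem BlockLaw.exists_sparse_set (hd : 0 < d) {α β γ : ℝ} (hα : 0 ≤ α) (hβ : 0 ≤ β)
    (hγ : γ = α + β) (hγc : γ < c) :
    ∃ M : Set 𝒩[d], MeasurableSet M ∧ P M = 1 ∧ ∃ rr : 𝒩[d] → ZLat d → ℕ,
      (∀ x i, 1 ≤ rr x i) ∧
      (∀ x ∈ M, ∀ (i : ZLat d) (I : ℱ[d]), i ∈ I → rr x i < diamIdx I →
        byBox (vPsi P α) I x = 0) ∧
      ∀ x ∈ M, ∀ i : ZLat d, ∃ c : ℝ, 0 ≤ c ∧ ∀ F : Finset (ℱ[d]), (∀ I ∈ F, i ∈ I) →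
        ∑ I ∈ F, |byBox (vPsi P α) I x| ≤ c := by
  have := hP.prob
  have hae : ∀ᵐ x ∂P, ExpSummable P γ x := hP.ae_summable γ hγc
  obtain ⟨N, hNsup, hN, hN0⟩ := exists_measurable_superset_of_null (ae_iff.1 hae)
  obtain ⟨M, rfl⟩ : ∃ M, N = Mᶜ := ⟨Nᶜ, (compl_compl N).symm⟩
  have hM := hN.of_compl
  have hM0 := (prob_compl_eq_zero_iff hM).1 hN0
  have hMsub : ∀ {x}, x ∈ M → ExpSummable P γ x := fun {x} hx => by
    by_contra h
    exact hNsup h hx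
  have hrr : ∀ (x : 𝒩[d]) (i : ZLat d), ∃ N : ℕ, 1 ≤ N ∧ (x ∈ M →
      ∀ I : ℱ[d], i ∈ I → N < diamIdx I → byBox (vPsi P α) I x = 0) := by
    intro x i
    by_cases hx : x ∈ M
    · have hfin := (hMsub hx).finite hβ hγ i
      refine ⟨2 * hfin.toFinset.sup Prod.snd + 1, by omega, fun _ I hi hI => ?_⟩
      by_contra h
      by_cases hbx : ∃ p, bx p = I
      · obtain ⟨p, rfl⟩ := hbx
        rw [byBox_bx hd] at h
        have h1 : p.2 ≤ hfin.toFinset.sup Prod.snd :=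
          le_sup (f := Prod.snd) (hfin.mem_toFinset.2 ⟨hi, h⟩)
        have h2 := diamIdx_box_le p.1 p.2
        change _ < diamIdx (box p.1 p.2) at hI
        omega
      · exact h (byBox_of_ne _ hbx x)
    · exact ⟨1, le_rfl, fun h => (hx h).elim⟩
  choose rr hrr1 hrr2 using hrr
  refine ⟨M, hM, hM0, rr, hrr1, fun x hx i I => hrr2 x i hx I, fun x hx i => ?_⟩
  have hs := (hMsub hx).summable_vPsi (α := α) (by linarith) i
  have hnn : ∀ p : ZLat d × ℕ, 0 ≤ if i ∈ bx p then |vPsi P α p x| else 0 := fun p => by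
    split_ifs <;> simp
  refine ⟨∑' p : ZLat d × ℕ, if i ∈ bx p then |vPsi P α p x| else 0, tsum_nonneg hnn,
    fun F hF => ?_⟩
  have h1 := sum_byBox hd (vPsi P α) (fun _ => 1) F x
  simp only [one_mul] at h1
  rw [h1]
  refine le_trans (le_of_eq (sum_congr rfl fun p hp => ?_)) (hs.sum_le_tsum
    (F.preimage bx (bx_injective hd).injOn) fun p _ => hnn p)
  rw [if_pos (hF _ (Finset.mem_preimage.1 hp))]

lemma BlockLaw.rpow_vPsi_le {α β γ : ℝ} (hβ : 0 < β) (hγ : γ = α + β) {q : ℝ} (hq : 1 ≤ q)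
    {x : 𝒩[d]} (hx : ExpSummable P γ x) (hxK : ∀ i, x i ≤ K) (i : ZLat d) :
    |∑' p : ZLat d × ℕ, if i ∈ bx p then vPsi P α p x else 0| ^ q ≤
      ((2 * -log κ) ^ q * expConst ((d + 1) * ⌈q⌉₊) β) *
      ∑' p : ZLat d × ℕ, if i ∈ bx p then exp (γ * p.2) * |pot P Set.univ p x| else 0 := by
  have hL : 0 ≤ 2 * -log κ := by have := hP.log_nonneg; linarith
  have hE0 : ∀ n : ℕ, 0 ≤ ((2 * n + 1 : ℕ) : ℝ) ^ ((d + 1) * ⌈q⌉₊) * exp (-β * n) :=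
    fun n => by positivity
  have hE : 0 ≤ expConst ((d + 1) * ⌈q⌉₊) β := tsum_nonneg hE0
  have hnn : ∀ p : ZLat d × ℕ, 0 ≤ if i ∈ bx p then exp (γ * p.2) *
      |pot P Set.univ p x| else 0 := fun p => by split_ifs <;> positivity
  set S := (hx.finite hβ.le hγ i).toFinset with hS
  have hmem : ∀ p, p ∈ S ↔ i ∈ bx p ∧ vPsi P α p x ≠ 0 := fun p =>
    (hx.finite hβ.le hγ i).mem_toFinset
  have hsum : ∑' p : ZLat d × ℕ, (if i ∈ bx p then vPsi P α p x else 0) =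
      ∑ p ∈ S, vPsi P α p x := by
    rw [tsum_eq_sum (s := S)]
    · exact sum_congr rfl fun p hp => if_pos ((hmem p).1 hp).1
    · intro p hp
      by_cases h1 : i ∈ bx p
      · rw [if_pos h1]
        by_contra h2
        exact hp ((hmem p).2 ⟨h1, h2⟩)
      · exact if_neg h1
  rw [hsum]
  rcases S.eq_empty_or_nonempty with h0 | h0
  · rw [h0, Finset.sum_empty, abs_zero, Real.zero_rpow (by linarith)]
    exact mul_nonneg (mul_nonneg (rpow_nonneg hL _) hE) (tsum_nonneg hnn)
  obtain ⟨p, hp, hmax⟩ := S.exists_max_image Prod.snd h0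
  have hp' := (hmem p).1 hp
  have hcard : (S.card : ℝ) ≤ ((2 * p.2 + 1 : ℕ) : ℝ) ^ (d + 1) := by
    have h1 : S ⊆ box i p.2 ×ˢ range (p.2 + 1) := by
      intro p' h'
      have h2 := hmax p' h'
      have h3 := ((hmem p').1 h').1
      rw [bx, mem_box] at h3
      rw [mem_product, mem_box, mem_range, supD_comm]
      exact ⟨h3.trans h2, by omega⟩
    have h4 := card_le_card h1
    rw [Finset.card_product, card_box, card_range] at h4
    have h5 : (2 * p.2 + 1) ^ d * (p.2 + 1) ≤ (2 * p.2 + 1) ^ (d + 1) := by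
      rw [pow_succ]
      exact Nat.mul_le_mul_left _ (by omega)
    exact_mod_cast h4.trans h5
  have h1 : |∑ p ∈ S, vPsi P α p x| ≤ (2 * -log κ) * ((2 * p.2 + 1 : ℕ) : ℝ) ^ (d + 1) := by
    refine (abs_sum_le_sum_abs _ _).trans ((Finset.sum_le_card_nsmul _ _
      (2 * -log κ) fun p _ => (abs_vPsi_le P α p x).trans (hP.abs_pot_le _ p x hxK)).trans ?_)
    rw [nsmul_eq_mul, mul_comm]
    exact mul_le_mul_of_nonneg_left hcard hL
  have hbase : (1 : ℝ) ≤ ((2 * p.2 + 1 : ℕ) : ℝ) ^ (d + 1) := by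
    refine one_le_pow₀ ?_
    exact_mod_cast (by omega : 1 ≤ 2 * p.2 + 1)
  have h2 : (((2 * p.2 + 1 : ℕ) : ℝ) ^ (d + 1)) ^ q ≤
      expConst ((d + 1) * ⌈q⌉₊) β * exp (β * p.2) := by
    have h3 : (((2 * p.2 + 1 : ℕ) : ℝ) ^ (d + 1)) ^ q ≤
        ((2 * p.2 + 1 : ℕ) : ℝ) ^ ((d + 1) * ⌈q⌉₊) := by
      rw [pow_mul, ← Real.rpow_natCast _ ⌈q⌉₊]
      exact Real.rpow_le_rpow_of_exponent_le hbase (Nat.le_ceil q)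
    have h4 : ((2 * p.2 + 1 : ℕ) : ℝ) ^ ((d + 1) * ⌈q⌉₊) * exp (-β * p.2) ≤
        expConst ((d + 1) * ⌈q⌉₊) β :=
      (summable_expConst (d := (d + 1) * ⌈q⌉₊) β hβ).le_tsum p.2 fun n _ => hE0 n
    refine h3.trans ?_
    have h5 := mul_le_mul_of_nonneg_right h4 (exp_pos (β * p.2)).le
    rwa [mul_assoc, ← exp_add, neg_mul, neg_add_cancel, exp_zero, mul_one] at h5
  calc |∑ p ∈ S, vPsi P α p x| ^ q ≤
      ((2 * -log κ) * ((2 * p.2 + 1 : ℕ) : ℝ) ^ (d + 1)) ^ q :=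
        Real.rpow_le_rpow (abs_nonneg _) h1 (by linarith)
    _ = (2 * -log κ) ^ q * (((2 * p.2 + 1 : ℕ) : ℝ) ^ (d + 1)) ^ q :=
        Real.mul_rpow hL (by positivity)
    _ ≤ (2 * -log κ) ^ q * (expConst ((d + 1) * ⌈q⌉₊) β * exp (β * p.2)) :=
        mul_le_mul_of_nonneg_left h2 (rpow_nonneg hL _)
    _ ≤ _ := by
        rw [← mul_assoc]
        refine mul_le_mul_of_nonneg_left ?_ (mul_nonneg (rpow_nonneg hL _) hE)
        refine (lt_of_vPsi_ne hγ hp'.2).trans ?_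
        refine le_trans (le_of_eq ?_) ((hx i).le_tsum p fun p' _ => hnn p')
        exact (if_pos hp'.1).symm

/-- The moments of the sparse part are bounded uniformly in the site. -/
theorem BlockLaw.exists_moment_bound (hd : 0 < d) {α β γ : ℝ} (hβ : 0 < β)
    (hγ : γ = α + β) (hγc : γ < c) {q : ℝ} (hq : 1 ≤ q) :
    ∃ Cq : ℝ, ∀ i : ZLat d,
      ∫ x, |∑' I : {I : ℱ[d] // i ∈ I}, byBox (vPsi P α) I.1 x| ^ q ∂P ≤ Cq := by
  have := hP.prob
  have hL : 0 ≤ 2 * -log κ := by have := hP.log_nonneg; linarith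
  set A := (2 * -log κ) ^ q * expConst ((d + 1) * ⌈q⌉₊) β with hA
  have hA0 : 0 ≤ A := mul_nonneg (rpow_nonneg hL _) (tsum_nonneg fun n => by positivity)
  refine ⟨A * ∑' n : ℕ, ((2 * n + 1 : ℕ) : ℝ) ^ d * (exp (γ * n) * potBd d κ C c n),
    fun i => ?_⟩
  have h1 := summable_radius (fun n => exp (γ * n) * potBd d κ C c n)
    (fun n => mul_nonneg (exp_pos _).le (hP.potBd_nonneg n)) (hP.summable_potBd γ hγc) i
  refine le_trans ?_ (mul_le_mul_of_nonneg_left h1.2 hA0)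
  rw [← tsum_mul_left]
  have hitg : ∀ p : ZLat d × ℕ, Integrable (fun x => if i ∈ bx p then
      exp (γ * p.2) * |pot P Set.univ p x| else 0) P := by
    intro p
    split_ifs
    · exact (hP.integrable_pot _ p).abs.const_mul _
    · exact integrable_zero _ _ _
  refine integral_le_of_le_tsum (F := fun p x => A * if i ∈ bx p then
    exp (γ * p.2) * |pot P Set.univ p x| else 0) (fun p => (hitg p).const_mul A)
    (fun p x => mul_nonneg hA0 (by split_ifs <;> positivity)) (fun p => ?_) (h1.1.mul_left A)
    (fun x => rpow_nonneg (abs_nonneg _) _) ?_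
  · rw [integral_const_mul]
    refine mul_le_mul_of_nonneg_left ?_ hA0
    split_ifs
    · rw [integral_const_mul]
      exact mul_le_mul_of_nonneg_left (hP.integral_pot_le _ p) (exp_pos _).le
    · simp
  · have hae : ∀ᵐ x ∂P, ExpSummable P γ x := hP.ae_summable γ hγc
    filter_upwards [hae, hP.bdd] with x hx hxK
    refine ⟨(hx i).mul_left A, ?_⟩
    have h2 : ∑' I : {I : ℱ[d] // i ∈ I}, byBox (vPsi P α) I.1 x =
        ∑' p : ZLat d × ℕ, if i ∈ bx p then vPsi P α p x else 0 := by
      rw [← tsum_byBox hd (vPsi P α) (fun I => i ∈ I) x]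
      refine (tsum_subtype {I : ℱ[d] | i ∈ I} fun I => byBox (vPsi P α) I x).trans ?_
      refine tsum_congr fun I => ?_
      by_cases h : I ∈ {I : ℱ[d] | i ∈ I}
      · exact (Set.indicator_of_mem h _).trans (if_pos h).symm
      · exact (Set.indicator_of_notMem h _).trans (if_neg h).symm
    rw [h2, tsum_mul_left]
    exact hP.rpow_vPsi_le hβ hγ hq hx hxK i

end sparse

section gluing

variable {d : ℕ}

/-- The configuration equal to `k` in `J` and to `x` outside. -/
def glueN (J : ℱ[d]) (k : ↥J → ℕ) (x : 𝒩[d]) : ZLat d → ℕ :=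
  fun i => if h : i ∈ J then k ⟨i, h⟩ else x i

/-- The configurations in `J` with values at most `K`. -/
def cfgs (K : ℕ) (J : ℱ[d]) : Finset (↥J → ℕ) :=
  Fintype.piFinset fun _ => range (K + 1)

lemma mem_cfgs {K : ℕ} {J : ℱ[d]} {k : ↥J → ℕ} : k ∈ cfgs K J ↔ ∀ i, k i ≤ K := by
  simp [cfgs]

lemma glueN_mem (J : ℱ[d]) (k : ↥J → ℕ) (x : 𝒩[d]) {i : ZLat d} (h : i ∈ J) :
    glueN J k x i = k ⟨i, h⟩ := dif_pos h

lemma glueN_notMem (J : ℱ[d]) (k : ↥J → ℕ) (x : 𝒩[d]) {i : ZLat d}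
    (h : i ∉ J) : glueN J k x i = x i := dif_neg h

lemma glueN_le {K : ℕ} {J : ℱ[d]} {k : ↥J → ℕ} (hk : k ∈ cfgs K J) {x : 𝒩[d]}
    (hx : ∀ i, x i ≤ K) (i : ZLat d) : glueN J k x i ≤ K := by
  unfold glueN
  split_ifs
  exacts [mem_cfgs.1 hk _, hx i]

lemma LocalOnN.glueN {β : Type*} {g : 𝒩[d] → β} {U : ℱ[d]}
    (hg : LocalOnN g U) (J : ℱ[d]) (k : ↥J → ℕ) :
    LocalOnN (fun x => g (glueN J k x)) U := fun x y h => hg _ _ fun i hi => by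
  unfold Paper.glueN
  split_ifs
  exacts [rfl, h i hi]

lemma glueN_glueN (J : ℱ[d]) (k k' : ↥J → ℕ) (x : 𝒩[d]) :
    glueN J k (glueN J k' x) = glueN J k x := by
  funext i
  by_cases h : i ∈ J
  · rw [glueN_mem _ _ _ h, glueN_mem _ _ _ h]
  · rw [glueN_notMem _ _ _ h, glueN_notMem _ _ _ h, glueN_notMem _ _ _ h]

lemma glueN_self (J : ℱ[d]) (x : 𝒩[d]) : glueN J (fun i => x i) x = x := by
  funext i
  by_cases h : i ∈ J
  · rw [glueN_mem _ _ _ h]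
  · rw [glueN_notMem _ _ _ h]

lemma extZ_glueN {J Λ : ℱ[d]} (hJ : J ⊆ Λ) (k : ↥J → ℕ) (m : ↥Λ → ℕ) :
    extZ Λ (fun i => glueN J k (extZ Λ m) i) = glueN J k (extZ Λ m) := by
  funext i
  by_cases h : i ∈ Λ
  · exact extZ_mem Λ _ ⟨i, h⟩
  · rw [glueN_notMem _ _ _ fun h' => h (hJ h')]
    simp only [extZ, dif_neg h]

lemma sum_glueN_swap (K : ℕ) {J Λ : ℱ[d]} (hJ : J ⊆ Λ) (A B : 𝒩[d] → ℝ) :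
    ∑ m ∈ cfgs K Λ, ∑ k ∈ cfgs K J, A (extZ Λ m) * B (glueN J k (extZ Λ m)) =
      ∑ m ∈ cfgs K Λ, ∑ k ∈ cfgs K J, A (glueN J k (extZ Λ m)) * B (extZ Λ m) := by
  rw [← sum_product', ← sum_product']
  have hval : ∀ (m : ↥Λ → ℕ) (k : ↥J → ℕ) (a : ↥J),
      extZ Λ (fun i => glueN J k (extZ Λ m) i) a = k a := fun m k a => by
    rw [extZ_glueN hJ, glueN_mem J k _ a.2]
  have hmem : ∀ q ∈ cfgs K Λ ×ˢ cfgs K J, ((fun a => glueN J q.2 (extZ Λ q.1) a,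
      fun a => extZ Λ q.1 a) : (↥Λ → ℕ) × (↥J → ℕ)) ∈ cfgs K Λ ×ˢ cfgs K J := by
    rintro ⟨m, k⟩ hq
    rw [mem_product] at hq ⊢
    have h1 : ∀ i, extZ Λ m i ≤ K := fun i => by
      unfold extZ
      split_ifs
      exacts [mem_cfgs.1 hq.1 _, Nat.zero_le _]
    exact ⟨mem_cfgs.2 fun i => glueN_le hq.2 h1 i, mem_cfgs.2 fun i => h1 i⟩
  have hinv : ∀ q ∈ cfgs K Λ ×ˢ cfgs K J, ((fun a => glueN J (fun a => extZ Λ q.1 a)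
      (extZ Λ fun a => glueN J q.2 (extZ Λ q.1) a) a,
      fun a => extZ Λ (fun a => glueN J q.2 (extZ Λ q.1) a) a) : (↥Λ → ℕ) × (↥J → ℕ)) = q := by
    rintro ⟨m, k⟩ -
    refine Prod.ext (funext fun a => ?_) (funext fun a => hval m k a)
    simp only
    rw [extZ_glueN hJ, glueN_glueN, glueN_self, extZ_mem]
  refine Finset.sum_nbij' (fun q => (fun a => glueN J q.2 (extZ Λ q.1) a, fun a => extZ Λ q.1 a))
    (fun q => (fun a => glueN J q.2 (extZ Λ q.1) a, fun a => extZ Λ q.1 a)) hmem hmem hinv hinv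
    fun q _ => ?_
  simp only
  rw [extZ_glueN hJ, glueN_glueN, glueN_self]

variable {P : Measure 𝒩[d]} {K : ℕ} {κ C c : ℝ} (hP : BlockLaw P K κ C c)

include hP

lemma BlockLaw.sum_cyl_pos (J Λ : ℱ[d]) {x : 𝒩[d]} (hx : ∀ i, x i ≤ K) :
    0 < ∑ k ∈ cfgs K J, cyl P Λ (glueN J k x) :=
  sum_pos (fun _ hk => hP.cyl_pos Λ _ (glueN_le hk hx))
    ⟨fun _ => 0, mem_cfgs.2 fun _ => Nat.zero_le _⟩

/-- The equations for conditional probabilities in a finite region. -/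
theorem BlockLaw.integral_eq_cond {J Λ : ℱ[d]} (hJ : J ⊆ Λ) {h : 𝒩[d] → ℝ}
    (hh : LocalOnN h Λ) : ∫ x, h x ∂P = ∫ x, (∑ k ∈ cfgs K J, h (glueN J k x) *
      cyl P Λ (glueN J k x)) / ∑ k ∈ cfgs K J, cyl P Λ (glueN J k x) ∂P := by
  have := hP.prob
  set Z : 𝒩[d] → ℝ := fun x => ∑ k ∈ cfgs K J, cyl P Λ (glueN J k x) with hZ
  have hloc : LocalOnN (fun x => (∑ k ∈ cfgs K J, h (glueN J k x) *
      cyl P Λ (glueN J k x)) / Z x) Λ := by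
    intro x y hxy
    have h1 : ∀ k, h (glueN J k x) = h (glueN J k y) := fun k => hh.glueN J k x y hxy
    have h2 : ∀ k, cyl P Λ (glueN J k x) = cyl P Λ (glueN J k y) := fun k =>
      (cyl_congr P Λ).glueN J k x y hxy
    simp only [hZ, h1, h2]
  rw [hh.integral_eq hP.bdd, hloc.integral_eq hP.bdd]
  have h1 := sum_glueN_swap K hJ (fun x => cyl P Λ x / Z x) fun x => h x * cyl P Λ x
  calc _ = ∑ m ∈ cfgs K Λ, ∑ k ∈ cfgs K J, cyl P Λ (glueN J k (extZ Λ m)) /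
        Z (glueN J k (extZ Λ m)) * (h (extZ Λ m) * cyl P Λ (extZ Λ m)) := by
        refine sum_congr rfl fun m hm => ?_
        have hx : ∀ i, extZ Λ m i ≤ K := fun i => by
          unfold extZ
          split_ifs
          exacts [mem_cfgs.1 hm _, Nat.zero_le _]
        have h2 : ∀ k, Z (glueN J k (extZ Λ m)) = Z (extZ Λ m) := fun k => by
          simp only [hZ, glueN_glueN]
        simp only [h2]
        rw [← sum_mul, ← sum_div]
        have h3 : Z (extZ Λ m) ≠ 0 := (hP.sum_cyl_pos J Λ hx).ne'
        change _ = Z (extZ Λ m) / Z (extZ Λ m) * _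
        rw [div_self h3]; ring
    _ = _ := by
        rw [← h1]
        refine sum_congr rfl fun m _ => ?_
        rw [← mul_sum]; ring

lemma BlockLaw.cyl_union (Γ J : ℱ[d]) {x : 𝒩[d]} (hx : ∀ i, x i ≤ K) :
    κ ^ J.card * cyl P Γ x ≤ cyl P (J ∪ Γ) x := by
  induction J using induction_on with
  | empty => simp
  | insert i J hi ih =>
    rw [Finset.card_insert_of_notMem hi, pow_succ', mul_assoc, Finset.insert_union]
    exact (mul_le_mul_of_nonneg_left ih hP.kpos.le).trans (hP.ins _ i x (hx i))

lemma BlockLaw.sum_cyl_le {J Λ : ℱ[d]} (hJ : J ⊆ Λ) {x : 𝒩[d]}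
    (hx : ∀ i, x i ≤ K) {k : ↥J → ℕ} (hk : k ∈ cfgs K J) :
    κ ^ J.card * ∑ k' ∈ cfgs K J, cyl P Λ (glueN J k' x) ≤
      (cfgs K J).card * cyl P Λ (glueN J k x) := by
  have := hP.prob
  have h0 : ∀ k', cyl P (Λ \ J) (glueN J k' x) = cyl P (Λ \ J) x := fun k' =>
    cyl_congr P _ _ _ fun i hi => glueN_notMem _ _ _ (mem_sdiff.1 hi).2
  have h1 := hP.cyl_union (Λ \ J) J (glueN_le hk hx)
  rw [union_sdiff_of_subset hJ, h0] at h1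
  have h2 := Finset.sum_le_card_nsmul (cfgs K J) (fun k' => cyl P Λ (glueN J k' x))
    (cyl P (Λ \ J) x) fun k' _ => (cyl_anti P sdiff_subset _).trans (h0 k').le
  rw [nsmul_eq_mul] at h2
  calc _ ≤ κ ^ J.card * ((cfgs K J).card * cyl P (Λ \ J) x) :=
        mul_le_mul_of_nonneg_left h2 (pow_nonneg hP.kpos.le _)
    _ = (cfgs K J).card * (κ ^ J.card * cyl P (Λ \ J) x) := by ring
    _ ≤ _ := mul_le_mul_of_nonneg_left h1 (Nat.cast_nonneg _)

lemma BlockLaw.integral_glueN_le (J : ℱ[d]) {k : ↥J → ℕ} (hk : k ∈ cfgs K J)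
    {U : ℱ[d]} {h : 𝒩[d] → ℝ} (hh : LocalOnN h U) (hh0 : ∀ x, 0 ≤ h x) :
    ∫ x, h (glueN J k x) ∂P ≤ ((cfgs K J).card / κ ^ J.card) * ∫ x, h x ∂P := by
  have := hP.prob
  have hκ : 0 < κ ^ J.card := pow_pos hP.kpos _
  have hJ : J ⊆ U ∪ J := Finset.subset_union_right
  have hh' : LocalOnN h (U ∪ J) := hh.mono subset_union_left
  have hcl := cyl_congr P (U ∪ J)
  rw [hP.integral_eq_cond hJ hh', ← integral_const_mul]
  refine integral_mono_ae ((hh'.glueN J k).integrable hP.bdd)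
    (LocalOnN.integrable hP.bdd (U := U ∪ J) fun x y hxy => ?_) ?_
  · have h1 : ∀ k, h (glueN J k x) = h (glueN J k y) := fun k => hh'.glueN J k x y hxy
    have h2 : ∀ k, cyl P (U ∪ J) (glueN J k x) = cyl P (U ∪ J) (glueN J k y) := fun k =>
      hcl.glueN J k x y hxy
    simp only [h1, h2]
  · filter_upwards [hP.bdd] with x hx
    have hZ := hP.sum_cyl_pos J (U ∪ J) hx
    rw [div_mul_div_comm, le_div_iff₀ (mul_pos hκ hZ)]
    have h1 : h (glueN J k x) * cyl P (U ∪ J) (glueN J k x) ≤ ∑ k ∈ cfgs K J, h (glueN J k x) *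
        cyl P (U ∪ J) (glueN J k x) :=
      single_le_sum (f := fun k => h (glueN J k x) * cyl P (U ∪ J) (glueN J k x))
        (fun k _ => mul_nonneg (hh0 _) measureReal_nonneg) hk
    calc _ ≤ h (glueN J k x) * ((cfgs K J).card * cyl P (U ∪ J) (glueN J k x)) :=
          mul_le_mul_of_nonneg_left (hP.sum_cyl_le hJ hx hk) (hh0 _)
      _ = (cfgs K J).card * (h (glueN J k x) * cyl P (U ∪ J) (glueN J k x)) := by ring
      _ ≤ _ := mul_le_mul_of_nonneg_left h1 (Nat.cast_nonneg _)

end gluing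

section equations

variable {d : ℕ}

/-- The total contribution of the boxes meeting `J`. -/
def potSum (P : Measure 𝒩[d]) (J : ℱ[d]) (x : 𝒩[d]) : ℝ :=
  ∑' p : ZLat d × ℕ, if (bx p ∩ J).Nonempty then pot P Set.univ p x else 0

/-- The contribution of a box in the finite volume `box 0 n`. -/
def cutPot (P : Measure 𝒩[d]) (n : ℕ) (p : ZLat d × ℕ) (x : 𝒩[d]) : ℝ :=
  if p ∈ box 0 n ×ˢ range (2 * n + 1) then pot P (box 0 n : ℱ[d]) p x else 0

/-- The total contribution of the boxes meeting `J` in a finite volume. -/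
def cutSum (P : Measure 𝒩[d]) (J : ℱ[d]) (n : ℕ) (x : 𝒩[d]) : ℝ :=
  ∑ p ∈ (box 0 n ×ˢ range (2 * n + 1)).filter fun p => (bx p ∩ J).Nonempty,
    pot P (box 0 n : ℱ[d]) p x

lemma cutSum_eq (P : Measure 𝒩[d]) (J : ℱ[d]) (n : ℕ) (x : 𝒩[d]) :
    cutSum P J n x = ∑' p : ZLat d × ℕ, if (bx p ∩ J).Nonempty then cutPot P n p x else 0 := by
  rw [tsum_eq_sum (s := box 0 n ×ˢ range (2 * n + 1)), cutSum, sum_filter]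
  · refine sum_congr rfl fun p hp => ?_
    simp only [cutPot, if_pos hp]
  · intro p hp
    simp only [cutPot, if_neg hp, ite_self]

lemma cutPot_eq (P : Measure 𝒩[d]) {n : ℕ} {p : ZLat d × ℕ} (h : supD 0 p.1 + p.2 ≤ n)
    (x : 𝒩[d]) : cutPot P n p x = pot P Set.univ p x := by
  have h1 : p ∈ box 0 n ×ˢ range (2 * n + 1) := by
    rw [mem_product, mem_box, mem_range]
    omega
  have h2 : ∀ m ≤ p.2, past (box 0 n : ℱ[d]) p.1 m = past Set.univ p.1 m := by
    intro m hm
    ext j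
    simp only [past, mem_filter, mem_coe, mem_box, Set.mem_univ]
    have := supD_tri 0 p.1 j
    exact and_congr_right fun hj => and_congr_right fun _ => iff_true_intro (by omega)
  rw [cutPot, if_pos h1, pot, pot, h2 _ le_rfl, h2 _ (Nat.sub_le _ _)]

variable {P : Measure 𝒩[d]} {K : ℕ} {κ C c : ℝ} (hP : BlockLaw P K κ C c)

include hP

lemma BlockLaw.log_cyl (Λ : ℱ[d]) (x : 𝒩[d]) :
    log (cyl P Λ x) = ∑ i ∈ Λ, gInc P i (Λ.filter fun j => toLex j < toLex i) x := by
  have := hP.prob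
  refine Finset.induction_on_max_value (fun i => toLex i) Λ (by simp [cyl_empty]) ?_
  · intro a s ha hmax ih
    have h1 : ((insert a s).filter fun j => toLex j < toLex a) = s := by
      ext j
      rw [mem_filter, mem_insert]
      constructor
      · rintro ⟨rfl | h, h2⟩
        exacts [(lt_irrefl _ h2).elim, h]
      · intro h
        exact ⟨Or.inr h, lt_of_le_of_ne (hmax j h) fun h2 => ha (toLex.injective h2 ▸ h)⟩
    have h2 : ∀ i ∈ s, ((insert a s).filter fun j => toLex j < toLex i) =
        s.filter fun j => toLex j < toLex i := fun i hi => by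
      rw [Finset.filter_insert]; exact if_neg (not_lt.2 (hmax i hi))
    rw [sum_insert ha, h1, sum_congr rfl fun i hi => by rw [h2 i hi], ← ih, gInc]
    ring

lemma BlockLaw.log_cyl_box (n : ℕ) (x : 𝒩[d]) : log (cyl P (box 0 n) x) =
    ∑ p ∈ box 0 n ×ˢ range (2 * n + 1), pot P (box 0 n : ℱ[d]) p x := by
  rw [hP.log_cyl, Finset.sum_product]
  refine sum_congr rfl fun i hi => ?_
  rw [sum_pot]
  congr 1
  ext j
  simp only [past, mem_filter, mem_coe, mem_box] at hi ⊢
  have := supD_tri i 0 j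
  rw [supD_comm i 0] at this
  constructor
  · rintro ⟨h1, h2⟩
    exact ⟨by omega, h2, h1⟩
  · rintro ⟨_, h2, h1⟩
    exact ⟨h1, h2⟩

lemma BlockLaw.exists_cyl_eq (J : ℱ[d]) (n : ℕ) {x : 𝒩[d]}
    (hx : ∀ i, x i ≤ K) : ∃ R : ℝ, 0 < R ∧ ∀ k ∈ cfgs K J,
      cyl P (box 0 n) (glueN J k x) = R * exp (cutSum P J n (glueN J k x)) := by
  refine ⟨_, exp_pos (∑ p ∈ (box 0 n ×ˢ range (2 * n + 1)).filter fun p =>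
    ¬ (bx p ∩ J).Nonempty, pot P (box 0 n : ℱ[d]) p x), fun k hk => ?_⟩
  rw [← exp_add, ← Real.exp_log (hP.cyl_pos (box 0 n) _ (glueN_le hk hx)), hP.log_cyl_box,
    ← Finset.sum_filter_add_sum_filter_not _ fun p => (bx p ∩ J).Nonempty, add_comm, cutSum]
  congr 2
  refine sum_congr rfl fun p hp => pot_local P _ p _ _ fun i hi => ?_
  refine glueN_notMem _ _ _ fun hJ => (mem_filter.1 hp).2 ⟨i, ?_⟩
  exact mem_inter.2 ⟨hi, hJ⟩

lemma BlockLaw.ae_summable_glueN (J : ℱ[d]) {k : ↥J → ℕ} (hk : k ∈ cfgs K J)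
    {ι : Type*} [Countable ι] {F : ι → 𝒩[d] → ℝ} {U : ι → ℱ[d]} {e : ι → ℝ}
    (hF : ∀ p, LocalOnN (F p) (U p)) (he : ∀ p, ∫ x, |F p x| ∂P ≤ e p) (hs : Summable e) :
    ∀ᵐ x ∂P, Summable fun p => |F p (glueN J k x)| := by
  have := hP.prob
  refine ae_summable_of_integral_le (fun p => ((hF p).glueN J k).integrable hP.bdd)
    (fun p => (hP.integral_glueN_le J hk (U := U p) (h := fun x => |F p x|)
      (fun x y h => congrArg abs (hF p x y h)) fun x => abs_nonneg _).trans
      (mul_le_mul_of_nonneg_left (he p) ?_)) (hs.mul_left _)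
  exact div_nonneg (Nat.cast_nonneg _) (pow_nonneg hP.kpos.le _)

lemma BlockLaw.integral_cutPot_sub_le (n : ℕ) (p : ZLat d × ℕ) :
    ∫ x, |cutPot P n p x - pot P Set.univ p x| ∂P ≤ 2 * potBd d κ C c p.2 := by
  have h1 : Integrable (cutPot P n p) P ∧ ∫ x, |cutPot P n p x| ∂P ≤ potBd d κ C c p.2 := by
    unfold cutPot
    split_ifs
    · exact ⟨hP.integrable_pot _ p, hP.integral_pot_le _ p⟩
    · exact ⟨integrable_zero _ _ _, by simpa using hP.potBd_nonneg p.2⟩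
  have h2 := hP.integrable_pot Set.univ p
  calc _ ≤ ∫ x, (|cutPot P n p x| + |pot P Set.univ p x|) ∂P :=
        integral_mono (h1.1.sub h2).abs (h1.1.abs.add h2.abs) fun x => abs_sub _ _
    _ ≤ _ := by
        rw [integral_add h1.1.abs h2.abs]
        have := hP.integral_pot_le Set.univ p
        linarith [h1.2]

/-- Almost sure convergence of the finite volume energies. -/
theorem BlockLaw.ae_tendsto_cutSum (J : ℱ[d]) {k : ↥J → ℕ} (hk : k ∈ cfgs K J) :
    ∀ᵐ x ∂P, Filter.Tendsto (fun n : ℕ => cutSum P J n (glueN J k x)) Filter.atTop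
      (nhds (potSum P J (glueN J k x))) := by
  have := hP.prob
  have hc := hP.cpos
  obtain ⟨R, hR⟩ := exists_subset_box J
  set w : ℕ → ℝ := fun n => exp (c / 2 * n) * potBd d κ C c n with hw
  have hw0 : ∀ n, 0 ≤ w n := fun n => mul_nonneg (exp_pos _).le (hP.potBd_nonneg n)
  have hws := summable_radius_inter w hw0 (hP.summable_potBd (c / 2) (by linarith)) J
  have hwb : ∀ n, potBd d κ C c n ≤ w n := fun n =>
    le_mul_of_one_le_left (hP.potBd_nonneg n) (one_le_exp (by positivity))
  have h1 := hP.ae_summable_glueN J hk (F := fun p x => if (bx p ∩ J).Nonempty then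
    pot P Set.univ p x else 0) (U := bx) (fun p x y h => by simp only [pot_local P _ p x y h])
    (fun p => by
      split_ifs
      · exact (hP.integral_pot_le _ p).trans (hwb p.2)
      · simp) hws
  have hexp : Summable fun n : ℕ => exp (-(c / 4) * n) := by
    simpa using summable_expConst (d := 0) (c / 4) (by linarith)
  have hprod := (hexp.mul_of_nonneg hws (fun n => (exp_pos _).le) fun p => by
    split_ifs; exacts [hw0 _, le_rfl]).mul_left (2 * exp (c / 4 * R))
  have h2 := hP.ae_summable_glueN J hk (F := fun (q : ℕ × (ZLat d × ℕ)) x =>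
    if (bx q.2 ∩ J).Nonempty then cutPot P q.1 q.2 x - pot P Set.univ q.2 x else 0)
    (U := fun q => bx q.2) (fun q x y h => by
      simp only [cutPot, pot_local P _ q.2 x y h])
    (fun q => by
      have h3 := hw0 q.2.2
      by_cases hq : (bx q.2 ∩ J).Nonempty
      · simp only [if_pos hq]
        by_cases hn : supD 0 q.2.1 + q.2.2 ≤ q.1
        · simp only [cutPot_eq P hn, sub_self, abs_zero, integral_zero]
          positivity
        · refine (hP.integral_cutPot_sub_le q.1 q.2).trans ?_
          obtain ⟨i, hi⟩ := hq
          rw [mem_inter, bx, mem_box] at hi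
          have h4 := (mem_box _ _ _).1 (hR hi.2)
          have h5 := supD_tri 0 i q.2.1
          rw [supD_comm i] at h5
          have h6 : (q.1 : ℝ) ≤ R + 2 * q.2.2 := by exact_mod_cast (by omega)
          rw [mul_assoc, hw]
          refine mul_le_mul_of_nonneg_left ?_ zero_le_two
          simp only
          rw [← mul_assoc, ← mul_assoc, ← exp_add, ← exp_add]
          refine le_mul_of_one_le_left (hP.potBd_nonneg _) (one_le_exp ?_)
          nlinarith
      · simp [if_neg hq]) hprod
  filter_upwards [h1, h2] with x hx1 hx2
  have h3 : ∀ n, Summable fun p : ZLat d × ℕ => if (bx p ∩ J).Nonempty then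
      cutPot P n p (glueN J k x) - pot P Set.univ p (glueN J k x) else 0 := fun n =>
    Summable.of_abs (hx2.prod_factor n)
  have h4 : ∀ n : ℕ, cutSum P J n (glueN J k x) = potSum P J (glueN J k x) +
      ∑' p : ZLat d × ℕ, if (bx p ∩ J).Nonempty then
        cutPot P n p (glueN J k x) - pot P Set.univ p (glueN J k x) else 0 := by
    intro n
    rw [cutSum_eq, potSum, ← (Summable.of_abs hx1).tsum_add (h3 n)]
    refine tsum_congr fun p => ?_
    split_ifs <;> ring
  have h5 := hx2.prod.tendsto_atTop_zero
  simp only [h4]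
  have h6 : Filter.Tendsto (fun n : ℕ => ∑' p : ZLat d × ℕ, if (bx p ∩ J).Nonempty then
      cutPot P n p (glueN J k x) - pot P Set.univ p (glueN J k x) else 0) Filter.atTop
      (nhds 0) := by
    refine squeeze_zero_norm (fun n => ?_) h5
    have := norm_tsum_le_tsum_norm (f := fun p : ZLat d × ℕ => if (bx p ∩ J).Nonempty then
      cutPot P n p (glueN J k x) - pot P Set.univ p (glueN J k x) else 0) (hx2.prod_factor n)
    exact this
  simpa using h6.const_add (potSum P J (glueN J k x))

/-- The equations for the conditional probabilities in infinite volume. -/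
theorem BlockLaw.integral_eq_potSum (J : ℱ[d]) {f : 𝒩[d] → ℝ}
    (hf : LocalOnN f J) {M : ℝ} (hM : ∀ x, |f x| ≤ M) : ∫ x, f x ∂P =
      ∫ x, (∑ k ∈ cfgs K J, f (glueN J k x) * exp (potSum P J (glueN J k x))) /
        ∑ k ∈ cfgs K J, exp (potSum P J (glueN J k x)) ∂P := by
  have := hP.prob
  obtain ⟨R, hR⟩ := exists_subset_box J
  have hsub : ∀ n, J ⊆ box 0 (n + R) := fun n i hi => by
    have := (mem_box _ _ _).1 (hR hi)
    exact (mem_box _ _ _).2 (by omega)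
  set G : ℕ → 𝒩[d] → ℝ := fun n x => (∑ k ∈ cfgs K J, f (glueN J k x) *
    cyl P (box 0 n) (glueN J k x)) / ∑ k ∈ cfgs K J, cyl P (box 0 n) (glueN J k x) with hG
  have hGint : ∀ n, Integrable (G n) P := fun n => by
    refine LocalOnN.integrable hP.bdd (U := J ∪ box 0 n) fun x y hxy => ?_
    have h1 : ∀ k, f (glueN J k x) = f (glueN J k y) := fun k =>
      (hf.mono subset_union_left).glueN J k x y hxy
    have h2 : ∀ k, cyl P (box 0 n) (glueN J k x) = cyl P (box 0 n) (glueN J k y) := fun k =>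
      ((cyl_congr P (box 0 n)).mono Finset.subset_union_right).glueN J k x y hxy
    simp only [hG, h1, h2]
  have hlim : ∀ᵐ x ∂P, ∀ k : ↥J → ℕ, k ∈ cfgs K J → Filter.Tendsto
      (fun n : ℕ => cutSum P J n (glueN J k x)) Filter.atTop
      (nhds (potSum P J (glueN J k x))) := by
    rw [ae_all_iff]
    intro k
    by_cases hk : k ∈ cfgs K J
    · filter_upwards [hP.ae_tendsto_cutSum J hk] with x hx _ using hx
    · exact Filter.Eventually.of_forall fun x h => (hk h).elim
  have hlim2 := tendsto_integral_of_dominated_convergence (μ := P) (F := fun n => G (n + R))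
    (f := fun x => (∑ k ∈ cfgs K J, f (glueN J k x) * exp (potSum P J (glueN J k x))) /
        ∑ k ∈ cfgs K J, exp (potSum P J (glueN J k x))) (fun _ => M)
    (fun n => (hGint _).1) (integrable_const M) (fun n => ?_) ?_
  · refine tendsto_nhds_unique (tendsto_const_nhds.congr fun n => ?_) hlim2
    exact hP.integral_eq_cond (hsub n) (hf.mono (hsub n))
  · filter_upwards [hP.bdd] with x hx
    have hZ := hP.sum_cyl_pos J (box 0 (n + R)) hx
    rw [Real.norm_eq_abs, hG, abs_div, abs_of_pos hZ, div_le_iff₀ hZ, mul_sum]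
    refine (abs_sum_le_sum_abs _ _).trans (sum_le_sum fun k _ => ?_)
    rw [abs_mul, abs_of_nonneg (a := cyl P _ _) measureReal_nonneg]
    exact mul_le_mul_of_nonneg_right (hM _) measureReal_nonneg
  · filter_upwards [hP.bdd, hlim] with x hx hxl
    refine Filter.Tendsto.comp (g := fun n => G n x) ?_ (Filter.tendsto_add_atTop_nat R)
    have h1 : ∀ n, G n x = (∑ k ∈ cfgs K J, f (glueN J k x) *
        exp (cutSum P J n (glueN J k x))) /
        ∑ k ∈ cfgs K J, exp (cutSum P J n (glueN J k x)) := by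
      intro n
      obtain ⟨Q, hQ, hcyl⟩ := hP.exists_cyl_eq J n hx
      simp only [hG]
      rw [sum_congr rfl hcyl, ← mul_sum, sum_congr rfl fun k hk => by
        rw [hcyl k hk, mul_left_comm], ← mul_sum, mul_div_mul_left _ _ hQ.ne']
    simp only [h1]
    refine Filter.Tendsto.div (tendsto_finsetSum _ fun k hk => ?_)
      (tendsto_finsetSum _ fun k hk => ?_) (sum_pos (fun k _ => exp_pos _)
        ⟨fun _ => 0, mem_cfgs.2 fun _ => Nat.zero_le _⟩).ne'
    · exact ((Real.continuous_exp.tendsto _).comp (hxl k hk)).const_mul _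
    · exact (Real.continuous_exp.tendsto _).comp (hxl k hk)

end equations

section transfer

variable {d : ℕ}

/-- Affine normalization of a configuration of counts. -/
def enc (a s : ℝ) (x : 𝒩[d]) : ZLat d → ℝ := fun i => ((x i : ℝ) - a) / s

/-- The configuration of counts with a given normalization. -/
def dec (a s : ℝ) (m : ZLat d → ℝ) : ZLat d → ℕ := fun i => ⌊m i * s + a + 1 / 2⌋₊

lemma dec_enc (a : ℝ) {s : ℝ} (hs : 0 < s) (x : 𝒩[d]) : dec a s (enc a s x) = x := by
  funext i
  rw [dec, enc, div_mul_cancel₀ _ hs.ne', sub_add_cancel, Nat.floor_eq_iff (by positivity)]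
  constructor <;> linarith

lemma measurable_enc (a s : ℝ) : Measurable (enc (d := d) a s) :=
  measurable_pi_lambda _ fun i =>
    ((measurable_from_top.comp (measurable_pi_apply i)).sub_const a).div_const s

lemma measurable_dec (a s : ℝ) : Measurable (dec (d := d) a s) :=
  measurable_pi_lambda _ fun i => by
    have h : Measurable fun m : ZLat d → ℝ => m i := measurable_pi_apply i
    exact Nat.measurable_floor.comp (((h.mul_const s).add_const a).add_const _)

lemma measurableEmbedding_enc (a : ℝ) {s : ℝ} (hs : 0 < s) :
    MeasurableEmbedding (enc (d := d) a s) := by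
  refine MeasurableEmbedding.of_measurable_inverse (measurable_enc a s) ?_ (measurable_dec a s)
    (dec_enc a hs)
  have h : Set.range (enc (d := d) a s) = {m | enc a s (dec a s m) = m} := by
    ext m
    exact ⟨fun ⟨x, hx⟩ => by rw [← hx, Set.mem_ofPred_eq, dec_enc a hs], fun h => ⟨_, h⟩⟩
  rw [h]
  exact measurableSet_eq_fun ((measurable_enc a s).comp (measurable_dec a s)) measurable_id

lemma Mblk_eq_enc (μ : Measure (GConf d)) (ℓ : ℕ) (η : GConf d) :
    (fun i => Mblk μ ℓ i η) =
      enc (rho μ * (ℓ : ℝ) ^ d) (sqrt ((ℓ : ℝ) ^ d * chi μ)) (blk ℓ η) := by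
  funext i
  rw [Mblk, enc, blk, cnt_eq_sum]

lemma nu_eq_map (μ : Measure (GConf d)) (ℓ : ℕ) : nu μ ℓ = (μ.map (blk ℓ)).map
    (enc (rho μ * (ℓ : ℝ) ^ d) (sqrt ((ℓ : ℝ) ^ d * chi μ))) := by
  rw [Measure.map_map (measurable_enc _ _) (measurable_blk ℓ), nu]
  exact congrArg (fun g => μ.map g) (funext fun η => Mblk_eq_enc μ ℓ η)

lemma mem_Mset (μ : Measure (GConf d)) (ℓ : ℕ) (r : ℝ) : r ∈ Mset d μ ℓ ↔
    ∃ k ∈ range (ℓ ^ d + 1),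
      ((k : ℝ) - rho μ * (ℓ : ℝ) ^ d) / sqrt ((ℓ : ℝ) ^ d * chi μ) = r := by
  simp only [Mset, Finset.bind_def, Finset.pure_def, mem_image, Finset.mem_sup,
    mem_singleton]
  exact ⟨fun ⟨_, ⟨k, hk, h1⟩, h2⟩ => ⟨k, hk, h1 ▸ h2⟩, fun ⟨k, hk, h⟩ => ⟨k, ⟨k, hk, rfl⟩, h⟩⟩

lemma sum_piFinset_enc (a : ℝ) {s : ℝ} (hs : 0 < s) (K : ℕ) (J : ℱ[d])
    (x : 𝒩[d]) (g : (ZLat d → ℝ) → ℝ) :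
    ∑ mJ ∈ Fintype.piFinset fun _ : ↥J =>
        (range (K + 1)).image fun k : ℕ => ((k : ℝ) - a) / s, g (glue J mJ (enc a s x)) =
      ∑ k ∈ cfgs K J, g (enc a s (glueN J k x)) := by
  symm
  refine Finset.sum_bij (fun k _ i => ((k i : ℝ) - a) / s) (fun k hk => ?_)
    (fun k _ k' _ h => ?_) (fun mJ hmJ => ?_) fun k _ => ?_
  · exact Fintype.mem_piFinset.2 fun i => mem_image_of_mem (fun k : ℕ => ((k : ℝ) - a) / s)
      (Fintype.mem_piFinset.1 hk i)
  · funext i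
    have h1 : ((k i : ℝ) - a) / s = ((k' i : ℝ) - a) / s := congrFun h i
    rw [div_left_inj' hs.ne', sub_left_inj] at h1
    exact_mod_cast h1
  · choose k hk hk' using fun i => mem_image.1 (Fintype.mem_piFinset.1 hmJ i)
    exact ⟨k, Fintype.mem_piFinset.2 hk, funext hk'⟩
  · congr 1
    funext i
    unfold enc glue glueN
    split_ifs <;> rfl

lemma byBox_add (P : Measure 𝒩[d]) (hd : 0 < d) (α : ℝ) (I : ℱ[d])
    (x : 𝒩[d]) : byBox (vPsi P α) I x + byBox (vPhi P α) I x =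
      byBox (pot P Set.univ) I x := by
  by_cases hI : ∃ p, bx p = I
  · obtain ⟨p, rfl⟩ := hI
    rw [byBox_bx hd, byBox_bx hd, byBox_bx hd, vPsi_add_vPhi]
  · rw [byBox_of_ne _ hI, byBox_of_ne _ hI, byBox_of_ne _ hI, add_zero]

lemma Wsum_byBox (hd : 0 < d) (P : Measure 𝒩[d]) (α : ℝ) (J : ℱ[d])
    (D : (ZLat d → ℝ) → ZLat d → ℕ) (m : ZLat d → ℝ) :
    Wsum (fun I m => byBox (vPsi P α) I (D m)) (fun I m => byBox (vPhi P α) I (D m)) J m =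
      potSum P J (D m) := by
  simp only [Wsum, byBox_add P hd α]
  exact tsum_byBox hd (pot P Set.univ) (fun I => (I ∩ J).Nonempty) (D m)

theorem weakGibbs_of_blockLaw (hd : 0 < d) (μ : Measure (GConf d)) {ℓ : ℕ} (hℓ : 0 < ℓ)
    (hχ : 0 < chi μ) {κ C c : ℝ} (hP : BlockLaw (μ.map (blk ℓ)) (ℓ ^ d) κ C c) :
    ∃ ψ φ : ℱ[d] → (ZLat d → ℝ) → ℝ, WeakGibbs μ ℓ ψ φ := by
  have hc := hP.cpos
  have hs : 0 < sqrt ((ℓ : ℝ) ^ d * chi μ) := Real.sqrt_pos.2 (by positivity)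
  have hnu := nu_eq_map μ ℓ
  have hMset : Mset d μ ℓ = (range (ℓ ^ d + 1)).image fun k : ℕ =>
    ((k : ℝ) - rho μ * (ℓ : ℝ) ^ d) / sqrt ((ℓ : ℝ) ^ d * chi μ) := by
    ext r; rw [mem_Mset, mem_image]
  set a := rho μ * (ℓ : ℝ) ^ d
  set s := sqrt ((ℓ : ℝ) ^ d * chi μ)
  set P := μ.map (blk ℓ)
  have hE := measurableEmbedding_enc (d := d) a hs
  have hα : 0 < c / 4 := by linarith
  have hγ : c / 2 = c / 4 + c / 4 := by ring
  have hγc : c / 2 < c := by linarith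
  have hloc : ∀ (g : 𝒩[d] → ℝ) (I : ℱ[d]), LocalOnN g I →
      LocalOnR (fun m => g (dec a s m)) I := fun g I hg m m' h => hg _ _ fun i hi => by
    simp only [dec, h i hi]
  refine ⟨fun I m => byBox (vPsi P (c / 4)) I (dec a s m),
    fun I m => byBox (vPhi P (c / 4)) I (dec a s m),
    fun I => ⟨hloc _ _ (byBox_local hd (vPsi_local P _) I),
      hloc _ _ (byBox_local hd (vPhi_local P _) I)⟩,
    fun I hI => ⟨funext fun m => byBox_of_not_connected _ hI _,
      funext fun m => byBox_of_not_connected _ hI _⟩,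
    fun I i m => ⟨byBox_shift hd (hP.vPsi_shift _ i (dec a s m)) I,
      byBox_shift hd (hP.vPhi_shift _ i (dec a s m)) I⟩, ?_, fun q hq => ?_,
    ⟨c / 4 / 4, by linarith, _, fun m i F hF => sum_vPhi_le hd P hα (dec a s m) i F hF⟩,
    fun J f hf hM => ?_⟩
  · obtain ⟨M, hM, hM1, rr, h1, h2, h3⟩ := hP.exists_sparse_set hd hα.le hα.le hγ hγc
    refine ⟨dec a s ⁻¹' M, measurable_dec a s hM, ?_, fun m => rr (dec a s m),
      fun m _ i => h1 _ i, fun m hm i I => h2 _ hm i I, fun m hm i => h3 _ hm i⟩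
    rw [hnu, hE.map_apply, ← Set.preimage_comp]
    simpa only [Function.comp_def, dec_enc a hs, Set.preimage_id'] using hM1
  · obtain ⟨Cq, hCq⟩ := hP.exists_moment_bound hd hα hγ hγc hq
    refine ⟨Cq, fun i => ?_⟩
    rw [hnu, hE.integral_map]
    simpa only [dec_enc a hs] using hCq i
  · obtain ⟨M, hM⟩ := hM
    rw [hnu, hE.integral_map, hE.integral_map, hP.integral_eq_potSum J
      (f := fun x => f (enc a s x)) (fun x y h => hf _ _ fun i hi => by simp only [enc, h i hi])
      fun x => hM _]
    refine integral_congr_ae (Filter.Eventually.of_forall fun x => ?_)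
    simp only [Wsum_byBox hd, hMset]
    rw [sum_piFinset_enc a hs _ J x fun m => f m * exp (potSum P J (dec a s m)),
      sum_piFinset_enc a hs _ J x fun m => exp (potSum P J (dec a s m))]
    simp only [dec_enc a hs]

/-- With a degenerate normalization the renormalized measure is concentrated at zero. -/
theorem weakGibbs_of_chi_nonpos (μ : Measure (GConf d)) [IsProbabilityMeasure μ] (ℓ : ℕ)
    (hχ : chi μ ≤ 0) : WeakGibbs μ ℓ 0 0 := by
  have hs : sqrt ((ℓ : ℝ) ^ d * chi μ) = 0 :=
    Real.sqrt_eq_zero_of_nonpos (mul_nonpos_of_nonneg_of_nonpos (by positivity) hχ)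
  have hnu : nu μ ℓ = Measure.dirac 0 := by
    have h : (fun (η : GConf d) i => Mblk μ ℓ i η) = fun _ => 0 := by
      funext η i
      rw [Mblk, hs, div_zero, Pi.zero_apply]
    rw [nu, h, Measure.map_const, measure_univ, one_smul]
  have hMset : Mset d μ ℓ = {0} := by
    ext r
    simp only [mem_Mset, hs, div_zero, mem_singleton]
    exact ⟨fun ⟨_, _, h⟩ => h.symm, fun h => ⟨0, mem_range.2 (Nat.succ_pos _), h.symm⟩⟩
  refine ⟨fun I => ⟨fun _ _ _ => rfl, fun _ _ _ => rfl⟩, fun _ _ => ⟨rfl, rfl⟩,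
    fun _ _ _ => ⟨rfl, rfl⟩, ⟨Set.univ, MeasurableSet.univ, by rw [hnu, measure_univ],
      fun _ _ => 1, fun _ _ _ => le_rfl, fun _ _ _ _ _ _ => rfl,
      fun _ _ _ => ⟨0, le_rfl, fun F _ => by simp⟩⟩,
    fun q hq => ⟨0, fun i => ?_⟩, ⟨1, one_pos, 0, fun m i F _ => by simp⟩, fun J f hf _ => ?_⟩
  · have : (0 : ℝ) ^ q = 0 := Real.zero_rpow (by linarith)
    simp [this]
  · have hpi : (Fintype.piFinset fun _ : ↥J => ({0} : Finset ℝ)) = {fun _ => 0} :=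
      Fintype.piFinset_singleton _
    have hglue : glue J (fun _ => 0) (0 : ZLat d → ℝ) = 0 := by
      funext i; unfold glue; split_ifs <;> rfl
    have hW : ∀ m, Wsum (d := d) 0 0 J m = 0 := fun m => by simp [Wsum]
    rw [hnu, integral_dirac, integral_dirac, hMset, hpi]
    simp [hglue, hW]

end transfer

end

/-- weak Gibbsianity of the renormalized measure. For a translationally
invariant finite-range lattice gas potential satisfying SM(ℓ0,b,B), with unique
infinite volume Gibbs measure `μ`, for any sufficiently large `ℓ` multiple of `ℓ0`
there exists a renormalized potential `{ψ_I, φ_I}` satisfying items (1)–(7) of the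
weak Gibbsianity theorem for `ν^{(ℓ)}`. -/
theorem stmt1 {d : ℕ} (hd : 0 < d) (G : LatticeGas d)
    (ℓ0 : ℕ) (hℓ0 : 0 < ℓ0) (b B : ℝ) (hb : 0 < b) (hB : 0 < B)
    (hSM : SM (gasPotH G) ℓ0 b B)
    (μ : Measure (GConf d)) [IsProbabilityMeasure μ] (hμ : IsGibbs (gasPotH G) μ) :
    ∃ ℓ₁ : ℕ, ∀ ℓ : ℕ, ℓ₁ ≤ ℓ → ℓ0 ∣ ℓ →
      ∃ ψ φ : Finset (ZLat d) → (ZLat d → ℝ) → ℝ, WeakGibbs μ ℓ ψ φ := by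
  obtain ⟨ℓ₁, h1, h⟩ := exists_blockLaw G hd hℓ0 hb hB hSM μ hμ
  refine ⟨ℓ₁, fun ℓ hℓ hdvd => ?_⟩
  obtain ⟨κ, C, c, hP⟩ := h ℓ hℓ hdvd
  rcases le_or_gt (chi μ) 0 with hχ | hχ
  · exact ⟨0, 0, weakGibbs_of_chi_nonpos μ ℓ hχ⟩
  · exact weakGibbs_of_blockLaw hd μ (h1.trans hℓ) hχ hP

end

end Paper
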